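/- For all integers n ≥ 1 and d ≥ 1, the space SP^d(ℂP^n) is path-connected, and for every integer k with 1 ≤ k ≤ 2d its homotopy group satisfies: π_k(SP^d(ℂP^n)) is isomorphic to ℤ if k is even and k ≤ min{2d, 2n}, and π_k(SP^d(ℂP^n)) is the trivial group for all other k with 1 ≤ k < 2d (in particular for all odd k < 2d and for all even k with 2n < k < 2d). -/

import Mathlib

open scoped Topology

noncomputable section

/-- Complex projective `n`-space with its standard (quotient) topology. -/
def CP (n : ℕ) : Type := Projectivization ℂ (Fin (n + 1) → ℂ)

instance (n : ℕ) : TopologicalSpace (CP n) :=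
  instTopologicalSpaceQuotient

/-- Two `d`-tuples are related iff they differ by a permutation of the indices. -/
def SPSetoid (d : ℕ) (X : Type*) : Setoid (Fin d → X) where
  r f g := ∃ σ : Equiv.Perm (Fin d), f ∘ σ = g
  iseqv := by
    refine ⟨fun f => ⟨Equiv.refl _, rfl⟩, ?_, ?_⟩
    · rintro f g ⟨σ, rfl⟩
      exact ⟨σ.symm, by ext j; simp⟩
    · rintro f g h ⟨σ, rfl⟩ ⟨τ, rfl⟩
      exact ⟨τ.trans σ, by ext j; simp⟩

/-- The `d`-th symmetric product of a topological space `X`: the quotient of `X^d = (Fin d → X)`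
by the permutation action of the symmetric group `S_d`, with the quotient topology. -/
def SP (d : ℕ) (X : Type*) [TopologicalSpace X] : Type _ :=
  Quotient (SPSetoid d X)

instance (d : ℕ) (X : Type*) [TopologicalSpace X] : TopologicalSpace (SP d X) :=
  instTopologicalSpaceQuotient

/-- The point `x_1 + ⋯ + x_d` of `SP^d X` determined by a `d`-tuple. -/
def SP.mk {d : ℕ} {X : Type*} [TopologicalSpace X] (f : Fin d → X) : SP d X :=
  Quotient.mk _ f

/-- The point `d·x₀` of `SP^d X`. -/
def SP.diag (d : ℕ) {X : Type*} [TopologicalSpace X] (x₀ : X) : SP d X :=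
  SP.mk fun _ => x₀

namespace HS

/-! ## Relative connectivity on sup-norm balls -/

/-- clamp to the unit interval -/
def cl01 (t : ℝ) : ℝ := max 0 (min 1 t)

lemma continuous_cl01 : Continuous cl01 := by unfold cl01; fun_prop
@[fun_prop] lemma Continuous.cl01 {M : Type*} [TopologicalSpace M] {f : M → ℝ}
    (hf : Continuous f) : Continuous fun x => cl01 (f x) := continuous_cl01.comp hf
lemma cl01_nonneg (t : ℝ) : 0 ≤ cl01 t := le_max_left _ _
lemma cl01_le (t : ℝ) : cl01 t ≤ 1 := max_le zero_le_one (min_le_left _ _)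
lemma cl01_of_mem {t : ℝ} (h0 : 0 ≤ t) (h1 : t ≤ 1) : cl01 t = t := by
  unfold cl01; rw [min_eq_right h1, max_eq_right h0]
lemma cl01_of_le {t : ℝ} (h0 : t ≤ 0) : cl01 t = 0 := by
  unfold cl01; rw [min_eq_right (by linarith), max_eq_left h0]
lemma cl01_of_ge {t : ℝ} (h0 : 1 ≤ t) : cl01 t = 1 := by
  unfold cl01; rw [min_eq_left h0, max_eq_right zero_le_one]
@[simp] lemma cl01_zero : cl01 0 = 0 := cl01_of_le le_rfl
@[simp] lemma cl01_one : cl01 1 = 1 := cl01_of_ge le_rfl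

section
variable {ι : Type} [Fintype ι]

/-- the stretching `x ↦ x / max (1/(1+t)) (min 1 ‖x‖)` -/
def sc (t : ℝ) (x : ι → ℝ) : ι → ℝ :=
  (max (1 / (1 + cl01 t)) (min 1 ‖x‖))⁻¹ • x

lemma sc_den_pos (t : ℝ) (x : ι → ℝ) : 0 < max (1 / (1 + cl01 t)) (min 1 ‖x‖) :=
  lt_max_of_lt_left (by have := cl01_nonneg t; positivity)

lemma continuous_sc : Continuous fun p : ℝ × (ι → ℝ) => sc p.1 p.2 := by
  unfold sc
  refine Continuous.smul (Continuous.inv₀ ?_ fun p => (sc_den_pos _ _).ne') (by fun_prop)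
  refine Continuous.max ?_ (by fun_prop)
  refine Continuous.div continuous_const (by fun_prop) fun p => ?_
  have := cl01_nonneg p.1; positivity

@[fun_prop] lemma Continuous.sc {M : Type*} [TopologicalSpace M] {f : M → ℝ} {g : M → (ι → ℝ)}
    (hf : Continuous f) (hg : Continuous g) : Continuous fun x => sc (f x) (g x) :=
  continuous_sc.comp (hf.prodMk hg)

lemma sc_zero (x : ι → ℝ) : sc 0 x = x := by
  unfold sc
  simp

lemma sc_of_ge (t : ℝ) {x : ι → ℝ} (hx : 1 ≤ ‖x‖) : sc t x = x := by
  unfold sc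
  rw [min_eq_left hx, max_eq_right]
  · simp
  · have := cl01_nonneg t
    rw [div_le_one (by linarith)]; linarith

lemma norm_sc_one {x : ι → ℝ} (hx : 1 / 2 ≤ ‖x‖) : 1 ≤ ‖sc 1 x‖ := by
  unfold sc
  rw [norm_smul, norm_inv, Real.norm_of_nonneg (sc_den_pos _ _).le, ← div_eq_inv_mul,
    le_div_iff₀ (sc_den_pos _ _), one_mul]
  refine max_le ?_ (min_le_right _ _)
  simp only [cl01_one]; linarith

/-- homotopy of maps of the ball, relative to the outside of the open ball, inside `A` -/
def RH {Y : Type*} [TopologicalSpace Y] (A : Set Y) (g g' : (ι → ℝ) → Y) : Prop :=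
  ∃ H : (ι → ℝ) × ℝ → Y, Continuous H ∧ (∀ x, H (x, 0) = g x) ∧ (∀ x, H (x, 1) = g' x) ∧
    (∀ p, H p ∈ A) ∧ ∀ x t, 1 ≤ ‖x‖ → H (x, t) = g x

/-- homotopy of maps of pairs -/
def PH {Y : Type*} [TopologicalSpace Y] (A B : Set Y) (g g' : (ι → ℝ) → Y) : Prop :=
  ∃ H : (ι → ℝ) × ℝ → Y, Continuous H ∧ (∀ x, H (x, 0) = g x) ∧ (∀ x, H (x, 1) = g' x) ∧
    (∀ p, H p ∈ A) ∧ ∀ x t, 1 ≤ ‖x‖ → H (x, t) ∈ B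

variable {Y : Type*} [TopologicalSpace Y]

/-- concatenation of homotopies -/
def cat {M : Type*} (H K : M × ℝ → Y) (p : M × ℝ) : Y :=
  if p.2 ≤ 1 / 2 then H (p.1, cl01 (2 * p.2)) else K (p.1, cl01 (2 * p.2 - 1))

lemma continuous_cat {M : Type*} [TopologicalSpace M] {H K : M × ℝ → Y} (hH : Continuous H)
    (hK : Continuous K) (h : ∀ x, H (x, 1) = K (x, 0)) : Continuous (cat H K) := by
  unfold cat
  refine continuous_if_le (by fun_prop) (by fun_prop) ?_ ?_ ?_
  · exact (hH.comp (by fun_prop : Continuous fun p : M × ℝ => (p.1, cl01 (2 * p.2)))).continuousOn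
  · exact (hK.comp (by fun_prop :
      Continuous fun p : M × ℝ => (p.1, cl01 (2 * p.2 - 1)))).continuousOn
  · intro p hp
    rw [hp]; norm_num [h]

lemma cat_zero {M : Type*} (H K : M × ℝ → Y) (x : M) : cat H K (x, 0) = H (x, 0) := by
  simp [cat]
lemma cat_one {M : Type*} (H K : M × ℝ → Y) (x : M) : cat H K (x, 1) = K (x, 1) := by
  have : ¬ ((1:ℝ) ≤ 2⁻¹) := by norm_num
  have h2 : (2:ℝ) - 1 = 1 := by norm_num
  simp [cat, this, h2]
lemma cat_mem {M : Type*} {H K : M × ℝ → Y} {x : M} {A : Set Y} (h : ∀ t, H (x, t) ∈ A)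
    (h' : ∀ t, K (x, t) ∈ A) (t : ℝ) : cat H K (x, t) ∈ A := by
  unfold cat; split_ifs
  · exact h _
  · exact h' _

lemma RH.trans {A : Set Y} {g g' g'' : (ι → ℝ) → Y} (h : RH A g g') (h' : RH A g' g'') :
    RH A g g'' := by
  obtain ⟨H, hc, h0, h1, hA, hr⟩ := h
  obtain ⟨K, kc, k0, k1, kA, kr⟩ := h'
  have hgg : ∀ x, 1 ≤ ‖x‖ → g' x = g x := fun x hx => by rw [← h1, hr x 1 hx]
  refine ⟨cat H K, continuous_cat hc kc fun x => by rw [h1, k0], fun x => by rw [cat_zero, h0],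
    fun x => by rw [cat_one, k1], fun p => cat_mem (fun t => hA _) (fun t => kA _) _,
    fun x t hx => ?_⟩
  have : cat H K (x, t) ∈ ({g x} : Set Y) :=
    cat_mem (fun t => hr x t hx) (fun t => (kr x t hx).trans (hgg x hx)) t
  exact this

lemma PH.trans {A B : Set Y} {g g' g'' : (ι → ℝ) → Y} (h : PH A B g g') (h' : PH A B g' g'') :
    PH A B g g'' := by
  obtain ⟨H, hc, h0, h1, hA, hr⟩ := h
  obtain ⟨K, kc, k0, k1, kA, kr⟩ := h'
  exact ⟨cat H K, continuous_cat hc kc fun x => by rw [h1, k0], fun x => by rw [cat_zero, h0],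
    fun x => by rw [cat_one, k1], fun p => cat_mem (fun t => hA _) (fun t => kA _) _,
    fun x t hx => cat_mem (fun t => hr x t hx) (fun t => kr x t hx) t⟩

lemma RH.symm {A : Set Y} {g g' : (ι → ℝ) → Y} (h : RH A g g') : RH A g' g := by
  obtain ⟨H, hc, h0, h1, hA, hr⟩ := h
  refine ⟨fun p => H (p.1, 1 - p.2), hc.comp (by fun_prop), fun x => by simp [h1],
    fun x => by simp [h0], fun p => hA _, fun x t hx => ?_⟩
  simp only [hr x _ hx]
  rw [← h1, hr x 1 hx]

lemma RH.refl {A : Set Y} {g : (ι → ℝ) → Y} (hg : Continuous g) (hA : ∀ x, g x ∈ A) : RH A g g :=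
  ⟨fun p => g p.1, by fun_prop, fun _ => rfl, fun _ => rfl, fun _ => hA _, fun _ _ _ => rfl⟩

lemma RH.mono {A A' : Set Y} {g g' : (ι → ℝ) → Y} (h : RH A g g') (hA : A ⊆ A') : RH A' g g' := by
  obtain ⟨H, hc, h0, h1, h2, hr⟩ := h
  exact ⟨H, hc, h0, h1, fun p => hA (h2 p), hr⟩

lemma RH.toPH {A B : Set Y} {g g' : (ι → ℝ) → Y} (h : RH A g g') (hB : ∀ x, 1 ≤ ‖x‖ → g x ∈ B) :
    PH A B g g' := by
  obtain ⟨H, hc, h0, h1, h2, hr⟩ := h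
  exact ⟨H, hc, h0, h1, h2, fun x t hx => by rw [hr x t hx]; exact hB x hx⟩

lemma RH.cont_right {A : Set Y} {g g' : (ι → ℝ) → Y} (h : RH A g g') : Continuous g' := by
  obtain ⟨H, hc, h0, h1, h2, hr⟩ := h
  have : g' = fun x => H (x, 1) := funext fun x => (h1 x).symm
  rw [this]; fun_prop
lemma RH.eq_out {A : Set Y} {g g' : (ι → ℝ) → Y} (h : RH A g g') {x : ι → ℝ} (hx : 1 ≤ ‖x‖) :
    g' x = g x := by
  obtain ⟨H, hc, h0, h1, h2, hr⟩ := h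
  rw [← h1, hr x 1 hx]
lemma RH.mem_right {A : Set Y} {g g' : (ι → ℝ) → Y} (h : RH A g g') (x) : g' x ∈ A := by
  obtain ⟨H, hc, h0, h1, h2, hr⟩ := h
  rw [← h1]; exact h2 _

/-- a free homotopy of pairs into `B` can be made relative -/
lemma PH.compress {A B : Set Y} {g g' : (ι → ℝ) → Y} (h : PH A B g g') (hB : ∀ x, g' x ∈ B) :
    ∃ g'', RH A g g'' ∧ ∀ x, g'' x ∈ B := by
  obtain ⟨G, hc, h0, h1, hA, hr⟩ := h
  let τ : (ι → ℝ) × ℝ → ℝ := fun p => cl01 p.2 - max 0 ((1 + cl01 p.2) * min 1 ‖p.1‖ - 1)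
  have hτ : Continuous τ := by fun_prop
  let H : (ι → ℝ) × ℝ → Y := fun p => G (sc p.2 p.1, τ p)
  have hH : Continuous H := hc.comp (by fun_prop)
  refine ⟨fun x => H (x, 1), ⟨H, hH, fun x => ?_, fun x => rfl, fun p => hA _, fun x t hx => ?_⟩,
    fun x => ?_⟩
  · have : τ (x, 0) = 0 := by simp [τ]
    simp only [H, this, sc_zero, h0]
  · have : τ (x, t) = 0 := by
      simp only [τ, min_eq_left hx]
      have := cl01_nonneg t
      rw [max_eq_right] <;> linarith
    simp only [H, this, sc_of_ge t hx, h0]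
  · rcases le_total ‖x‖ (1/2) with hx | hx
    · have : τ (x, 1) = 1 := by
        simp only [τ, cl01_one]
        rw [max_eq_left, sub_zero]
        have := min_le_right 1 ‖x‖
        linarith
      simp only [H, this, h1, hB]
    · exact hr _ _ (norm_sc_one hx)

lemma RH_sc {A : Set Y} {g : (ι → ℝ) → Y} (hg : Continuous g) (hA : ∀ x, g x ∈ A) :
    RH A g (fun x => g (sc 1 x)) :=
  ⟨fun p => g (sc p.2 p.1), by fun_prop, fun x => by simp [sc_zero], fun x => rfl, fun p => hA _,
    fun x t hx => by simp only [sc_of_ge t hx]⟩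

end

/-- `(A,B)` relative connectivity for the `ι`-ball. -/
def Conn (ι : Type) [Fintype ι] {Y : Type*} [TopologicalSpace Y] (A B : Set Y) : Prop :=
  ∀ g : (ι → ℝ) → Y, Continuous g → (∀ x, g x ∈ A) → (∀ x, 1 ≤ ‖x‖ → g x ∈ B) →
    ∃ g', RH A g g' ∧ ∀ x, g' x ∈ B

section
variable {ι : Type} [Fintype ι] {Y : Type*} [TopologicalSpace Y]

lemma Conn.trans {A B C : Set Y} (hBA : B ⊆ A) (hCB : C ⊆ B) (h : Conn ι A B) (h' : Conn ι B C) :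
    Conn ι A C := by
  intro g hg hA hC
  obtain ⟨g1, h1, h1B⟩ := h g hg hA fun x hx => hCB (hC x hx)
  obtain ⟨g2, h2, h2C⟩ := h' g1 h1.cont_right h1B fun x hx => by rw [h1.eq_out hx]; exact hC x hx
  exact ⟨g2, h1.trans (h2.mono hBA), h2C⟩

lemma Conn.refl (A : Set Y) : Conn ι A A := fun g hg hA _ => ⟨g, RH.refl hg hA, hA⟩

/-- collar gluing -/
lemma continuous_collar {M : Type*} [TopologicalSpace M] {r : M → ℝ} (hr : Continuous r)
    {F K : M → Y} (hF : ContinuousOn F {p | r p ≤ 1/2}) (hK : ContinuousOn K {p | 1/2 ≤ r p})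
    (h : ∀ p, r p = 1/2 → F p = K p) : Continuous fun p => if r p ≤ 1/2 then F p else K p :=
  continuous_if_le hr continuous_const hF hK h

lemma Conn.of_deform {A X X' : Set Y} (hXA : X ⊆ A) (hX : X' ⊆ X) (h : Conn ι A X')
    (Φ : Y × ℝ → Y) (hΦ : ContinuousOn Φ (X ×ˢ Set.Icc 0 1))
    (h0 : ∀ x ∈ X, Φ (x, 0) = x) (hm : ∀ x ∈ X, ∀ t ∈ Set.Icc (0:ℝ) 1, Φ (x, t) ∈ X)
    (h1 : ∀ x ∈ X, Φ (x, 1) ∈ X') : Conn ι A X := by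
  intro g hg hA hB
  have key : PH A X (fun x => g (sc 1 x)) (fun x => if ‖x‖ ≤ 1/2 then g (sc 1 x) else
      Φ (g (sc 1 x), cl01 (2 * ‖x‖ - 1))) := by
    refine ⟨fun p => if ‖p.1‖ ≤ 1/2 then g (sc 1 p.1) else
      Φ (g (sc 1 p.1), cl01 p.2 * cl01 (2 * ‖p.1‖ - 1)), ?_, ?_, ?_, ?_, ?_⟩
    · refine continuous_collar (by fun_prop) (by fun_prop) ?_ ?_
      · refine hΦ.comp (by fun_prop) fun p hp => ⟨hB _ (norm_sc_one hp), ?_, ?_⟩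
        · exact mul_nonneg (cl01_nonneg _) (cl01_nonneg _)
        · exact mul_le_one₀ (cl01_le _) (cl01_nonneg _) (cl01_le _)
      · intro p hp
        rw [hp]
        norm_num
        rw [h0 _ (hB _ (norm_sc_one hp.ge))]
    · intro x
      simp only [cl01_zero, zero_mul]
      split_ifs with hx
      · rfl
      · exact h0 _ (hB _ (norm_sc_one (by linarith)))
    · intro x
      simp
    · intro p
      simp only
      split_ifs with hx
      · exact hA _
      · exact hXA (hm _ (hB _ (norm_sc_one (by linarith))) _
          ⟨mul_nonneg (cl01_nonneg _) (cl01_nonneg _),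
            mul_le_one₀ (cl01_le _) (cl01_nonneg _) (cl01_le _)⟩)
    · intro x t hx
      simp only
      rw [if_neg (by linarith)]
      exact hm _ (hB _ (norm_sc_one (by linarith))) _
          ⟨mul_nonneg (cl01_nonneg _) (cl01_nonneg _),
            mul_le_one₀ (cl01_le _) (cl01_nonneg _) (cl01_le _)⟩
  have k1 := ((RH_sc hg hA).toPH hB).trans key
  obtain ⟨G, hc, g0, g1, gA, gr⟩ := id key
  obtain ⟨g2, hg2, hg2'⟩ := h (fun x => G (x, 1)) (by fun_prop) (fun x => gA _) (fun x hx => by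
        rw [g1]
        simp only
        rw [if_neg (by linarith), cl01_of_ge (by linarith)]
        exact h1 _ (hB _ (norm_sc_one (by linarith))))
  have e : (fun x => G (x, 1)) = fun x => if ‖x‖ ≤ 1/2 then g (sc 1 x) else
      Φ (g (sc 1 x), cl01 (2 * ‖x‖ - 1)) := funext fun x => g1 x
  rw [← e] at k1
  exact (k1.trans (hg2.toPH fun x hx => gr _ _ hx)).compress fun x => hX (hg2' x)

lemma Conn.deform {A X : Set Y} (Θ : Y × ℝ → Y) (Λ : Y × ℝ × ℝ → Y)
    (hXA : X ⊆ A)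
    (hΘ : ContinuousOn Θ (A ×ˢ Set.Icc 0 1))
    (hΛ : ContinuousOn Λ (X ×ˢ (Set.Icc 0 1 ×ˢ Set.Icc 0 1)))
    (Θ0 : ∀ y ∈ A, Θ (y, 0) = y) (ΘA : ∀ y ∈ A, ∀ s ∈ Set.Icc (0:ℝ) 1, Θ (y, s) ∈ A)
    (Θ1 : ∀ y ∈ A, Θ (y, 1) ∈ X)
    (Λ0 : ∀ x ∈ X, ∀ s ∈ Set.Icc (0:ℝ) 1, Λ (x, s, 0) = Θ (x, s))
    (ΛA : ∀ x ∈ X, ∀ s ∈ Set.Icc (0:ℝ) 1, ∀ u ∈ Set.Icc (0:ℝ) 1, Λ (x, s, u) ∈ A)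
    (Λ1 : ∀ x ∈ X, ∀ s ∈ Set.Icc (0:ℝ) 1, Λ (x, s, 1) ∈ X)
    (Λs0 : ∀ x ∈ X, ∀ u ∈ Set.Icc (0:ℝ) 1, Λ (x, 0, u) = x)
    (Λs1 : ∀ x ∈ X, ∀ u ∈ Set.Icc (0:ℝ) 1, Λ (x, 1, u) ∈ X) : Conn ι A X := by
  intro g hg hA hB
  have c01 : ∀ t, cl01 t ∈ Set.Icc (0:ℝ) 1 := fun t => ⟨cl01_nonneg t, cl01_le t⟩
  have hB' : ∀ x, ¬ ‖x‖ ≤ 1/2 → g (sc 1 x) ∈ X := fun x hx => hB _ (norm_sc_one (by linarith))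
  have key : PH A X (fun x => g (sc 1 x)) (fun x => if ‖x‖ ≤ 1/2 then Θ (g (sc 1 x), 1) else
      Λ (g (sc 1 x), 1, cl01 (2 * ‖x‖ - 1))) := by
    refine ⟨fun p => if ‖p.1‖ ≤ 1/2 then Θ (g (sc 1 p.1), cl01 p.2) else
      Λ (g (sc 1 p.1), cl01 p.2, cl01 (2 * ‖p.1‖ - 1)), ?_, ?_, ?_, ?_, ?_⟩
    · refine continuous_collar (by fun_prop) ?_ ?_ ?_
      · exact hΘ.comp (by fun_prop) fun p hp => ⟨hA _, c01 _⟩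
      · exact hΛ.comp (by fun_prop) fun p hp => ⟨hB _ (norm_sc_one hp), c01 _, c01 _⟩
      · intro p hp
        rw [hp]
        norm_num
        rw [Λ0 _ (hB _ (norm_sc_one hp.ge)) _ (c01 _)]
    · intro x
      simp only [cl01_zero]
      split_ifs with hx
      · exact Θ0 _ (hA _)
      · exact Λs0 _ (hB' x hx) _ (c01 _)
    · intro x
      simp
    · intro p
      simp only
      split_ifs with hx
      · exact ΘA _ (hA _) _ (c01 _)
      · exact ΛA _ (hB' _ hx) _ (c01 _) _ (c01 _)
    · intro x t hx
      simp only
      rw [if_neg (by linarith), cl01_of_ge (by linarith : 1 ≤ 2 * ‖x‖ - 1)]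
      exact Λ1 _ (hB' _ (by linarith)) _ (c01 _)
  refine (((RH_sc hg hA).toPH hB).trans key).compress fun x => ?_
  split_ifs with hx
  · exact Θ1 _ (hA _)
  · exact Λs1 _ (hB' _ hx) _ (c01 _)

/-- homotopy extension and lifting for one ball -/
lemma Conn.help {A B : Set Y} (h : Conn ι A B) (k : (ι → ℝ) × ℝ → Y)
    (hk : ContinuousOn k {p | ‖p.1‖ ≤ 1 ∧ 0 ≤ p.2 ∧ p.2 ≤ 1 ∧ (p.2 = 0 ∨ ‖p.1‖ = 1)})
    (hA : ∀ x t, ‖x‖ ≤ 1 → 0 ≤ t → t ≤ 1 → (t = 0 ∨ ‖x‖ = 1) → k (x, t) ∈ A)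
    (hB : ∀ x, ‖x‖ = 1 → k (x, 1) ∈ B) :
    ∃ H : (ι → ℝ) × ℝ → Y, Continuous H ∧ (∀ p, H p ∈ A) ∧ (∀ x, ‖x‖ ≤ 1 → H (x, 1) ∈ B) ∧
      ∀ x t, ‖x‖ ≤ 1 → 0 ≤ t → t ≤ 1 → (t = 0 ∨ ‖x‖ = 1) → H (x, t) = k (x, t) := by
  -- the radial clamp
  let shr : ℝ → (ι → ℝ) → (ι → ℝ) := fun ρ x => (ρ / max ρ ‖x‖) • x
  have shr_norm : ∀ ρ x, 0 < ρ → ‖shr ρ x‖ ≤ ρ := by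
    intro ρ x hρ
    have : 0 < max ρ ‖x‖ := lt_max_of_lt_left hρ
    simp only [shr]
    rw [norm_smul, Real.norm_of_nonneg (by positivity), div_mul_eq_mul_div, div_le_iff₀ this]
    exact mul_le_mul_of_nonneg_left (le_max_right _ _) hρ.le
  have shr_ge : ∀ ρ x, 0 < ρ → ρ ≤ ‖x‖ → ‖shr ρ x‖ = ρ := by
    intro ρ x hρ hx
    simp only [shr]
    rw [norm_smul, max_eq_right hx, Real.norm_of_nonneg (by positivity)]
    field_simp [show ‖x‖ ≠ 0 by linarith]
  have shr_le : ∀ ρ x, 0 < ρ → ‖x‖ ≤ ρ → shr ρ x = x := by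
    intro ρ x hρ hx
    simp only [shr]
    rw [max_eq_left hx, div_self hρ.ne', one_smul]
  let b : (ι → ℝ) → (ι → ℝ) × ℝ := fun x => (shr 1 ((2:ℝ) • x), cl01 (2 * ‖x‖ - 1))
  have hb : Continuous b := by
    have : Continuous fun x : ι → ℝ => (1 / max 1 ‖(2:ℝ) • x‖) :=
      Continuous.div (by fun_prop) (by fun_prop) fun x => (lt_max_of_lt_left one_pos).ne'
    simp only [b, shr]
    fun_prop
  have hbox : ∀ x, ‖(b x).1‖ ≤ 1 ∧ 0 ≤ (b x).2 ∧ (b x).2 ≤ 1 ∧ ((b x).2 = 0 ∨ ‖(b x).1‖ = 1) := by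
    intro x
    refine ⟨shr_norm _ _ one_pos, cl01_nonneg _, cl01_le _, ?_⟩
    rcases le_total (2 * ‖x‖) 1 with hx | hx
    · exact Or.inl (cl01_of_le (by linarith))
    · refine Or.inr (shr_ge _ _ one_pos ?_)
      rw [norm_smul]; simpa using hx
  obtain ⟨g', ⟨G, hc, h0, h1, gA, gr⟩, hg'⟩ := h (fun x => k (b x)) (hk.comp_continuous hb hbox)
    (fun x => by obtain ⟨a1, a2, a3, a4⟩ := hbox x; exact hA _ _ a1 a2 a3 a4) (fun x hx => by
      have e : (b x).2 = 1 := cl01_of_ge (by linarith)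
      have : b x = ((b x).1, 1) := by rw [← e]
      rw [this]
      refine hB _ ?_
      rcases (hbox x).2.2.2 with h | h
      · rw [e] at h; norm_num at h
      · exact h)
  let u : (ι → ℝ) × ℝ → (ι → ℝ) × ℝ := fun p =>
    (shr ((1 + cl01 p.2) / 2) (((1 + 3 * cl01 p.2) / 2) • p.1),
      min 1 (2 * (1 - ‖p.1‖)) * cl01 p.2)
  have ρpos : ∀ t, 0 < (1 + cl01 t) / 2 := fun t => by have := cl01_nonneg t; linarith
  have hu : Continuous u := by
    have : Continuous fun p : (ι → ℝ) × ℝ => ((1 + cl01 p.2) / 2) /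
        max ((1 + cl01 p.2) / 2) ‖((1 + 3 * cl01 p.2) / 2) • p.1‖ :=
      Continuous.div (by fun_prop) (by fun_prop) fun p => (lt_max_of_lt_left (ρpos _)).ne'
    simp only [u, shr]
    fun_prop
  have nrm : ∀ x t, ‖((1 + 3 * cl01 t) / 2) • x‖ = (1 + 3 * cl01 t) / 2 * ‖(x : ι → ℝ)‖ := by
    intro x t
    have := cl01_nonneg t
    rw [norm_smul, Real.norm_of_nonneg (by linarith)]
  refine ⟨fun p => G (u p), hc.comp hu, fun p => gA _, fun x hx => ?_, ?_⟩
  · rcases le_total ‖x‖ (1/2) with hx2 | hx2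
    · have : (u (x, 1)).2 = 1 := by
        simp only [u, cl01_one]
        rw [min_eq_left (by linarith), mul_one]
      have e : u (x, 1) = ((u (x, 1)).1, 1) := Prod.ext rfl this
      show G (u (x, 1)) ∈ B
      rw [e, h1]
      exact hg' _
    · have : ‖(u (x, 1)).1‖ = 1 := by
        simp only [u]
        rw [shr_ge _ _ (ρpos _)]
        · norm_num
        · rw [nrm, cl01_one]; linarith
      show G ((u (x, 1)).1, (u (x, 1)).2) ∈ B
      rw [gr _ _ this.ge, ← gr _ 1 this.ge, h1]
      exact hg' _
  · intro x t hx t0 t1 ht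
    rcases ht with rfl | ht
    · have : u (x, 0) = ((1/2 : ℝ) • x, 0) := by
        simp only [u, cl01_zero, mul_zero, add_zero]
        rw [shr_le _ _ (by norm_num)]
        rw [norm_smul]; norm_num; linarith
      simp only [this, h0]
      have : b ((1/2 : ℝ) • x) = (x, 0) := by
        simp only [b]
        rw [smul_smul, norm_smul, shr_le _ _ one_pos]
        · rw [cl01_of_le] <;> norm_num; linarith
        · norm_num; linarith
      rw [this]
    · have : u (x, t) = (((1 + t) / 2) • x, 0) := by
        simp only [u, cl01_of_mem t0 t1, ht, sub_self, mul_zero]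
        simp only [shr, norm_smul, ht]
        rw [Real.norm_of_nonneg (by linarith), max_eq_right (by linarith), smul_smul]
        congr 2
        · field_simp
        · norm_num
      simp only [this, h0]
      have : b (((1 + t) / 2) • x) = (x, t) := by
        simp only [b, shr]
        rw [smul_smul 2, norm_smul, norm_smul, ht, mul_one]
        have e : ‖2 * ((1 + t) / 2)‖ = 1 + t := by rw [Real.norm_of_nonneg (by linarith)]; ring
        have e2 : ‖(1 + t) / 2‖ = (1 + t) / 2 := by rw [Real.norm_of_nonneg (by linarith)]
        rw [e, e2, mul_one, max_eq_right (by linarith), smul_smul]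
        congr 1
        · rw [show 1 / (1 + t) * (2 * ((1 + t) / 2)) = 1 by field_simp, one_smul]
        · rw [show 2 * ((1 + t) / 2) - 1 = t by ring, cl01_of_mem t0 t1]
      rw [this]

end
end HS

namespace HS

/-! ## Gluing over finitely many cells -/

lemma glue_cells {κ : Type*} [DecidableEq κ] {M T : Type*} [TopologicalSpace M]
    [TopologicalSpace T] [Nonempty T]
    (s : Finset κ) (dim : κ → ℕ) (cl bd : κ → Set M) (P : M → Set T)
    (hcl : ∀ σ, IsClosed (cl σ)) (hbc : ∀ σ, bd σ ⊆ cl σ)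
    (hcell : ∀ σ ∈ s, ∀ τ ∈ s, ∀ x ∈ cl σ, x ∉ bd σ → x ∈ cl τ → σ = τ ∨ dim σ < dim τ)
    (hbd : ∀ σ ∈ s, ∀ x ∈ bd σ, ∃ τ ∈ s, dim τ < dim σ ∧ x ∈ cl τ)
    (hext : ∀ σ ∈ s, ∀ g : M → T, ContinuousOn g (bd σ) → (∀ x ∈ bd σ, g x ∈ P x) →
      ∃ g', ContinuousOn g' (cl σ) ∧ Set.EqOn g' g (bd σ) ∧ ∀ x ∈ cl σ, g' x ∈ P x) :
    ∃ g : M → T, ContinuousOn g (⋃ σ ∈ s, cl σ) ∧ ∀ x ∈ ⋃ σ ∈ s, cl σ, g x ∈ P x := by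
  classical
  suffices H : ∀ n, ∀ L : Finset κ, L.card = n → L ⊆ s →
      (∀ σ ∈ L, ∀ τ ∈ s, dim τ < dim σ → τ ∈ L) →
      ∃ g : M → T, ContinuousOn g (⋃ σ ∈ L, cl σ) ∧ ∀ x ∈ ⋃ σ ∈ L, cl σ, g x ∈ P x from
    H _ s rfl (fun _ h => h) fun _ _ _ h _ => h
  intro n
  induction n with
  | zero =>
    intro L hL _ _
    rw [Finset.card_eq_zero] at hL
    subst hL
    exact ⟨fun _ => Classical.arbitrary T, by simp, by simp⟩
  | succ n ih =>
    intro L hL hLs hdc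
    have hne : L.Nonempty := by rw [← Finset.card_pos]; omega
    obtain ⟨σ, hσ, hmax⟩ := L.exists_max_image dim hne
    obtain ⟨g, gc, gP⟩ := ih (L.erase σ) (by rw [Finset.card_erase_of_mem hσ]; omega)
      ((Finset.erase_subset _ _).trans hLs) (by
        intro ρ hρ τ hτ hd
        rw [Finset.mem_erase] at hρ ⊢
        refine ⟨?_, hdc ρ hρ.2 τ hτ hd⟩
        rintro rfl
        exact absurd (hmax ρ hρ.2) (by omega))
    have hsub : bd σ ⊆ ⋃ τ ∈ L.erase σ, cl τ := by
      intro x hx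
      obtain ⟨τ, hτ, hd, hx'⟩ := hbd σ (hLs hσ) x hx
      simp only [Set.mem_iUnion]
      exact ⟨τ, Finset.mem_erase.2 ⟨by rintro rfl; omega, hdc σ hσ τ hτ hd⟩, hx'⟩
    obtain ⟨g', gc', ge, gP'⟩ := hext σ (hLs hσ) g (gc.mono hsub) fun x hx => gP x (hsub hx)
    let G : M → T := fun x => if x ∈ cl σ then g' x else g x
    have G1 : Set.EqOn G g' (cl σ) := fun x hx => if_pos hx
    have G2 : Set.EqOn G g (⋃ τ ∈ L.erase σ, cl τ) := by
      intro x hx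
      by_cases hxσ : x ∈ cl σ
      · rw [G1 hxσ]
        by_cases hb : x ∈ bd σ
        · exact ge hb
        · exfalso
          simp only [Set.mem_iUnion] at hx
          obtain ⟨τ, hτ, hxτ⟩ := hx
          rw [Finset.mem_erase] at hτ
          rcases hcell σ (hLs hσ) τ (hLs hτ.2) x hxσ hb hxτ with h | h
          · exact hτ.1 h.symm
          · exact absurd (hmax τ hτ.2) (by omega)
      · exact if_neg hxσ
    have hU : (⋃ τ ∈ L, cl τ) = cl σ ∪ ⋃ τ ∈ L.erase σ, cl τ := by
      conv_lhs => rw [← Finset.insert_erase hσ]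
      rw [Finset.set_biUnion_insert]
    refine ⟨G, ?_, ?_⟩
    · rw [hU]
      refine ContinuousOn.union_of_isClosed (gc'.congr G1) (gc.congr G2) (hcl σ) ?_
      exact Set.Finite.isClosed_biUnion (Finset.finite_toSet _) fun τ _ => hcl τ
    · rw [hU]
      rintro x (hx | hx)
      · rw [G1 hx]; exact gP' x hx
      · rw [G2 hx]; exact gP x hx

/-! ## Cubical cells -/

/-- a cubical cell: lower corner and the set of free directions -/
abbrev Cell (ι : Type) := ι → ℕ × Bool

section
variable {ι : Type} [Fintype ι]

def Cell.lo (σ : Cell ι) (i : ι) : ℝ := ((σ i).1 : ℝ)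
def Cell.fr (σ : Cell ι) (i : ι) : Prop := (σ i).2 = true
instance (σ : Cell ι) : DecidablePred σ.fr := fun i => inferInstanceAs (Decidable (_ = _))
def Cell.hi (σ : Cell ι) (i : ι) : ℝ := σ.lo i + if σ.fr i then 1 else 0
def Cell.cl (σ : Cell ι) : Set (ι → ℝ) := Set.Icc σ.lo σ.hi
def Cell.bd (σ : Cell ι) : Set (ι → ℝ) := {x ∈ σ.cl | ∃ i, σ.fr i ∧ (x i = σ.lo i ∨ x i = σ.hi i)}
def Cell.dim (σ : Cell ι) : ℕ := (Finset.univ.filter σ.fr).card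

open Classical in
def cells (ι : Type) [Fintype ι] (N : ℕ) : Finset (Cell ι) :=
  Fintype.piFinset fun _ => ((Finset.range (N + 1)) ×ˢ Finset.univ).filter
    fun q => q.1 + (if q.2 = true then 1 else 0) ≤ N

/-- the big cube and its boundary -/
def bigK (ι : Type) (N : ℕ) : Set (ι → ℝ) := Set.Icc 0 (fun _ => (N : ℝ))
def bdK (ι : Type) (N : ℕ) : Set (ι → ℝ) := {x ∈ bigK ι N | ∃ i, x i = 0 ∨ x i = N}

lemma mem_cells {N : ℕ} {σ : Cell ι} :
    σ ∈ cells ι N ↔ ∀ i, (σ i).1 + (if σ.fr i then 1 else 0) ≤ N := by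
  classical
  simp only [cells, Fintype.mem_piFinset, Finset.mem_filter, Finset.mem_product, Finset.mem_range,
    Finset.mem_univ, and_true]
  refine forall_congr' fun i => ⟨fun h => ?_, fun h => ⟨?_, ?_⟩⟩
  · have := h.2
    by_cases hf : (σ i).2 = true <;> simpa [Cell.fr, hf] using this
  · split_ifs at h <;> omega
  · by_cases hf : (σ i).2 = true <;> simpa [Cell.fr, hf] using h

open Classical in
/-- the carrier of a point -/
def car (x : ι → ℝ) : Cell ι := fun i => (⌊x i⌋₊, decide ((⌊x i⌋₊ : ℝ) ≠ x i))

lemma car_fr (x : ι → ℝ) (i : ι) : (car x).fr i ↔ (⌊x i⌋₊ : ℝ) ≠ x i := by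
  simp [car, Cell.fr]

lemma car_mem_cl {x : ι → ℝ} (hx : 0 ≤ x) : x ∈ (car x).cl := by
  constructor
  · intro i
    exact Nat.floor_le (hx i)
  · intro i
    simp only [Cell.hi]
    split_ifs with h
    · exact (Nat.lt_floor_add_one (x i)).le
    · rw [car_fr, not_not] at h
      simp only [Cell.lo, car, add_zero]; exact h.ge

lemma eq_car {σ : Cell ι} {x : ι → ℝ} (hx : x ∈ σ.cl) (hb : x ∉ σ.bd) : σ = car x := by
  funext i
  have h1 := hx.1 i
  have h2 := hx.2 i
  by_cases hf : σ.fr i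
  · have h3 : x i ≠ σ.lo i ∧ x i ≠ σ.hi i := by
      constructor <;> intro h <;> exact hb ⟨hx, i, hf, by simp [h]⟩
    have h4 : σ.hi i = σ.lo i + 1 := by simp [Cell.hi, hf]
    have h5 : ⌊x i⌋₊ = (σ i).1 := by
      rw [Nat.floor_eq_iff]
      · refine ⟨h1, ?_⟩
        have := lt_of_le_of_ne h2 h3.2
        rw [h4] at this
        exact this
      · exact le_trans (Nat.cast_nonneg _) h1
    have h6 : ((⌊x i⌋₊ : ℝ) ≠ x i) := by rw [h5]; exact fun h => h3.1 h.symm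
    refine Prod.ext h5.symm ?_
    simp only [car]
    rw [show (σ i).2 = true from hf]
    simp [h6]
  · have h4 : σ.hi i = σ.lo i := by simp [Cell.hi, hf]
    have h5 : x i = ((σ i).1 : ℝ) := le_antisymm (h2.trans h4.le) h1
    simp only [car]
    rw [h5, Nat.floor_natCast]
    refine Prod.ext rfl ?_
    simp only [Cell.fr, Bool.not_eq_true] at hf
    simp [hf]

lemma car_not_bd {x : ι → ℝ} : x ∉ (car x).bd := by
  rintro ⟨hx, i, hi, h⟩
  rw [car_fr] at hi
  rcases h with h | h
  · exact hi h.symm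
  · have : (car x).hi i = ⌊x i⌋₊ + 1 := by
      rw [Cell.hi, if_pos ((car_fr x i).2 hi)]; rfl
    have h2 := Nat.lt_floor_add_one (x i)
    linarith

lemma nonneg_of_cl {σ : Cell ι} {x : ι → ℝ} (hx : x ∈ σ.cl) : 0 ≤ x := fun i =>
  le_trans (Nat.cast_nonneg _) (hx.1 i)

lemma car_coord {τ : Cell ι} {x : ι → ℝ} (hx : x ∈ τ.cl) (i : ι) :
    car x i = τ i ∨ (τ.fr i ∧ ¬ (car x).fr i ∧ τ.lo i ≤ (car x).lo i ∧ (car x).lo i ≤ τ.hi i) := by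
  have h1 := hx.1 i
  have h2 := hx.2 i
  have x0 := nonneg_of_cl hx i
  by_cases hf : τ.fr i
  · have h4 : τ.hi i = τ.lo i + 1 := by simp [Cell.hi, hf]
    by_cases hc : (car x).fr i
    · left
      have hc' := (car_fr x i).1 hc
      refine Prod.ext ?_ (by rw [show (τ i).2 = true from hf]; exact hc)
      show ⌊x i⌋₊ = _
      rw [Nat.floor_eq_iff x0]
      refine ⟨h1, lt_of_le_of_ne (h2.trans h4.le) ?_⟩
      intro h
      apply hc'
      rw [h]
      have : ((τ i).1 : ℝ) + 1 = (((τ i).1 + 1 : ℕ) : ℝ) := by push_cast; rfl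
      simp only [Cell.lo, this, Nat.floor_natCast]
    · right
      have hc' := hc
      rw [car_fr, not_not] at hc'
      have : (car x).lo i = x i := hc'
      rw [this]
      exact ⟨hf, hc, h1, h2⟩
  · left
    have h4 : τ.hi i = τ.lo i := by simp [Cell.hi, hf]
    have h5 : x i = ((τ i).1 : ℝ) := le_antisymm (h2.trans h4.le) h1
    simp only [car]
    rw [h5, Nat.floor_natCast]
    refine Prod.ext rfl ?_
    simp only [Cell.fr, Bool.not_eq_true] at hf
    simp [hf]

lemma car_sub {τ : Cell ι} {x : ι → ℝ} (hx : x ∈ τ.cl) : (car x).cl ⊆ τ.cl := by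
  refine Set.Icc_subset_Icc (fun i => ?_) (fun i => ?_)
  · rcases car_coord hx i with h | h
    · simp [Cell.lo, h]
    · exact h.2.2.1
  · rcases car_coord hx i with h | h
    · by_cases hf : (τ i).2 = true <;> simp [Cell.hi, Cell.lo, Cell.fr, h, hf]
    · have : (car x).hi i = (car x).lo i := by simp [Cell.hi, h.2.1]
      rw [this]; exact h.2.2.2

lemma car_dim {τ : Cell ι} {x : ι → ℝ} (hx : x ∈ τ.cl) : car x = τ ∨ (car x).dim < τ.dim := by
  by_cases he : car x = τ
  · exact Or.inl he
  · right
    obtain ⟨i, hi⟩ := Function.ne_iff.1 he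
    refine Finset.card_lt_card ⟨?_, ?_⟩
    · intro j hj
      simp only [Finset.mem_filter, Finset.mem_univ, true_and] at hj ⊢
      rcases car_coord hx j with h | h
      · simpa [Cell.fr, h] using hj
      · exact h.1
    · intro hsub
      rcases car_coord hx i with h | h
      · exact hi h
      · have := hsub (show i ∈ Finset.univ.filter τ.fr by simp [h.1])
        simp [h.2.1] at this

lemma car_mem_cells {N : ℕ} {x : ι → ℝ} (hx : x ∈ bigK ι N) : car x ∈ cells ι N := by
  rw [mem_cells]
  intro i
  have h0 := hx.1 i
  have h1 : x i ≤ N := hx.2 i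
  have h2 : ⌊x i⌋₊ ≤ N := by
    have := Nat.floor_le_floor h1
    rwa [Nat.floor_natCast] at this
  split_ifs with h
  · rw [car_fr] at h
    have : ⌊x i⌋₊ < N := by
      refine lt_of_le_of_ne h2 fun h3 => h (le_antisymm (Nat.floor_le h0) ?_)
      rw [h3]; exact h1
    exact this
  · simpa [car] using h2

lemma cl_sub_bigK {N : ℕ} {σ : Cell ι} (hσ : σ ∈ cells ι N) : σ.cl ⊆ bigK ι N := by
  rw [mem_cells] at hσ
  refine Set.Icc_subset_Icc (fun i => Nat.cast_nonneg _) (fun i => ?_)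
  have := hσ i
  simp only [Cell.hi, Cell.lo]
  split_ifs at this ⊢ <;> exact_mod_cast this

lemma iUnion_cells (N : ℕ) : (⋃ σ ∈ cells ι N, Cell.cl σ) = bigK ι N := by
  ext x
  simp only [Set.mem_iUnion, exists_prop]
  exact ⟨fun ⟨σ, h, hx⟩ => cl_sub_bigK h hx, fun hx => ⟨car x, car_mem_cells hx, car_mem_cl hx.1⟩⟩

/-- extension over prisms `σ × [0,1]` -/
lemma cell_ext {T : Type*} [TopologicalSpace T] [Nonempty T] (N : ℕ) (P : (ι → ℝ) × ℝ → Set T)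
    (hext : ∀ σ ∈ cells ι N, ∀ g : (ι → ℝ) × ℝ → T, ContinuousOn g (σ.bd ×ˢ Set.Icc 0 1) →
      (∀ p ∈ σ.bd ×ˢ Set.Icc (0:ℝ) 1, g p ∈ P p) →
      ∃ g', ContinuousOn g' (σ.cl ×ˢ Set.Icc 0 1) ∧ Set.EqOn g' g (σ.bd ×ˢ Set.Icc 0 1) ∧
        ∀ p ∈ σ.cl ×ˢ Set.Icc (0:ℝ) 1, g' p ∈ P p) :
    ∃ g : (ι → ℝ) × ℝ → T, ContinuousOn g (bigK ι N ×ˢ Set.Icc 0 1) ∧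
      ∀ p ∈ bigK ι N ×ˢ Set.Icc (0:ℝ) 1, g p ∈ P p := by
  classical
  have := glue_cells (cells ι N) Cell.dim (fun σ => σ.cl ×ˢ Set.Icc (0:ℝ) 1)
    (fun σ => σ.bd ×ˢ Set.Icc (0:ℝ) 1) P (fun σ => isClosed_Icc.prod isClosed_Icc)
    (fun σ => Set.prod_mono (fun x hx => hx.1) subset_rfl) (by
      rintro σ hσ τ hτ ⟨x, t⟩ ⟨hx, ht⟩ hb ⟨hx', -⟩
      have : σ = car x := eq_car hx fun h => hb ⟨h, ht⟩
      rw [this]; exact car_dim hx') (by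
      rintro σ hσ ⟨x, t⟩ ⟨hx, ht⟩
      refine ⟨car x, car_mem_cells (cl_sub_bigK hσ hx.1), ?_,
        car_mem_cl (nonneg_of_cl hx.1), ht⟩
      rcases car_dim hx.1 with h | h
      · exact absurd hx (by simp only; rw [← h]; exact car_not_bd)
      · exact h) hext
  have e : (⋃ σ ∈ cells ι N, σ.cl ×ˢ Set.Icc (0:ℝ) 1) = bigK ι N ×ˢ Set.Icc (0:ℝ) 1 := by
    rw [← iUnion_cells]
    ext ⟨x, t⟩
    simp only [Set.mem_iUnion, Set.mem_prod, exists_prop]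
    exact ⟨fun ⟨σ, h, a, b⟩ => ⟨⟨σ, h, a⟩, b⟩, fun ⟨⟨σ, h, a⟩, b⟩ => ⟨σ, h, a, b⟩⟩
  rwa [e] at this

/-- index type of the free directions -/
abbrev Cell.Fr (σ : Cell ι) : Type := {i : ι // σ.fr i}

def Cell.par (σ : Cell ι) (y : σ.Fr → ℝ) : ι → ℝ := fun i =>
  if h : σ.fr i then σ.lo i + (1 + y ⟨i, h⟩) / 2 else σ.lo i

def Cell.unpar (σ : Cell ι) (x : ι → ℝ) : σ.Fr → ℝ := fun i => 2 * (x i - σ.lo i) - 1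

lemma continuous_par (σ : Cell ι) : Continuous σ.par := by
  refine continuous_pi fun i => ?_
  unfold Cell.par
  split_ifs <;> fun_prop
lemma continuous_unpar (σ : Cell ι) : Continuous σ.unpar := by
  unfold Cell.unpar; fun_prop

lemma unpar_par (σ : Cell ι) (y) : σ.unpar (σ.par y) = y := by
  funext i
  simp only [Cell.unpar, Cell.par, dif_pos i.2]
  ring
lemma par_unpar {σ : Cell ι} {x : ι → ℝ} (hx : x ∈ σ.cl) : σ.par (σ.unpar x) = x := by
  funext i
  simp only [Cell.par, Cell.unpar]
  split_ifs with h
  · ring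
  · have h4 : σ.hi i = σ.lo i := by simp [Cell.hi, h]
    exact le_antisymm (hx.1 i) ((hx.2 i).trans h4.le)
lemma par_mem {σ : Cell ι} {y : σ.Fr → ℝ} (hy : ‖y‖ ≤ 1) : σ.par y ∈ σ.cl := by
  rw [pi_norm_le_iff_of_nonneg zero_le_one] at hy
  constructor <;> intro i <;> simp only [Cell.par, Cell.hi]
  · split_ifs with h
    · have := abs_le.1 (hy ⟨i, h⟩); linarith
    · exact le_rfl
  · split_ifs with h
    · have := abs_le.1 (hy ⟨i, h⟩); linarith
    · simp
lemma norm_unpar_le {σ : Cell ι} {x : ι → ℝ} (hx : x ∈ σ.cl) : ‖σ.unpar x‖ ≤ 1 := by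
  rw [pi_norm_le_iff_of_nonneg zero_le_one]
  intro i
  have h1 := hx.1 i
  have h2 := hx.2 i
  have h4 : σ.hi i = σ.lo i + 1 := by simp [Cell.hi, i.2]
  rw [Real.norm_eq_abs, abs_le]
  simp only [Cell.unpar]
  constructor <;> linarith
lemma par_bd {σ : Cell ι} {y : σ.Fr → ℝ} (hy : ‖y‖ = 1) : σ.par y ∈ σ.bd := by
  refine ⟨par_mem hy.le, ?_⟩
  have hne : Nonempty σ.Fr := by
    by_contra h
    rw [not_nonempty_iff] at h
    have : y = 0 := Subsingleton.elim _ _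
    rw [this, norm_zero] at hy; norm_num at hy
  obtain ⟨i, hi⟩ : ∃ i, ‖y i‖ = ‖y‖ := by
    by_contra! hh
    have : ‖y‖ < 1 := by
      rw [pi_norm_lt_iff one_pos]
      intro i
      exact lt_of_le_of_ne ((norm_le_pi_norm y i).trans hy.le) (hy ▸ hh i)
    linarith
  refine ⟨i.1, i.2, ?_⟩
  have h4 : σ.hi i = σ.lo i + 1 := by simp [Cell.hi, i.2]
  rw [hy, Real.norm_eq_abs] at hi
  simp only [Cell.par, dif_pos i.2, h4]
  rcases (abs_eq zero_le_one).1 hi with h | h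
  · right
    rw [show y ⟨i.1, i.2⟩ = 1 from h]; ring
  · left
    rw [show y ⟨i.1, i.2⟩ = -1 from h]; ring
lemma norm_unpar_bd {σ : Cell ι} {x : ι → ℝ} (hx : x ∈ σ.bd) : ‖σ.unpar x‖ = 1 := by
  refine le_antisymm (norm_unpar_le hx.1) ?_
  obtain ⟨hx, i, hf, h⟩ := hx
  have h4 : σ.hi i = σ.lo i + 1 := by simp [Cell.hi, hf]
  refine le_trans ?_ (norm_le_pi_norm _ ⟨i, hf⟩)
  simp only [Cell.unpar, Real.norm_eq_abs]
  rcases h with h | h <;> rw [h] <;> norm_num [h4]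

/-- cells in the boundary of the big cube -/
lemma bdK_of_cell {N : ℕ} {σ : Cell ι} (hσ : σ ∈ cells ι N) {x : ι → ℝ} (hx : x ∈ σ.cl)
    (hb : x ∉ σ.bd) (hK : x ∈ bdK ι N) : σ.cl ⊆ bdK ι N := by
  intro y hy
  refine ⟨cl_sub_bigK hσ hy, ?_⟩
  obtain ⟨-, i, hi⟩ := hK
  refine ⟨i, ?_⟩
  have hf : ¬ σ.fr i := by
    rw [eq_car hx hb, car_fr, not_not]
    rcases hi with h | h <;> simp [h]
  have h4 : σ.hi i = σ.lo i := by simp [Cell.hi, hf]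
  have e : ∀ z ∈ σ.cl, z i = σ.lo i := fun z hz => le_antisymm ((hz.2 i).trans h4.le) (hz.1 i)
  rw [e y hy, ← e x hx]; exact hi

lemma prism {Y : Type*} [TopologicalSpace Y] (N : ℕ) (A B : Cell ι → Set Y)
    (hA : ∀ σ ∈ cells ι N, ∀ τ ∈ cells ι N, σ.cl ⊆ τ.cl → A σ ⊆ A τ)
    (hB : ∀ σ ∈ cells ι N, ∀ τ ∈ cells ι N, σ.cl ⊆ τ.cl → B σ ⊆ B τ)
    (hconn : ∀ σ ∈ cells ι N, Conn σ.Fr (A σ) (B σ))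
    (f : (ι → ℝ) → Y) (hf : ContinuousOn f (bigK ι N)) (hfA : ∀ σ ∈ cells ι N, ∀ x ∈ σ.cl, f x ∈ A σ)
    (hfB : ∀ σ ∈ cells ι N, ∀ x ∈ σ.cl, x ∈ bdK ι N → f x ∈ B σ) :
    ∃ H : (ι → ℝ) × ℝ → Y, ContinuousOn H (bigK ι N ×ˢ Set.Icc 0 1) ∧
      (∀ x ∈ bigK ι N, H (x, 0) = f x) ∧
      (∀ σ ∈ cells ι N, ∀ x ∈ σ.cl, ∀ t ∈ Set.Icc (0:ℝ) 1, H (x, t) ∈ A σ) ∧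
      (∀ σ ∈ cells ι N, ∀ x ∈ σ.cl, H (x, 1) ∈ B σ) ∧
      (∀ x ∈ bdK ι N, ∀ t ∈ Set.Icc (0:ℝ) 1, H (x, t) = f x) := by
  classical
  haveI : Nonempty Y := ⟨f 0⟩
  let P : (ι → ℝ) × ℝ → Set Y := fun p => {z | (∀ σ ∈ cells ι N, p.1 ∈ σ.cl → z ∈ A σ) ∧
    (p.2 = 0 → z = f p.1) ∧ (p.2 = 1 → ∀ σ ∈ cells ι N, p.1 ∈ σ.cl → z ∈ B σ) ∧
    (p.1 ∈ bdK ι N → z = f p.1)}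
  have key := cell_ext N P ?_
  · obtain ⟨H, hc, hP⟩ := key
    have z0 : (0:ℝ) ∈ Set.Icc (0:ℝ) 1 := by simp
    have z1 : (1:ℝ) ∈ Set.Icc (0:ℝ) 1 := by simp
    exact ⟨H, hc, fun x hx => (hP (x, 0) ⟨hx, z0⟩).2.1 rfl,
      fun σ hσ x hx t ht => (hP (x, t) ⟨cl_sub_bigK hσ hx, ht⟩).1 σ hσ hx,
      fun σ hσ x hx => (hP (x, 1) ⟨cl_sub_bigK hσ hx, z1⟩).2.2.1 rfl σ hσ hx,
      fun x hx t ht => (hP (x, t) ⟨hx.1, ht⟩).2.2.2 hx⟩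
  · intro σ hσ g gc gP
    by_cases hK : σ.cl ⊆ bdK ι N
    · refine ⟨fun p => f p.1, ?_, fun p hp => ((gP p hp).2.2.2 (hK hp.1.1)).symm, fun p hp =>
        ⟨fun τ hτ hx => hfA τ hτ _ hx, fun _ => rfl, fun _ τ hτ hx => hfB τ hτ _ hx (hK hp.1),
          fun _ => rfl⟩⟩
      exact hf.comp (by fun_prop) fun p hp => cl_sub_bigK hσ hp.1
    · let k : (σ.Fr → ℝ) × ℝ → Y := fun p => if p.2 = 0 then f (σ.par p.1) else g (σ.par p.1, p.2)
      have kg : ∀ y t, ‖y‖ = 1 → 0 ≤ t → t ≤ 1 → k (y, t) = g (σ.par y, t) := by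
        intro y t hy h0 h1
        simp only [k]
        split_ifs with h
        · exact ((gP (σ.par y, t) ⟨par_bd hy, h0, h1⟩).2.1 h).symm
        · rfl
      obtain ⟨H, hc, hHA, hHB, hH⟩ := (hconn σ hσ).help k (by
        have : {p : (σ.Fr → ℝ) × ℝ | ‖p.1‖ ≤ 1 ∧ 0 ≤ p.2 ∧ p.2 ≤ 1 ∧ (p.2 = 0 ∨ ‖p.1‖ = 1)} =
          {p | ‖p.1‖ ≤ 1 ∧ p.2 = 0} ∪ {p | ‖p.1‖ = 1 ∧ 0 ≤ p.2 ∧ p.2 ≤ 1} := by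
          ext p
          simp only [Set.mem_setOf_eq, Set.mem_union]
          constructor
          · rintro ⟨a, b, c, d | d⟩
            · exact Or.inl ⟨a, d⟩
            · exact Or.inr ⟨d, b, c⟩
          · rintro (⟨a, b⟩ | ⟨a, b, c⟩)
            · exact ⟨a, b.ge, b.le.trans zero_le_one, Or.inl b⟩
            · exact ⟨a.le, b, c, Or.inr a⟩
        rw [this]
        refine ContinuousOn.union_of_isClosed ?_ ?_ ?_ ?_
        · refine ContinuousOn.congr (f := fun p => f (σ.par p.1)) ?_ fun p hp => if_pos hp.2
          exact hf.comp ((continuous_par σ).comp continuous_fst).continuousOn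
            fun p hp => cl_sub_bigK hσ (par_mem hp.1)
        · refine ContinuousOn.congr (f := fun p => g (σ.par p.1, p.2)) ?_
            fun p hp => kg p.1 p.2 hp.1 hp.2.1 hp.2.2
          exact gc.comp (((continuous_par σ).comp continuous_fst).prodMk
            continuous_snd).continuousOn fun p hp => ⟨par_bd hp.1, hp.2.1, hp.2.2⟩
        · have c1 : IsClosed {p : (σ.Fr → ℝ) × ℝ | ‖p.1‖ ≤ 1} :=
            isClosed_le (by fun_prop) (by fun_prop)
          have c2 : IsClosed {p : (σ.Fr → ℝ) × ℝ | p.2 = 0} :=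
            isClosed_eq (by fun_prop) (by fun_prop)
          exact c1.inter c2
        · have c1 : IsClosed {p : (σ.Fr → ℝ) × ℝ | ‖p.1‖ = 1} :=
            isClosed_eq (by fun_prop) (by fun_prop)
          have c2 : IsClosed {p : (σ.Fr → ℝ) × ℝ | 0 ≤ p.2} :=
            isClosed_le (by fun_prop) (by fun_prop)
          have c3 : IsClosed {p : (σ.Fr → ℝ) × ℝ | p.2 ≤ 1} :=
            isClosed_le (by fun_prop) (by fun_prop)
          exact c1.inter (c2.inter c3))
        (by
          intro y t hy h0 h1 h
          rcases h with rfl | h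
          · simp only [k, if_true]
            exact hfA σ hσ _ (par_mem hy)
          · rw [kg y t h h0 h1]
            exact (gP (σ.par y, t) ⟨par_bd h, h0, h1⟩).1 σ hσ (par_mem hy))
        (by
          intro y hy
          rw [kg y 1 hy zero_le_one le_rfl]
          exact (gP (σ.par y, 1) ⟨par_bd hy, by simp⟩).2.2.1 rfl σ hσ (par_mem hy.le))
      have heq : Set.EqOn (fun p => H (σ.unpar p.1, p.2)) g (σ.bd ×ˢ Set.Icc 0 1) := by
        rintro ⟨x, t⟩ ⟨hx, ht⟩
        have n1 := norm_unpar_bd hx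
        simp only
        rw [hH _ _ n1.le ht.1 ht.2 (Or.inr n1), kg _ _ n1 ht.1 ht.2, par_unpar hx.1]
      refine ⟨fun p => H (σ.unpar p.1, p.2), ?_, heq, ?_⟩
      · exact (hc.comp (((continuous_unpar σ).comp continuous_fst).prodMk
            continuous_snd)).continuousOn
      · rintro ⟨x, t⟩ ⟨hx, ht⟩
        by_cases hb : x ∈ σ.bd
        · rw [heq ⟨hb, ht⟩]; exact gP _ ⟨hb, ht⟩
        · have hc := eq_car hx hb
          have hsub : ∀ τ ∈ cells ι N, x ∈ τ.cl → σ.cl ⊆ τ.cl := fun τ _ h => by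
            rw [hc]; exact car_sub h
          refine ⟨fun τ hτ h => hA σ hσ τ hτ (hsub τ hτ h) (hHA _), ?_, ?_, ?_⟩
          · rintro h
            simp only at h
            subst h
            simp only
            rw [hH _ _ (norm_unpar_le hx) le_rfl zero_le_one (Or.inl rfl)]
            simp only [k, if_true]
            rw [par_unpar hx]
          · intro h τ hτ h'
            simp only at h
            subst h
            exact hB σ hσ τ hτ (hsub τ hτ h') (hHB _ (norm_unpar_le hx))
          · intro h
            exact absurd (bdK_of_cell hσ hx hb h) hK

end
end HS

namespace HS

/-! ## Levels of small open sets -/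

/-- a basis-like family of open sets -/
structure Fam {B : Type*} [TopologicalSpace B] (𝓑 : Set (Set B)) : Prop where
  op : ∀ U ∈ 𝓑, IsOpen U
  cov : ∀ b : B, ∃ U ∈ 𝓑, b ∈ U
  fil : ∀ U ∈ 𝓑, ∀ V ∈ 𝓑, ∀ b, b ∈ U → b ∈ V → ∃ W ∈ 𝓑, b ∈ W ∧ W ⊆ U ∧ W ⊆ V

lemma Fam.fin {B : Type*} [TopologicalSpace B] {𝓑 : Set (Set B)} (h : Fam 𝓑) (b : B)
    (S : Finset (Set B)) (hS : ∀ U ∈ S, U ∈ 𝓑) :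
    ∃ W ∈ 𝓑, b ∈ W ∧ ∀ U ∈ S, b ∈ U → W ⊆ U := by
  classical
  induction S using Finset.induction_on with
  | empty =>
    obtain ⟨U, h1, h2⟩ := h.cov b
    exact ⟨U, h1, h2, by simp⟩
  | insert V S hV ih =>
    obtain ⟨W, h1, h2, h3⟩ := ih fun U hU => hS U (Finset.mem_insert_of_mem hU)
    by_cases hb : b ∈ V
    · obtain ⟨W', a1, a2, a3, a4⟩ := h.fil W h1 V (hS V (Finset.mem_insert_self _ _)) b h2 hb
      refine ⟨W', a1, a2, ?_⟩
      intro U hU hbU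
      rcases Finset.mem_insert.1 hU with rfl | hU
      · exact a4
      · exact a3.trans (h3 U hU hbU)
    · refine ⟨W, h1, h2, ?_⟩
      intro U hU hbU
      rcases Finset.mem_insert.1 hU with rfl | hU
      · exact absurd hbU hb
      · exact h3 U hU hbU

lemma levels {B M : Type*} [TopologicalSpace B] [PseudoMetricSpace M] {𝓑 : Set (Set B)}
    (h : Fam 𝓑) {K : Set M} (hK : IsCompact K) {f : M → B} (hf : Continuous f) (m : ℕ) :
    ∃ (V : ℕ → M → Set B) (δ : ℝ), 0 < δ ∧ (∀ k x, k ≤ m → x ∈ K → V k x ∈ 𝓑) ∧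
      (∀ k x y, k ≤ m → x ∈ K → y ∈ K → dist x y < δ → f y ∈ V k x) ∧
      (∀ k l x y, k < l → l ≤ m → x ∈ K → y ∈ K → dist x y < δ → V k x ⊆ V l y) := by
  classical
  suffices H : ∃ (V : ℕ → M → Set B) (S : Finset (Set B)) (δ : ℝ), 0 < δ ∧
      (∀ U ∈ S, U ∈ 𝓑) ∧ (∀ k x, k ≤ m → x ∈ K → V k x ∈ S) ∧
      (∀ k x y, k ≤ m → x ∈ K → y ∈ K → dist x y < δ → f y ∈ V k x) ∧
      (∀ k l x y, k < l → l ≤ m → x ∈ K → y ∈ K → dist x y < δ → V k x ⊆ V l y) by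
    obtain ⟨V, S, δ, h1, h2, h3, h4, h5⟩ := H
    exact ⟨V, δ, h1, fun k x a b => h2 _ (h3 k x a b), h4, h5⟩
  have step : ∀ (S : Finset (Set B)) (δ : ℝ), 0 < δ → (∀ U ∈ S, U ∈ 𝓑) →
      ∃ (W : M → Set B) (S' : Finset (Set B)) (δ' : ℝ), 0 < δ' ∧ δ' ≤ δ ∧ (∀ U ∈ S', U ∈ 𝓑) ∧
        (∀ x ∈ K, W x ∈ S') ∧ (∀ x ∈ K, ∀ y ∈ K, dist x y < δ' → f y ∈ W x) ∧
        (∀ x ∈ K, ∀ y ∈ K, dist x y < δ' → ∀ U ∈ S, (∀ z ∈ K, dist y z < δ → f z ∈ U) → W x ⊆ U) := by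
    intro S δ hδ hS
    choose W W1 W2 W3 using fun x : M => h.fin (f x) S hS
    obtain ⟨t, ht⟩ := hK.elim_nhds_subcover' (fun x _ => f ⁻¹' (W x) ∩ Metric.ball x (δ / 2))
      (fun x _ => Filter.inter_mem (((h.op _ (W1 x)).preimage hf).mem_nhds (W2 x))
        (Metric.ball_mem_nhds _ (half_pos hδ)))
    obtain ⟨δ', hδ', hL⟩ := lebesgue_number_lemma_of_metric (s := K)
      (c := fun x : t => f ⁻¹' (W x.1) ∩ Metric.ball x.1.1 (δ / 2)) hK
      (fun x => ((h.op _ (W1 _)).preimage hf).inter Metric.isOpen_ball) (by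
        intro x hx
        have := ht hx
        simp only [Set.mem_iUnion] at this ⊢
        obtain ⟨y, hy, hxy⟩ := this
        exact ⟨⟨y, hy⟩, hxy⟩)
    by_cases hne : Nonempty t
    swap
    · have hKe : K = ∅ := by
        by_contra hcon
        obtain ⟨x, hx⟩ := Set.nonempty_iff_ne_empty.2 hcon
        have := ht hx
        simp only [Set.mem_iUnion] at this
        obtain ⟨y, hy, -⟩ := this
        exact hne ⟨⟨y, hy⟩⟩
      exact ⟨fun _ => ∅, ∅, δ, hδ, le_rfl, by simp, by simp [hKe], by simp [hKe], by simp [hKe]⟩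
    choose! c hc using hL
    refine ⟨fun x => W (c x).1, Finset.univ.image (fun x : t => W x.1), min δ' (δ / 2),
      lt_min hδ' (half_pos hδ), (min_le_right _ _).trans (half_le_self hδ.le), ?_, ?_, ?_, ?_⟩
    · intro U hU
      obtain ⟨x, -, rfl⟩ := Finset.mem_image.1 hU
      exact W1 _
    · intro x hx
      exact Finset.mem_image_of_mem _ (Finset.mem_univ _)
    · intro x hx y hy hd
      exact (hc x hx (show y ∈ Metric.ball x δ' by
        rw [Metric.mem_ball, dist_comm]; exact hd.trans_le (min_le_left _ _))).1
    · intro x hx y hy hd U hU hz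
      refine W3 _ U hU (hz _ (c x).1.2 ?_)
      have h1 : dist x (c x).1.1 < δ / 2 := (hc x hx (Metric.mem_ball_self hδ')).2
      have h2 : dist x y < δ / 2 := hd.trans_le (min_le_right _ _)
      calc dist y (c x).1.1 ≤ dist y x + dist x (c x).1.1 := dist_triangle _ _ _
        _ < δ := by rw [dist_comm y x]; linarith
  induction m with
  | zero =>
    obtain ⟨W, S', δ', h1, -, h2, h3, h4, -⟩ := step ∅ 1 one_pos (by simp)
    exact ⟨fun _ => W, S', δ', h1, h2, fun k x _ hx => h3 x hx,
      fun k x y _ hx hy hd => h4 x hx y hy hd, fun k l x y hkl hl => by omega⟩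
  | succ m ih =>
    obtain ⟨V, S, δ, hδ, h2, h3, h4, h5⟩ := ih
    obtain ⟨W, S', δ', g1, g1', g2, g3, g4, g5⟩ := step S δ hδ h2
    refine ⟨fun k => Nat.casesOn k W V, S ∪ S', δ', g1, ?_, ?_, ?_, ?_⟩
    · intro U hU
      rcases Finset.mem_union.1 hU with h | h
      · exact h2 U h
      · exact g2 U h
    · rintro (_ | k) x hk hx
      · exact Finset.mem_union_right _ (g3 x hx)
      · exact Finset.mem_union_left _ (h3 k x (by omega) hx)
    · rintro (_ | k) x y hk hx hy hd
      · exact g4 x hx y hy hd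
      · exact h4 k x y (by omega) hx hy (hd.trans_le g1')
    · rintro (_ | k) (_ | l) x y hkl hl hx hy hd
      · omega
      · exact g5 x hx y hy hd _ (h3 l y (by omega) hy) fun z hz hz' =>
          h4 l y z (by omega) hy hz hz'
      · omega
      · exact h5 k l x y (by omega) (by omega) hx hy (hd.trans_le g1')

/-! ## Scaling between the grid and the unit ball -/
section
variable {ι : Type} [Fintype ι]

def gs (N : ℕ) (x : ι → ℝ) : ι → ℝ := fun i => 2 * x i / N - 1
def gu (N : ℕ) (x : ι → ℝ) : ι → ℝ := fun i => (x i + 1) * N / 2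

lemma continuous_gs (N : ℕ) : Continuous (gs (ι := ι) N) := by unfold gs; fun_prop
lemma continuous_gu (N : ℕ) : Continuous (gu (ι := ι) N) := by unfold gu; fun_prop

lemma gs_gu {N : ℕ} (hN : 0 < N) (x : ι → ℝ) : gs N (gu N x) = x := by
  have : (N:ℝ) ≠ 0 := by positivity
  funext i; simp only [gs, gu]; field_simp; ring
lemma gu_gs {N : ℕ} (hN : 0 < N) (x : ι → ℝ) : gu N (gs N x) = x := by
  have : (N:ℝ) ≠ 0 := by positivity
  funext i; simp only [gs, gu]; field_simp; ring

lemma gs_coord_le {N : ℕ} (hN : 0 < N) (t : ℝ) : |2 * t / N - 1| ≤ 1 ↔ 0 ≤ t ∧ t ≤ N := by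
  have : (0:ℝ) < N := by positivity
  rw [abs_le, neg_le_sub_iff_le_add, sub_le_iff_le_add, div_le_iff₀ this]
  constructor
  · rintro ⟨a, b⟩
    refine ⟨?_, by linarith⟩
    by_contra! hc
    have : 2 * t / N < 0 := by apply div_neg_of_neg_of_pos <;> linarith
    linarith
  · rintro ⟨a, b⟩
    refine ⟨?_, by linarith⟩
    have : 0 ≤ 2 * t / N := by positivity
    linarith

lemma norm_gs_le {N : ℕ} (hN : 0 < N) {x : ι → ℝ} : ‖gs N x‖ ≤ 1 ↔ x ∈ bigK ι N := by
  rw [pi_norm_le_iff_of_nonneg zero_le_one]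
  simp only [gs, Real.norm_eq_abs, gs_coord_le hN]
  exact ⟨fun h => ⟨fun i => (h i).1, fun i => (h i).2⟩, fun h i => ⟨h.1 i, h.2 i⟩⟩

lemma gu_mem {N : ℕ} (hN : 0 < N) {x : ι → ℝ} (hx : ‖x‖ ≤ 1) : gu N x ∈ bigK ι N := by
  rw [← norm_gs_le hN, gs_gu hN]; exact hx

lemma exists_norm_eq {x : ι → ℝ} (hx : 1 ≤ ‖x‖) : ∃ i, 1 ≤ |x i| := by
  by_contra! hh
  have : ‖x‖ < 1 := by
    rw [pi_norm_lt_iff one_pos]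
    exact hh
  linarith

lemma norm_gs_bd {N : ℕ} (hN : 0 < N) {x : ι → ℝ} (hx : x ∈ bdK ι N) : ‖gs N x‖ = 1 := by
  refine le_antisymm ((norm_gs_le hN).2 hx.1) ?_
  obtain ⟨i, hi⟩ := hx.2
  refine le_trans ?_ (norm_le_pi_norm _ i)
  have : (N:ℝ) ≠ 0 := by positivity
  simp only [gs, Real.norm_eq_abs]
  rcases hi with h | h <;> rw [h]
  · norm_num
  · rw [mul_div_assoc, div_self this]; norm_num

lemma bdK_of_norm {N : ℕ} (hN : 0 < N) {x : ι → ℝ} (hx : ‖x‖ = 1) : gu N x ∈ bdK ι N := by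
  refine ⟨gu_mem hN hx.le, ?_⟩
  obtain ⟨i, hi⟩ := exists_norm_eq hx.ge
  have h2 : |x i| ≤ 1 := (norm_le_pi_norm x i).trans hx.le
  refine ⟨i, ?_⟩
  rcases (abs_eq zero_le_one).1 (le_antisymm h2 hi) with h | h
  · right; simp only [gu, h]; ring
  · left; simp only [gu, h]; ring

lemma dist_gs {N : ℕ} (hN : 0 < N) {σ : Cell ι} {x y : ι → ℝ} (hx : x ∈ σ.cl) (hy : y ∈ σ.cl) :
    dist (gs N x) (gs N y) ≤ 2 / N := by
  have : (0:ℝ) < N := by positivity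
  rw [dist_pi_le_iff (by positivity)]
  intro i
  simp only [gs, Real.dist_eq]
  have h1 := hx.1 i
  have h2 := hx.2 i
  have h3 := hy.1 i
  have h4 := hy.2 i
  have h5 : σ.hi i ≤ σ.lo i + 1 := by
    simp only [Cell.hi]; split_ifs <;> linarith
  rw [show 2 * x i / N - 1 - (2 * y i / N - 1) = 2 * (x i - y i) / N by ring, abs_div,
    abs_of_pos this]
  gcongr
  rw [abs_le]; constructor <;> linarith

lemma lo_mem (σ : Cell ι) : σ.lo ∈ σ.cl := by
  refine ⟨le_rfl, fun i => ?_⟩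
  simp only [Cell.hi]; split_ifs <;> linarith

lemma mid_not_bd (σ : Cell ι) : σ.par 0 ∈ σ.cl ∧ σ.par 0 ∉ σ.bd := by
  have h0 : σ.par 0 ∈ σ.cl := par_mem (by simp)
  refine ⟨h0, fun h => ?_⟩
  have := norm_unpar_bd h
  rw [unpar_par, norm_zero] at this
  norm_num at this

lemma sub_dim {σ τ : Cell ι} (h : σ.cl ⊆ τ.cl) : σ = τ ∨ σ.dim < τ.dim := by
  obtain ⟨h1, h2⟩ := mid_not_bd σ
  have := eq_car h1 h2
  rw [this]
  exact car_dim (h h1)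

lemma dim_le (σ : Cell ι) : σ.dim ≤ Fintype.card ι := Finset.card_le_univ _
lemma card_Fr (σ : Cell ι) : Fintype.card σ.Fr = σ.dim := Fintype.card_subtype _

variable {Y : Type*} [TopologicalSpace Y]

/-- from a homotopy on the grid to a total homotopy -/
lemma total_of_grid {N : ℕ} (hN : 0 < N) {g : (ι → ℝ) → Y} (hg : Continuous g)
    {H : (ι → ℝ) × ℝ → Y} (hH : ContinuousOn H (bigK ι N ×ˢ Set.Icc 0 1))
    (h1 : ∀ x ∈ bdK ι N, ∀ t ∈ Set.Icc (0:ℝ) 1, H (x, t) = g (gs N x)) :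
    ∃ H' : (ι → ℝ) × ℝ → Y, Continuous H' ∧
      (∀ x ∈ bigK ι N, ∀ t ∈ Set.Icc (0:ℝ) 1, H' (gs N x, t) = H (x, t)) ∧
      (∀ x t, 1 ≤ ‖x‖ → H' (x, t) = g x) ∧
      (∀ x t, ‖x‖ ≤ 1 → H' (x, t) = H (gu N x, cl01 t)) := by
  classical
  have e : ∀ x t, ‖x‖ = 1 → H (gu N x, cl01 t) = g x := by
    intro x t hx
    rw [h1 _ (bdK_of_norm hN hx) _ ⟨cl01_nonneg _, cl01_le _⟩, gs_gu hN]
  refine ⟨fun p => if ‖p.1‖ ≤ 1 then H (gu N p.1, cl01 p.2) else g p.1, ?_, ?_, ?_, ?_⟩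
  · refine continuous_if_le (by fun_prop) (by fun_prop) ?_ (by fun_prop) ?_
    · refine hH.comp (((continuous_gu N).comp continuous_fst).prodMk
        (continuous_cl01.comp continuous_snd)).continuousOn ?_
      intro p hp
      exact ⟨gu_mem hN hp, cl01_nonneg _, cl01_le _⟩
    · intro p hp
      exact e _ _ hp
  · intro x hx t ht
    simp only
    rw [if_pos ((norm_gs_le hN).2 hx), gu_gs hN, cl01_of_mem ht.1 ht.2]
  · intro x t hx
    simp only
    split_ifs with h
    · exact e _ _ (le_antisymm h hx)
    · rfl
  · intro x t hx
    simp only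
    rw [if_pos hx]

lemma prismRH {N : ℕ} (hN : 0 < N) (A B : Cell ι → Set Y)
    (hA : ∀ σ ∈ cells ι N, ∀ τ ∈ cells ι N, σ.cl ⊆ τ.cl → A σ ⊆ A τ)
    (hB : ∀ σ ∈ cells ι N, ∀ τ ∈ cells ι N, σ.cl ⊆ τ.cl → B σ ⊆ B τ)
    (hconn : ∀ σ ∈ cells ι N, Conn σ.Fr (A σ) (B σ))
    {g : (ι → ℝ) → Y} (hg : Continuous g)
    (hgA : ∀ σ ∈ cells ι N, ∀ x ∈ σ.cl, g (gs N x) ∈ A σ)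
    (hgB : ∀ σ ∈ cells ι N, ∀ x ∈ σ.cl, ‖gs N x‖ = 1 → g (gs N x) ∈ B σ) :
    ∃ H : (ι → ℝ) × ℝ → Y, Continuous H ∧ (∀ x, H (x, 0) = g x) ∧
      (∀ σ ∈ cells ι N, ∀ x ∈ σ.cl, ∀ t, H (gs N x, t) ∈ A σ) ∧
      (∀ σ ∈ cells ι N, ∀ x ∈ σ.cl, H (gs N x, 1) ∈ B σ) ∧
      (∀ x t, 1 ≤ ‖x‖ → H (x, t) = g x) := by
  obtain ⟨H, c, H0, HA, HB, Hb⟩ := prism N A B hA hB hconn (g ∘ gs N)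
    (hg.comp (continuous_gs N)).continuousOn hgA
    (fun σ hσ x hx hb => hgB σ hσ x hx (norm_gs_bd hN hb))
  obtain ⟨H', c', e1, e2, e3⟩ := total_of_grid hN hg c Hb
  refine ⟨H', c', ?_, ?_, ?_, e2⟩
  · intro x
    rcases le_total ‖x‖ 1 with h | h
    · rw [e3 x 0 h, cl01_zero, H0 _ (gu_mem hN h)]; simp only [Function.comp, gs_gu hN]
    · exact e2 x 0 h
  · intro σ hσ x hx t
    rw [e3 _ _ ((norm_gs_le hN).2 (cl_sub_bigK hσ hx)), gu_gs hN]
    exact HA σ hσ x hx _ ⟨cl01_nonneg _, cl01_le _⟩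
  · intro σ hσ x hx
    rw [e3 _ _ ((norm_gs_le hN).2 (cl_sub_bigK hσ hx)), gu_gs hN, cl01_one]
    exact HB σ hσ x hx

lemma exists_cell {N : ℕ} (hN : 0 < N) {x : ι → ℝ} (hx : ‖x‖ ≤ 1) :
    ∃ σ ∈ cells ι N, ∃ y ∈ σ.cl, x = gs N y :=
  ⟨car (gu N x), car_mem_cells (gu_mem hN hx), gu N x, car_mem_cl (gu_mem hN hx).1, (gs_gu hN x).symm⟩

/-- local-to-global principle for connectivity of pairs -/
theorem Conn.locGlob {X : Set Y} {𝓑 : Set (Set Y)} (h𝓑 : Fam 𝓑) (m : ℕ)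
    (hloc : ∀ U ∈ 𝓑, ∀ (κ : Type) [Fintype κ], Fintype.card κ ≤ m → Conn κ U (U ∩ X))
    (hι : Fintype.card ι ≤ m) : Conn ι Set.univ X := by
  intro g hg _ hgX
  obtain ⟨V, δ, hδ, h1, h2, h3⟩ := levels h𝓑 (isCompact_closedBall (0 : ι → ℝ) 1) hg
    (Fintype.card ι)
  obtain ⟨n, hn⟩ := exists_nat_gt (2 / δ)
  set N := n + 1 with hNdef
  have hN : 0 < N := by omega
  have hNδ : 2 / (N:ℝ) < δ := by
    have : (0:ℝ) < N := by positivity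
    rw [div_lt_iff₀ this]
    rw [div_lt_iff₀ hδ] at hn
    push_cast [hNdef]; nlinarith
  have inK : ∀ σ ∈ cells ι N, ∀ x ∈ σ.cl, gs N x ∈ Metric.closedBall (0 : ι → ℝ) 1 := by
    intro σ hσ x hx
    rw [mem_closedBall_zero_iff]
    exact (norm_gs_le hN).2 (cl_sub_bigK hσ hx)
  have mono : ∀ σ ∈ cells ι N, ∀ τ ∈ cells ι N, σ.cl ⊆ τ.cl →
      V σ.dim (gs N σ.lo) ⊆ V τ.dim (gs N τ.lo) := by
    intro σ hσ τ hτ hs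
    rcases sub_dim hs with rfl | hd
    · exact subset_rfl
    · exact h3 _ _ _ _ hd (dim_le _) (inK σ hσ _ (lo_mem σ)) (inK τ hτ _ (lo_mem τ))
        ((dist_gs hN (hs (lo_mem σ)) (lo_mem τ)).trans_lt hNδ)
  have hgV : ∀ σ ∈ cells ι N, ∀ x ∈ σ.cl, g (gs N x) ∈ V σ.dim (gs N σ.lo) := fun σ hσ x hx =>
    h2 _ _ _ (dim_le _) (inK σ hσ _ (lo_mem σ)) (inK σ hσ _ hx)
      ((dist_gs hN (lo_mem σ) hx).trans_lt hNδ)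
  obtain ⟨H, c, H0, HA, HB, Hb⟩ := prismRH hN (fun σ => V σ.dim (gs N σ.lo))
    (fun σ => V σ.dim (gs N σ.lo) ∩ X) mono
    (fun σ hσ τ hτ hs => Set.inter_subset_inter_left _ (mono σ hσ τ hτ hs))
    (fun σ hσ => hloc _ (h1 _ _ (dim_le _) (inK σ hσ _ (lo_mem σ))) _
      ((card_Fr σ).le.trans ((dim_le σ).trans hι))) hg hgV
    (fun σ hσ x hx hb => ⟨hgV σ hσ x hx, hgX _ hb.ge⟩)
  refine ⟨fun x => H (x, 1), ⟨H, c, H0, fun _ => rfl, fun _ => trivial, Hb⟩, ?_⟩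
  intro x
  rcases le_total ‖x‖ 1 with h | h
  · obtain ⟨σ, hσ, y, hy, rfl⟩ := exists_cell hN h
    exact (HB σ hσ y hy).2
  · simp only; rw [Hb _ _ h]; exact hgX _ h
end
end HS

namespace HS

/-- contractible (in itself) subset -/
def Ctr {B : Type*} [TopologicalSpace B] (U : Set B) : Prop :=
  ∃ (c : B × ℝ → B) (pt : B), pt ∈ U ∧ ContinuousOn c (U ×ˢ Set.Icc 0 1) ∧
    (∀ b ∈ U, c (b, 0) = b) ∧ (∀ b ∈ U, c (b, 1) = pt) ∧
    ∀ b ∈ U, ∀ t ∈ Set.Icc (0:ℝ) 1, c (b, t) ∈ U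

lemma Ctr.cone {B : Type*} [TopologicalSpace B] {U : Set B} (hU : Ctr U) {V : Type*}
    [NormedAddCommGroup V] [NormedSpace ℝ V] (k : V → B)
    (hk : ContinuousOn k {p | ‖p‖ = 1}) (hkU : ∀ p, ‖p‖ = 1 → k p ∈ U) :
    ∃ K : V → B, ContinuousOn K {p | ‖p‖ ≤ 1} ∧ (∀ p, ‖p‖ ≤ 1 → K p ∈ U) ∧
      ∀ p, ‖p‖ = 1 → K p = k p := by
  classical
  obtain ⟨c, pt, hpt, cc, c0, c1, cU⟩ := hU
  let K1 : V → B := fun p => c (k (‖p‖⁻¹ • p), 2 * (1 - ‖p‖))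
  have nrm : ∀ p : V, 1/2 ≤ ‖p‖ → ‖‖p‖⁻¹ • p‖ = 1 := by
    intro p hp
    rw [norm_smul, norm_inv, norm_norm, inv_mul_cancel₀ (by linarith)]
  have K1c : ContinuousOn K1 {p | 1/2 ≤ ‖p‖ ∧ ‖p‖ ≤ 1} := by
    refine cc.comp (ContinuousOn.prodMk (hk.comp ?_ ?_) (by fun_prop)) ?_
    · refine ContinuousOn.smul (ContinuousOn.inv₀ (by fun_prop) ?_) continuousOn_id
      intro p hp h; have := hp.1; linarith
    · intro p hp; exact nrm p hp.1
    · intro p hp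
      exact ⟨hkU _ (nrm p hp.1), by have := hp.1; have := hp.2; constructor <;> linarith⟩
  have e1 : Set.EqOn (fun p : V => if ‖p‖ ≤ 1/2 then pt else K1 p) K1 {p | 1/2 ≤ ‖p‖ ∧ ‖p‖ ≤ 1} := by
    intro p hp
    simp only
    split_ifs with h
    · have : ‖p‖ = 1/2 := le_antisymm h hp.1
      simp only [K1]
      rw [show 2 * (1 - ‖p‖) = 1 by rw [this]; norm_num, c1 _ (hkU _ (nrm p hp.1))]
    · rfl
  refine ⟨fun p => if ‖p‖ ≤ 1/2 then pt else K1 p, ?_, ?_, ?_⟩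
  · have : {p : V | ‖p‖ ≤ 1} = {p | ‖p‖ ≤ 1/2} ∪ {p | 1/2 ≤ ‖p‖ ∧ ‖p‖ ≤ 1} := by
      ext p
      simp only [Set.mem_ofPred_eq, Set.mem_union]
      constructor
      · intro h
        rcases le_total ‖p‖ (1/2) with h' | h'
        · exact Or.inl h'
        · exact Or.inr ⟨h', h⟩
      · rintro (h | h)
        · linarith
        · exact h.2
    rw [this]
    have d1 : IsClosed {p : V | ‖p‖ ≤ 1/2} := isClosed_le (by fun_prop) (by fun_prop)
    have d2 : IsClosed {p : V | 1/2 ≤ ‖p‖} := isClosed_le (by fun_prop) (by fun_prop)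
    have d3 : IsClosed {p : V | ‖p‖ ≤ 1} := isClosed_le (by fun_prop) (by fun_prop)
    refine ContinuousOn.union_of_isClosed ?_ (K1c.congr e1) d1 (d2.inter d3)
    exact continuousOn_const.congr fun p hp => if_pos hp
  · intro p hp
    simp only
    split_ifs with h
    · exact hpt
    · exact cU _ (hkU _ (nrm p (by linarith))) _ (by constructor <;> linarith)
  · intro p hp
    simp only
    rw [if_neg (by rw [hp]; norm_num)]
    simp only [K1]
    rw [hp, inv_one, one_smul, sub_self, mul_zero, c0 _ (hkU p hp)]

section
variable {ι : Type} [Fintype ι]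

lemma cellcover {B : Type*} [TopologicalSpace B] {𝓑 : Set (Set B)} (h𝓑 : Fam 𝓑)
    {f : (ι → ℝ) → B} (hf : Continuous f) (N₀ : ℕ) :
    ∃ N, N₀ ≤ N ∧ 0 < N ∧ ∃ U : Cell ι → Set B, (∀ σ ∈ cells ι N, U σ ∈ 𝓑) ∧
      (∀ σ ∈ cells ι N, ∀ τ ∈ cells ι N, σ.cl ⊆ τ.cl → U σ ⊆ U τ) ∧
      ∀ σ ∈ cells ι N, ∀ x ∈ σ.cl, f (gs N x) ∈ U σ := by
  obtain ⟨V, δ, hδ, h1, h2, h3⟩ := levels h𝓑 (isCompact_closedBall (0 : ι → ℝ) 1) hf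
    (Fintype.card ι)
  obtain ⟨n, hn⟩ := exists_nat_gt (2 / δ)
  set N := n + N₀ + 1 with hNdef
  have hN : 0 < N := by omega
  have hNδ : 2 / (N:ℝ) < δ := by
    have : (0:ℝ) < N := by positivity
    rw [div_lt_iff₀ this]
    rw [div_lt_iff₀ hδ] at hn
    have : (n:ℝ) ≤ N := by rw [hNdef]; push_cast; linarith [(Nat.cast_nonneg N₀ : (0:ℝ) ≤ N₀)]
    nlinarith
  have inK : ∀ σ ∈ cells ι N, ∀ x ∈ σ.cl, gs N x ∈ Metric.closedBall (0 : ι → ℝ) 1 := by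
    intro σ hσ x hx
    rw [mem_closedBall_zero_iff]
    exact (norm_gs_le hN).2 (cl_sub_bigK hσ hx)
  refine ⟨N, by omega, hN, fun σ => V σ.dim (gs N σ.lo), ?_, ?_, ?_⟩
  · exact fun σ hσ => h1 _ _ (dim_le _) (inK σ hσ _ (lo_mem σ))
  · intro σ hσ τ hτ hs
    rcases sub_dim hs with rfl | hd
    · exact subset_rfl
    · exact h3 _ _ _ _ hd (dim_le _) (inK σ hσ _ (lo_mem σ)) (inK τ hτ _ (lo_mem τ))
        ((dist_gs hN (hs (lo_mem σ)) (lo_mem τ)).trans_lt hNδ)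
  · exact fun σ hσ x hx => h2 _ _ _ (dim_le _) (inK σ hσ _ (lo_mem σ)) (inK σ hσ _ hx)
      ((dist_gs hN (lo_mem σ) hx).trans_lt hNδ)

lemma close {B : Type*} [TopologicalSpace B] {N : ℕ} (hN : 0 < N) (U : Cell ι → Set B)
    (hU : ∀ σ ∈ cells ι N, Ctr (U σ))
    (mono : ∀ σ ∈ cells ι N, ∀ τ ∈ cells ι N, σ.cl ⊆ τ.cl → U σ ⊆ U τ)
    {f0 f1 : (ι → ℝ) → B} (hf0 : Continuous f0) (hf1 : Continuous f1)
    (m0 : ∀ σ ∈ cells ι N, ∀ x ∈ σ.cl, f0 (gs N x) ∈ U σ)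
    (m1 : ∀ σ ∈ cells ι N, ∀ x ∈ σ.cl, f1 (gs N x) ∈ U σ)
    (hout : ∀ x, 1 ≤ ‖x‖ → f0 x = f1 x) : RH Set.univ f0 f1 := by
  classical
  haveI : Nonempty B := ⟨f0 0⟩
  let P : (ι → ℝ) × ℝ → Set B := fun p => {z | (∀ σ ∈ cells ι N, p.1 ∈ σ.cl → z ∈ U σ) ∧
    (p.2 = 0 → z = f0 (gs N p.1)) ∧ (p.2 = 1 → z = f1 (gs N p.1)) ∧
    (p.1 ∈ bdK ι N → z = f0 (gs N p.1))}
  have key := cell_ext N P ?_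
  · obtain ⟨H, hc, hP⟩ := key
    have z0 : (0:ℝ) ∈ Set.Icc (0:ℝ) 1 := by simp
    have z1 : (1:ℝ) ∈ Set.Icc (0:ℝ) 1 := by simp
    obtain ⟨H', c', e1, e2, e3⟩ := total_of_grid hN hf0 hc
      (fun x hx t ht => (hP (x, t) ⟨hx.1, ht⟩).2.2.2 hx)
    refine ⟨H', c', ?_, ?_, fun _ => trivial, e2⟩
    · intro x
      rcases le_total ‖x‖ 1 with h | h
      · rw [e3 x 0 h, cl01_zero, (hP _ ⟨gu_mem hN h, z0⟩).2.1 rfl, gs_gu hN]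
      · exact e2 x 0 h
    · intro x
      rcases le_total ‖x‖ 1 with h | h
      · rw [e3 x 1 h, cl01_one, (hP _ ⟨gu_mem hN h, z1⟩).2.2.1 rfl, gs_gu hN]
      · rw [e2 x 1 h]; exact hout x h
  · intro σ hσ g gc gP
    by_cases hK : σ.cl ⊆ bdK ι N
    · refine ⟨fun p => f0 (gs N p.1), ?_, fun p hp => ((gP p hp).2.2.2 (hK hp.1.1)).symm,
        fun p hp => ⟨fun τ hτ hx => m0 τ hτ _ hx, fun _ => rfl,
          fun _ => hout _ (norm_gs_bd hN (hK hp.1)).ge, fun _ => rfl⟩⟩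
      exact (hf0.comp ((continuous_gs N).comp continuous_fst)).continuousOn
    · let k : (σ.Fr → ℝ) × ℝ → B := fun p => if p.2 = -1 then f0 (gs N (σ.par p.1)) else
        if p.2 = 1 then f1 (gs N (σ.par p.1)) else g (σ.par p.1, (p.2 + 1) / 2)
      have kg : ∀ y t, ‖y‖ = 1 → |t| ≤ 1 → k (y, t) = g (σ.par y, (t + 1) / 2) := by
        intro y t hy ht
        have ht' := abs_le.1 ht
        have hm : (σ.par y, (t + 1) / 2) ∈ σ.bd ×ˢ Set.Icc (0:ℝ) 1 :=
          ⟨par_bd hy, by constructor <;> simp only <;> linarith⟩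
        simp only [k]
        split_ifs with h h'
        · exact ((gP _ hm).2.1 (by simp only [h]; norm_num)).symm
        · exact ((gP _ hm).2.2.1 (by simp only [h']; norm_num)).symm
        · rfl
      have hcase : ∀ p : (σ.Fr → ℝ) × ℝ, ‖p‖ = 1 → ‖p.1‖ ≤ 1 ∧ |p.2| ≤ 1 ∧
          (p.2 = -1 ∨ p.2 = 1 ∨ ‖p.1‖ = 1) := by
        intro p hp
        rw [Prod.norm_def, Real.norm_eq_abs] at hp
        refine ⟨(le_max_left _ _).trans hp.le, (le_max_right _ _).trans hp.le, ?_⟩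
        rcases max_choice ‖p.1‖ |p.2| with h | h
        · exact Or.inr (Or.inr (h.symm.trans hp))
        · rcases (abs_eq zero_le_one).1 (h.symm.trans hp) with h | h
          · exact Or.inr (Or.inl h)
          · exact Or.inl h
      obtain ⟨G, Gc, GU, Gk⟩ := (hU σ hσ).cone k (by
        refine ContinuousOn.mono (s := ({p | ‖p.1‖ ≤ 1 ∧ p.2 = -1} ∪ {p | ‖p.1‖ ≤ 1 ∧ p.2 = 1}) ∪
          {p | ‖p.1‖ = 1 ∧ |p.2| ≤ 1}) ?_ ?_
        · have c1 : IsClosed {p : (σ.Fr → ℝ) × ℝ | ‖p.1‖ ≤ 1} :=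
            isClosed_le (by fun_prop) (by fun_prop)
          have c2 : IsClosed {p : (σ.Fr → ℝ) × ℝ | p.2 = -1} :=
            isClosed_eq (by fun_prop) (by fun_prop)
          have c3 : IsClosed {p : (σ.Fr → ℝ) × ℝ | p.2 = 1} :=
            isClosed_eq (by fun_prop) (by fun_prop)
          have c4 : IsClosed {p : (σ.Fr → ℝ) × ℝ | ‖p.1‖ = 1} :=
            isClosed_eq (by fun_prop) (by fun_prop)
          have c5 : IsClosed {p : (σ.Fr → ℝ) × ℝ | |p.2| ≤ 1} :=
            isClosed_le (by fun_prop) (by fun_prop)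
          have cp : Continuous fun p : (σ.Fr → ℝ) × ℝ => gs N (σ.par p.1) :=
            (continuous_gs N).comp ((continuous_par σ).comp continuous_fst)
          refine ContinuousOn.union_of_isClosed (ContinuousOn.union_of_isClosed ?_ ?_
            (c1.inter c2) (c1.inter c3)) ?_ ((c1.inter c2).union (c1.inter c3)) (c4.inter c5)
          · exact (hf0.comp cp).continuousOn.congr fun p hp => if_pos hp.2
          · refine (hf1.comp cp).continuousOn.congr fun p hp => ?_
            simp only [k]
            rw [if_neg (by rw [hp.2]; norm_num), if_pos hp.2]; rfl
          · refine ContinuousOn.congr (f := fun p => g (σ.par p.1, (p.2 + 1) / 2)) ?_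
              fun p hp => kg p.1 p.2 hp.1 hp.2
            refine gc.comp (((continuous_par σ).comp continuous_fst).prodMk
              (by fun_prop)).continuousOn fun p hp => ⟨par_bd hp.1, ?_⟩
            have := abs_le.1 hp.2
            constructor <;> simp only <;> linarith
        · intro p hp
          obtain ⟨a, b, c | c | c⟩ := hcase p hp
          · exact Or.inl (Or.inl ⟨a, c⟩)
          · exact Or.inl (Or.inr ⟨a, c⟩)
          · exact Or.inr ⟨c, b⟩)
        (by
          intro p hp
          obtain ⟨a, b, c⟩ := hcase p hp
          by_cases c3 : ‖p.1‖ = 1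
          · have := kg p.1 p.2 c3 b
            rw [Prod.mk.eta] at this
            rw [this]
            have := abs_le.1 b
            exact (gP _ ⟨par_bd c3, by constructor <;> simp only <;> linarith⟩).1 σ hσ (par_mem a)
          · rcases c with c | c | c
            · simp only [k]; rw [if_pos c]; exact m0 σ hσ _ (par_mem a)
            · simp only [k]; rw [if_neg (by rw [c]; norm_num), if_pos c]
              exact m1 σ hσ _ (par_mem a)
            · exact absurd c c3)
      have nr : ∀ x ∈ σ.cl, ∀ t ∈ Set.Icc (0:ℝ) 1, ‖((σ.unpar x, 2 * t - 1) : (σ.Fr → ℝ) × ℝ)‖ ≤ 1 := by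
        intro x hx t ht
        rw [Prod.norm_def]
        refine max_le (norm_unpar_le hx) ?_
        simp only [Real.norm_eq_abs]
        rw [abs_le]; constructor <;> linarith [ht.1, ht.2]
      have heq : Set.EqOn (fun p => G (σ.unpar p.1, 2 * p.2 - 1)) g (σ.bd ×ˢ Set.Icc 0 1) := by
        rintro ⟨x, t⟩ ⟨hx, ht⟩
        have n1 := norm_unpar_bd hx
        simp only at ht ⊢
        have hab : |2 * t - 1| ≤ 1 := by rw [abs_le]; constructor <;> linarith [ht.1, ht.2]
        rw [Gk _ (le_antisymm (nr x hx.1 t ht) (by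
          rw [Prod.norm_def]; exact le_trans n1.ge (le_max_left _ _))), kg _ _ n1 hab,
          par_unpar hx.1]
        congr 2; ring
      have nrm1 : ∀ x ∈ σ.cl, ∀ t ∈ Set.Icc (0:ℝ) 1, |2 * t - 1| = 1 →
          G (σ.unpar x, 2 * t - 1) = k (σ.unpar x, 2 * t - 1) := by
        intro x hx t ht h
        refine Gk _ (le_antisymm (nr x hx t ht) ?_)
        rw [Prod.norm_def]; exact le_trans h.ge (le_max_right _ _)
      refine ⟨fun p => G (σ.unpar p.1, 2 * p.2 - 1), ?_, heq, ?_⟩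
      · exact Gc.comp (((continuous_unpar σ).comp continuous_fst).prodMk
            (by fun_prop)).continuousOn fun p hp => nr _ hp.1 _ hp.2
      · rintro ⟨x, t⟩ ⟨hx, ht⟩
        by_cases hb : x ∈ σ.bd
        · rw [heq ⟨hb, ht⟩]; exact gP _ ⟨hb, ht⟩
        · have hc := eq_car hx hb
          have hsub : ∀ τ ∈ cells ι N, x ∈ τ.cl → σ.cl ⊆ τ.cl := fun τ _ h => by
            rw [hc]; exact car_sub h
          refine ⟨fun τ hτ h => mono σ hσ τ hτ (hsub τ hτ h) (GU _ (nr x hx t ht)), ?_, ?_, ?_⟩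
          · rintro h
            simp only at h ⊢
            subst h
            rw [nrm1 x hx 0 ht (by norm_num)]
            simp only [k]
            rw [if_pos (by norm_num), par_unpar hx]
          · rintro h
            simp only at h ⊢
            subst h
            rw [nrm1 x hx 1 ht (by norm_num)]
            simp only [k]
            rw [if_neg (by norm_num), if_pos (by norm_num), par_unpar hx]
          · intro h
            exact absurd (bdK_of_cell hσ hx hb h) hK

end
end HS

namespace HS

section
variable {ι : Type} [Fintype ι]

def ocons {α : Type*} (s : α) (x : ι → α) : Option ι → α := fun o => o.elim s x
def otl {α : Type*} (y : Option ι → α) : ι → α := fun i => y (some i)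
lemma ocons_otl {α : Type*} (y : Option ι → α) : ocons (y none) (otl y) = y := by
  funext o; cases o <;> rfl
lemma continuous_otl : Continuous (otl : (Option ι → ℝ) → (ι → ℝ)) := by unfold otl; fun_prop
@[fun_prop] lemma Continuous.otl' {M : Type*} [TopologicalSpace M] {f : M → (Option ι → ℝ)}
    (hf : Continuous f) : Continuous fun x => otl (f x) := continuous_otl.comp hf

lemma mem_cells_cons {N : ℕ} {c : ℕ × Bool} {σ : Cell ι} :
    (ocons c σ : Cell (Option ι)) ∈ cells (Option ι) N ↔
      c.1 + (if c.2 = true then 1 else 0) ≤ N ∧ σ ∈ cells ι N := by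
  rw [mem_cells, mem_cells]
  constructor
  · intro h
    refine ⟨?_, fun i => ?_⟩
    · have := h none
      by_cases hf : c.2 = true <;> simpa [ocons, Cell.fr, hf] using this
    · have := h (some i)
      by_cases hf : (σ i).2 = true <;> simpa [ocons, Cell.fr, hf] using this
  · rintro ⟨h1, h2⟩ (_ | i)
    · by_cases hf : c.2 = true <;> simpa [ocons, Cell.fr, hf] using h1
    · have := h2 i
      by_cases hf : (σ i).2 = true <;> simpa [ocons, Cell.fr, hf] using this

lemma mem_cl_cons {c : ℕ × Bool} {σ : Cell ι} {y : Option ι → ℝ} :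
    y ∈ Cell.cl (ocons c σ) ↔
      ((c.1 : ℝ) ≤ y none ∧ y none ≤ c.1 + (if c.2 = true then 1 else 0)) ∧ otl y ∈ σ.cl := by
  constructor
  · rintro ⟨h1, h2⟩
    refine ⟨⟨h1 none, ?_⟩, fun i => h1 (some i), fun i => ?_⟩
    · have := h2 none
      by_cases hf : c.2 = true <;> simpa [ocons, Cell.fr, Cell.hi, Cell.lo, hf] using this
    · have := h2 (some i)
      by_cases hf : (σ i).2 = true <;> simpa [ocons, Cell.fr, Cell.hi, Cell.lo, hf, otl] using this
  · rintro ⟨⟨h1, h2⟩, h3, h4⟩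
    refine ⟨?_, ?_⟩
    · rintro (_ | i)
      · exact h1
      · exact h3 i
    · rintro (_ | i)
      · by_cases hf : c.2 = true <;> simpa [ocons, Cell.fr, Cell.hi, Cell.lo, hf] using h2
      · have := h4 i
        by_cases hf : (σ i).2 = true <;>
          simpa [ocons, Cell.fr, Cell.hi, Cell.lo, hf, otl] using this

lemma norm_ocons_cases {y : Option ι → ℝ} (hy : 1 ≤ ‖y‖) :
    1 ≤ ‖otl y‖ ∨ y none ≤ -1 ∨ 1 ≤ y none := by
  obtain ⟨i, hi⟩ := exists_norm_eq hy
  cases i with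
  | none =>
    right
    rcases le_abs'.1 hi with h | h
    · exact Or.inl h
    · exact Or.inr h
  | some i => exact Or.inl (hi.trans (norm_le_pi_norm (otl y) i))

/-- quasifibration data -/
structure QF {E B : Type*} [TopologicalSpace E] [TopologicalSpace B] (q : E → B)
    (𝓑 : Set (Set B)) (b0 : B) : Prop where
  cont : Continuous q
  fam : Fam 𝓑
  ctr : ∀ U ∈ 𝓑, Ctr U
  conn : ∀ U ∈ 𝓑, ∀ W ∈ 𝓑, W ⊆ U → ∀ (κ : Type) [Fintype κ], Conn κ (q ⁻¹' U) (q ⁻¹' W)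
  conn0 : ∀ U ∈ 𝓑, b0 ∈ U → ∀ (κ : Type) [Fintype κ], Conn κ (q ⁻¹' U) (q ⁻¹' {b0})

/-- the almost homotopy lifting property -/
theorem QF.ahlp {E B : Type*} [TopologicalSpace E] [TopologicalSpace B] {q : E → B}
    {𝓑 : Set (Set B)} {b0 : B} (hq : QF q 𝓑 b0) {g : (ι → ℝ) → E} (hg : Continuous g)
    {h : (ι → ℝ) × ℝ → B} (hh : Continuous h) (h0 : ∀ x, h (x, 0) = q (g x))
    (h1 : ∀ x, h (x, 1) = b0) (hout : ∀ x t, 1 ≤ ‖x‖ → h (x, t) = b0) :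
    ∃ H : (ι → ℝ) × ℝ → E, Continuous H ∧ (∀ x, H (x, 0) = g x) ∧
      (∀ x, q (H (x, 1)) = b0) ∧ (∀ x t, 1 ≤ ‖x‖ → H (x, t) = g x) ∧
      RH Set.univ (fun y : Option ι → ℝ => q (H (otl y, cl01 ((y none + 1) / 2))))
        (fun y => h (otl y, cl01 ((y none + 1) / 2))) := by
  have hgout : ∀ x, 1 ≤ ‖x‖ → q (g x) = b0 := fun x hx => by rw [← h0]; exact hout x 0 hx
  let f : (Option ι → ℝ) → B := fun y => h (otl y, cl01 (y none + 1))
  have hf : Continuous f := hh.comp (by fun_prop)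
  obtain ⟨N, hN2, hN, U, U1, U2, U3⟩ := cellcover hq.fam hf 2
  have hNr : (0:ℝ) < N := by positivity
  -- one slab
  have slab : ∀ (j : ℕ), j < N → ∀ (H : (ι → ℝ) × ℝ → E), Continuous H →
      (∀ x, H (x, 0) = g x) → (∀ x t, 1 ≤ ‖x‖ → H (x, t) = g x) →
      (∀ c : ℕ × Bool, ∀ σ ∈ cells ι N, c.1 + (if c.2 = true then 1 else 0) ≤ j → ∀ x ∈ σ.cl,
        ∀ s : ℝ, (c.1 : ℝ) ≤ s → s ≤ c.1 + (if c.2 = true then 1 else 0) →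
          q (H (gs N x, s)) ∈ U (ocons c σ)) →
      ∀ (D : Cell ι → Set E), (∀ σ ∈ cells ι N, ∀ τ ∈ cells ι N, σ.cl ⊆ τ.cl → D σ ⊆ D τ) →
      (∀ σ ∈ cells ι N, Conn σ.Fr (q ⁻¹' (U (ocons (j, true) σ))) (D σ)) →
      (∀ σ ∈ cells ι N, D σ ⊆ q ⁻¹' (U (ocons (j + 1, false) σ))) →
      (∀ σ ∈ cells ι N, ∀ x ∈ σ.cl, ‖gs N x‖ = 1 → g (gs N x) ∈ D σ) →
      ∃ H : (ι → ℝ) × ℝ → E, Continuous H ∧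
      (∀ x, H (x, 0) = g x) ∧ (∀ x t, 1 ≤ ‖x‖ → H (x, t) = g x) ∧
      (∀ c : ℕ × Bool, ∀ σ ∈ cells ι N, c.1 + (if c.2 = true then 1 else 0) ≤ j + 1 → ∀ x ∈ σ.cl,
        ∀ s : ℝ, (c.1 : ℝ) ≤ s → s ≤ c.1 + (if c.2 = true then 1 else 0) →
          q (H (gs N x, s)) ∈ U (ocons c σ)) ∧
      (∀ σ ∈ cells ι N, ∀ x ∈ σ.cl, H (gs N x, j + 1) ∈ D σ) := by
    classical
    intro j hj H Hc H0 Ho HU D Dm Dc DU Dg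
    have mem1 : ∀ σ ∈ cells ι N, (ocons (j, true) σ : Cell (Option ι)) ∈ cells (Option ι) N :=
      fun σ hσ => mem_cells_cons.2 ⟨by simp; omega, hσ⟩
    have mem0 : ∀ σ ∈ cells ι N, (ocons (j, false) σ : Cell (Option ι)) ∈ cells (Option ι) N :=
      fun σ hσ => mem_cells_cons.2 ⟨by simp; omega, hσ⟩
    obtain ⟨K, Kc, K0, KA, KB, Ko⟩ := prismRH hN (fun σ => q ⁻¹' (U (ocons (j, true) σ))) D
      (fun σ hσ τ hτ hs => Set.preimage_mono (U2 _ (mem1 σ hσ) _ (mem1 τ hτ) (by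
        intro y hy
        rw [mem_cl_cons] at hy ⊢
        exact ⟨hy.1, hs hy.2⟩))) Dm Dc (g := fun x => H (x, j)) (by fun_prop) (by
          intro σ hσ x hx
          have := HU (j, false) σ hσ (by simp) x hx j (by simp) (by simp)
          refine U2 _ (mem0 σ hσ) _ (mem1 σ hσ) ?_ this
          intro y hy
          rw [mem_cl_cons] at hy ⊢
          refine ⟨⟨hy.1.1, hy.1.2.trans (by simp)⟩, hy.2⟩) (by
          intro σ hσ x hx hb
          rw [Ho _ _ hb.ge]
          exact Dg σ hσ x hx hb)
    refine ⟨fun p => if p.2 ≤ j then H p else K (p.1, p.2 - j), ?_, ?_, ?_, ?_, ?_⟩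
    · refine Continuous.if_le Hc (by fun_prop) (by fun_prop) (by fun_prop) ?_
      rintro ⟨x, t⟩ ht
      simp only at ht ⊢
      rw [ht, sub_self, K0]
    · intro x
      simp only
      rw [if_pos (Nat.cast_nonneg j), H0]
    · intro x t hx
      simp only
      split_ifs
      · exact Ho x t hx
      · rw [Ko _ _ hx]; exact Ho x _ hx
    · intro c σ hσ hc x hx s hs1 hs2
      have eK : ∀ t : ℝ, (j:ℝ) ≤ t → (if t ≤ j then H (gs N x, t) else K (gs N x, t - j)) =
          K (gs N x, t - j) := by
        intro t ht
        split_ifs with h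
        · rw [le_antisymm h ht, sub_self, K0]
        · rfl
      simp only
      by_cases hcj : c.1 + (if c.2 = true then 1 else 0) ≤ j
      · have : s ≤ j := hs2.trans (by exact_mod_cast hcj)
        rw [if_pos this]
        exact HU c σ hσ hcj x hx s hs1 hs2
      · obtain ⟨a, b⟩ := c
        cases b
        · have ha : a = j + 1 := by simp at hc hcj; omega
          subst ha
          have hs : s = j + 1 := by
            simp at hs1 hs2; linarith
          rw [eK s (by rw [hs]; linarith), hs, add_sub_cancel_left]
          exact DU σ hσ (KB σ hσ x hx)
        · have ha : a = j := by simp at hc hcj; omega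
          subst ha
          rw [eK s hs1]
          exact KA σ hσ x hx _
    · intro σ hσ x hx
      simp only
      rw [if_neg (by linarith), add_sub_cancel_left]
      exact KB σ hσ x hx
  have fU : ∀ (c : ℕ × Bool) (σ), σ ∈ cells ι N → c.1 + (if c.2 = true then 1 else 0) ≤ N →
      ∀ x ∈ σ.cl, h (gs N x, cl01 (2 * c.1 / N)) ∈ U (ocons c σ) := by
    intro c σ hσ hc x hx
    have := U3 (ocons c σ) (mem_cells_cons.2 ⟨hc, hσ⟩) (ocons (c.1 : ℝ) x)
      (mem_cl_cons.2 ⟨⟨le_rfl, by simp only [ocons, Option.elim]; split_ifs <;> simp⟩, hx⟩)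
    have e : f (gs N (ocons (c.1 : ℝ) x)) = h (gs N x, cl01 (2 * c.1 / N)) := by
      have : gs N (ocons (c.1 : ℝ) x) none + 1 = 2 * c.1 / N := by
        simp only [gs, ocons, Option.elim]; ring
      simp only [f, this]; rfl
    rwa [e] at this
  have upto : ∀ j, j < N → ∃ H : (ι → ℝ) × ℝ → E, Continuous H ∧
      (∀ x, H (x, 0) = g x) ∧ (∀ x t, 1 ≤ ‖x‖ → H (x, t) = g x) ∧
      (∀ c : ℕ × Bool, ∀ σ ∈ cells ι N, c.1 + (if c.2 = true then 1 else 0) ≤ j → ∀ x ∈ σ.cl,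
        ∀ s : ℝ, (c.1 : ℝ) ≤ s → s ≤ c.1 + (if c.2 = true then 1 else 0) →
          q (H (gs N x, s)) ∈ U (ocons c σ)) := by
    intro j
    induction j with
    | zero =>
      intro _
      refine ⟨fun p => g p.1, by fun_prop, fun _ => rfl, fun _ _ _ => rfl, ?_⟩
      rintro ⟨a, b⟩ σ hσ hc x hx s hs1 hs2
      have ha : a = 0 := by simp at hc; omega
      have := fU (a, b) σ hσ (hc.trans (by omega)) x hx
      simpa [ha, h0] using this
    | succ j ih =>
      intro hj
      obtain ⟨H, a1, a2, a3, a4⟩ := ih (by omega)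
      have mem1 : ∀ σ ∈ cells ι N, (ocons (j, true) σ : Cell (Option ι)) ∈ cells (Option ι) N :=
        fun σ hσ => mem_cells_cons.2 ⟨by simp; omega, hσ⟩
      have mem0 : ∀ σ ∈ cells ι N, (ocons (j + 1, false) σ : Cell (Option ι)) ∈ cells (Option ι) N :=
        fun σ hσ => mem_cells_cons.2 ⟨by simp; omega, hσ⟩
      obtain ⟨H', b1, b2, b3, b4, -⟩ := slab j (by omega) H a1 a2 a3 a4
        (fun σ => q ⁻¹' (U (ocons (j + 1, false) σ)))
        (fun σ hσ τ hτ hs => Set.preimage_mono (U2 _ (mem0 σ hσ) _ (mem0 τ hτ) (by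
          intro y hy
          rw [mem_cl_cons] at hy ⊢
          exact ⟨hy.1, hs hy.2⟩)))
        (fun σ hσ => hq.conn _ (U1 _ (mem1 σ hσ)) _ (U1 _ (mem0 σ hσ))
          (U2 _ (mem0 σ hσ) _ (mem1 σ hσ) (by
            intro y hy
            rw [mem_cl_cons] at hy ⊢
            simp only [Bool.false_eq_true, if_false, if_true] at hy ⊢
            push_cast at hy ⊢
            exact ⟨⟨by linarith [hy.1.1], by linarith [hy.1.2]⟩, hy.2⟩)) _)
        (fun σ hσ => subset_rfl) (by
          intro σ hσ x hx hb
          have := fU (j + 1, false) σ hσ (by simp; omega) x hx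
          rw [hout _ _ hb.ge] at this
          rw [Set.mem_preimage, hgout _ hb.ge]; exact this)
      exact ⟨H', b1, b2, b3, b4⟩
  obtain ⟨n, rfl⟩ : ∃ n, N = n + 1 := ⟨N - 1, by omega⟩
  obtain ⟨H, a1, a2, a3, a4⟩ := upto n (by omega)
  have hn1 : ∀ j : ℕ, n ≤ j → cl01 (2 * (j:ℝ) / (n + 1 : ℕ)) = 1 := by
    intro j hj
    apply cl01_of_ge
    rw [le_div_iff₀ hNr]
    have h1 : (n:ℝ) ≤ j := by exact_mod_cast hj
    have h2 : (2:ℝ) ≤ (n + 1 : ℕ) := by exact_mod_cast hN2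
    push_cast at h2 ⊢; linarith
  have mem1 : ∀ σ ∈ cells ι (n+1), (ocons (n, true) σ : Cell (Option ι)) ∈ cells (Option ι) (n+1) :=
    fun σ hσ => mem_cells_cons.2 ⟨by simp, hσ⟩
  obtain ⟨H', b1, b2, b3, b4, b5⟩ := slab n (by omega) H a1 a2 a3 a4
    (fun σ => q ⁻¹' {b0}) (fun _ _ _ _ _ => subset_rfl)
    (fun σ hσ => hq.conn0 _ (U1 _ (mem1 σ hσ)) (by
      have := fU (n, true) σ hσ (by simp) _ (lo_mem σ)
      rwa [hn1 n le_rfl, h1] at this) _)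
    (fun σ hσ e he => by
      have := fU (n + 1, false) σ hσ (by simp) _ (lo_mem σ)
      rw [hn1 (n + 1) (by omega), h1] at this
      rw [Set.mem_preimage, Set.mem_singleton_iff.1 he]; exact this)
    (fun σ hσ x hx hb => hgout _ hb.ge)
  let H2 : (ι → ℝ) × ℝ → E := fun p => H' (p.1, p.2 * (n + 1 : ℕ))
  have H2c : Continuous H2 := by fun_prop
  have H20 : ∀ x, H2 (x, 0) = g x := fun x => by simp only [H2]; rw [zero_mul, b2]
  have H21 : ∀ x, q (H2 (x, 1)) = b0 := by
    intro x
    rcases le_total ‖x‖ 1 with h | h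
    · obtain ⟨σ, hσ, y, hy, rfl⟩ := exists_cell hN h
      have := b5 σ hσ y hy
      simp only [H2]
      rw [one_mul]; push_cast; exact this
    · simp only [H2]; rw [b3 _ _ h]; exact hgout x h
  have H2o : ∀ x t, 1 ≤ ‖x‖ → H2 (x, t) = g x := fun x t hx => b3 _ _ hx
  refine ⟨H2, H2c, H20, H21, H2o, ?_⟩
  have r1 : RH Set.univ (fun y : Option ι → ℝ => q (H2 (otl y, cl01 ((y none + 1) / 2)))) f := by
    refine close hN U (fun τ hτ => hq.ctr _ (U1 τ hτ)) U2
      (hq.cont.comp (H2c.comp (by fun_prop))) hf ?_ U3 ?_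
    · intro τ hτ y hy
      rw [← ocons_otl τ] at hτ hy ⊢
      have m := mem_cells_cons.1 hτ
      have hy := mem_cl_cons.1 hy
      have := b4 _ _ m.2 m.1 (otl y) hy.2 (y none) hy.1.1 hy.1.2
      convert this using 2
      simp only [H2]
      congr 2
      have e : (gs (n+1) y none + 1) / 2 = y none / (n + 1 : ℕ) := by simp only [gs]; ring
      have l1 : y none ≤ (n + 1 : ℕ) := hy.1.2.trans (by exact_mod_cast m.1)
      have l0 : 0 ≤ y none := le_trans (Nat.cast_nonneg _) hy.1.1
      rw [e, cl01_of_mem (by positivity) ((div_le_one hNr).2 l1), div_mul_cancel₀ _ hNr.ne']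
    · intro y hy
      simp only [f]
      rcases norm_ocons_cases hy with h | h | h
      · rw [H2o _ _ h, hout _ _ h, hgout _ h]
      · rw [cl01_of_le (by linarith), cl01_of_le (by linarith), H20, h0]
      · rw [cl01_of_ge (by linarith), cl01_of_ge (by linarith), H21, h1]
  refine r1.trans ?_
  refine ⟨fun p => h (otl p.1, cl01 ((2 - cl01 p.2) * ((p.1 none + 1) / 2))),
    hh.comp (by fun_prop), ?_, ?_, fun _ => trivial, ?_⟩
  · intro y; simp only [f, cl01_zero]; congr 3; ring
  · intro y; simp only [cl01_one]; congr 3; ring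
  · intro y t hy
    simp only [f]
    have u0 := cl01_nonneg t
    have u1 := cl01_le t
    rcases norm_ocons_cases hy with h | h | h
    · rw [hout _ _ h, hout _ _ h]
    · rw [cl01_of_le (by nlinarith), cl01_of_le (by linarith)]
    · rw [cl01_of_ge (by nlinarith), cl01_of_ge (by linarith)]

/-- the lifting criterion without the comparison -/
lemma QF.push {E B : Type*} [TopologicalSpace E] [TopologicalSpace B] {q : E → B}
    {𝓑 : Set (Set B)} {b0 : B} (hq : QF q 𝓑 b0) {g : (ι → ℝ) → E} (hg : Continuous g)
    (h : RH Set.univ (fun x => q (g x)) (fun _ => b0)) :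
    ∃ g', RH Set.univ g g' ∧ ∀ x, g' x ∈ q ⁻¹' {b0} := by
  obtain ⟨h', hc, h0, h1, -, ho⟩ := h
  obtain ⟨H, c, H0, H1, Ho, -⟩ := hq.ahlp hg hc h0 h1 (fun x t hx => by
    rw [ho x t hx, ← ho x 1 hx, h1])
  exact ⟨fun x => H (x, 1), ⟨H, c, H0, fun _ => rfl, fun _ => trivial, Ho⟩, H1⟩
end
end HS

namespace HS

section
variable {ι : Type} [Fintype ι] {Y : Type*} [TopologicalSpace Y]

/-! ## Loops and their products -/

structure LoopIn (A : Set Y) (y0 : Y) (g : (ι → ℝ) → Y) : Prop where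
  cont : Continuous g
  mem : ∀ x, g x ∈ A
  out : ∀ x, 1 ≤ ‖x‖ → g x = y0

open Classical in
def upd (i : ι) (v : ℝ) (x : ι → ℝ) : ι → ℝ := fun j => if j = i then v else x j

lemma upd_same (i : ι) (v : ℝ) (x : ι → ℝ) : upd i v x i = v := if_pos rfl
lemma upd_ne {i j : ι} (h : j ≠ i) (v : ℝ) (x : ι → ℝ) : upd i v x j = x j := if_neg h

@[fun_prop] lemma Continuous.upd' {M : Type*} [TopologicalSpace M] {i : ι} {f : M → ℝ}
    {g : M → (ι → ℝ)} (hf : Continuous f) (hg : Continuous g) :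
    Continuous fun x => upd i (f x) (g x) := by
  refine continuous_pi fun j => ?_
  by_cases h : j = i
  · subst h; simpa [upd] using hf
  · simp only [upd, if_neg h]; fun_prop

lemma one_le_norm {x : ι → ℝ} (j : ι) (h : 1 ≤ |x j|) : 1 ≤ ‖x‖ := h.trans (norm_le_pi_norm x j)

/-- product of loops in direction `i` -/
def mulAt {T : Type*} (i : ι) (f g : (ι → ℝ) → T) (x : ι → ℝ) : T :=
  if x i ≤ 0 then f (upd i (2 * x i + 1) x) else g (upd i (2 * x i - 1) x)

lemma mulAt_const {T : Type*} (i : ι) (t : T) : mulAt i (fun _ => t) (fun _ => t) = fun _ => t := by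
  funext x; simp [mulAt]

lemma mulAt_out {i : ι} {f g : (ι → ℝ) → Y} {c : Y} (hf : ∀ x, 1 ≤ ‖x‖ → f x = c)
    (hg : ∀ x, 1 ≤ ‖x‖ → g x = c) {x : ι → ℝ} (hx : 1 ≤ ‖x‖) : mulAt i f g x = c := by
  obtain ⟨j, hj⟩ := exists_norm_eq hx
  simp only [mulAt]
  by_cases h : j = i
  · subst h
    split_ifs with h'
    · refine hf _ (one_le_norm j ?_)
      rw [upd_same]
      rw [abs_of_nonpos h'] at hj
      rw [le_abs']; left; linarith
    · refine hg _ (one_le_norm j ?_)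
      rw [upd_same]
      rw [abs_of_pos (not_le.1 h')] at hj
      rw [le_abs']; right; linarith
  · split_ifs
    · exact hf _ (one_le_norm j (by rwa [upd_ne h]))
    · exact hg _ (one_le_norm j (by rwa [upd_ne h]))

lemma mulAt_mem {i : ι} {f g : (ι → ℝ) → Y} {A : Set Y} (hf : ∀ x, f x ∈ A) (hg : ∀ x, g x ∈ A) (x) :
    mulAt i f g x ∈ A := by
  simp only [mulAt]; split_ifs
  · exact hf _
  · exact hg _

lemma continuous_mulAt {P : Type*} [TopologicalSpace P] {i : ι} {F G : (ι → ℝ) × P → Y}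
    (hF : Continuous F) (hG : Continuous G) {c : P → Y} (oF : ∀ x p, 1 ≤ ‖x‖ → F (x, p) = c p)
    (oG : ∀ x p, 1 ≤ ‖x‖ → G (x, p) = c p) :
    Continuous fun q : (ι → ℝ) × P => mulAt i (fun x => F (x, q.2)) (fun x => G (x, q.2)) q.1 := by
  unfold mulAt
  refine Continuous.if_le (by fun_prop) (by fun_prop) (by fun_prop) (by fun_prop) ?_
  rintro ⟨x, p⟩ h
  simp only at h ⊢
  rw [oF _ _ (one_le_norm i (by rw [upd_same, h]; norm_num)),
    oG _ _ (one_le_norm i (by rw [upd_same, h]; norm_num))]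

lemma LoopIn.mul {A : Set Y} {y0 : Y} {f g : (ι → ℝ) → Y} (hf : LoopIn A y0 f) (hg : LoopIn A y0 g)
    (i : ι) : LoopIn A y0 (mulAt i f g) := by
  refine ⟨?_, mulAt_mem hf.mem hg.mem, fun x hx => mulAt_out hf.out hg.out hx⟩
  have := continuous_mulAt (P := Unit) (i := i) (F := fun p => f p.1) (G := fun p => g p.1)
    (c := fun _ => y0) (hf.cont.comp continuous_fst) (hg.cont.comp continuous_fst)
    (fun x _ hx => hf.out x hx) (fun x _ hx => hg.out x hx)
  exact this.comp (Continuous.prodMk continuous_id (continuous_const (y := ())))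

lemma LoopIn.const {A : Set Y} {y0 : Y} (h : y0 ∈ A) : LoopIn A y0 (fun _ : ι → ℝ => y0) :=
  ⟨continuous_const, fun _ => h, fun _ _ => rfl⟩

lemma LoopIn.mono {A A' : Set Y} {y0 : Y} {f : (ι → ℝ) → Y} (hf : LoopIn A y0 f) (h : A ⊆ A') :
    LoopIn A' y0 f := ⟨hf.cont, fun x => h (hf.mem x), hf.out⟩

lemma RH.mul {A : Set Y} {y0 : Y} {f f' g g' : (ι → ℝ) → Y} (h : RH A f f') (h' : RH A g g')
    (hf : ∀ x, 1 ≤ ‖x‖ → f x = y0) (hg : ∀ x, 1 ≤ ‖x‖ → g x = y0) (i : ι) :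
    RH A (mulAt i f g) (mulAt i f' g') := by
  obtain ⟨H, c, h0, h1, hA, ho⟩ := h
  obtain ⟨K, d, k0, k1, kA, ko⟩ := h'
  have oH : ∀ x (t : ℝ), 1 ≤ ‖x‖ → H (x, t) = y0 := fun x t hx => (ho x t hx).trans (hf x hx)
  have oK : ∀ x (t : ℝ), 1 ≤ ‖x‖ → K (x, t) = y0 := fun x t hx => (ko x t hx).trans (hg x hx)
  refine ⟨_, continuous_mulAt (i := i) (c := fun _ => y0) c d oH oK, ?_, ?_, ?_, ?_⟩
  · intro x; simp only [h0, k0]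
  · intro x; simp only [h1, k1]
  · intro p; exact mulAt_mem (fun x => hA _) (fun x => kA _) _
  · intro x t hx
    simp only
    rw [mulAt_out (c := y0) (fun x hx => oH x t hx) (fun x hx => oK x t hx) hx,
      mulAt_out hf hg hx]

lemma RH.loop {A : Set Y} {y0 : Y} {f g : (ι → ℝ) → Y} (h : RH A f g) (hf : LoopIn A y0 f) :
    LoopIn A y0 g := ⟨h.cont_right, h.mem_right, fun x hx => (h.eq_out hx).trans (hf.out x hx)⟩

lemma RH.map {Y' : Type*} [TopologicalSpace Y'] {A : Set Y} {f g : (ι → ℝ) → Y} (h : RH A f g)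
    {A' : Set Y'} {q : Y → Y'} (hq : Continuous q) (hA : ∀ y ∈ A, q y ∈ A') :
    RH A' (fun x => q (f x)) (fun x => q (g x)) := by
  obtain ⟨H, c, h0, h1, hm, ho⟩ := h
  exact ⟨fun p => q (H p), hq.comp c, fun x => by simp only [h0], fun x => by simp only [h1],
    fun p => hA _ (hm p), fun x t hx => by simp only [ho x t hx]⟩

abbrev Null (A : Set Y) (y0 : Y) (f : (ι → ℝ) → Y) : Prop := RH A f (fun _ => y0)

lemma Conn.null {A : Set Y} {y0 : Y} (h : Conn ι A {y0}) {f : (ι → ℝ) → Y} (hf : LoopIn A y0 f) :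
    Null A y0 f := by
  obtain ⟨g, hg, hg'⟩ := h f hf.cont hf.mem hf.out
  have : g = fun _ => y0 := funext hg'
  rw [this] at hg; exact hg

lemma Conn.of_null {A : Set Y} {y0 : Y}
    (h : ∀ f : (ι → ℝ) → Y, LoopIn A y0 f → Null A y0 f) : Conn ι A {y0} :=
  fun g hg hA ho => ⟨fun _ => y0, h g ⟨hg, hA, ho⟩, fun _ => rfl⟩

/-- the homotopy group is infinite cyclic -/
def HasZ (ι : Type) [Fintype ι] (i : ι) {Y : Type*} [TopologicalSpace Y] (A : Set Y) (y0 : Y) : Prop :=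
  ∃ R : ((ι → ℝ) → Y) → ℤ → Prop, (∀ f, LoopIn A y0 f → ∃ n, R f n) ∧
    (∀ n, ∃ f, LoopIn A y0 f ∧ R f n) ∧
    (∀ f g n m, LoopIn A y0 f → LoopIn A y0 g → R f n → R g m → R (mulAt i f g) (n + m)) ∧
    (∀ f n, LoopIn A y0 f → R f n → (n = 0 ↔ Null A y0 f))

lemma HasZ.transfer {κ : Type} [Fintype κ] {Y' : Type*} [TopologicalSpace Y'] {i : ι} {k : κ}
    {A : Set Y} {y0 : Y} {A' : Set Y'} {y0' : Y'} (h : HasZ ι i A y0)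
    (r : ((ι → ℝ) → Y) → ((κ → ℝ) → Y') → Prop)
    (ha : ∀ f, LoopIn A y0 f → ∃ f', LoopIn A' y0' f' ∧ r f f')
    (hb : ∀ f', LoopIn A' y0' f' → ∃ f, LoopIn A y0 f ∧ r f f')
    (hc : ∀ f g f' g', LoopIn A y0 f → LoopIn A y0 g → LoopIn A' y0' f' → LoopIn A' y0' g' →
      r f f' → r g g' → r (mulAt i f g) (mulAt k f' g'))
    (hd : ∀ f f', LoopIn A y0 f → LoopIn A' y0' f' → r f f' → (Null A y0 f ↔ Null A' y0' f')) :
    HasZ κ k A' y0' := by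
  obtain ⟨R, h1, h2, h3, h4⟩ := h
  refine ⟨fun f' n => ∃ f, LoopIn A y0 f ∧ r f f' ∧ R f n, ?_, ?_, ?_, ?_⟩
  · intro f' hf'
    obtain ⟨f, hf, hr⟩ := hb f' hf'
    obtain ⟨n, hn⟩ := h1 f hf
    exact ⟨n, f, hf, hr, hn⟩
  · intro n
    obtain ⟨f, hf, hn⟩ := h2 n
    obtain ⟨f', hf', hr⟩ := ha f hf
    exact ⟨f', hf', f, hf, hr, hn⟩
  · rintro f' g' n m hf' hg' ⟨f, hf, rf, Rf⟩ ⟨g, hg, rg, Rg⟩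
    exact ⟨mulAt i f g, hf.mul hg i, hc f g f' g' hf hg hf' hg' rf rg, h3 f g n m hf hg Rf Rg⟩
  · rintro f' n hf' ⟨f, hf, rf, Rf⟩
    rw [h4 f n hf Rf]
    exact hd f f' hf hf' rf

/-! ## Homotopies as maps on the cube with one more direction -/

def pr {T : Type*} (H : (ι → ℝ) × ℝ → T) (y : Option ι → ℝ) : T := H (otl y, cl01 ((y none + 1) / 2))

lemma continuous_pr {H : (ι → ℝ) × ℝ → Y} (hH : Continuous H) : Continuous (pr H) :=
  hH.comp (by fun_prop)

@[fun_prop] lemma continuous_ocons : Continuous fun p : (ι → ℝ) × ℝ => (ocons p.2 p.1 : Option ι → ℝ) := by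
  refine continuous_pi fun o => ?_
  cases o with
  | none => exact continuous_snd
  | some i => exact (continuous_apply i).comp continuous_fst

lemma norm_ocons_left {s : ℝ} {x : ι → ℝ} (h : 1 ≤ |s|) : 1 ≤ ‖(ocons s x : Option ι → ℝ)‖ :=
  one_le_norm (none : Option ι) h
lemma norm_ocons_right {s : ℝ} {x : ι → ℝ} (h : 1 ≤ ‖x‖) : 1 ≤ ‖(ocons s x : Option ι → ℝ)‖ := by
  obtain ⟨i, hi⟩ := exists_norm_eq h
  exact one_le_norm (some i) hi

lemma pr_ocons {T : Type*} (H : (ι → ℝ) × ℝ → T) {t : ℝ} (h0 : 0 ≤ t) (h1 : t ≤ 1) (x : ι → ℝ) :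
    pr H (ocons (2 * t - 1) x) = H (x, t) := by
  simp only [pr, ocons, Option.elim]
  rw [show (2 * t - 1 + 1) / 2 = t by ring, cl01_of_mem h0 h1]; rfl

/-- undoing `pr` -/
lemma RH.of_cube {A : Set Y} {g' : (Option ι → ℝ) → Y} {H : (ι → ℝ) × ℝ → Y}
    (h : RH Set.univ (pr H) g') (hA : ∀ y, g' y ∈ A) {f : (ι → ℝ) → Y}
    (ho : ∀ x t, 1 ≤ ‖x‖ → H (x, t) = f x) (h0 : ∀ x, H (x, 0) = f x) :
    RH A f (fun x => H (x, 1)) := by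
  refine ⟨fun p => g' (ocons (2 * p.2 - 1) p.1), h.cont_right.comp
    (continuous_ocons.comp (by fun_prop : Continuous fun p : (ι → ℝ) × ℝ => (p.1, 2 * p.2 - 1))),
    ?_, ?_, fun p => hA _, ?_⟩
  · intro x
    simp only
    rw [h.eq_out (norm_ocons_left (by norm_num)), pr_ocons H le_rfl zero_le_one, h0]
  · intro x
    simp only
    rw [h.eq_out (norm_ocons_left (by norm_num)), pr_ocons H zero_le_one le_rfl]
  · intro x t hx
    simp only
    rw [h.eq_out (norm_ocons_right hx)]
    simp only [pr]; exact ho _ _ hx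

lemma Conn.inj {A A' : Set Y} (h : Conn (Option ι) A' A) {f g : (ι → ℝ) → Y} (hf : ∀ x, f x ∈ A)
    (hg : ∀ x, g x ∈ A) (hr : RH A' f g) : RH A f g := by
  obtain ⟨H, c, h0, h1, hm, ho⟩ := hr
  obtain ⟨g', hg', hA⟩ := h (pr H) (continuous_pr c) (fun y => hm _) (by
    intro y hy
    simp only [pr]
    rcases norm_ocons_cases hy with h | h | h
    · rw [ho _ _ h]; exact hf _
    · rw [cl01_of_le (by linarith), h0]; exact hf _
    · rw [cl01_of_ge (by linarith), h1]; exact hg _)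
  have := (hg'.mono (Set.subset_univ _)).of_cube hA ho h0
  simpa only [h1] using this

/-- transfer along an inclusion -/
lemma HasZ.incl {A A' : Set Y} {y0 : Y} {i : ι} (hA : A ⊆ A') (h0 : y0 ∈ A) (h1 : Conn ι A' A)
    (h2 : Conn (Option ι) A' A) :
    HasZ ι i A y0 ↔ HasZ ι i A' y0 := by
  have nul : ∀ f f' : (ι → ℝ) → Y, LoopIn A y0 f → LoopIn A' y0 f' → RH A' f f' →
      (Null A y0 f ↔ Null A' y0 f') := by
    intro f f' hf hf' hr
    constructor
    · intro h; exact hr.symm.trans (h.mono hA)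
    · intro h; exact h2.inj hf.mem (fun _ => h0) (hr.trans h)
  have ex : ∀ f' : (ι → ℝ) → Y, LoopIn A' y0 f' → ∃ f, LoopIn A y0 f ∧ RH A' f f' := by
    intro f' hf'
    obtain ⟨g, hg, hgA⟩ := h1 f' hf'.cont hf'.mem fun x hx => by rw [hf'.out x hx]; exact h0
    exact ⟨g, ⟨hg.cont_right, hgA, fun x hx => (hg.eq_out hx).trans (hf'.out x hx)⟩, hg.symm⟩
  constructor
  · intro h
    refine h.transfer (fun f f' => RH A' f f') (fun f hf => ⟨f, hf.mono hA, RH.refl hf.cont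
      (hf.mono hA).mem⟩) ex ?_ nul
    intro f g f' g' hf hg hf' hg' rf rg
    exact rf.mul rg hf.out hg.out i
  · intro h
    refine h.transfer (fun f' f => RH A' f f') ex (fun f hf => ⟨f, hf.mono hA, RH.refl hf.cont
      (hf.mono hA).mem⟩) ?_ (fun f' f hf' hf hr => (nul f f' hf hf' hr).symm)
    intro f g f' g' hf hg hf' hg' rf rg
    exact rf.mul rg hf'.out hg'.out i

/-- transfer along a topological embedding -/
lemma HasZ.emb {Y' : Type*} [TopologicalSpace Y'] {j : Y → Y'} (hj : Topology.IsEmbedding j) {i : ι}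
    {A : Set Y} {y0 : Y} (h : HasZ ι i A y0) : HasZ ι i (j '' A) (j y0) := by
  classical
  have lift : ∀ {M : Type} [TopologicalSpace M] (F : M → Y'), Continuous F → (∀ m, F m ∈ j '' A) →
      ∃ G : M → Y, Continuous G ∧ (∀ m, G m ∈ A) ∧ ∀ m, j (G m) = F m := by
    intro M _ F hF hm
    choose G h1 h2 using hm
    refine ⟨G, hj.continuous_iff.2 ?_, h1, h2⟩
    simpa [Function.comp_def, h2] using hF
  refine h.transfer (fun f f' => ∀ x, f' x = j (f x)) ?_ ?_ ?_ ?_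
  · intro f hf
    exact ⟨fun x => j (f x), ⟨hj.continuous.comp hf.cont, fun x => ⟨_, hf.mem x, rfl⟩,
      fun x hx => by simp only [hf.out x hx]⟩, fun _ => rfl⟩
  · intro f' hf'
    obtain ⟨G, h1, h2, h3⟩ := lift f' hf'.cont hf'.mem
    exact ⟨G, ⟨h1, h2, fun x hx => hj.injective (by rw [h3, hf'.out x hx])⟩, fun x => (h3 x).symm⟩
  · intro f g f' g' hf hg hf' hg' rf rg x
    simp only [mulAt]; split_ifs
    · exact rf _
    · exact rg _
  · intro f f' hf hf' rf
    have ef : f' = fun x => j (f x) := funext rf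
    constructor
    · intro h
      rw [ef]; exact RH.map h hj.continuous fun y hy => ⟨y, hy, rfl⟩
    · rintro ⟨H, c, h0, h1, hm, ho⟩
      obtain ⟨G, g1, g2, g3⟩ := lift H c hm
      exact ⟨G, g1, fun x => hj.injective (by rw [g3, h0, rf]),
        fun x => hj.injective (by rw [g3, h1]), g2,
        fun x t hx => hj.injective (by rw [g3, ho x t hx, rf])⟩

lemma Conn.emb {Y' : Type*} [TopologicalSpace Y'] {j : Y → Y'} (hj : Topology.IsEmbedding j)
    {A B : Set Y} (hBA : B ⊆ A) (h : Conn ι A B) : Conn ι (j '' A) (j '' B) := by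
  intro g hg hA hB
  choose G h1 h2 using hA
  have hG : Continuous G := hj.continuous_iff.2 (by simpa [Function.comp_def, h2] using hg)
  obtain ⟨G', r, hG'⟩ := h G hG h1 (fun x hx => by
    obtain ⟨y, hy, e⟩ := hB x hx
    rw [← h2] at e
    rw [← hj.injective e]; exact hy)
  refine ⟨fun x => j (G' x), ?_, fun x => ⟨_, hG' x, rfl⟩⟩
  have := RH.map r hj.continuous (A' := j '' A) fun y hy => ⟨y, hy, rfl⟩
  simpa only [h2] using this

lemma Conn.of_emb {Y' : Type*} [TopologicalSpace Y'] {j : Y → Y'} (hj : Topology.IsEmbedding j)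
    {A B : Set Y} (h : Conn ι (j '' A) (j '' B)) : Conn ι A B := by
  intro g hg hA hB
  obtain ⟨g', ⟨H, c, h0, h1, hm, ho⟩, hB'⟩ := h (fun x => j (g x)) (hj.continuous.comp hg)
    (fun x => ⟨_, hA x, rfl⟩) (fun x hx => ⟨_, hB x hx, rfl⟩)
  choose G g1 g2 using hm
  have hG : Continuous G := hj.continuous_iff.2 (by simpa [Function.comp_def, g2] using c)
  refine ⟨fun x => G (x, 1), ⟨G, hG, fun x => hj.injective (by rw [g2, h0]), fun _ => rfl, g1,
    fun x t hx => hj.injective (by rw [g2, ho x t hx])⟩, fun x => ?_⟩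
  obtain ⟨y, hy, e⟩ := hB' x
  rw [← h1, ← g2] at e
  simp only
  rw [← hj.injective e]; exact hy

/-- reindexing -/
def rx {κ : Type} (e : ι ≃ κ) (x : κ → ℝ) : ι → ℝ := fun i => x (e i)

lemma norm_rx {κ : Type} [Fintype κ] (e : ι ≃ κ) (x : κ → ℝ) : ‖rx e x‖ = ‖x‖ := by
  apply le_antisymm
  · rw [pi_norm_le_iff_of_nonneg (norm_nonneg _)]
    exact fun i => norm_le_pi_norm x (e i)
  · rw [pi_norm_le_iff_of_nonneg (norm_nonneg _)]
    intro k
    have := norm_le_pi_norm (rx e x) (e.symm k)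
    simpa [rx] using this

lemma continuous_rx {κ : Type} (e : ι ≃ κ) : Continuous (rx e) := by unfold rx; fun_prop
lemma rx_symm {κ : Type} [Fintype κ] (e : ι ≃ κ) (x : κ → ℝ) : rx e.symm (rx e x) = x := by
  funext i; simp [rx]
lemma rx_symm' {κ : Type} [Fintype κ] (e : ι ≃ κ) (x : ι → ℝ) : rx e (rx e.symm x) = x := by
  funext i; simp [rx]

lemma RH.rx {κ : Type} [Fintype κ] (e : ι ≃ κ) {A : Set Y} {f g : (ι → ℝ) → Y} (h : RH A f g) :
    RH A (fun x => f (rx e x)) (fun x => g (rx e x)) := by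
  obtain ⟨H, c, h0, h1, hm, ho⟩ := h
  exact ⟨fun p => H (HS.rx e p.1, p.2), c.comp (((continuous_rx e).comp continuous_fst).prodMk
    continuous_snd), fun x => h0 _, fun x => h1 _, fun p => hm _, fun x t hx =>
      ho _ _ (by rwa [norm_rx])⟩

lemma Conn.reindex {κ : Type} [Fintype κ] (e : ι ≃ κ) {A B : Set Y} (h : Conn ι A B) :
    Conn κ A B := by
  intro g hg hA hB
  obtain ⟨g', hr, hB'⟩ := h (fun x => g (rx e.symm x)) (hg.comp (continuous_rx _)) (fun x => hA _)
    (fun x hx => hB _ (by rwa [norm_rx]))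
  refine ⟨fun x => g' (rx e x), ?_, fun x => hB' _⟩
  have := hr.rx e
  simpa only [rx_symm] using this

lemma Conn.of_card {κ : Type} [Fintype κ] (h : Fintype.card ι = Fintype.card κ) {A B : Set Y}
    (hc : Conn ι A B) : Conn κ A B := hc.reindex (Fintype.equivOfCardEq h)

lemma HasZ.reindex {κ : Type} [Fintype κ] (e : ι ≃ κ) {i : ι} {A : Set Y} {y0 : Y}
    (h : HasZ ι i A y0) : HasZ κ (e i) A y0 := by
  refine h.transfer (fun f f' => ∀ x, f' x = f (rx e x)) ?_ ?_ ?_ ?_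
  · intro f hf
    exact ⟨fun x => f (rx e x), ⟨hf.cont.comp (continuous_rx e), fun x => hf.mem _, fun x hx =>
      hf.out _ (by rwa [norm_rx])⟩, fun _ => rfl⟩
  · intro f hf
    exact ⟨fun x => f (rx e.symm x), ⟨hf.cont.comp (continuous_rx _), fun x => hf.mem _, fun x hx =>
      hf.out _ (by rwa [norm_rx])⟩, fun x => by simp only [rx_symm]⟩
  · intro f g f' g' hf hg hf' hg' rf rg x
    have key : ∀ v, rx e (upd (e i) v x) = upd i v (rx e x) := by
      intro v; funext j
      by_cases h : j = i <;> simp [rx, upd, h]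
    simp only [mulAt, rf, rg, key]
    rfl
  · intro f f' hf hf' rf
    have ef : f' = fun x => f (rx e x) := funext rf
    rw [ef]
    constructor
    · intro h; exact RH.rx e h
    · intro h
      have := RH.rx e.symm h
      simpa only [rx_symm'] using this

end
end HS

namespace HS

section
variable {ι : Type} [Fintype ι] {Y : Type*} [TopologicalSpace Y]

/-! ## change of base point -/

def BP (γ : ℝ → Y) (f f' : (ι → ℝ) → Y) : Prop :=
  ∃ G : (ι → ℝ) × ℝ → Y, Continuous G ∧ (∀ x, G (x, 0) = f x) ∧ (∀ x, G (x, 1) = f' x) ∧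
    ∀ x t, 1 ≤ ‖x‖ → 0 ≤ t → t ≤ 1 → G (x, t) = γ t

lemma BP.symm {γ : ℝ → Y} {f f' : (ι → ℝ) → Y} (h : BP γ f f') : BP (fun t => γ (1 - t)) f' f := by
  obtain ⟨G, c, g0, g1, go⟩ := h
  refine ⟨fun p => G (p.1, 1 - p.2), c.comp (by fun_prop), fun x => by simp [g1], fun x => by simp [g0],
    fun x t hx h0 h1 => go _ _ hx (by linarith) (by linarith)⟩

lemma BP.exists {γ : ℝ → Y} (hγ : Continuous γ) {f : (ι → ℝ) → Y} (hf : LoopIn Set.univ (γ 0) f) :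
    ∃ f', LoopIn Set.univ (γ 1) f' ∧ BP γ f f' := by
  let G : (ι → ℝ) × ℝ → Y := fun p => if (1 + cl01 p.2) * ‖p.1‖ ≤ 1 then f ((1 + cl01 p.2) • p.1)
    else γ (min (cl01 p.2) (max 0 ((1 + cl01 p.2) * ‖p.1‖ - 1)))
  have hG : Continuous G := by
    refine Continuous.if_le (hf.cont.comp (by fun_prop)) (hγ.comp (by fun_prop)) (by fun_prop)
      continuous_const ?_
    intro p hp
    have := cl01_nonneg p.2
    rw [hp, sub_self, max_self, min_eq_right this]
    refine hf.out _ ?_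
    rw [norm_smul, Real.norm_of_nonneg (by linarith), hp]
  have hout : ∀ x t, 1 ≤ ‖x‖ → 0 ≤ t → t ≤ 1 → G (x, t) = γ t := by
    intro x t hx h0 h1
    simp only [G]
    rw [cl01_of_mem h0 h1]
    split_ifs with h
    · have : t = 0 := by nlinarith
      subst this
      exact hf.out _ (by simpa using hx)
    · rw [max_eq_right (by linarith), min_eq_left (by nlinarith)]
  refine ⟨fun x => G (x, 1), ⟨by fun_prop, fun _ => trivial, fun x hx => hout x 1 hx zero_le_one le_rfl⟩,
    G, hG, ?_, fun _ => rfl, hout⟩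
  intro x
  by_cases h : ‖x‖ ≤ 1
  · simp [G, h]
  · rw [hout x 0 (by linarith) le_rfl zero_le_one, hf.out x (by linarith)]

lemma BP.null {γ : ℝ → Y} (hγ : Continuous γ) {f f' : (ι → ℝ) → Y}
    (hf' : LoopIn Set.univ (γ 1) f') (h : BP γ f f') (hN : Null Set.univ (γ 0) f) :
    Null Set.univ (γ 1) f' := by
  obtain ⟨G, c, g0, g1, go⟩ := h
  obtain ⟨N, nc, n0, n1, -, no⟩ := hN
  have no' : ∀ x t, 1 ≤ ‖x‖ → N (x, t) = γ 0 := fun x t hx =>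
    (no x t hx).trans ((no x 1 hx).symm.trans (n1 x))
  have two : ∀ x : ι → ℝ, ‖x‖ = 1/2 → 1 ≤ ‖(2:ℝ) • x‖ := fun x hx => by
    rw [norm_smul, hx]; norm_num
  have big : ∀ x : ι → ℝ, 1/2 ≤ ‖x‖ → 1 ≤ ‖(2:ℝ) • x‖ := fun x hx => by
    rw [norm_smul]; norm_num; linarith
  have s1 : RH Set.univ f' (fun x => f' ((2:ℝ) • x)) := by
    refine ⟨fun p => f' ((1 + cl01 p.2) • p.1), hf'.cont.comp (by fun_prop), fun x => by simp,
      fun x => by norm_num, fun _ => trivial, fun x t hx => ?_⟩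
    have := cl01_nonneg t
    simp only
    rw [hf'.out x hx, hf'.out]
    rw [norm_smul, Real.norm_of_nonneg (by linarith)]; nlinarith
  have s2 : RH Set.univ (fun x => f' ((2:ℝ) • x)) (fun x => if ‖x‖ ≤ 1/2 then f ((2:ℝ) • x)
      else γ (cl01 (2 * ‖x‖ - 1))) := by
    refine ⟨fun p => if ‖p.1‖ ≤ 1/2 then G ((2:ℝ) • p.1, 1 - cl01 p.2) else
      γ ((1 - cl01 p.2) + cl01 p.2 * cl01 (2 * ‖p.1‖ - 1)), ?_, ?_, ?_, fun _ => trivial, ?_⟩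
    · refine continuous_collar (by fun_prop) (Continuous.continuousOn (c.comp (by fun_prop)))
        (Continuous.continuousOn (hγ.comp (by fun_prop))) ?_
      intro p hp
      rw [go _ _ (two _ hp) (by linarith [cl01_le p.2]) (by linarith [cl01_nonneg p.2]), hp]
      norm_num
    · intro x
      simp only [cl01_zero, sub_zero, zero_mul, add_zero, g1]
      split_ifs with h
      · rfl
      · rw [hf'.out _ (big x (by linarith))]
    · intro x
      simp only [cl01_one, sub_self, one_mul, zero_add, g0]
    · intro x t hx
      simp only
      rw [if_neg (by linarith), cl01_of_ge (by linarith : 1 ≤ 2 * ‖x‖ - 1), hf'.out _ (big x (by linarith))]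
      congr 1; ring
  have s3 : RH Set.univ (fun x => if ‖x‖ ≤ 1/2 then f ((2:ℝ) • x) else γ (cl01 (2 * ‖x‖ - 1)))
      (fun x => γ (cl01 (2 * ‖x‖ - 1))) := by
    refine ⟨fun p => if ‖p.1‖ ≤ 1/2 then N ((2:ℝ) • p.1, p.2) else γ (cl01 (2 * ‖p.1‖ - 1)),
      ?_, ?_, ?_, fun _ => trivial, ?_⟩
    · refine continuous_collar (by fun_prop) (Continuous.continuousOn (nc.comp (by fun_prop)))
        (Continuous.continuousOn (hγ.comp (by fun_prop))) ?_
      intro p hp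
      rw [no' _ _ (two _ hp), hp]
      norm_num
    · intro x; simp only [n0]
    · intro x; simp only [n1]
      split_ifs with h
      · rw [cl01_of_le (by linarith)]
      · rfl
    · intro x t hx
      simp only
      rw [if_neg (by linarith), if_neg (by linarith)]
  have s4 : RH Set.univ (fun x : ι → ℝ => γ (cl01 (2 * ‖x‖ - 1))) (fun _ => γ 1) := by
    refine ⟨fun p => γ (max (cl01 (2 * ‖p.1‖ - 1)) (cl01 p.2)), hγ.comp (by fun_prop), ?_, ?_,
      fun _ => trivial, ?_⟩
    · intro x; simp only [cl01_zero]; rw [max_eq_left (cl01_nonneg _)]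
    · intro x; simp only [cl01_one]; rw [max_eq_right (cl01_le _)]
    · intro x t hx
      simp only
      rw [cl01_of_ge (by linarith : 1 ≤ 2 * ‖x‖ - 1), max_eq_left (cl01_le _)]
  exact ((s1.trans s2).trans s3).trans s4

lemma BP.existsL {γ : ℝ → Y} (hγ : Continuous γ) {f' : (ι → ℝ) → Y} (hf : LoopIn Set.univ (γ 1) f') :
    ∃ f, LoopIn Set.univ (γ 0) f ∧ BP γ f f' := by
  obtain ⟨f, h1, h2⟩ := BP.exists (γ := fun t => γ (1 - t)) (by fun_prop) (f := f') (by simpa using hf)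
  refine ⟨f, by simpa using h1, ?_⟩
  have := h2.symm
  simpa using this

lemma Conn.basept {y0 y1 : Y} {γ : ℝ → Y} (hγ : Continuous γ) (h0 : γ 0 = y0) (h1 : γ 1 = y1)
    (h : Conn ι Set.univ {y0}) : Conn ι Set.univ {y1} := by
  subst h0 h1
  refine Conn.of_null fun f' hf' => ?_
  obtain ⟨f, hf, hr⟩ := BP.existsL hγ hf'
  exact hr.null hγ hf' (h.null hf)

lemma HasZ.basept {y0 y1 : Y} {γ : ℝ → Y} (hγ : Continuous γ) (h0 : γ 0 = y0) (h1 : γ 1 = y1) {i : ι}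
    (h : HasZ ι i Set.univ y0) : HasZ ι i Set.univ y1 := by
  subst h0 h1
  refine h.transfer (BP γ) (fun f hf => BP.exists hγ hf) (fun f hf => BP.existsL hγ hf) ?_ ?_
  · rintro f g f' g' hf hg hf' hg' ⟨F, c, a0, a1, ao⟩ ⟨G, d, b0, b1, bo⟩
    refine ⟨_, continuous_mulAt (i := i) (F := fun p => F (p.1, cl01 p.2))
      (G := fun p => G (p.1, cl01 p.2)) (c := fun t => γ (cl01 t)) (c.comp (by fun_prop))
      (d.comp (by fun_prop)) (fun x p hx => ao _ _ hx (cl01_nonneg _) (cl01_le _))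
      (fun x p hx => bo _ _ hx (cl01_nonneg _) (cl01_le _)), ?_, ?_, ?_⟩
    · intro x; simp only [cl01_zero, a0, b0]
    · intro x; simp only [cl01_one, a1, b1]
    · intro x t hx h0 h1
      simp only
      refine mulAt_out ?_ ?_ hx
      · intro x hx; rw [cl01_of_mem h0 h1]; exact ao _ _ hx h0 h1
      · intro x hx; rw [cl01_of_mem h0 h1]; exact bo _ _ hx h0 h1
  · intro f f' hf hf' hr
    constructor
    · exact hr.null hγ hf'
    · intro hN
      have := (hr.symm).null (γ := fun t => γ (1 - t)) (by fun_prop) (by simpa using hf) (by simpa using hN)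
      simpa using this

/-! ## quasifibrations -/

variable {E B : Type*} [TopologicalSpace E] [TopologicalSpace B] {q : E → B}
    {𝓑 : Set (Set B)} {b0 : B} {e0 : E}

lemma pr_out {H : (ι → ℝ) × ℝ → Y} {c : Y} (h0 : ∀ x, H (x, 0) = c) (h1 : ∀ x, H (x, 1) = c)
    (ho : ∀ x t, 1 ≤ ‖x‖ → H (x, t) = c) {y : Option ι → ℝ} (hy : 1 ≤ ‖y‖) : pr H y = c := by
  simp only [pr]
  rcases norm_ocons_cases hy with h | h | h
  · exact ho _ _ h
  · rw [cl01_of_le (by linarith), h0]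
  · rw [cl01_of_ge (by linarith), h1]

lemma reparam {h : (ι → ℝ) × ℝ → Y} {c : Y} (hc : Continuous h) (h0 : ∀ x, h (x, 0) = c)
    (h1 : ∀ x, h (x, 1) = c) (ho : ∀ x t, 1 ≤ ‖x‖ → h (x, t) = c) :
    RH Set.univ (pr h) (pr fun p => h (p.1, cl01 (2 * p.2))) := by
  refine ⟨fun p => h (otl p.1, cl01 ((1 + cl01 p.2) * cl01 ((p.1 none + 1) / 2))),
    hc.comp (by fun_prop), ?_, ?_, fun _ => trivial, ?_⟩
  · intro y
    simp only [cl01_zero, add_zero, one_mul, pr]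
    rw [cl01_of_mem (cl01_nonneg _) (cl01_le _)]
  · intro y
    simp only [cl01_one, pr]
    norm_num
  · intro y t hy
    rw [pr_out h0 h1 ho hy]
    simp only
    rcases norm_ocons_cases hy with h | h | h
    · exact ho _ _ h
    · rw [cl01_of_le (t := (y none + 1) / 2) (by linarith), mul_zero, cl01_zero, h0]
    · rw [cl01_of_ge (t := (y none + 1) / 2) (by linarith), mul_one, cl01_of_ge, h1]
      linarith [cl01_nonneg t]

/-- concatenating with a homotopy in the fibre does not change the class downstairs -/
lemma cat_fib (hq : Continuous q) {H K : (ι → ℝ) × ℝ → E} (hH : Continuous H)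
    (h0 : ∀ x, q (H (x, 0)) = b0) (ho : ∀ x t, 1 ≤ ‖x‖ → q (H (x, t)) = b0)
    (h1 : ∀ x, q (H (x, 1)) = b0) (hK : ∀ p, q (K p) = b0) :
    RH Set.univ (fun y => q (pr H y)) (fun y => q (pr (cat H K) y)) := by
  have := reparam (h := fun p => q (H p)) (hq.comp hH) h0 h1 ho
  have e : (fun y => q (pr (cat H K) y)) = pr fun p => q (H (p.1, cl01 (2 * p.2))) := by
    funext y
    simp only [pr, cat]
    split_ifs with h
    · rfl
    · rw [hK, cl01_of_ge (t := 2 * _) (by linarith), h1]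
  rw [e]; exact this

def Bdry (q : E → B) (e0 : E) (f : (ι → ℝ) → E) (b : (Option ι → ℝ) → B) : Prop :=
  ∃ H : (ι → ℝ) × ℝ → E, Continuous H ∧ (∀ x, H (x, 0) = e0) ∧ (∀ x, H (x, 1) = f x) ∧
    (∀ x t, 1 ≤ ‖x‖ → H (x, t) = e0) ∧ RH Set.univ (fun y => q (pr H y)) b

lemma Bdry.existsL (hq : QF q 𝓑 b0) (he : q e0 = b0) {b : (Option ι → ℝ) → B}
    (hb : LoopIn Set.univ b0 b) :
    ∃ f, LoopIn (q ⁻¹' {b0}) e0 f ∧ Bdry q e0 f b := by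
  let h : (ι → ℝ) × ℝ → B := fun p => b (ocons (2 * p.2 - 1) p.1)
  have hh : Continuous h := hb.cont.comp
    (continuous_ocons.comp (by fun_prop : Continuous fun p : (ι → ℝ) × ℝ => (p.1, 2 * p.2 - 1)))
  obtain ⟨H, c, H0, H1, Ho, hr⟩ := hq.ahlp (g := fun _ : ι → ℝ => e0) continuous_const hh (fun x => by
      simp only [h]; rw [hb.out _ (norm_ocons_left (by norm_num)), he]) (fun x => by
      simp only [h]; rw [hb.out _ (norm_ocons_left (by norm_num))]) (fun x t hx => by
      simp only [h]; rw [hb.out _ (norm_ocons_right hx)])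
  refine ⟨fun x => H (x, 1), ⟨by fun_prop, H1, fun x hx => Ho x 1 hx⟩, H, c, H0, fun _ => rfl, Ho, ?_⟩
  have e : b = (fun y => h (otl y, cl01 ((y none + 1) / 2))) := by
    funext y
    simp only [h]
    by_cases hy : 1 ≤ ‖y‖
    · rw [hb.out y hy, hb.out]
      rcases norm_ocons_cases hy with h | h | h
      · exact norm_ocons_right h
      · exact norm_ocons_left (by rw [cl01_of_le (by linarith)]; norm_num)
      · exact norm_ocons_left (by rw [cl01_of_ge (by linarith)]; norm_num)
    · have h1 : |y none| ≤ 1 := (norm_le_pi_norm y none).trans (le_of_not_ge hy)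
      rw [abs_le] at h1
      rw [cl01_of_mem (by linarith) (by linarith), show 2 * ((y none + 1) / 2) - 1 = y none by ring,
        ocons_otl]
  rw [e]; exact hr

lemma Bdry.null1 (hq : QF q 𝓑 b0) (he : q e0 = b0) (hE : Conn (Option ι) Set.univ {e0})
    {f : (ι → ℝ) → E} {b : (Option ι → ℝ) → B} (hf : LoopIn (q ⁻¹' {b0}) e0 f)
    (h : Bdry q e0 f b) (hN : Null (q ⁻¹' {b0}) e0 f) : Null Set.univ b0 b := by
  obtain ⟨H, c, H0, H1, Ho, hr⟩ := h
  obtain ⟨K, kc, k0, k1, km, ko⟩ := hN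
  have hc : Continuous (cat H K) := continuous_cat c kc fun x => by rw [H1, k0]
  have h2 : LoopIn Set.univ e0 (pr (cat H K)) := by
    refine ⟨continuous_pr hc, fun _ => trivial, fun y hy => pr_out ?_ ?_ ?_ hy⟩
    · intro x; rw [cat_zero, H0]
    · intro x; rw [cat_one, k1]
    · intro x t hx
      have : cat H K (x, t) ∈ ({e0} : Set E) := cat_mem (fun t => Ho x t hx)
        (fun t => (ko x t hx).trans (hf.out x hx)) t
      exact this
  have h3 := RH.map (hE.null h2) hq.cont (A' := Set.univ) fun _ _ => trivial
  have h4 := cat_fib hq.cont c (K := K) (b0 := b0) (fun x => by rw [H0, he])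
    (fun x t hx => by rw [Ho x t hx, he]) (fun x => by rw [H1]; exact hf.mem x) (fun p => km p)
  have := (hr.symm.trans h4).trans h3
  simpa only [he] using this

lemma Bdry.null2 (hq : QF q 𝓑 b0)
    {f : (ι → ℝ) → E} {b : (Option ι → ℝ) → B} 
    (h : Bdry q e0 f b) (hN : Null Set.univ b0 b) : Null (q ⁻¹' {b0}) e0 f := by
  obtain ⟨H, c, H0, H1, Ho, hr⟩ := h
  obtain ⟨g', hg, hm⟩ := hq.push (continuous_pr c) (hr.trans hN)
  have := hg.of_cube hm (f := fun _ => e0) Ho H0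
  simp only [H1] at this
  exact this.symm

lemma Conn.boundary (hq : QF q 𝓑 b0) (he : q e0 = b0) (hE : Conn (Option ι) Set.univ {e0})
    (hF : Conn ι (q ⁻¹' {b0}) {e0}) : Conn (Option ι) Set.univ {b0} := by
  refine Conn.of_null fun b hb => ?_
  obtain ⟨f, hf, h⟩ := Bdry.existsL hq he hb
  exact h.null1 hq he hE hf (hF.null hf)

lemma pr_mulAt {T : Type*} (i : ι) (H K : (ι → ℝ) × ℝ → T) :
    pr (fun p => mulAt i (fun x => H (x, p.2)) (fun x => K (x, p.2)) p.1) =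
      mulAt (some i) (pr H) (pr K) := by
  funext y
  have e : ∀ v, otl (upd (some i) v y) = upd i v (otl y) := by
    intro v; funext j
    by_cases h : j = i <;> simp [otl, upd, h]
  have e2 : ∀ v, upd (some i) v y none = y none := fun v => upd_ne (by simp) _ _
  simp only [pr, mulAt, e, e2]
  rfl

lemma map_mulAt {T T' : Type*} (q : T → T') (i : ι) (f g : (ι → ℝ) → T) :
    (fun x => q (mulAt i f g x)) = mulAt i (fun x => q (f x)) (fun x => q (g x)) := by
  funext x; simp only [mulAt]; split_ifs <;> rfl

lemma HasZ.boundary (hq : QF q 𝓑 b0) (he : q e0 = b0) (hE : Conn (Option ι) Set.univ {e0})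
    (hE' : Conn ι Set.univ {e0}) {i : ι}
    (hF : HasZ ι i (q ⁻¹' {b0}) e0) : HasZ (Option ι) (some i) Set.univ b0 := by
  refine hF.transfer (Bdry q e0) ?_ (fun b hb => Bdry.existsL hq he hb) ?_ ?_
  · intro f hf
    obtain ⟨H, c, h0, h1, -, ho⟩ := (hE'.null (hf.mono (Set.subset_univ _))).symm
    have hc := continuous_pr c
    refine ⟨fun y => q (pr H y), ⟨hq.cont.comp hc, fun _ => trivial, fun y hy => ?_⟩,
      H, c, h0, h1, ho, RH.refl (hq.cont.comp hc) fun _ => trivial⟩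
    refine pr_out (H := fun p => q (H p)) ?_ ?_ ?_ hy
    · intro x; simp only [h0, he]
    · intro x; simp only [h1]; exact hf.mem x
    · intro x t hx; simp only [ho x t hx, he]
  · rintro f g b b' hf hg hb hb' ⟨F, c, a0, a1, ao, ar⟩ ⟨G, d, d0, d1, dO, dr⟩
    refine ⟨_, continuous_mulAt (i := i) (c := fun _ => e0) c d ao dO, ?_, ?_, ?_, ?_⟩
    · intro x; simp only [a0, d0, mulAt_const]
    · intro x; simp only [a1, d1]
    · intro x t hx; exact mulAt_out (fun x hx => ao x t hx) (fun x hx => dO x t hx) hx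
    · rw [pr_mulAt, map_mulAt]
      refine ar.mul dr (y0 := b0) ?_ ?_ _
      · intro y hy; rw [← ar.eq_out hy, hb.out y hy]
      · intro y hy; rw [← dr.eq_out hy, hb'.out y hy]
  · intro f b hf hb h
    exact ⟨h.null1 hq he hE hf, h.null2 hq⟩

lemma HasZ.total (hq : QF q 𝓑 b0) (he : q e0 = b0) (hF : Conn (Option ι) (q ⁻¹' {b0}) {e0})
    (hF' : Conn ι (q ⁻¹' {b0}) {e0}) {i : Option ι}
    (hB : HasZ (Option ι) i Set.univ b0) : HasZ (Option ι) i Set.univ e0 := by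
  have out : ∀ f : (Option ι → ℝ) → E, LoopIn Set.univ e0 f → LoopIn Set.univ b0 (fun x => q (f x)) :=
    fun f hf => ⟨hq.cont.comp hf.cont, fun _ => trivial, fun x hx => by simp only [hf.out x hx, he]⟩
  refine hB.transfer (fun b f => RH Set.univ (fun x => q (f x)) b) ?_ ?_ ?_ ?_
  · intro b hb
    obtain ⟨f, hf, H, c, H0, H1, Ho, hr⟩ := Bdry.existsL hq he hb
    obtain ⟨K, kc, k0, k1, km, ko⟩ := hF'.null hf
    have hc : Continuous (cat H K) := continuous_cat c kc fun x => by rw [H1, k0]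
    have h2 : LoopIn Set.univ e0 (pr (cat H K)) := by
      refine ⟨continuous_pr hc, fun _ => trivial, fun y hy => pr_out ?_ ?_ ?_ hy⟩
      · intro x; rw [cat_zero, H0]
      · intro x; rw [cat_one, k1]
      · intro x t hx
        have : cat H K (x, t) ∈ ({e0} : Set E) := cat_mem (fun t => Ho x t hx)
          (fun t => (ko x t hx).trans (hf.out x hx)) t
        exact this
    have h4 := cat_fib hq.cont c (K := K) (b0 := b0) (fun x => by rw [H0, he])
      (fun x t hx => by rw [Ho x t hx, he]) (fun x => by rw [H1]; exact hf.mem x) (fun p => km p)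
    exact ⟨_, h2, h4.symm.trans hr⟩
  · intro f hf
    exact ⟨_, out f hf, RH.refl (hq.cont.comp hf.cont) fun _ => trivial⟩
  · intro b b' f f' hb hb' hf hf' r r'
    rw [map_mulAt]
    exact r.mul r' (out f hf).out (out f' hf').out i
  · intro b f hb hf r
    constructor
    · intro hN
      obtain ⟨g', hg, hm⟩ := hq.push hf.cont (r.trans hN)
      have : LoopIn (q ⁻¹' {b0}) e0 g' := ⟨hg.cont_right, hm, fun x hx => by
        rw [hg.eq_out hx, hf.out x hx]⟩
      exact hg.trans ((hF.null this).mono (Set.subset_univ _))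
    · intro hN
      have := r.symm.trans (RH.map hN hq.cont (A' := Set.univ) fun _ _ => trivial)
      simpa only [he] using this

lemma QF.connF (hq : QF q 𝓑 b0) (hB : Conn ι Set.univ {b0}) : Conn ι Set.univ (q ⁻¹' {b0}) := by
  intro g hg _ ho
  exact hq.push hg (hB.null ⟨hq.cont.comp hg, fun _ => trivial, ho⟩)

end

end HS

namespace HS

/-! ## comparison with the homotopy groups of the library -/

section
variable {ι : Type} [Fintype ι] {Y : Type*} [TopologicalSpace Y] {bp : Y}

abbrev pj (t : ℝ) : unitInterval := Set.projIcc 0 1 zero_le_one t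

lemma pj_coe (t : ℝ) : (pj t : ℝ) = cl01 t := by
  simp [pj, Set.coe_projIcc, cl01]

def cubeOf (x : ι → ℝ) : ι → unitInterval := fun j => pj ((x j + 1) / 2)
def ofCube (t : ι → unitInterval) : ι → ℝ := fun j => 2 * (t j : ℝ) - 1

lemma continuous_cubeOf : Continuous (cubeOf (ι := ι)) := by
  unfold cubeOf pj
  exact continuous_pi fun j => continuous_projIcc.comp (by fun_prop)
lemma continuous_ofCube : Continuous (ofCube (ι := ι)) := by unfold ofCube; fun_prop

lemma cubeOf_ofCube (t : ι → unitInterval) : cubeOf (ofCube t) = t := by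
  funext j
  apply Subtype.ext
  simp only [cubeOf, ofCube]
  rw [pj_coe, show (2 * (t j : ℝ) - 1 + 1) / 2 = t j by ring, cl01_of_mem (t j).2.1 (t j).2.2]

lemma ofCube_cubeOf {x : ι → ℝ} (hx : ‖x‖ ≤ 1) : ofCube (cubeOf x) = x := by
  funext j
  simp only [cubeOf, ofCube]
  have := abs_le.1 ((norm_le_pi_norm x j).trans hx)
  rw [pj_coe, cl01_of_mem (by linarith) (by linarith)]; ring

lemma cubeOf_bdry {x : ι → ℝ} (hx : 1 ≤ ‖x‖) : cubeOf x ∈ Cube.boundary ι := by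
  obtain ⟨j, hj⟩ := exists_norm_eq hx
  refine ⟨j, ?_⟩
  rcases le_abs'.1 hj with h | h
  · left; apply Subtype.ext; simp only [cubeOf]; rw [pj_coe, cl01_of_le (by linarith)]; rfl
  · right; apply Subtype.ext; simp only [cubeOf]; rw [pj_coe, cl01_of_ge (by linarith)]; rfl

lemma ofCube_bdry {t : ι → unitInterval} (ht : t ∈ Cube.boundary ι) : 1 ≤ ‖ofCube t‖ := by
  obtain ⟨j, h⟩ := ht
  refine one_le_norm j ?_
  rcases h with h | h <;> simp only [ofCube, h] <;> norm_num

def toTot (p : GenLoop ι Y bp) (x : ι → ℝ) : Y := p (cubeOf x)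

lemma toTot_loop (p : GenLoop ι Y bp) : LoopIn Set.univ bp (toTot p) :=
  ⟨p.1.continuous.comp continuous_cubeOf, fun _ => trivial, fun x hx => p.2 _ (cubeOf_bdry hx)⟩

lemma exists_toTot {f : (ι → ℝ) → Y} (hf : LoopIn Set.univ bp f) : ∃ p : GenLoop ι Y bp, toTot p = f := by
  refine ⟨⟨⟨fun t => f (ofCube t), hf.cont.comp continuous_ofCube⟩, fun t ht =>
    hf.out _ (ofCube_bdry ht)⟩, ?_⟩
  funext x
  show f (ofCube (cubeOf x)) = f x
  by_cases hx : 1 ≤ ‖x‖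
  · rw [hf.out x hx, hf.out _ (ofCube_bdry (cubeOf_bdry hx))]
  · rw [ofCube_cubeOf (le_of_not_ge hx)]

lemma toTot_trans [DecidableEq ι] (i : ι) (p q : GenLoop ι Y bp) :
    toTot (GenLoop.transAt i p q) = mulAt i (toTot p) (toTot q) := by
  funext x
  have e1 : ((cubeOf x i : unitInterval) : ℝ) = cl01 ((x i + 1) / 2) := pj_coe _
  show (if ((cubeOf x i : unitInterval) : ℝ) ≤ 1/2 then
      p (Function.update (cubeOf x) i (Set.projIcc 0 1 zero_le_one (2 * (cubeOf x i : ℝ)))) else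
      q (Function.update (cubeOf x) i (Set.projIcc 0 1 zero_le_one (2 * (cubeOf x i : ℝ) - 1)))) = _
  simp only [mulAt, toTot]
  have c1 : (cl01 ((x i + 1) / 2) ≤ 1/2) ↔ x i ≤ 0 := by
    constructor
    · intro h; by_contra h'
      rcases le_total 1 (x i) with h2 | h2
      · rw [cl01_of_ge (by linarith)] at h; norm_num at h
      · rw [cl01_of_mem (by linarith) (by linarith)] at h; linarith
    · intro h
      rcases le_total (x i) (-1) with h2 | h2
      · rw [cl01_of_le (by linarith)]; norm_num
      · rw [cl01_of_mem (by linarith) (by linarith)]; linarith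
  rw [e1]
  by_cases h : x i ≤ 0
  · rw [if_pos (c1.2 h), if_pos h]
    congr 1
    funext j
    by_cases hj : j = i
    · subst hj
      rw [Function.update_self]
      apply Subtype.ext
      simp only [cubeOf]
      rw [upd_same]
      erw [pj_coe, pj_coe]
      rcases le_total (x j) (-1) with h2 | h2
      · rw [cl01_of_le (t := (x j + 1) / 2) (by linarith), cl01_of_le (by linarith), cl01_of_le (by linarith)]
      · rw [cl01_of_mem (t := (x j + 1) / 2) (by linarith) (by linarith)]; congr 1; ring
    · rw [Function.update_of_ne hj]; simp only [cubeOf]; rw [upd_ne hj]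
  · rw [if_neg (fun h' => h (c1.1 h')), if_neg h]
    congr 1
    funext j
    by_cases hj : j = i
    · subst hj
      rw [Function.update_self]
      apply Subtype.ext
      simp only [cubeOf]
      rw [upd_same]
      erw [pj_coe, pj_coe]
      rcases le_total 1 (x j) with h2 | h2
      · rw [cl01_of_ge (t := (x j + 1) / 2) (by linarith), cl01_of_ge (by linarith), cl01_of_ge (by linarith)]
      · rw [cl01_of_mem (t := (x j + 1) / 2) (by linarith) (by linarith)]; congr 1; ring
    · rw [Function.update_of_ne hj]; simp only [cubeOf]; rw [upd_ne hj]

lemma homotopic_iff (p q : GenLoop ι Y bp) :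
    GenLoop.Homotopic p q ↔ RH Set.univ (toTot p) (toTot q) := by
  constructor
  · rintro ⟨H⟩
    refine ⟨fun z => H (pj z.2, cubeOf z.1), ?_, ?_, ?_, fun _ => trivial, ?_⟩
    · exact H.continuous.comp ((continuous_projIcc.comp continuous_snd).prodMk
        (continuous_cubeOf.comp continuous_fst))
    · intro x
      have : pj 0 = 0 := Subtype.ext (by rw [pj_coe, cl01_zero]; rfl)
      simp only [this, H.apply_zero]; rfl
    · intro x
      have : pj 1 = 1 := Subtype.ext (by rw [pj_coe, cl01_one]; rfl)
      simp only [this, H.apply_one]; rfl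
    · intro x t hx
      exact H.eq_fst _ (cubeOf_bdry hx)
  · rintro ⟨H, c, h0, h1, -, ho⟩
    refine ⟨⟨⟨⟨fun z => H (ofCube z.2, (z.1 : ℝ)), ?_⟩, ?_, ?_⟩, ?_⟩⟩
    · exact c.comp ((continuous_ofCube.comp continuous_snd).prodMk (by fun_prop))
    · intro t
      show H (ofCube t, ((0 : unitInterval) : ℝ)) = p t
      rw [Set.Icc.coe_zero, h0]
      show p (cubeOf (ofCube t)) = _
      rw [cubeOf_ofCube]
    · intro t
      show H (ofCube t, ((1 : unitInterval) : ℝ)) = q t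
      rw [Set.Icc.coe_one, h1]
      show q (cubeOf (ofCube t)) = _
      rw [cubeOf_ofCube]
    · intro t x hx
      show H (ofCube x, (t : ℝ)) = p x
      rw [ho _ _ (ofCube_bdry hx)]
      show p (cubeOf (ofCube x)) = _
      rw [cubeOf_ofCube]

lemma homotopic_const_iff (p : GenLoop ι Y bp) :
    GenLoop.Homotopic p GenLoop.const ↔ Null Set.univ bp (toTot p) := homotopic_iff p _

lemma algebra_z {G : Type*} [Group G] (R : G → ℤ → Prop) (h1 : ∀ a, ∃ n, R a n) (h2 : ∀ n, ∃ a, R a n)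
    (h3 : ∀ a b n m, R a n → R b m → R (a * b) (n + m)) (h4 : ∀ a n, R a n → (n = 0 ↔ a = 1)) :
    Nonempty (G ≃* Multiplicative ℤ) := by
  choose φ hφ using h1
  have uniq : ∀ a n, R a n → n = φ a := by
    intro a n h
    have e1 := (h4 _ _ (h3 a a⁻¹ _ _ h (hφ a⁻¹))).2 (mul_inv_cancel a)
    have e2 := (h4 _ _ (h3 a a⁻¹ _ _ (hφ a) (hφ a⁻¹))).2 (mul_inv_cancel a)
    omega
  have hmul : ∀ a b, φ (a * b) = φ a + φ b := fun a b => (uniq _ _ (h3 _ _ _ _ (hφ a) (hφ b))).symm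
  let f : G →* Multiplicative ℤ :=
    { toFun := fun a => Multiplicative.ofAdd (φ a)
      map_one' := by
        have := (h4 1 _ (hφ 1)).2 rfl
        simp [this]
      map_mul' := fun a b => by simp [hmul] }
  refine ⟨MulEquiv.ofBijective f ⟨?_, ?_⟩⟩
  · rw [injective_iff_map_eq_one]
    intro a ha
    refine (h4 a _ (hφ a)).1 ?_
    simpa [f] using ha
  · intro n
    obtain ⟨a, ha⟩ := h2 (Multiplicative.toAdd n)
    refine ⟨a, ?_⟩
    show Multiplicative.ofAdd (φ a) = n
    rw [← uniq _ _ ha]; rfl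

theorem HasZ.group [DecidableEq ι] [Nonempty ι] {i : ι} (h : HasZ ι i Set.univ bp) :
    Nonempty (HomotopyGroup ι Y bp ≃* Multiplicative ℤ) := by
  obtain ⟨R, r1, r2, r3, r4⟩ := h
  refine algebra_z (fun a n => ∃ p : GenLoop ι Y bp, (Quotient.mk _ p : HomotopyGroup ι Y bp) = a ∧ R (toTot p) n)
    ?_ ?_ ?_ ?_
  · intro a
    obtain ⟨p, rfl⟩ := Quotient.exists_rep a
    obtain ⟨n, hn⟩ := r1 _ (toTot_loop p)
    exact ⟨n, p, rfl, hn⟩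
  · intro n
    obtain ⟨f, hf, hn⟩ := r2 n
    obtain ⟨p, rfl⟩ := exists_toTot hf
    exact ⟨_, p, rfl, hn⟩
  · rintro _ _ n m ⟨p, rfl, hp⟩ ⟨q, rfl, hq⟩
    refine ⟨GenLoop.transAt i q p, HomotopyGroup.mul_spec.symm, ?_⟩
    rw [toTot_trans, add_comm]
    exact r3 _ _ _ _ (toTot_loop q) (toTot_loop p) hq hp
  · rintro _ n ⟨p, rfl, hp⟩
    rw [r4 _ _ (toTot_loop p) hp, ← homotopic_const_iff, HomotopyGroup.one_def]
    exact ⟨fun h => Quotient.sound h, fun h => Quotient.exact h⟩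

theorem Conn.group [DecidableEq ι] [Nonempty ι] (h : Conn ι Set.univ {bp}) (a : HomotopyGroup ι Y bp) :
    a = 1 := by
  obtain ⟨p, rfl⟩ := Quotient.exists_rep a
  rw [HomotopyGroup.one_def]
  exact Quotient.sound ((homotopic_const_iff p).2 (h.null (toTot_loop p)))

end
end HS

namespace HS

/-! ## The infinite symmetric product -/

section
variable {X : Type*}

/-- the multiset of entries of a tuple -/
def ms {ι : Type*} [Fintype ι] (x : ι → X) : Multiset X := Finset.univ.val.map x

lemma mem_ms {ι : Type*} [Fintype ι] {x : ι → X} {a : X} : a ∈ ms x ↔ ∃ i, x i = a := by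
  simp [ms]
lemma ms_map {ι X' : Type*} [Fintype ι] (φ : X → X') (x : ι → X) :
    (ms x).map φ = ms (fun i => φ (x i)) := by simp [ms, Function.comp_def]
lemma card_ms {ι : Type*} [Fintype ι] (x : ι → X) : (ms x).card = Fintype.card ι := by
  simp [ms]
lemma ms_sum {ι κ : Type*} [Fintype ι] [Fintype κ] (x : ι → X) (y : κ → X) :
    ms (Sum.elim x y) = ms x + ms y := by
  unfold ms
  rw [← Finset.univ_disjSum_univ, Finset.val_disjSum, Multiset.disjSum, Multiset.map_add,
    Multiset.map_map, Multiset.map_map]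
  rfl
lemma ms_equiv {ι κ : Type*} [Fintype ι] [Fintype κ] (e : ι ≃ κ) (y : κ → X) :
    ms (fun i => y (e i)) = ms y := by
  unfold ms
  have := Finset.map_univ_equiv e
  have h2 : (Finset.univ.map e.toEmbedding).val = (Finset.univ : Finset κ).val := by rw [this]
  rw [← h2, Finset.map_val, Multiset.map_map]; rfl
lemma ms_surj (s : Multiset X) : ∃ x : Fin s.card → X, ms x = s := by
  induction s using Quotient.inductionOn with
  | h l =>
    refine ⟨fun i => l.get i, ?_⟩
    show Multiset.map (fun i : Fin l.length => l.get i) Finset.univ.val = _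
    rw [Fin.univ_val_map]
    have := List.ofFn_get l
    exact congrArg _ this
lemma exists_perm_of_ms_eq {ι : Type*} [Fintype ι] {x y : ι → X} (h : ms x = ms y) :
    ∃ σ : Equiv.Perm ι, x ∘ σ = y := by
  classical
  obtain ⟨e, he⟩ : ∃ e : ι ≃ ι, ∀ i, x (e i) = y i := by
    have hc : ∀ a, Fintype.card {i // y i = a} = Fintype.card {i // x i = a} := by
      intro a
      have := congrArg (Multiset.count a) h
      unfold ms at this
      rw [Multiset.count_map, Multiset.count_map] at this
      rw [Fintype.card_subtype, Fintype.card_subtype]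
      simp only [Finset.card_def, Finset.filter_val]
      simp only [eq_comm (a := a)] at this
      exact this.symm
    let e : ι ≃ ι := (Equiv.sigmaFiberEquiv y).symm.trans
      ((Equiv.sigmaCongrRight fun a => Fintype.equivOfCardEq (hc a)).trans (Equiv.sigmaFiberEquiv x))
    refine ⟨e, fun i => ?_⟩
    exact (Fintype.equivOfCardEq (hc (y i)) ⟨i, rfl⟩).2
  exact ⟨e, funext he⟩

/-- multisets in `X` modulo the base point -/
def Z (X : Type*) (a0 : X) : Type _ := {s : Multiset X // a0 ∉ s}

variable {a0 : X}

open Classical in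
def mkZ (a0 : X) (s : Multiset X) : Z X a0 := ⟨s.filter (fun x => x ≠ a0), by simp⟩

lemma mkZ_val (ξ : Z X a0) : mkZ a0 ξ.1 = ξ := by
  apply Subtype.ext
  classical
  simp only [mkZ]
  rw [Multiset.filter_eq_self]
  intro a ha h; exact ξ.2 (h ▸ ha)

lemma mem_mkZ {s : Multiset X} {x : X} : x ∈ (mkZ a0 s).1 ↔ x ∈ s ∧ x ≠ a0 := by
  simp [mkZ]

lemma mkZ_add_congr {s s' t t' : Multiset X} (h : mkZ a0 s = mkZ a0 s') (h' : mkZ a0 t = mkZ a0 t') :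
    mkZ a0 (s + t) = mkZ a0 (s' + t') := by
  classical
  have h := congrArg Subtype.val h
  have h' := congrArg Subtype.val h'
  apply Subtype.ext
  simp only [mkZ] at h h' ⊢
  rw [Multiset.filter_add, Multiset.filter_add, h, h']

lemma mkZ_map {X' : Type*} {a0' : X'} {φ : X → X'} (h : φ a0 = a0') (s : Multiset X) :
    mkZ a0' ((mkZ a0 s).1.map φ) = mkZ a0' (s.map φ) := by
  classical
  apply Subtype.ext
  simp only [mkZ]
  induction s using Multiset.induction_on with
  | empty => simp
  | cons a s ih =>
    by_cases ha : a = a0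
    · subst ha; simp [h]; simpa using ih
    · rw [Multiset.filter_cons_of_pos (p := fun x => x ≠ a0) _ ha, Multiset.map_cons, Multiset.map_cons]
      by_cases hb : φ a = a0'
      · rw [Multiset.filter_cons_of_neg (p := fun x => x ≠ a0') _ (by simpa using hb), Multiset.filter_cons_of_neg (p := fun x => x ≠ a0') _ (by simpa using hb), ih]
      · rw [Multiset.filter_cons_of_pos (p := fun x => x ≠ a0') _ hb, Multiset.filter_cons_of_pos (p := fun x => x ≠ a0') _ hb, ih]

lemma mkZ_const {s : Multiset X} (h : ∀ x ∈ s, x = a0) : mkZ a0 s = mkZ a0 0 := by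
  classical
  apply Subtype.ext
  simp only [mkZ]
  rw [Multiset.filter_eq_nil.2 (by simpa using h)]; simp

lemma mkZ_map_congr {X' : Type*} {a0' : X'} {φ ψ : X → X'} {s : Multiset X} (h : ∀ x ∈ s, φ x = ψ x) :
    mkZ a0' (s.map φ) = mkZ a0' (s.map ψ) := by rw [Multiset.map_congr rfl h]

lemma mkZ_zero_val : (mkZ a0 0).1 = 0 := by simp [mkZ]
lemma mkZ_rep (s : Multiset X) : ∃ n, s = (mkZ a0 s).1 + Multiset.replicate n a0 := by
  classical
  refine ⟨s.count a0, ?_⟩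
  simp only [mkZ]
  rw [← Multiset.filter_eq' s a0, add_comm]
  exact (Multiset.filter_add_not (fun x => x = a0) s).symm

lemma mkZ_eq {s : Multiset X} (h : a0 ∉ s) : (mkZ a0 s).1 = s := by
  have := congrArg Subtype.val (mkZ_val (a0 := a0) ⟨s, h⟩); exact this

def nf (a0 : X) (x : Σ d : ℕ, Fin d → X) : Z X a0 := mkZ a0 (ms x.2)

variable [TopologicalSpace X]

instance : TopologicalSpace (Z X a0) := TopologicalSpace.coinduced (nf a0) inferInstance

lemma nf_surj : Function.Surjective (nf a0) := by
  intro ξ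
  obtain ⟨x, hx⟩ := ms_surj ξ.1
  exact ⟨⟨_, x⟩, by simp only [nf, hx, mkZ_val]⟩

lemma isQuotientMap_nf : Topology.IsQuotientMap (nf a0) := ⟨⟨rfl⟩, nf_surj⟩

lemma Z.isOpen_iff {U : Set (Z X a0)} :
    IsOpen U ↔ ∀ d, IsOpen {x : Fin d → X | mkZ a0 (ms x) ∈ U} := by
  rw [← isQuotientMap_nf.isOpen_preimage, isOpen_sigma_iff]; rfl
lemma Z.isClosed_iff {U : Set (Z X a0)} :
    IsClosed U ↔ ∀ d, IsClosed {x : Fin d → X | mkZ a0 (ms x) ∈ U} := by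
  rw [← isQuotientMap_nf.isClosed_preimage, isClosed_sigma_iff]; rfl

lemma continuous_mkZ {ι : Type*} [Fintype ι] : Continuous fun x : ι → X => mkZ a0 (ms x) := by
  have e := Fintype.equivFin ι
  have h1 : Continuous fun y : Fin (Fintype.card ι) → X => mkZ a0 (ms y) :=
    isQuotientMap_nf.continuous.comp continuous_sigmaMk
  have h2 : (fun x : ι → X => mkZ a0 (ms x)) = (fun y : Fin (Fintype.card ι) → X => mkZ a0 (ms y)) ∘
      fun x j => x (e.symm j) := by
    funext x
    simp only [Function.comp]; rw [ms_equiv e.symm x]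
  rw [h2]; exact h1.comp (by fun_prop)

lemma Z.continuous_iff {T : Type*} [TopologicalSpace T] {F : Z X a0 → T} :
    Continuous F ↔ ∀ d, Continuous fun x : Fin d → X => F (mkZ a0 (ms x)) := by
  rw [isQuotientMap_nf.continuous_iff, continuous_sigma_iff]; rfl

lemma Z.continuousOn_prod {P T : Type*} [TopologicalSpace P] [LocallyCompactSpace P] [TopologicalSpace T]
    {W : Set (Z X a0)} (hW : IsOpen W) {F : Z X a0 × P → T}
    (h : ∀ d, ContinuousOn (fun z : (Fin d → X) × P => F (mkZ a0 (ms z.1), z.2))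
      {z | mkZ a0 (ms z.1) ∈ W}) : ContinuousOn F (W ×ˢ Set.univ) := by
  have hW' : IsOpen (nf a0 ⁻¹' W) := hW.preimage isQuotientMap_nf.continuous
  have h1 : ContinuousOn (fun z : (Σ d : ℕ, Fin d → X) × P => F (nf a0 z.1, z.2))
      ((nf a0 ⁻¹' W) ×ˢ Set.univ) := by
    rintro ⟨⟨d, x⟩, p⟩ ⟨hx, -⟩
    apply ContinuousAt.continuousWithinAt
    have hd : IsOpen {z : (Fin d → X) × P | mkZ a0 (ms z.1) ∈ W} :=
      hW.preimage (continuous_mkZ.comp continuous_fst)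
    have e : Topology.IsOpenEmbedding (fun z : (Fin d → X) × P => ((⟨d, z.1⟩ : Σ d : ℕ, Fin d → X), z.2)) :=
      Topology.IsOpenEmbedding.prodMap (f := fun x : Fin d → X => (⟨d, x⟩ : Σ d : ℕ, Fin d → X)) (g := fun p : P => p)
        (Topology.IsOpenEmbedding.sigmaMk (σ := fun d : ℕ => Fin d → X) (i := d)) Topology.IsOpenEmbedding.id
    have := (h d).continuousAt (hd.mem_nhds (show (x, p) ∈ _ from hx))
    exact (e.continuousAt_iff (x := (x, p))).1 this
  have hr := isQuotientMap_nf.restrictPreimage_isOpen hW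
  have h2 : Continuous (fun z : W × P => F (z.1, z.2)) := by
    refine hr.continuous_lift_prod_left (g := fun z : W × P => F (z.1, z.2)) ?_
    exact h1.comp_continuous (f := fun z : (nf a0 ⁻¹' W) × P => (z.1.1, z.2)) (by fun_prop)
      fun z => ⟨z.1.2, trivial⟩
  rw [continuousOn_iff_continuous_domRestrict]
  exact h2.comp (f := fun z : ↥(W ×ˢ (Set.univ : Set P)) => ((⟨z.1.1, z.2.1⟩ : W), z.1.2)) (by fun_prop)

def sup (O : Set X) : Set (Z X a0) := {ξ | ∀ x ∈ ξ.1, x ∈ O}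

lemma mem_sup_mk {O : Set X} (h0 : a0 ∈ O) {s : Multiset X} : mkZ a0 s ∈ sup O ↔ ∀ x ∈ s, x ∈ O := by
  simp only [sup, Set.mem_ofPred_eq, mem_mkZ]
  constructor
  · intro h x hx
    by_cases e : x = a0
    · rw [e]; exact h0
    · exact h x ⟨hx, e⟩
  · intro h x hx; exact h x hx.1

/-- the operation `ξ ↦ φ_* ξ + α` -/
def zop {X' : Type*} (a0' : X') {P ι : Type*} [Fintype ι] (φ : X × P → X') (α : P → ι → X')
    (z : Z X a0 × P) : Z X' a0' :=
  mkZ a0' (z.1.1.map (fun x => φ (x, z.2)) + ms (α z.2))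

lemma zop_mk {X' : Type*} {a0' : X'} {P ι : Type*} [Fintype ι] {φ : X × P → X'} {α : P → ι → X'}
    (s : Multiset X) (p : P) (h : φ (a0, p) = a0') :
    zop a0' φ α (mkZ a0 s, p) = mkZ a0' (s.map (fun x => φ (x, p)) + ms (α p)) :=
  mkZ_add_congr (mkZ_map (φ := fun x => φ (x, p)) h s) rfl

lemma isOpen_sup_and {O : Set X} (hO : IsOpen O) (h0 : a0 ∈ O) {K : Type*} (κ : X → K) 
    (hκ : ∀ k, IsOpen {x ∈ O | κ x = k}) (C : Multiset K → Prop)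
    (hC : ∀ s : Multiset X, C (s.map κ) ↔ C ((mkZ a0 s).1.map κ)) :
    IsOpen {ξ : Z X a0 | ξ ∈ sup O ∧ C (ξ.1.map κ)} := by
  rw [Z.isOpen_iff]
  intro d
  have : {x : Fin d → X | mkZ a0 (ms x) ∈ {ξ : Z X a0 | ξ ∈ sup O ∧ C (ξ.1.map κ)}} =
      ⋃ (k : Fin d → K) (_ : C (ms k)), {x : Fin d → X | ∀ i, x i ∈ O ∧ κ (x i) = k i} := by
    ext x
    simp only [Set.mem_ofPred_eq, mem_sup_mk h0, ← hC, ms_map, Set.mem_iUnion, mem_ms, exists_prop]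
    constructor
    · rintro ⟨h1, h2⟩
      exact ⟨_, h2, fun i => ⟨h1 _ ⟨i, rfl⟩, rfl⟩⟩
    · rintro ⟨k, h1, h2⟩
      refine ⟨?_, ?_⟩
      · rintro _ ⟨i, rfl⟩; exact (h2 i).1
      · convert h1 using 3 with i; exact (h2 i).2
  rw [this]
  refine isOpen_iUnion fun k => isOpen_iUnion fun _ => ?_
  rw [show {x : Fin d → X | ∀ i, x i ∈ O ∧ κ (x i) = k i} = ⋂ i, (fun x => x i) ⁻¹' {x ∈ O | κ x = k i} by
    ext; simp]
  exact isOpen_iInter_of_finite fun i => (hκ _).preimage (continuous_apply i)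

lemma isOpen_sup {O : Set X} (hO : IsOpen O) (h0 : a0 ∈ O) : IsOpen (sup O : Set (Z X a0)) := by
  have := isOpen_sup_and hO h0 (fun _ => ()) (fun k => by simpa using hO) (fun _ => True) (by simp)
  simpa using this

lemma isClosed_sup {O : Set X} (hO : IsClosed O) (h0 : a0 ∈ O) : IsClosed (sup O : Set (Z X a0)) := by
  rw [Z.isClosed_iff]
  intro d
  simp only [mem_sup_mk h0, mem_ms]
  have : {x : Fin d → X | ∀ y, (∃ i, x i = y) → y ∈ O} = ⋂ i, (fun x => x i) ⁻¹' O := by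
    ext; simp
  rw [this]; exact isClosed_iInter fun i => hO.preimage (continuous_apply i)

lemma zop_continuousOn {X' : Type*} [TopologicalSpace X'] {a0' : X'} {P ι : Type*} [Fintype ι]
    [TopologicalSpace P] [LocallyCompactSpace P] {O : Set X} (hO : IsOpen O) (h0 : a0 ∈ O)
    {φ : X × P → X'} (hφ : ContinuousOn φ (O ×ˢ Set.univ)) (hφ0 : ∀ p, φ (a0, p) = a0')
    {α : P → ι → X'} (hα : Continuous α) :
    ContinuousOn (zop a0' φ α : Z X a0 × P → Z X' a0') (sup O ×ˢ Set.univ) := by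
  refine Z.continuousOn_prod (isOpen_sup hO h0) fun d => ?_
  have e : (fun z : (Fin d → X) × P => zop a0' φ α (mkZ a0 (ms z.1), z.2)) =
      fun z => mkZ a0' (ms (Sum.elim (fun i => φ (z.1 i, z.2)) (α z.2))) := by
    funext z
    rw [zop_mk _ _ (hφ0 _), ms_sum, ms_map]
  rw [e]
  refine continuous_mkZ.comp_continuousOn (continuousOn_pi.2 fun i => ?_)
  cases i with
  | inl i =>
    simp only [Sum.elim_inl]
    refine hφ.comp (by fun_prop) ?_
    intro z hz
    simp only [Set.mem_ofPred_eq, mem_sup_mk h0, mem_ms] at hz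
    exact ⟨hz _ ⟨i, rfl⟩, trivial⟩
  | inr i => simp only [Sum.elim_inr]; fun_prop

/-- functoriality -/
def zmap {X' : Type*} {a0' : X'} (f : X → X') (ξ : Z X a0) : Z X' a0' := mkZ a0' (ξ.1.map f)

lemma zmap_mk {X' : Type*} {a0' : X'} {f : X → X'} (h : f a0 = a0') (s : Multiset X) :
    zmap (a0' := a0') f (mkZ a0 s) = mkZ a0' (s.map f) := mkZ_map h s

lemma continuous_zmap {X' : Type*} [TopologicalSpace X'] {a0' : X'} {f : X → X'} (hf : Continuous f)
    (h : f a0 = a0') : Continuous (zmap f : Z X a0 → Z X' a0') := by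
  rw [Z.continuous_iff]
  intro d
  simp only [zmap_mk h, ms_map]
  exact continuous_mkZ.comp (by fun_prop)

lemma zmap_injective {X' : Type*} {a0' : X'} {f : X → X'} (hf : Function.Injective f)
    (h : f a0 = a0') : Function.Injective (zmap f : Z X a0 → Z X' a0') := by
  intro ξ η e
  have e := congrArg Subtype.val e
  have k : ∀ ξ : Z X a0, (zmap (a0' := a0') f ξ).1 = ξ.1.map f := by
    intro ξ
    apply mkZ_eq
    rw [Multiset.mem_map]
    rintro ⟨x, hx, e⟩
    rw [← h] at e
    exact ξ.2 (hf e ▸ hx)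
  rw [k, k] at e
  exact Subtype.ext (Multiset.map_injective hf e)

lemma zmap_closedEmbedding {X' : Type*} [TopologicalSpace X'] {a0' : X'} {f : X → X'}
    (hf : Topology.IsClosedEmbedding f)
    (h : f a0 = a0') : Topology.IsClosedEmbedding (zmap f : Z X a0 → Z X' a0') := by
  refine .of_continuous_injective_isClosedMap (continuous_zmap hf.continuous h)
    (zmap_injective hf.injective h) ?_
  intro C hC
  rw [Z.isClosed_iff]
  intro d
  have e : {x : Fin d → X' | mkZ a0' (ms x) ∈ (zmap f : Z X a0 → Z X' a0') '' C} =
      (fun y : Fin d → X => fun i => f (y i)) '' {y : Fin d → X | mkZ a0 (ms y) ∈ C} := by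
    ext x
    constructor
    · rintro ⟨ξ, hξ, e⟩
      have : ∀ i, ∃ y, f y = x i := by
        intro i
        by_cases hi : x i = a0'
        · exact ⟨a0, by rw [hi, h]⟩
        · have : x i ∈ (mkZ a0' (ms x)).1 := mem_mkZ.2 ⟨mem_ms.2 ⟨i, rfl⟩, hi⟩
          rw [← e] at this
          have := (mem_mkZ.1 this).1
          obtain ⟨y, -, hy⟩ := Multiset.mem_map.1 this
          exact ⟨y, hy⟩
      choose y hy using this
      refine ⟨y, ?_, funext hy⟩
      have e2 : zmap (a0' := a0') f (mkZ a0 (ms y)) = zmap f ξ := by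
        rw [zmap_mk h, ms_map, e]
        congr 2
        exact funext hy
      show mkZ a0 (ms y) ∈ C
      rw [zmap_injective hf.injective h e2]; exact hξ
    · rintro ⟨y, hy, rfl⟩
      refine ⟨_, hy, ?_⟩
      rw [zmap_mk h, ms_map]
  rw [e]
  have := Topology.IsClosedEmbedding.piMap (fun _ : Fin d => hf)
  exact this.isClosedMap _ (hC.preimage continuous_mkZ)

lemma zmap_range {X' : Type*} {a0' : X'} {f : X → X'} (h : f a0 = a0') :
    Set.range (zmap f : Z X a0 → Z X' a0') = sup (Set.range f) := by
  ext ξ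
  constructor
  · rintro ⟨η, rfl⟩ x hx
    obtain ⟨y, -, hy⟩ := Multiset.mem_map.1 (mem_mkZ.1 hx).1
    exact ⟨y, hy⟩
  · intro hξ
    have : Nonempty X := ⟨a0⟩
    choose! g hg using hξ
    refine ⟨mkZ a0 (ξ.1.map g), ?_⟩
    rw [zmap_mk h, Multiset.map_map]
    rw [Multiset.map_congr rfl (f := f ∘ g) (g := id) (fun x hx => hg x hx), Multiset.map_id, mkZ_val]

lemma isClosed_card [T1Space X] (d : ℕ) : IsClosed {ξ : Z X a0 | ξ.1.card ≤ d} := by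
  classical
  rw [Z.isClosed_iff]
  intro e
  have : {x : Fin e → X | mkZ a0 (ms x) ∈ {ξ : Z X a0 | ξ.1.card ≤ d}} =
      ⋃ (S : Finset (Fin e)) (_ : S.card ≤ d), {x | ∀ i ∉ S, x i = a0} := by
    ext x
    simp only [Set.mem_ofPred_eq, Set.mem_iUnion, exists_prop]
    have hcard : (mkZ a0 (ms x)).1.card = (Finset.univ.filter fun i => x i ≠ a0).card := by
      simp only [mkZ, ms, Multiset.filter_map, Multiset.card_map]
      rfl
    rw [hcard]
    constructor
    · intro h
      exact ⟨_, h, fun i hi => by simpa using hi⟩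
    · rintro ⟨S, hS, h⟩
      refine (Finset.card_le_card ?_).trans hS
      intro i hi
      by_contra h'
      exact (Finset.mem_filter.1 hi).2 (h i h')
  rw [this]
  refine isClosed_iUnion_of_finite fun S => isClosed_iUnion_of_finite fun _ => ?_
  simp only [Set.ofPred_forall]
  exact isClosed_iInter fun i => isClosed_iInter fun _ =>
    isClosed_singleton.preimage (continuous_apply i)
end
end HS

namespace HS

/-! ## Neighbourhoods in the infinite symmetric product of a sphere -/

open OnePoint

section
variable {V : Type*} [NormedAddCommGroup V] [NormedSpace ℝ V]

def far (r : ℝ) : Set (OnePoint V) := {p | ∀ v : V, p = ↑v → r < ‖v‖}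

def dd (p : OnePoint V) : V := Option.getD p 0

lemma dd_coe (v : V) : dd (v : OnePoint V) = v := rfl

lemma coe_dd {p : OnePoint V} (h : p ≠ ∞) : ((dd p : V) : OnePoint V) = p := by
  induction p using OnePoint.rec with
  | infty => exact absurd rfl h
  | coe v => rfl

lemma continuousAt_dd {p : OnePoint V} (h : p ≠ ∞) : ContinuousAt (dd : OnePoint V → V) p := by
  induction p using OnePoint.rec with
  | infty => exact absurd rfl h
  | coe v =>
    rw [OnePoint.continuousAt_coe]
    exact continuousAt_id

lemma isOpen_far [ProperSpace V] (r : ℝ) : IsOpen (far r : Set (OnePoint V)) := by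
  have : (far r : Set (OnePoint V)) = ((fun v : V => (v : OnePoint V)) '' Metric.closedBall 0 r)ᶜ := by
    ext p
    simp only [far, Set.mem_ofPred_eq, Set.mem_compl_iff, Set.mem_image, mem_closedBall_zero_iff, not_exists, not_and]
    constructor
    · intro h v hv e; exact absurd (h v e.symm) (by linarith)
    · intro h v e; by_contra h'; exact h v (by linarith) e.symm
  rw [this, OnePoint.isOpen_compl_image_coe]
  exact ⟨Metric.isClosed_closedBall, isCompact_closedBall _ _⟩

/-- a neighbourhood datum -/
structure Nbd (N : Set (OnePoint V)) (κ : OnePoint V → OnePoint V) : Prop where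
  op : ∀ k, IsOpen {p | p ∈ N ∧ κ p = k}
  inf : ∃ r : ℝ, 0 ≤ r ∧ ∀ p, (p ∈ N ∧ κ p = ∞) ↔ p ∈ far r
  fin : ∀ p (v : V), p ∈ N → κ p = v → p ≠ ∞ ∧ ∀ t ∈ Set.Icc (0:ℝ) 1,
    ((dd p + t • (v - dd p) : V) : OnePoint V) ∈ N ∧ κ ((dd p + t • (v - dd p) : V) : OnePoint V) = v

lemma Nbd.isOpen {N : Set (OnePoint V)} {κ} (h : Nbd N κ) : IsOpen N := by
  have : N = ⋃ k, {p | p ∈ N ∧ κ p = k} := by ext; simp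
  rw [this]; exact isOpen_iUnion h.op

lemma Nbd.infty {N : Set (OnePoint V)} {κ} (h : Nbd N κ) : ∞ ∈ N ∧ κ ∞ = ∞ := by
  obtain ⟨r, -, hr⟩ := h.inf
  exact (hr ∞).2 fun v e => absurd e.symm (OnePoint.coe_ne_infty v)

lemma Nbd.idem {N : Set (OnePoint V)} {κ} (h : Nbd N κ) {p} (hp : p ∈ N) : κ p ∈ N ∧ κ (κ p) = κ p := by
  by_cases e : κ p = ∞
  · rw [e]; exact h.infty
  · have e2 := coe_dd e
    have := (h.fin p (dd (κ p)) hp e2.symm).2 1 (by simp)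
    simp only [one_smul, add_sub_cancel, e2] at this
    exact this

lemma exists_far {G : Set (OnePoint V)} (hG : G ∈ 𝓝 (∞ : OnePoint V)) [ProperSpace V] :
    ∃ r : ℝ, 0 ≤ r ∧ far r ⊆ G := by
  have h1 := OnePoint.tendsto_coe_infty (X := V) hG
  rw [Filter.coclosedCompact_eq_cocompact, ← Metric.cobounded_eq_cocompact, Filter.mem_map,
    (Filter.hasBasis_cobounded_norm (E := V)).mem_iff] at h1
  obtain ⟨r, -, hr⟩ := h1
  refine ⟨max r 0, le_max_right _ _, ?_⟩
  intro p hp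
  induction p using OnePoint.rec with
  | infty => exact mem_of_mem_nhds hG
  | coe v => exact hr (show r ≤ ‖v‖ from (le_max_left _ _).trans (hp v rfl).le)

lemma Nbd.exists_small [ProperSpace V] (b : Z (OnePoint V) ∞) (G : OnePoint V → Set (OnePoint V))
    (hG : ∀ p, G p ∈ 𝓝 p) :
    ∃ N κ, Nbd N κ ∧ (∀ p ∈ b.1, p ∈ N ∧ κ p = p) ∧ ∀ p ∈ N, p ∈ G (κ p) := by
  classical
  set S : Finset V := (b.1.map dd).toFinset with hSd
  have hS : ∀ v : V, v ∈ S ↔ (v : OnePoint V) ∈ b.1 := by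
    intro v
    rw [hSd, Multiset.mem_toFinset, Multiset.mem_map]
    constructor
    · rintro ⟨p, hp, rfl⟩; rw [coe_dd]; exact hp; rintro rfl; exact b.2 hp
    · intro h; exact ⟨_, h, rfl⟩
  obtain ⟨r0, hr0, hfar⟩ := exists_far (hG ∞)
  obtain ⟨r, hr, hrS⟩ : ∃ r, r0 ≤ r ∧ ∀ v ∈ S, ‖v‖ + 1 ≤ r := by
    refine ⟨r0 + ∑ v ∈ S, (‖v‖ + 1), ?_, ?_⟩
    · have : 0 ≤ ∑ v ∈ S, (‖v‖ + 1) := Finset.sum_nonneg fun v _ => by positivity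
      linarith
    · intro v hv
      have := Finset.single_le_sum (f := fun v : V => ‖v‖ + 1) (fun v _ => by positivity) hv
      linarith
  have hev : ∀ᶠ ε in 𝓝[>] (0:ℝ), ∀ v ∈ S, (∀ w ∈ Metric.ball v ε, (w : OnePoint V) ∈ G v) ∧ ε ≤ 1 ∧
      ∀ v' ∈ S, v ≠ v' → 2 * ε ≤ dist v v' := by
    rw [Filter.eventually_all_finset]
    intro v hv
    refine Filter.Eventually.and ?_ (Filter.Eventually.and ?_ ?_)
    · have : (fun w : V => (w : OnePoint V)) ⁻¹' G v ∈ 𝓝 v :=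
        OnePoint.continuous_coe.continuousAt (hG v)
      obtain ⟨e, he, h⟩ := Metric.mem_nhds_iff.1 this
      filter_upwards [Ioc_mem_nhdsGT he] with ε hε w hw
      exact h (Metric.ball_subset_ball hε.2 hw)
    · filter_upwards [Ioc_mem_nhdsGT (zero_lt_one' ℝ)] with ε hε using hε.2
    · rw [Filter.eventually_all_finset]
      intro v' hv'
      by_cases e : v = v'
      · simp [e]
      · have : 0 < dist v v' / 2 := by have := dist_pos.2 e; linarith
        filter_upwards [Ioc_mem_nhdsGT this] with ε hε _
        have := hε.2; linarith
  obtain ⟨ε, hε, hε0⟩ := (hev.and self_mem_nhdsWithin).exists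
  have hε0 : 0 < ε := hε0
  let κ : OnePoint V → OnePoint V := fun p =>
    if h : ∃ v ∈ S, ∃ w ∈ Metric.ball v ε, p = (w : OnePoint V) then ((h.choose : V) : OnePoint V) else ∞
  have k1 : ∀ v ∈ S, ∀ w ∈ Metric.ball v ε, κ w = v := by
    intro v hv w hw
    have h : ∃ v ∈ S, ∃ w' ∈ Metric.ball v ε, (w : OnePoint V) = (w' : OnePoint V) := ⟨v, hv, w, hw, rfl⟩
    have e1 : κ w = ((h.choose : V) : OnePoint V) := dif_pos h
    obtain ⟨h1, w', h2, h3⟩ := h.choose_spec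
    rw [e1]
    rw [OnePoint.coe_eq_coe] at h3
    subst h3
    by_contra h4
    have h5 := (hε v hv).2.2 _ h1 (fun e => h4 (by rw [← e]))
    have h6 : dist v h.choose ≤ dist v w + dist w h.choose := dist_triangle _ _ _
    rw [dist_comm v w] at h6
    have := Metric.mem_ball.1 hw
    have := Metric.mem_ball.1 h2
    linarith
  have k2 : ∀ p ∈ far r, κ p = ∞ := by
    intro p hp
    refine dif_neg ?_
    rintro ⟨v, hv, w, hw, rfl⟩
    have h1 := hp w rfl
    have h2 := hrS v hv
    have h3 := (hε v hv).2.1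
    have h4 := Metric.mem_ball.1 hw
    have h5 : ‖w‖ ≤ ‖v‖ + dist w v := by
      rw [dist_eq_norm]; have := norm_add_le v (w - v); simpa using this
    linarith
  have k3 : ∀ v : V, v ∈ S → (v : OnePoint V) ∈ b.1 := fun v h => (hS v).1 h
  let N : Set (OnePoint V) := {p | p ∈ far r ∨ ∃ v ∈ S, ∃ w ∈ Metric.ball v ε, p = (w : OnePoint V)}
  have hNb : ∀ v ∈ S, ∀ w ∈ Metric.ball v ε, (w : OnePoint V) ∈ N := fun v hv w hw => Or.inr ⟨v, hv, w, hw, rfl⟩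
  have kinf : ∀ p, (p ∈ N ∧ κ p = ∞) ↔ p ∈ far r := by
    intro p
    constructor
    · rintro ⟨h | ⟨v, hv, w, hw, rfl⟩, h'⟩
      · exact h
      · rw [k1 v hv w hw] at h'; exact absurd h' (OnePoint.coe_ne_infty _)
    · intro h; exact ⟨Or.inl h, k2 p h⟩
  have kfin : ∀ p (v : V), (p ∈ N ∧ κ p = v) → v ∈ S ∧ ∃ w ∈ Metric.ball v ε, p = (w : OnePoint V) := by
    rintro p v ⟨h | ⟨v', hv', w, hw, rfl⟩, h'⟩
    · rw [k2 p h] at h'; exact absurd h'.symm (OnePoint.coe_ne_infty _)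
    · rw [k1 v' hv' w hw, OnePoint.coe_eq_coe] at h'
      subst h'
      exact ⟨hv', w, hw, rfl⟩
  refine ⟨N, κ, ⟨?_, ⟨r, hr0.trans hr, kinf⟩, ?_⟩, ?_, ?_⟩
  · intro k
    induction k using OnePoint.rec with
    | infty => 
      have : {p | p ∈ N ∧ κ p = ∞} = far r := Set.ext kinf
      rw [this]; exact isOpen_far r
    | coe v =>
      by_cases hv : v ∈ S
      · have : {p | p ∈ N ∧ κ p = v} = (fun w : V => (w : OnePoint V)) '' Metric.ball v ε := by
          ext p
          constructor
          · intro h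
            obtain ⟨-, w, hw, rfl⟩ := kfin p v h
            exact ⟨w, hw, rfl⟩
          · rintro ⟨w, hw, rfl⟩
            exact ⟨hNb v hv w hw, k1 v hv w hw⟩
        rw [this, OnePoint.isOpen_image_coe]
        exact Metric.isOpen_ball
      · have : {p | p ∈ N ∧ κ p = v} = ∅ := by
          ext p
          simp only [Set.mem_empty_iff_false, iff_false]
          intro h; exact hv (kfin p v h).1
        rw [this]; exact isOpen_empty
  · intro p v hp hk
    obtain ⟨hv, w, hw, rfl⟩ := kfin p v ⟨hp, hk⟩
    refine ⟨OnePoint.coe_ne_infty _, fun t ht => ?_⟩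
    have : w + t • (v - w) ∈ Metric.ball v ε := by
      have hc := (convex_ball v ε) hw (Metric.mem_ball_self hε0) (a := 1 - t) (b := t) (by linarith [ht.2]) ht.1 (by ring)
      convert hc using 1
      rw [smul_sub, sub_smul, one_smul]; abel
    rw [dd_coe]
    exact ⟨hNb v hv _ this, k1 v hv _ this⟩
  · intro p hp
    have hne : p ≠ ∞ := fun e => b.2 (e ▸ hp)
    have e := coe_dd hne
    have h1 : dd p ∈ S := by rw [hS, e]; exact hp
    rw [← e]
    exact ⟨hNb _ h1 _ (Metric.mem_ball_self hε0), k1 _ h1 _ (Metric.mem_ball_self hε0)⟩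
  · rintro p (h | ⟨v, hv, w, hw, rfl⟩)
    · rw [k2 p h]
      exact hfar fun v hv => lt_of_le_of_lt hr (h v hv)
    · rw [k1 v hv w hw]
      exact (hε v hv).1 w hw

/-- basic open set -/
def UU (N : Set (OnePoint V)) (κ : OnePoint V → OnePoint V) (c : Z (OnePoint V) ∞) :
    Set (Z (OnePoint V) ∞) := {ξ | ξ ∈ sup N ∧ zmap κ ξ = c}

def BB (V : Type*) [NormedAddCommGroup V] [NormedSpace ℝ V] : Set (Set (Z (OnePoint V) ∞)) :=
  {U | ∃ N κ c, Nbd N κ ∧ c ∈ UU N κ c ∧ U = UU N κ c}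

lemma isOpen_UU {N : Set (OnePoint V)} {κ} (h : Nbd N κ) (c : Z (OnePoint V) ∞) : IsOpen (UU N κ c) := by
  refine isOpen_sup_and h.isOpen h.infty.1 κ h.op (fun s => mkZ ∞ s = c) ?_
  intro s
  rw [mkZ_map h.infty.2]

lemma mem_UU_self {N : Set (OnePoint V)} {κ} {b : Z (OnePoint V) ∞}
    (h : ∀ p ∈ b.1, p ∈ N ∧ κ p = p) : b ∈ UU N κ b := by
  refine ⟨fun p hp => (h p hp).1, ?_⟩
  unfold zmap
  rw [Multiset.map_congr rfl (f := κ) (g := id) (fun x hx => (h x hx).2), Multiset.map_id, mkZ_val]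

lemma Fam_BB [ProperSpace V] : Fam (BB V) := by
  refine ⟨?_, ?_, ?_⟩
  · rintro U ⟨N, κ, c, h, -, rfl⟩; exact isOpen_UU h c
  · intro b
    obtain ⟨N, κ, h, h1, -⟩ := Nbd.exists_small b (fun _ => Set.univ) (fun _ => Filter.univ_mem)
    exact ⟨_, ⟨N, κ, b, h, mem_UU_self h1, rfl⟩, mem_UU_self h1⟩
  · rintro U ⟨N1, κ1, c1, h1, -, rfl⟩ U2 ⟨N2, κ2, c2, h2, -, rfl⟩ b hb1 hb2
    obtain ⟨N, κ, h, hb, hG⟩ := Nbd.exists_small b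
      (fun p => {p' | (p ∈ N1 → p' ∈ N1 ∧ κ1 p' = κ1 p) ∧ (p ∈ N2 → p' ∈ N2 ∧ κ2 p' = κ2 p)}) (by
        intro p
        refine Filter.Eventually.and ?_ ?_
        · by_cases hp : p ∈ N1
          · filter_upwards [(h1.op (κ1 p)).mem_nhds ⟨hp, rfl⟩] with p' hp' _ using hp'
          · filter_upwards with p' hp' using absurd hp' hp
        · by_cases hp : p ∈ N2
          · filter_upwards [(h2.op (κ2 p)).mem_nhds ⟨hp, rfl⟩] with p' hp' _ using hp'
          · filter_upwards with p' hp' using absurd hp' hp)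
    have key : ∀ ξ ∈ UU N κ b, ∀ p ∈ ξ.1, κ p ∈ b.1 ∨ κ p = ∞ := by
      rintro ξ ⟨h3, h4⟩ p hp
      by_cases e : κ p = ∞
      · exact Or.inr e
      · left
        rw [← h4]
        exact mem_mkZ.2 ⟨Multiset.mem_map_of_mem _ hp, e⟩
    have aux : ∀ (N1 : Set (OnePoint V)) (κ1 : OnePoint V → OnePoint V) (c1 : Z (OnePoint V) ∞), Nbd N1 κ1 → b ∈ UU N1 κ1 c1 →
        (∀ p ∈ N, κ p ∈ N1 → p ∈ N1 ∧ κ1 p = κ1 (κ p)) → UU N κ b ⊆ UU N1 κ1 c1 := by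
      intro N1 κ1 c1 h1 hb1 hG ξ hξ
      have hN1 : ∀ p ∈ ξ.1, κ p ∈ N1 := by
        intro p hp
        rcases key ξ hξ p hp with h | h
        · exact hb1.1 _ h
        · rw [h]; exact h1.infty.1
      refine ⟨fun p hp => (hG p (hξ.1 p hp) (hN1 p hp)).1, ?_⟩
      have e1 : zmap (a0' := ∞) κ1 ξ = zmap κ1 (zmap κ ξ : Z (OnePoint V) ∞) := by
        unfold zmap
        rw [mkZ_map h1.infty.2, Multiset.map_map]
        exact mkZ_map_congr fun p hp => (hG p (hξ.1 p hp) (hN1 p hp)).2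
      rw [e1, hξ.2, hb1.2]
    exact ⟨_, ⟨N, κ, b, h, mem_UU_self hb, rfl⟩, mem_UU_self hb,
      aux _ _ _ h1 hb1 fun p hp hp1 => (hG p hp).1 hp1, aux _ _ _ h2 hb2 fun p hp hp1 => (hG p hp).2 hp1⟩

end
end HS

namespace HS

/-! ## Collapses induce quasifibrations -/

open OnePoint

lemma mkZ_pair {X X' : Type*} {a0 : X'} (s : Multiset X) {f g f' g' : X → X'}
    (h : ∀ x ∈ s, mkZ a0 ({f x} + {g x}) = mkZ a0 ({f' x} + {g' x})) :
    mkZ a0 (s.map f + s.map g) = mkZ a0 (s.map f' + s.map g') := by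
  induction s using Multiset.induction_on with
  | empty => simp
  | cons a s ih =>
    have e : ∀ f g : X → X', (a ::ₘ s).map f + (a ::ₘ s).map g = ({f a} + {g a}) + (s.map f + s.map g) := by
      intro f g
      rw [Multiset.map_cons, Multiset.map_cons, ← Multiset.singleton_add, ← Multiset.singleton_add]
      abel
    rw [e, e]
    exact mkZ_add_congr (h a (Multiset.mem_cons_self _ _)) (ih fun x hx => h x (Multiset.mem_cons_of_mem hx))

lemma mkZ_add_base {X : Type*} {a0 : X} (s : Multiset X) : mkZ a0 (s + {a0}) = mkZ a0 s := by
  classical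
  apply Subtype.ext
  simp only [mkZ]
  rw [Multiset.filter_add]; simp
lemma mkZ_base_add {X : Type*} {a0 : X} (s : Multiset X) : mkZ a0 ({a0} + s) = mkZ a0 s := by
  rw [add_comm, mkZ_add_base]

lemma mkZ_add_const {X X' : Type*} {a0 : X'} (s : Multiset X') (t : Multiset X) :
    mkZ a0 (s + t.map (fun _ => a0)) = mkZ a0 s := by
  have : mkZ a0 (s + t.map (fun _ => a0)) = mkZ a0 (s + 0) :=
    mkZ_add_congr rfl (mkZ_const fun x hx => by obtain ⟨_, _, rfl⟩ := Multiset.mem_map.1 hx; rfl)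
  simpa using this

section
variable {V : Type*} [NormedAddCommGroup V] [NormedSpace ℝ V]
variable {X : Type*} [TopologicalSpace X]

structure Collapse (a0 : X) (q0 : X → OnePoint V) (j : V → X) (Ψ : X × ℝ → X) : Prop where
  cont_q : Continuous q0
  q_a0 : q0 a0 = ∞
  cont_j : Continuous j
  q_j : ∀ v, q0 (j v) = v
  j_q : ∀ x (v : V), q0 x = v → j v = x
  cont_Ψ : ContinuousOn Ψ ({x | q0 x ≠ ((0 : V) : OnePoint V)} ×ˢ Set.Icc 0 1)
  Ψ0 : ∀ x, q0 x ≠ ((0 : V) : OnePoint V) → Ψ (x, 0) = x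
  Ψinf : ∀ x, q0 x = ∞ → ∀ t ∈ Set.Icc (0:ℝ) 1, Ψ (x, t) = x
  Ψ1 : ∀ x, q0 x ≠ ((0 : V) : OnePoint V) → q0 (Ψ (x, 1)) = ∞
  mono : ∀ x r, 0 ≤ r → q0 x ∈ far r → ∀ t ∈ Set.Icc (0:ℝ) 1, q0 (Ψ (x, t)) ∈ far r
  path : ∀ a, q0 a = ∞ → ∃ γ : ℝ → X, Continuous γ ∧ γ 0 = a0 ∧ γ 1 = a ∧ ∀ t, q0 (γ t) = ∞

open Classical in
/-- the local contraction of a neighbourhood -/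
def phi (q0 : X → OnePoint V) (j : V → X) (Ψ : X × ℝ → X) (κ : OnePoint V → OnePoint V) (z : X × ℝ) : X :=
  if κ (q0 z.1) = ∞ then Ψ (z.1, cl01 z.2)
  else j (dd (q0 z.1) + cl01 z.2 • (dd (κ (q0 z.1)) - dd (q0 z.1)))

open Classical in
def rho (a0 : X) (q0 : X → OnePoint V) (Ψ : X × ℝ → X) (κ : OnePoint V → OnePoint V) (x : X) : X :=
  if κ (q0 x) = ∞ then Ψ (x, 1) else a0

variable {a0 : X} {q0 : X → OnePoint V} {j : V → X} {Ψ : X × ℝ → X}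
  {N : Set (OnePoint V)} {κ : OnePoint V → OnePoint V}

lemma far_ne_zero {r : ℝ} (hr : 0 ≤ r) {p : OnePoint V} (h : p ∈ far r) : p ≠ ((0 : V) : OnePoint V) := by
  intro e; have := h 0 e; rw [norm_zero] at this; linarith

lemma Nbd.ne_zero (h : Nbd N κ) {p} (hp : p ∈ N) (hk : κ p = ∞) : p ≠ ((0 : V) : OnePoint V) := by
  obtain ⟨r, hr, h⟩ := h.inf
  exact far_ne_zero hr ((h p).1 ⟨hp, hk⟩)

lemma cl01_mem (t : ℝ) : cl01 t ∈ Set.Icc (0:ℝ) 1 := ⟨cl01_nonneg t, cl01_le t⟩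

lemma Collapse.phi_mem (hC : Collapse a0 q0 j Ψ) (h : Nbd N κ) {x : X} (hx : q0 x ∈ N) (t : ℝ) :
    q0 (phi q0 j Ψ κ (x, t)) ∈ N ∧ κ (q0 (phi q0 j Ψ κ (x, t))) = κ (q0 x) := by
  unfold phi
  by_cases hk : κ (q0 x) = ∞
  · simp only [if_pos hk]
    obtain ⟨r, hr, hi⟩ := h.inf
    rw [hk]
    exact (hi _).2 (hC.mono x r hr ((hi _).1 ⟨hx, hk⟩) _ (cl01_mem t))
  · simp only [if_neg hk]
    rw [hC.q_j]
    have := (h.fin _ (dd (κ (q0 x))) hx (coe_dd hk).symm).2 (cl01 t) (cl01_mem t)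
    refine ⟨this.1, this.2.trans (coe_dd hk)⟩

lemma Collapse.phi_zero (hC : Collapse a0 q0 j Ψ) (h : Nbd N κ) {x : X} (hx : q0 x ∈ N) :
    phi q0 j Ψ κ (x, 0) = x := by
  unfold phi
  by_cases hk : κ (q0 x) = ∞
  · simp only [if_pos hk, cl01_zero]
    exact hC.Ψ0 _ (h.ne_zero hx hk)
  · simp only [if_neg hk, cl01_zero, zero_smul, add_zero]
    refine hC.j_q _ _ (coe_dd ?_).symm
    exact (h.fin _ (dd (κ (q0 x))) hx (coe_dd hk).symm).1

lemma Collapse.phi_inf (hC : Collapse a0 q0 j Ψ) (h : Nbd N κ) {x : X} (hx : q0 x = ∞) (t : ℝ) :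
    phi q0 j Ψ κ (x, t) = x := by
  have : κ (q0 x) = ∞ := by rw [hx]; exact h.infty.2
  unfold phi
  simp only [if_pos this]
  exact hC.Ψinf x hx _ (cl01_mem t)

lemma phi_one_fin {x : X} (hk : κ (q0 x) ≠ ∞) : phi q0 j Ψ κ (x, 1) = j (dd (κ (q0 x))) := by
  unfold phi
  simp only [if_neg hk, cl01_one, one_smul, add_sub_cancel]

lemma phi_one_inf {x : X} (hk : κ (q0 x) = ∞) : phi q0 j Ψ κ (x, 1) = Ψ (x, 1) := by
  unfold phi
  simp only [if_pos hk, cl01_one]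

lemma Collapse.q_phi_one (hC : Collapse a0 q0 j Ψ) (h : Nbd N κ) {x : X} (hx : q0 x ∈ N) :
    q0 (phi q0 j Ψ κ (x, 1)) = κ (q0 x) := by
  by_cases hk : κ (q0 x) = ∞
  · rw [phi_one_inf hk, hk]
    exact hC.Ψ1 _ (h.ne_zero hx hk)
  · rw [phi_one_fin hk, hC.q_j, coe_dd hk]

lemma Collapse.q_rho (hC : Collapse a0 q0 j Ψ) (h : Nbd N κ) {x : X} (hx : q0 x ∈ N) :
    q0 (rho a0 q0 Ψ κ x) = ∞ := by
  unfold rho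
  split_ifs with hk
  · exact hC.Ψ1 _ (h.ne_zero hx hk)
  · exact hC.q_a0

lemma Collapse.rho_inf (hC : Collapse a0 q0 j Ψ) (h : Nbd N κ) {x : X} (hx : q0 x = ∞) :
    rho a0 q0 Ψ κ x = x := by
  unfold rho
  rw [if_pos (by rw [hx]; exact h.infty.2)]
  exact hC.Ψinf _ hx _ (by simp)

lemma Collapse.continuousOn_phi (hC : Collapse a0 q0 j Ψ) (h : Nbd N κ) :
    ContinuousOn (phi q0 j Ψ κ) ((q0 ⁻¹' N) ×ˢ Set.univ) := by
  rintro ⟨x, t⟩ ⟨hx, -⟩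
  have hx : q0 x ∈ N := hx
  apply ContinuousAt.continuousWithinAt
  have hO : IsOpen {z : X × ℝ | q0 z.1 ∈ N ∧ κ (q0 z.1) = κ (q0 x)} :=
    (h.op (κ (q0 x))).preimage (hC.cont_q.comp continuous_fst)
  by_cases hk : κ (q0 x) = ∞
  · have h1 : ContinuousOn (fun z : X × ℝ => Ψ (z.1, cl01 z.2)) {z : X × ℝ | q0 z.1 ∈ N ∧ κ (q0 z.1) = κ (q0 x)} := by
      refine hC.cont_Ψ.comp (by fun_prop) fun z hz => ⟨?_, cl01_mem _⟩
      exact h.ne_zero hz.1 (hz.2.trans hk)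
    have h2 := h1.continuousAt (hO.mem_nhds (show (x, t) ∈ _ from ⟨hx, rfl⟩))
    refine h2.congr ?_
    filter_upwards [hO.mem_nhds (show (x, t) ∈ _ from ⟨hx, rfl⟩)] with z hz
    unfold phi
    rw [if_pos (hz.2.trans hk)]
  · have hd : ContinuousAt (fun z : X × ℝ => dd (q0 z.1)) (x, t) := by
      have : q0 x ≠ ∞ := (h.fin _ (dd (κ (q0 x))) hx (coe_dd hk).symm).1
      exact ContinuousAt.comp (f := fun z : X × ℝ => q0 z.1) (continuousAt_dd this)
        (hC.cont_q.comp continuous_fst).continuousAt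
    have hc : ContinuousAt (fun z : X × ℝ => cl01 z.2) (x, t) := by
      apply Continuous.continuousAt; fun_prop
    have h2 : ContinuousAt (fun z : X × ℝ => j (dd (q0 z.1) + cl01 z.2 • (dd (κ (q0 x)) - dd (q0 z.1)))) (x, t) :=
      ContinuousAt.comp (hC.cont_j.continuousAt) (hd.add (hc.smul (continuousAt_const.sub hd)))
    refine h2.congr ?_
    filter_upwards [hO.mem_nhds (show (x, t) ∈ _ from ⟨hx, rfl⟩)] with z hz
    unfold phi
    rw [if_neg (by rw [hz.2]; exact hk), hz.2]

lemma Collapse.continuousOn_rho (hC : Collapse a0 q0 j Ψ) (h : Nbd N κ) :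
    ContinuousOn (rho a0 q0 Ψ κ) (q0 ⁻¹' N) := by
  intro x hx
  have hx : q0 x ∈ N := hx
  apply ContinuousAt.continuousWithinAt
  have hO : IsOpen {z : X | q0 z ∈ N ∧ κ (q0 z) = κ (q0 x)} :=
    (h.op (κ (q0 x))).preimage hC.cont_q
  by_cases hk : κ (q0 x) = ∞
  · have h1 : ContinuousOn (fun z : X => Ψ (z, 1)) {z : X | q0 z ∈ N ∧ κ (q0 z) = κ (q0 x)} := by
      refine hC.cont_Ψ.comp (by fun_prop) fun z hz => ⟨?_, by simp⟩
      exact h.ne_zero hz.1 (hz.2.trans hk)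
    have h2 := h1.continuousAt (hO.mem_nhds (show x ∈ _ from ⟨hx, rfl⟩))
    refine h2.congr ?_
    filter_upwards [hO.mem_nhds (show x ∈ _ from ⟨hx, rfl⟩)] with z hz
    unfold rho
    rw [if_pos (hz.2.trans hk)]
  · refine (continuousAt_const (y := a0)).congr ?_
    filter_upwards [hO.mem_nhds (show x ∈ _ from ⟨hx, rfl⟩)] with z hz
    unfold rho
    rw [if_neg (by rw [hz.2]; exact hk)]

/-- membership in preimages of basic open sets -/
lemma Collapse.mem_pre (hC : Collapse a0 q0 j Ψ) (h : Nbd N κ) (c : Z (OnePoint V) ∞) (s : Multiset X) :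
    mkZ a0 s ∈ (zmap q0 : Z X a0 → Z (OnePoint V) ∞) ⁻¹' (UU N κ c) ↔
      (∀ x ∈ s, q0 x ∈ N) ∧ mkZ ∞ (s.map (fun x => κ (q0 x))) = c := by
  show zmap q0 (mkZ a0 s) ∈ UU N κ c ↔ _
  rw [zmap_mk hC.q_a0]
  unfold UU
  rw [Set.mem_ofPred_eq, mem_sup_mk h.infty.1, zmap_mk h.infty.2, Multiset.map_map]
  simp [Function.comp_def]

lemma Collapse.mem_pre' (hC : Collapse a0 q0 j Ψ) (h : Nbd N κ) (c : Z (OnePoint V) ∞) (ξ : Z X a0) :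
    ξ ∈ (zmap q0 : Z X a0 → Z (OnePoint V) ∞) ⁻¹' (UU N κ c) ↔
      (∀ x ∈ ξ.1, q0 x ∈ N) ∧ mkZ ∞ (ξ.1.map (fun x => κ (q0 x))) = c := by
  rw [← hC.mem_pre h c ξ.1, mkZ_val]

def zphi (a0 : X) (q0 : X → OnePoint V) (j : V → X) (Ψ : X × ℝ → X) (κ : OnePoint V → OnePoint V)
    (z : Z X a0 × ℝ) : Z X a0 := zop a0 (phi q0 j Ψ κ) (fun _ (i : Fin 0) => a0) z

lemma zphi_def (z : Z X a0 × ℝ) : zphi a0 q0 j Ψ κ z = mkZ a0 (z.1.1.map (fun x => phi q0 j Ψ κ (x, z.2))) := by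
  unfold zphi zop
  have : ms (fun (i : Fin 0) => a0) = 0 := rfl
  rw [this, add_zero]

lemma Collapse.zphi_cont (hC : Collapse a0 q0 j Ψ) (h : Nbd N κ) (c : Z (OnePoint V) ∞) :
    ContinuousOn (zphi a0 q0 j Ψ κ) (((zmap q0 : Z X a0 → Z (OnePoint V) ∞) ⁻¹' (UU N κ c)) ×ˢ Set.univ) := by
  have := zop_continuousOn (a0 := a0) (a0' := a0) (h.isOpen.preimage hC.cont_q)
    (by rw [Set.mem_preimage, hC.q_a0]; exact h.infty.1)
    (hC.continuousOn_phi h) (fun p => hC.phi_inf h hC.q_a0 p) (α := fun _ (i : Fin 0) => a0) continuous_const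
  refine this.mono ?_
  rintro ⟨ξ, t⟩ ⟨h1, -⟩
  exact ⟨fun x hx => ((hC.mem_pre' h c ξ).1 h1).1 x hx, trivial⟩

lemma Collapse.zphi_mem (hC : Collapse a0 q0 j Ψ) (h : Nbd N κ) {c : Z (OnePoint V) ∞} {ξ : Z X a0}
    (hξ : ξ ∈ (zmap q0 : Z X a0 → Z (OnePoint V) ∞) ⁻¹' (UU N κ c)) (t : ℝ) :
    zphi a0 q0 j Ψ κ (ξ, t) ∈ (zmap q0 : Z X a0 → Z (OnePoint V) ∞) ⁻¹' (UU N κ c) := by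
  rw [zphi_def, hC.mem_pre h]
  obtain ⟨h1, h2⟩ := (hC.mem_pre' h c ξ).1 hξ
  refine ⟨?_, ?_⟩
  · intro x hx
    obtain ⟨y, hy, rfl⟩ := Multiset.mem_map.1 hx
    exact (hC.phi_mem h (h1 y hy) t).1
  · rw [Multiset.map_map, ← h2]
    exact mkZ_map_congr fun x hx => (hC.phi_mem h (h1 x hx) t).2

lemma Collapse.zphi_zero (hC : Collapse a0 q0 j Ψ) (h : Nbd N κ) {c : Z (OnePoint V) ∞} {ξ : Z X a0}
    (hξ : ξ ∈ (zmap q0 : Z X a0 → Z (OnePoint V) ∞) ⁻¹' (UU N κ c)) :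
    zphi a0 q0 j Ψ κ (ξ, 0) = ξ := by
  rw [zphi_def]
  obtain ⟨h1, h2⟩ := (hC.mem_pre' h c ξ).1 hξ
  refine (mkZ_map_congr (ψ := fun x => x) fun x hx => hC.phi_zero h (h1 x hx)).trans ?_
  rw [Multiset.map_id', mkZ_val]

lemma Collapse.zphi_one (hC : Collapse a0 q0 j Ψ) (h : Nbd N κ) {c : Z (OnePoint V) ∞} {ξ : Z X a0}
    (hξ : ξ ∈ (zmap q0 : Z X a0 → Z (OnePoint V) ∞) ⁻¹' (UU N κ c)) :
    zmap q0 (zphi a0 q0 j Ψ κ (ξ, 1)) = c := by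
  rw [zphi_def, zmap_mk hC.q_a0, Multiset.map_map]
  obtain ⟨h1, h2⟩ := (hC.mem_pre' h c ξ).1 hξ
  rw [← h2]
  exact mkZ_map_congr fun x hx => hC.q_phi_one h (h1 x hx)

end
end HS

namespace HS

open OnePoint

section
variable {V : Type*} [NormedAddCommGroup V] [NormedSpace ℝ V]
variable {X : Type*} [TopologicalSpace X]
variable {a0 : X} {q0 : X → OnePoint V} {j : V → X} {Ψ : X × ℝ → X}
  {N : Set (OnePoint V)} {κ : OnePoint V → OnePoint V}

def aA (s : ℝ) : ℝ := min (cl01 (2 * s)) (cl01 (4 * (1 - s)))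
def aB (s : ℝ) : ℝ := cl01 (4 * s - 2)

lemma continuous_aA : Continuous aA := by unfold aA; fun_prop
lemma continuous_aB : Continuous aB := by unfold aB; fun_prop
lemma aA_zero : aA 0 = 0 := by
  unfold aA; rw [mul_zero, cl01_zero]; exact min_eq_left (cl01_nonneg _)
lemma aA_one : aA 1 = 0 := by
  unfold aA; simp [cl01_nonneg]
lemma aA_le {s : ℝ} (h : s ≤ 1/2) : aA s = cl01 (2 * s) := by
  unfold aA; rw [cl01_of_ge (t := 4 * (1 - s)) (by linarith)]; exact min_eq_left (cl01_le _)
lemma aA_mid {s : ℝ} (h : 1/2 ≤ s) (h' : s ≤ 3/4) : aA s = 1 := by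
  unfold aA; rw [cl01_of_ge (t := 4 * (1 - s)) (by linarith), cl01_of_ge (by linarith)]; simp
lemma aB_le {s : ℝ} (h : s ≤ 1/2) : aB s = 0 := cl01_of_le (by linarith)
lemma aB_ge {s : ℝ} (h : 3/4 ≤ s) : aB s = 1 := cl01_of_ge (by linarith)

lemma mkZ_swap {x y : X} : mkZ a0 ({x} + {y}) = mkZ a0 ({y} + {x}) := by rw [add_comm]

lemma phi_cl01 (x : X) (t : ℝ) : phi q0 j Ψ κ (x, cl01 t) = phi q0 j Ψ κ (x, t) := by
  unfold phi
  simp only [cl01_of_mem (cl01_nonneg t) (cl01_le t)]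

lemma phi_one_ge (x : X) {t : ℝ} (ht : 1 ≤ t) : phi q0 j Ψ κ (x, t) = phi q0 j Ψ κ (x, 1) := by
  unfold phi
  simp only [cl01_of_ge ht, cl01_one]

theorem Collapse.key [ProperSpace V] (hC : Collapse a0 q0 j Ψ) (h : Nbd N κ) {c b : Z (OnePoint V) ∞}
    (hb : b ∈ UU N κ c) (ι : Type) [Fintype ι] :
    Conn ι ((zmap q0 : Z X a0 → Z (OnePoint V) ∞) ⁻¹' (UU N κ c))
      ((zmap q0 : Z X a0 → Z (OnePoint V) ∞) ⁻¹' {b}) := by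
  classical
  set q : Z X a0 → Z (OnePoint V) ∞ := zmap q0 with hq
  obtain ⟨m, w', hw'⟩ : ∃ m, ∃ w' : Fin m → OnePoint V, ms w' = b.1 := ⟨_, ms_surj b.1⟩
  -- the points of b
  have hwb : ∀ i, w' i ∈ b.1 := fun i => by rw [← hw']; exact mem_ms.2 ⟨i, rfl⟩
  have hwne : ∀ i, w' i ≠ ∞ := fun i e => b.2 (by have := hwb i; rw [e] at this; exact this)
  have hwN : ∀ i, w' i ∈ N := fun i => hb.1 _ (hwb i)
  set P : Fin m → X := fun i => j (dd (w' i)) with hP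
  have hqP : ∀ i, q0 (P i) = w' i := fun i => by rw [hP, hC.q_j, coe_dd (hwne i)]
  have hqPN : ∀ i, q0 (P i) ∈ N := fun i => by rw [hqP]; exact hwN i
  have hPq : ∀ x i, q0 x = w' i → x = P i := by
    intro x i e; rw [← coe_dd (hwne i)] at e; exact (hC.j_q x _ e).symm
  set α : ℝ → Fin m → X := fun t i => phi q0 j Ψ κ (P i, t) with hα
  have hαc : Continuous α := by
    refine continuous_pi fun i => ?_
    exact (hC.continuousOn_phi h).comp_continuous (f := fun t : ℝ => (P i, t)) (by fun_prop)
      fun t => ⟨hqPN i, trivial⟩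
  have hα0 : ∀ i, α 0 i = P i := fun i => hC.phi_zero h (hqPN i)
  have hαN : ∀ t i, q0 (α t i) ∈ N ∧ κ (q0 (α t i)) = κ (w' i) := fun t i => by
    have := hC.phi_mem h (hqPN i) t
    rw [hqP] at this; exact this
  have hα1 : ∀ i, q0 (α 1 i) = κ (w' i) := fun i => by
    have := hC.q_phi_one h (hqPN i); rw [hqP] at this; exact this
  have hω : ∀ i, ∃ γ : ℝ → X, Continuous γ ∧ γ 0 = a0 ∧ (κ (w' i) = ∞ → γ 1 = α 1 i) ∧
      (∀ t, q0 (γ t) = ∞) ∧ (κ (w' i) ≠ ∞ → ∀ t, γ t = a0) := by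
    intro i
    by_cases hk : κ (w' i) = ∞
    · obtain ⟨γ, h1, h2, h3, h4⟩ := hC.path (α 1 i) (by rw [hα1, hk])
      exact ⟨γ, h1, h2, fun _ => h3, h4, fun h => absurd hk h⟩
    · exact ⟨fun _ => a0, continuous_const, rfl, fun h => absurd h hk, fun _ => hC.q_a0, fun _ _ => rfl⟩
  choose ω hωc hω0 hω1 hωq hωf using hω
  set η : ℝ → Fin m → X := fun s i => if κ (w' i) = ∞ then (if s ≤ 3/4 then ω i (aB s) else α (aA s) i)
    else α (aA s) i with hη
  have hηc : Continuous η := by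
    refine continuous_pi fun i => ?_
    have hA : Continuous fun s => α (aA s) i := (continuous_apply i).comp (hαc.comp continuous_aA)
    by_cases hk : κ (w' i) = ∞
    · simp only [hη, if_pos hk]
      refine Continuous.if_le ((hωc i).comp continuous_aB) hA continuous_id continuous_const ?_
      intro s hs
      have hs : s = 3/4 := hs
      rw [aB_ge hs.ge, aA_mid (by linarith) hs.le, hω1 i hk]
    · simp only [hη, if_neg hk]; exact hA
  have hηN : ∀ s i, q0 (η s i) ∈ N ∧ κ (q0 (η s i)) = κ (w' i) := by
    intro s i
    simp only [hη]
    split_ifs with hk hs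
    · rw [hωq, hk]; exact h.infty
    · exact hαN _ _
    · exact hαN _ _
  have hη1 : ∀ i, η 1 i = P i := by
    intro i
    simp only [hη]
    rw [aA_one, hα0, if_neg (by norm_num : ¬ (1:ℝ) ≤ 3/4), ite_self]
  have hηh : ∀ i, (κ (w' i) = ∞ → η (1/2) i = a0) ∧ (κ (w' i) ≠ ∞ → η (1/2) i = j (dd (κ (w' i)))) := by
    intro i
    refine ⟨fun hk => ?_, fun hk => ?_⟩
    · simp only [hη]
      rw [if_pos hk, if_pos (by norm_num), aB_le le_rfl, hω0]
    · simp only [hη]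
      rw [if_neg hk, aA_mid le_rfl (by norm_num)]
      simp only [hα]
      rw [phi_one_fin (by rw [hqP]; exact hk), hqP]
  -- sums
  have hcb : mkZ ∞ (ms (fun i => κ (w' i))) = c := by
    rw [← hb.2]; unfold zmap; rw [← hw', ms_map]
  -- the second half
  set T2 : Z X a0 × ℝ → Z X a0 := zop a0 (fun z : X × ℝ => rho a0 q0 Ψ κ z.1) η with hT2
  set Θ : Z X a0 × ℝ → Z X a0 := fun z => if z.2 ≤ 1/2 then zphi a0 q0 j Ψ κ (z.1, 2 * z.2) else T2 z with hΘ
  -- the restriction to infinity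
  obtain ⟨N', κ', h', hb', hG'⟩ := Nbd.exists_small b (fun _ => Set.univ) (fun _ => Filter.univ_mem)
  set r : X → X := rho a0 q0 Ψ κ' with hr
  have hrinf : ∀ x, q0 x = ∞ → r x = x := fun x hx => hC.rho_inf h' hx
  have hrP : ∀ i, r (P i) = a0 := by
    intro i
    have : κ' (q0 (P i)) ≠ ∞ := by rw [hqP, (hb' _ (hwb i)).2]; exact hwne i
    simp only [hr, rho, if_neg this]
  set Λ : Z X a0 × ℝ × ℝ → Z X a0 := zop a0 (fun z : X × ℝ × ℝ => r z.1)
    (fun p : ℝ × ℝ => Sum.elim (α ((1 - p.2) * aA p.1)) (fun i => ω i (aB p.1))) with hΛ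
  have hT2def : ∀ ξ s, T2 (ξ, s) = mkZ a0 (ξ.1.map (rho a0 q0 Ψ κ) + ms (η s)) := fun ξ s => rfl
  have hΛdef : ∀ ξ s u, Λ (ξ, s, u) = mkZ a0 (ξ.1.map r + (ms (α ((1 - u) * aA s)) + ms (fun i => ω i (aB s)))) := by
    intro ξ s u
    simp only [hΛ, zop]
    rw [ms_sum]
  have ha0N : a0 ∈ q0 ⁻¹' N := by rw [Set.mem_preimage, hC.q_a0]; exact h.infty.1
  have ha0N' : a0 ∈ q0 ⁻¹' N' := by rw [Set.mem_preimage, hC.q_a0]; exact h'.infty.1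
  -- structure of points of the fibre
  have hsplit : ∀ ξ ∈ q ⁻¹' {b}, ∀ (f : X → X), f a0 = a0 → (∀ x, q0 x = ∞ → f x = x) →
      mkZ a0 (ξ.1.map f) = mkZ a0 (ξ.1.map r + ms (fun i => f (P i))) := by
    intro ξ hξ f hf0 hf
    have hξ : mkZ ∞ (ξ.1.map q0) = b := hξ
    have hPs : ms P = (ξ.1.filter fun x => q0 x ≠ ∞) := by
      have e1 : (ξ.1.map q0).filter (fun p => p ≠ ∞) = b.1 := by rw [← hξ]; unfold mkZ; congr
      rw [Multiset.filter_map] at e1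
      have e2 : ms P = b.1.map (fun p => j (dd p)) := by rw [← hw', ms_map]
      rw [e2, ← e1, Multiset.map_map]
      have : ∀ x ∈ ξ.1.filter fun x => q0 x ≠ ∞, ((fun p => j (dd p)) ∘ q0) x = x := by
        intro x hx
        exact hC.j_q _ _ (coe_dd (Multiset.mem_filter.1 hx).2).symm
      conv_rhs => rw [← Multiset.map_id (ξ.1.filter fun x => q0 x ≠ ∞)]
      exact Multiset.map_congr rfl this
    have e3 : ms (fun i => f (P i)) = (ξ.1.filter fun x => q0 x ≠ ∞).map f := by
      rw [← hPs, ms_map]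
    have hd : ξ.1.filter (fun x => q0 x = ∞) + ξ.1.filter (fun x => q0 x ≠ ∞) = ξ.1 :=
      Multiset.filter_add_not _ _
    rw [e3]
    conv_lhs => rw [← hd]
    conv_rhs => rw [← hd]
    rw [Multiset.map_add, Multiset.map_add]
    simp only [hd]
    rw [add_assoc]
    refine mkZ_add_congr ?_ ?_
    · refine mkZ_map_congr fun x hx => ?_
      have := (Multiset.mem_filter.1 hx).2
      rw [hf x this, hrinf x this]
    · have e4 : mkZ a0 ((ξ.1.filter fun x => q0 x ≠ ∞).map r + (ξ.1.filter fun x => q0 x ≠ ∞).map f) =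
          mkZ a0 (0 + (ξ.1.filter fun x => q0 x ≠ ∞).map f) := by
        refine mkZ_add_congr (mkZ_const ?_) rfl
        rw [← hPs, ms_map]
        intro x hx
        obtain ⟨i, rfl⟩ := mem_ms.1 hx
        exact hrP i
      rw [e4, zero_add]
  have hrq : ∀ ξ ∈ q ⁻¹' {b}, ∀ x ∈ ξ.1, q0 (r x) = ∞ ∧ q0 x ∈ N' := by
    intro ξ hξ x hx
    have hξ : mkZ ∞ (ξ.1.map q0) = b := hξ
    have : q0 x ∈ N' := by
      by_cases e : q0 x = ∞
      · rw [e]; exact h'.infty.1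
      · refine (hb' _ ?_).1
        rw [← hξ]; exact mem_mkZ.2 ⟨Multiset.mem_map_of_mem _ hx, e⟩
    exact ⟨hC.q_rho h' this, this⟩
  have hΛU : ∀ ξ ∈ q ⁻¹' {b}, ∀ s u, Λ (ξ, s, u) ∈ q ⁻¹' (UU N κ c) := by
    intro ξ hξ s u
    rw [hΛdef, hC.mem_pre h]
    refine ⟨?_, ?_⟩
    · intro x hx
      rcases Multiset.mem_add.1 hx with hx | hx
      · obtain ⟨y, hy, rfl⟩ := Multiset.mem_map.1 hx
        rw [(hrq ξ hξ y hy).1]; exact h.infty.1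
      rcases Multiset.mem_add.1 hx with hx | hx
      · obtain ⟨i, rfl⟩ := mem_ms.1 hx; exact (hαN _ _).1
      · obtain ⟨i, rfl⟩ := mem_ms.1 hx; rw [hωq]; exact h.infty.1
    · rw [← hcb, Multiset.map_add, Multiset.map_add, Multiset.map_map, ms_map, ms_map]
      have : ms (fun i => κ (w' i)) = 0 + (ms (fun i => κ (w' i)) + 0) := by simp
      rw [this]
      refine mkZ_add_congr (mkZ_const ?_) (mkZ_add_congr ?_ (mkZ_const ?_))
      · intro x hx
        obtain ⟨y, hy, rfl⟩ := Multiset.mem_map.1 hx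
        simp only [Function.comp]
        rw [(hrq ξ hξ y hy).1]; exact h.infty.2
      · simp only [(hαN _ _).2]
      · intro x hx
        obtain ⟨i, rfl⟩ := mem_ms.1 hx
        rw [hωq]; exact h.infty.2
  have hΛb : ∀ ξ ∈ q ⁻¹' {b}, ∀ s u, (1 - u) * aA s = 0 → Λ (ξ, s, u) ∈ q ⁻¹' {b} := by
    intro ξ hξ s u hsu
    rw [hΛdef, hsu]
    show zmap q0 _ = b
    rw [zmap_mk hC.q_a0, Multiset.map_add, Multiset.map_add, Multiset.map_map, ms_map, ms_map]
    have : b.1 = 0 + (ms w' + 0) := by rw [hw']; simp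
    rw [← mkZ_val b, this]
    refine mkZ_add_congr (mkZ_const ?_) (mkZ_add_congr ?_ (mkZ_const ?_))
    · intro x hx
      obtain ⟨y, hy, rfl⟩ := Multiset.mem_map.1 hx
      exact (hrq ξ hξ y hy).1
    · simp only [hα0, hqP]
    · intro x hx
      obtain ⟨i, rfl⟩ := mem_ms.1 hx
      exact hωq _ _
  refine Conn.deform Θ Λ ?_ ?_ ?_ ?_ ?_ ?_ ?_ ?_ ?_ ?_ ?_
  · rintro ξ hξ
    have : q ξ = b := hξ
    show q ξ ∈ UU N κ c
    rw [this]; exact hb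
  · -- continuity of Θ
    have c1 : ContinuousOn (fun z : Z X a0 × ℝ => zphi a0 q0 j Ψ κ (z.1, 2 * z.2)) ((q ⁻¹' UU N κ c) ×ˢ Set.univ) :=
      (hC.zphi_cont h c).comp (by fun_prop) fun z hz => ⟨hz.1, trivial⟩
    have c2 : ContinuousOn T2 ((q ⁻¹' UU N κ c) ×ˢ Set.univ) := by
      have := zop_continuousOn (a0 := a0) (a0' := a0) (h.isOpen.preimage hC.cont_q) ha0N
        (φ := fun z : X × ℝ => rho a0 q0 Ψ κ z.1) (α := η)
        ((hC.continuousOn_rho h).comp continuousOn_fst fun z hz => hz.1)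
        (fun p => hC.rho_inf h hC.q_a0) hηc
      refine this.mono ?_
      rintro ⟨ξ, t⟩ ⟨h1, -⟩
      exact ⟨fun x hx => ((hC.mem_pre' h c ξ).1 h1).1 x hx, trivial⟩
    have hglue : ∀ z ∈ (q ⁻¹' UU N κ c) ×ˢ (Set.univ : Set ℝ), z.2 = 1/2 →
        zphi a0 q0 j Ψ κ (z.1, 2 * z.2) = T2 z := by
      rintro ⟨ξ, s⟩ ⟨hξ, -⟩ hs
      have hs : s = 1/2 := hs
      subst hs
      obtain ⟨h1, h2⟩ := (hC.mem_pre' h c ξ).1 hξ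
      rw [zphi_def, hT2def]
      simp only
      norm_num
      -- j' of c
      let j' : OnePoint V → X := fun p => if p = ∞ then a0 else j (dd p)
      have hj' : j' ∞ = a0 := if_pos rfl
      have e1 : mkZ a0 (ms (η (1/2))) = mkZ a0 (ξ.1.map (fun x => j' (κ (q0 x)))) := by
        have e2 : (ms (η (1/2))) = (ms (fun i => κ (w' i))).map j' := by
          rw [ms_map]; congr 1; funext i
          by_cases hk : κ (w' i) = ∞
          · simp only [j', if_pos hk, (hηh i).1 hk]
          · simp only [j', if_neg hk, (hηh i).2 hk]
        have e3 : ξ.1.map (fun x => j' (κ (q0 x))) = (ξ.1.map (fun x => κ (q0 x))).map j' := by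
          rw [Multiset.map_map]; rfl
        rw [e2, e3, ← mkZ_map hj', hcb, ← h2, mkZ_map hj']
      have e4 : mkZ a0 (ξ.1.map (rho a0 q0 Ψ κ) + ms (η (1/2))) =
          mkZ a0 (ξ.1.map (rho a0 q0 Ψ κ) + ξ.1.map (fun x => j' (κ (q0 x)))) := mkZ_add_congr rfl e1
      rw [e4, ← mkZ_add_const _ ξ.1]
      refine mkZ_pair _ fun x hx => ?_
      by_cases hk : κ (q0 x) = ∞
      · simp only [rho, if_pos hk, j', phi_one_inf hk]
      · simp only [rho, if_neg hk, j', phi_one_fin hk]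
        rw [add_comm]
    have c3 : ContinuousOn Θ ((q ⁻¹' UU N κ c) ×ˢ Set.univ) := by
      rw [continuousOn_iff_continuous_domRestrict]
      have := Continuous.if_le (f' := fun z : ↥((q ⁻¹' UU N κ c) ×ˢ (Set.univ : Set ℝ)) => zphi a0 q0 j Ψ κ (z.1.1, 2 * z.1.2))
        (f := fun z => z.1.2) (g := fun _ => (1/2 : ℝ)) (g' := fun z => T2 z.1)
        (continuousOn_iff_continuous_domRestrict.1 c1) (continuousOn_iff_continuous_domRestrict.1 c2)
        (by fun_prop) (by fun_prop) fun z hz => hglue z.1 z.2 hz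
      exact this
    exact c3.mono (Set.prod_mono_right (Set.subset_univ _))
  · -- continuity of Λ
    have := zop_continuousOn (a0 := a0) (a0' := a0) (h'.isOpen.preimage hC.cont_q) ha0N'
      (φ := fun z : X × ℝ × ℝ => r z.1)
      (α := fun p : ℝ × ℝ => Sum.elim (α ((1 - p.2) * aA p.1)) (fun i => ω i (aB p.1)))
      ((hC.continuousOn_rho h').comp continuousOn_fst fun z hz => hz.1)
      (fun p => hC.rho_inf h' hC.q_a0) (by
        refine continuous_pi fun i => ?_
        have := continuous_aA
        have := continuous_aB
        cases i with
        | inl i =>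
          simp only [Sum.elim_inl]
          exact (continuous_apply i).comp (hαc.comp (by fun_prop))
        | inr i =>
          simp only [Sum.elim_inr]
          exact (hωc i).comp (by fun_prop))
    refine this.mono ?_
    rintro ⟨ξ, t⟩ ⟨h1, -⟩
    exact ⟨fun x hx => (hrq ξ h1 x hx).2, trivial⟩
  · intro ξ hξ
    simp only [hΘ, mul_zero]
    rw [if_pos (by norm_num)]
    exact hC.zphi_zero h hξ
  · intro ξ hξ s hs
    simp only [hΘ]
    split_ifs with h1
    · exact hC.zphi_mem h hξ _
    · rw [hT2def, hC.mem_pre h]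
      obtain ⟨h1, h2⟩ := (hC.mem_pre' h c ξ).1 hξ
      refine ⟨?_, ?_⟩
      · intro x hx
        rcases Multiset.mem_add.1 hx with hx | hx
        · obtain ⟨y, hy, rfl⟩ := Multiset.mem_map.1 hx
          rw [hC.q_rho h (h1 y hy)]; exact h.infty.1
        · obtain ⟨i, rfl⟩ := mem_ms.1 hx; exact (hηN _ _).1
      · rw [← hcb, Multiset.map_add, Multiset.map_map, ms_map]
        simp only [(hηN _ _).2]
        have : ms (fun i => κ (w' i)) = 0 + (ms (fun i => κ (w' i))) := by simp
        rw [this]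
        refine mkZ_add_congr (mkZ_const ?_) (by rw [← this])
        intro x hx
        obtain ⟨y, hy, rfl⟩ := Multiset.mem_map.1 hx
        simp only [Function.comp]
        rw [hC.q_rho h (h1 y hy)]; exact h.infty.2
  · intro ξ hξ
    simp only [hΘ]
    rw [if_neg (by norm_num), hT2def]
    obtain ⟨h1, h2⟩ := (hC.mem_pre' h c ξ).1 hξ
    show zmap q0 _ = b
    rw [zmap_mk hC.q_a0, Multiset.map_add, Multiset.map_map, ms_map]
    simp only [hη1, hqP]
    have : b.1 = 0 + ms w' := by rw [hw']; simp
    rw [← mkZ_val b, this]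
    refine mkZ_add_congr (mkZ_const ?_) rfl
    intro x hx
    obtain ⟨y, hy, rfl⟩ := Multiset.mem_map.1 hx
    exact hC.q_rho h (h1 y hy)
  · -- comparison
    intro ξ hξ s hs
    rw [hΛdef]
    simp only [sub_zero, one_mul, hΘ]
    split_ifs with h1
    · rw [zphi_def]
      simp only
      rw [hsplit ξ hξ _ (hC.phi_inf h hC.q_a0 _) fun x hx => hC.phi_inf h hx _]
      refine mkZ_add_congr rfl ?_
      have : ms (fun i => phi q0 j Ψ κ (P i, 2 * s)) = ms (fun i => phi q0 j Ψ κ (P i, 2 * s)) + 0 := by simp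
      rw [this]
      refine mkZ_add_congr ?_ (mkZ_const ?_)
      · simp only [hα, aA_le h1, phi_cl01]
      · intro x hx
        obtain ⟨i, rfl⟩ := mem_ms.1 hx
        rw [aB_le h1, hω0]
    · have h1' : 1/2 ≤ s := by linarith
      have e1 : T2 (ξ, s) = mkZ a0 (ξ.1.map r + (ms (fun i => rho a0 q0 Ψ κ (P i)) + ms (η s))) := by
        rw [hT2def, ← add_assoc]
        exact mkZ_add_congr (hsplit ξ hξ _ (hC.rho_inf h hC.q_a0) fun x hx => hC.rho_inf h hx) rfl
      rw [e1]
      refine mkZ_add_congr rfl ?_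
      unfold ms
      refine mkZ_pair _ fun i _ => ?_
      by_cases hk : κ (w' i) = ∞
      · have e2 : rho a0 q0 Ψ κ (P i) = α 1 i := by
          have hk' : κ (q0 (P i)) = ∞ := by rw [hqP, hk]
          simp only [hα, rho, if_pos hk', phi_one_inf hk']
        rw [e2]
        simp only [hη, if_pos hk]
        split_ifs with h3
        · rw [aA_mid h1' h3]
        · rw [aB_ge (by linarith), hω1 i hk, add_comm]
      · have e2 : rho a0 q0 Ψ κ (P i) = a0 := by
          have hk' : κ (q0 (P i)) ≠ ∞ := by rw [hqP]; exact hk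
          simp only [rho, if_neg hk']
        rw [e2]
        simp only [hη, if_neg hk, hωf i hk]
        rw [add_comm]
  · intro ξ hξ s _ u _; exact hΛU ξ hξ s u
  · intro ξ hξ s _; exact hΛb ξ hξ s 1 (by simp)
  · intro ξ hξ u _
    rw [hΛdef, aA_zero, mul_zero]
    have e1 := hsplit ξ hξ id rfl fun x _ => rfl
    rw [Multiset.map_id, mkZ_val] at e1
    conv_rhs => rw [e1]
    refine mkZ_add_congr rfl ?_
    have : ms (fun i => id (P i)) = ms (fun i => id (P i)) + 0 := by simp
    rw [this]
    refine mkZ_add_congr ?_ (mkZ_const ?_)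
    · congr 2; funext i; exact hα0 i
    · intro x hx
      obtain ⟨i, rfl⟩ := mem_ms.1 hx
      rw [aB_le (by norm_num), hω0]
  · intro ξ hξ u _; exact hΛb ξ hξ 1 u (by rw [aA_one, mul_zero])

theorem Collapse.QF [ProperSpace V] (hC : Collapse a0 q0 j Ψ) (hctr : ∀ U ∈ BB V, Ctr U) (b : Z (OnePoint V) ∞) :
    QF (zmap q0 : Z X a0 → Z (OnePoint V) ∞) (BB V) b := by
  refine ⟨continuous_zmap hC.cont_q hC.q_a0, Fam_BB, hctr, ?_, ?_⟩
  · rintro U ⟨N, κ, c, h, hc, rfl⟩ W ⟨N', κ', c', h', hc', rfl⟩ hWU ι _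
    refine Conn.of_deform (Set.preimage_mono hWU) (X' := zmap q0 ⁻¹' {c'}) ?_ (hC.key h (hWU hc') ι)
      (zphi a0 q0 j Ψ κ') ?_ ?_ ?_ ?_
    · exact Set.preimage_mono (Set.singleton_subset_iff.2 hc')
    · exact (hC.zphi_cont h' c').mono (Set.prod_mono_right (Set.subset_univ _))
    · intro ξ hξ; exact hC.zphi_zero h' hξ
    · intro ξ hξ t _; exact hC.zphi_mem h' hξ t
    · intro ξ hξ; exact hC.zphi_one h' hξ
  · rintro U ⟨N, κ, c, h, hc, rfl⟩ hb ι _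
    exact hC.key h hb ι

end
end HS

namespace HS

/-! ## The collapse instances -/

open OnePoint

section
variable {V : Type*} [NormedAddCommGroup V] [NormedSpace ℝ V]

lemma tendsto_infty [ProperSpace V] {α : Type*} {l : Filter α} {f : α → OnePoint V}
    (h : ∀ r : ℝ, 0 ≤ r → ∀ᶠ x in l, f x ∈ far r) : Filter.Tendsto f l (𝓝 (∞ : OnePoint V)) := by
  intro G hG
  obtain ⟨r, hr, h2⟩ := exists_far hG
  exact Filter.mem_of_superset (h r hr) fun x hx => h2 hx

open Classical in
def GG {𝕜 : Type*} [NormedField 𝕜] [NormedSpace 𝕜 V] (s : 𝕜) (v : V) : OnePoint V :=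
  if s = 0 then ∞ else ((s⁻¹ • v : V) : OnePoint V)

lemma GG_zero {𝕜 : Type*} [NormedField 𝕜] [NormedSpace 𝕜 V] (v : V) : GG (0:𝕜) v = ∞ := if_pos rfl
lemma GG_ne {𝕜 : Type*} [NormedField 𝕜] [NormedSpace 𝕜 V] {s : 𝕜} (h : s ≠ 0) (v : V) :
    GG s v = ((s⁻¹ • v : V) : OnePoint V) := if_neg h
lemma GG_eq_infty {𝕜 : Type*} [NormedField 𝕜] [NormedSpace 𝕜 V] {s : 𝕜} {v : V} :
    GG s v = ∞ ↔ s = 0 := by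
  constructor
  · intro h; by_contra hs; rw [GG_ne hs] at h; exact OnePoint.coe_ne_infty _ h
  · rintro rfl; exact GG_zero v

lemma GG_far {𝕜 : Type*} [NormedField 𝕜] [NormedSpace 𝕜 V] {s : 𝕜} {v : V} {r : ℝ} :
    GG s v ∈ far r ↔ s = 0 ∨ r * ‖s‖ < ‖v‖ := by
  by_cases h : s = 0
  · simp only [h, GG_zero, true_or, iff_true]; intro w hw; exact absurd hw.symm (OnePoint.coe_ne_infty _)
  · rw [GG_ne h]
    have hs : 0 < ‖s‖ := norm_pos_iff.2 h
    have : ((s⁻¹ • v : V) : OnePoint V) ∈ far r ↔ r < ‖s⁻¹ • v‖ :=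
      ⟨fun H => H _ rfl, fun H w hw => by rw [← OnePoint.coe_eq_coe.1 hw]; exact H⟩
    rw [this, norm_smul, norm_inv, ← div_eq_inv_mul, lt_div_iff₀ hs]
    simp [h]

lemma GG_scale {𝕜 : Type*} [NormedField 𝕜] [NormedSpace 𝕜 V] {s : 𝕜} {v : V} {c : 𝕜} (hc : c ≠ 0) :
    GG (c * s) (c • v) = GG s v := by
  by_cases h : s = 0
  · simp [h, GG_zero]
  · rw [GG_ne h, GG_ne (mul_ne_zero hc h), mul_inv, mul_comm, mul_smul, inv_smul_smul₀ hc]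

lemma continuousOn_GG [ProperSpace V] {𝕜 : Type*} [NormedField 𝕜] [NormedSpace 𝕜 V] :
    ContinuousOn (fun p : 𝕜 × V => GG p.1 p.2) {p | p.1 ≠ 0 ∨ p.2 ≠ 0} := by
  rintro ⟨s, v⟩ hp
  apply ContinuousAt.continuousWithinAt
  by_cases hs : s = 0
  · have hv : v ≠ 0 := hp.resolve_left (fun h => h hs)
    show Filter.Tendsto _ _ (𝓝 (GG s v))
    rw [hs, GG_zero]
    apply tendsto_infty
    intro r hr
    have ho : IsOpen {p : 𝕜 × V | r * ‖p.1‖ < ‖p.2‖} := isOpen_lt (by fun_prop) (by fun_prop)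
    filter_upwards [ho.mem_nhds (show ((0:𝕜), v) ∈ _ by simpa using hv)] with p hp
    exact GG_far.2 (Or.inr hp)
  · have : ContinuousAt (fun p : 𝕜 × V => ((p.1⁻¹ • p.2 : V) : OnePoint V)) (s, v) := by
      apply OnePoint.continuous_coe.continuousAt.comp
      exact (continuousAt_fst.inv₀ hs).smul continuousAt_snd
    refine this.congr ?_
    have ho : IsOpen {p : 𝕜 × V | p.1 ≠ 0} := isOpen_ne_fun (by fun_prop) (by fun_prop)
    filter_upwards [ho.mem_nhds hs] with p hp
    exact (GG_ne hp _).symm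

open Classical in
def Psi1 (p : OnePoint V × ℝ) : OnePoint V := if p.1 = ∞ then ∞ else GG (1 - p.2) (dd p.1)

lemma Psi1_infty (t : ℝ) : Psi1 ((∞ : OnePoint V), t) = ∞ := if_pos rfl
lemma Psi1_coe (v : V) (t : ℝ) : Psi1 ((v : OnePoint V), t) = GG (1 - t) v :=
  if_neg (OnePoint.coe_ne_infty v)

lemma Psi1_far {r : ℝ} (hr : 0 ≤ r) {p : OnePoint V} (hp : p ∈ far r) {t : ℝ} (ht : t ∈ Set.Icc (0:ℝ) 1) :
    Psi1 (p, t) ∈ far r := by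
  induction p using OnePoint.rec with
  | infty => rw [Psi1_infty]; exact hp
  | coe v =>
    rw [Psi1_coe, GG_far]
    right
    have := hp v rfl
    have h2 : ‖1 - t‖ ≤ 1 := by rw [Real.norm_eq_abs, abs_le]; constructor <;> linarith [ht.1, ht.2]
    nlinarith

lemma collapse_id [ProperSpace V] :
    Collapse (∞ : OnePoint V) id (fun v : V => (v : OnePoint V)) Psi1 where
  cont_q := continuous_id
  q_a0 := rfl
  cont_j := OnePoint.continuous_coe
  q_j _ := rfl
  j_q _ _ h := h.symm
  cont_Ψ := by
    rintro ⟨p, t⟩ ⟨hp, ht⟩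
    induction p using OnePoint.rec with
    | infty =>
      show Filter.Tendsto _ _ (𝓝 (Psi1 (∞, t)))
      rw [Psi1_infty]
      apply tendsto_infty
      intro r hr
      rw [nhdsWithin_prod_eq]
      have h1 : ∀ᶠ p in 𝓝[{x : OnePoint V | id x ≠ ((0:V) : OnePoint V)}] (∞ : OnePoint V), p ∈ far r :=
        nhdsWithin_le_nhds ((isOpen_far r).mem_nhds (fun w hw => absurd hw.symm (OnePoint.coe_ne_infty _)))
      have h2 : ∀ᶠ t in 𝓝[Set.Icc 0 1] t, t ∈ Set.Icc (0:ℝ) 1 := self_mem_nhdsWithin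
      filter_upwards [h1.prod_mk h2] with z hz
      exact Psi1_far hr hz.1 hz.2
    | coe v =>
      apply ContinuousAt.continuousWithinAt
      have hv : v ≠ 0 := fun h => hp (by rw [h]; rfl)
      have h1 : ContinuousAt (fun q : OnePoint V × ℝ => ((1 - q.2, dd q.1) : ℝ × V)) ((v : OnePoint V), t) := by
        refine ContinuousAt.prodMk (by fun_prop) ?_
        exact ContinuousAt.comp (f := Prod.fst) (continuousAt_dd (OnePoint.coe_ne_infty v)) continuousAt_fst
      have h2 : ContinuousAt (fun p : ℝ × V => GG p.1 p.2) (1 - t, v) := by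
        refine continuousOn_GG.continuousAt (IsOpen.mem_nhds ?_ (Or.inr hv))
        exact (isOpen_ne_fun (by fun_prop) (by fun_prop)).union (isOpen_ne_fun (by fun_prop) (by fun_prop))
      have h3 := ContinuousAt.comp (f := fun q : OnePoint V × ℝ => ((1 - q.2, dd q.1) : ℝ × V))
        (x := ((v : OnePoint V), t)) h2 h1
      refine h3.congr ?_
      have ho : IsOpen {p : OnePoint V × ℝ | p.1 ≠ ∞} := isOpen_ne_fun (by fun_prop) (by fun_prop)
      filter_upwards [ho.mem_nhds (OnePoint.coe_ne_infty v)] with q hq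
      exact (if_neg hq).symm
  Ψ0 := by
    intro x _
    induction x using OnePoint.rec with
    | infty => exact Psi1_infty 0
    | coe v => rw [Psi1_coe, GG_ne (by norm_num)]; simp
  Ψinf := by rintro _ rfl t _; exact Psi1_infty t
  Ψ1 := by
    intro x _
    induction x using OnePoint.rec with
    | infty => exact Psi1_infty 1
    | coe v => rw [Psi1_coe, sub_self, GG_zero]; rfl
  mono := fun x r hr h t ht => Psi1_far hr h ht
  path := fun a ha => ⟨fun _ => ∞, continuous_const, rfl, ha.symm, fun _ => rfl⟩

lemma zmap_id' {X : Type*} [TopologicalSpace X] {a0 : X} (ξ : Z X a0) : zmap (id : X → X) ξ = ξ := by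
  have := zmap_mk (f := (id : X → X)) (a0 := a0) (a0' := a0) rfl ξ.1
  rwa [mkZ_val, Multiset.map_id, mkZ_val] at this

lemma Ctr_BB [ProperSpace V] (U : Set (Z (OnePoint V) ∞)) (hU : U ∈ BB V) : Ctr U := by
  obtain ⟨N, κ, c, h, hc, rfl⟩ := hU
  have hC := collapse_id (V := V)
  have e : (zmap id : Z (OnePoint V) ∞ → Z (OnePoint V) ∞) ⁻¹' (UU N κ c) = UU N κ c := by
    ext ξ; rw [Set.mem_preimage, zmap_id']
  have h1 := hC.zphi_cont h c
  have h2 := fun ξ hξ => hC.zphi_mem h (c := c) (ξ := ξ) hξ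
  have h3 := fun ξ hξ => hC.zphi_zero h (c := c) (ξ := ξ) hξ
  have h4 := fun ξ hξ => hC.zphi_one h (c := c) (ξ := ξ) hξ
  rw [e] at h1 h2 h3 h4
  refine ⟨zphi ∞ id (fun v => (v : OnePoint V)) Psi1 κ, c, hc, h1.mono (Set.prod_mono_right (Set.subset_univ _)), h3, ?_, ?_⟩
  · intro ξ hξ; have := h4 ξ hξ; rwa [zmap_id'] at this
  · intro ξ hξ t _; exact h2 ξ hξ t

theorem Collapse.QF' [ProperSpace V] {X : Type*} [TopologicalSpace X] {a0 : X} {q0 : X → OnePoint V}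
    {j : V → X} {Ψ : X × ℝ → X} (hC : Collapse a0 q0 j Ψ) (b : Z (OnePoint V) ∞) :
    HS.QF (zmap q0 : Z X a0 → Z (OnePoint V) ∞) (BB V) b := hC.QF Ctr_BB b

end
end HS

namespace HS

open OnePoint

def zz {X : Type*} (a0 : X) : Z X a0 := mkZ a0 0

lemma zz_val {X : Type*} (a0 : X) : (zz a0).1 = 0 := mkZ_zero_val

section
variable {X : Type*} [TopologicalSpace X] {a0 : X}

lemma zmap_zz {X' : Type*} [TopologicalSpace X'] {a0' : X'} {f : X → X'} (h : f a0 = a0') :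
    (zmap f : Z X a0 → Z X' a0') (zz a0) = zz a0' := by
  unfold zz; rw [zmap_mk h, Multiset.map_zero]

lemma Conn.contract {Φ : X × ℝ → X} (hΦ : Continuous Φ) (h0 : ∀ x, Φ (x, 0) = x) (h1 : ∀ x, Φ (x, 1) = a0)
    (hb : ∀ t, Φ (a0, t) = a0) (ι : Type) [Fintype ι] : Conn ι (Set.univ : Set (Z X a0)) {zz a0} := by
  intro g hg _ hB
  have hc := zop_continuousOn (a0 := a0) (a0' := a0) (isOpen_univ (X := X)) trivial
    (hΦ.continuousOn (s := Set.univ ×ˢ Set.univ)) hb (α := fun _ (i : Fin 0) => a0) continuous_const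
  have hc' : Continuous (zop a0 Φ (fun _ (i : Fin 0) => a0) : Z X a0 × ℝ → Z X a0) := by
    rw [← continuousOn_univ]
    refine hc.mono ?_
    intro z _; exact ⟨fun _ _ => trivial, trivial⟩
  have e : ∀ z : Z X a0 × ℝ, zop a0 Φ (fun _ (i : Fin 0) => a0) z = mkZ a0 (z.1.1.map (fun x => Φ (x, z.2))) := by
    intro z
    unfold zop
    have : ms (fun (i : Fin 0) => a0) = 0 := rfl
    rw [this, add_zero]
  refine ⟨fun _ => zz a0, ⟨fun p => zop a0 Φ (fun _ (i : Fin 0) => a0) (g p.1, p.2), ?_, ?_, ?_, ?_, ?_⟩, fun _ => rfl⟩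
  · exact hc'.comp ((hg.comp continuous_fst).prodMk continuous_snd)
  · intro x
    simp only [e]
    refine (mkZ_map_congr (ψ := fun x => x) fun x _ => h0 x).trans ?_
    rw [Multiset.map_id', mkZ_val]
  · intro x
    simp only [e]
    exact mkZ_const fun y hy => by obtain ⟨w, _, rfl⟩ := Multiset.mem_map.1 hy; exact h1 w
  · intro _; trivial
  · intro x t hx
    have : g x = zz a0 := hB x hx
    simp only [e, this, zz_val]
    rfl

lemma Conn.of_path {Y : Type*} [TopologicalSpace Y] {y0 : Y} {A : Set Y}
    (h : ∀ y ∈ A, ∃ γ : ℝ → Y, Continuous γ ∧ γ 0 = y ∧ γ 1 = y0 ∧ ∀ t, γ t ∈ A)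
    (ι : Type) [Fintype ι] (hι : Fintype.card ι = 0) : Conn ι A {y0} := by
  have := Fintype.card_eq_zero_iff.1 hι
  intro g hg hA _
  obtain ⟨γ, h1, h2, h3, h4⟩ := h (g 0) (hA 0)
  refine ⟨fun _ => y0, ⟨fun p => γ p.2, h1.comp continuous_snd, ?_, ?_, ?_, ?_⟩, fun _ => rfl⟩
  · intro x; rw [Subsingleton.elim x 0]; exact h2
  · intro x; exact h3
  · intro p; exact h4 _
  · intro x t hx
    rw [Subsingleton.elim x 0, norm_zero] at hx
    norm_num at hx

lemma Z.path (h : ∀ x : X, ∃ γ : ℝ → X, Continuous γ ∧ γ 0 = x ∧ γ 1 = a0) (ξ : Z X a0) :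
    ∃ γ : ℝ → Z X a0, Continuous γ ∧ γ 0 = ξ ∧ γ 1 = zz a0 := by
  obtain ⟨m, w, hw⟩ : ∃ m, ∃ w : Fin m → X, ms w = ξ.1 := ⟨_, ms_surj ξ.1⟩
  choose γ h1 h2 h3 using h
  refine ⟨fun t => mkZ a0 (ms fun i => γ (w i) t), ?_, ?_, ?_⟩
  · exact continuous_mkZ.comp (continuous_pi fun i => h1 (w i))
  · simp only [h2]
    rw [hw, mkZ_val]
  · simp only [h3]
    exact mkZ_const fun y hy => by obtain ⟨i, rfl⟩ := mem_ms.1 hy; rfl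

lemma Z.conn0 [PathConnectedSpace X] (ι : Type) [Fintype ι] (hι : Fintype.card ι = 0) :
    Conn ι (Set.univ : Set (Z X a0)) {zz a0} := by
  refine Conn.of_path (fun ξ _ => ?_) ι hι
  obtain ⟨γ, h1, h2, h3⟩ := Z.path (a0 := a0) (fun x => by
    obtain ⟨γ⟩ := PathConnectedSpace.joined x a0
    exact ⟨γ.extend, γ.continuous_extend, by simp, by simp⟩) ξ
  exact ⟨γ, h1, h2, h3, fun _ => trivial⟩

end

/-! ### the ball -/

section
variable {V : Type*} [NormedAddCommGroup V] [NormedSpace ℝ V]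

abbrev Bl (V : Type*) [NormedAddCommGroup V] := Metric.closedBall (0 : V) 1

lemma Bl.norm_le (x : Bl V) : ‖(x : V)‖ ≤ 1 := mem_closedBall_zero_iff.1 x.2

def qB (x : Bl V) : OnePoint V := GG (1 - ‖(x : V)‖) (x : V)

def jB (v : V) : Bl V := ⟨(1 + ‖v‖)⁻¹ • v, by
  have h : 0 < 1 + ‖v‖ := by positivity
  rw [mem_closedBall_zero_iff, norm_smul, norm_inv, Real.norm_eq_abs, abs_of_pos h, inv_mul_le_iff₀ h]
  linarith⟩

open Classical in
def PB (p : Bl V × ℝ) : Bl V :=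
  ⟨((1 - cl01 p.2) + cl01 p.2 * ‖(p.1 : V)‖⁻¹) • (p.1 : V), by
    have h1 := cl01_nonneg p.2
    have h2 := cl01_le p.2
    have h3 : 0 ≤ ‖(p.1 : V)‖⁻¹ := by positivity
    have h4 := Bl.norm_le p.1
    rw [mem_closedBall_zero_iff, norm_smul, Real.norm_eq_abs, abs_of_nonneg (by nlinarith [mul_nonneg h1 h3]), add_mul]
    have h5 : ‖(p.1 : V)‖⁻¹ * ‖(p.1 : V)‖ ≤ 1 := inv_mul_le_one
    nlinarith [norm_nonneg (p.1 : V)]⟩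

lemma qB_infty {x : Bl V} : qB x = ∞ ↔ ‖(x : V)‖ = 1 := by
  unfold qB; rw [GG_eq_infty]; constructor <;> intro h <;> linarith

lemma qB_zero {x : Bl V} : qB x = ((0 : V) : OnePoint V) ↔ (x : V) = 0 := by
  constructor
  · intro h
    have h1 : 1 - ‖(x : V)‖ ≠ 0 := by
      intro h2
      have : qB x = ∞ := GG_eq_infty.2 h2
      rw [this] at h; exact OnePoint.coe_ne_infty _ h.symm
    unfold qB at h
    rw [GG_ne h1, OnePoint.coe_eq_coe, smul_eq_zero] at h
    exact h.resolve_left (inv_ne_zero h1)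
  · intro h; unfold qB; rw [h, norm_zero, GG_ne (by norm_num)]; simp

lemma PB_norm (x : Bl V) (hx : (x : V) ≠ 0) (t : ℝ) : ‖(PB (x, t) : V)‖ = (1 - cl01 t) * ‖(x : V)‖ + cl01 t := by
  have h1 := cl01_nonneg t
  have h2 := cl01_le t
  have h3 : 0 < ‖(x : V)‖ := norm_pos_iff.2 hx
  show ‖((1 - cl01 t) + cl01 t * ‖(x : V)‖⁻¹) • (x : V)‖ = _
  rw [norm_smul, Real.norm_eq_abs, abs_of_nonneg (by have := inv_pos.2 h3; nlinarith [mul_nonneg h1 this.le]), add_mul, mul_assoc, inv_mul_cancel₀ h3.ne', mul_one]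

lemma collapse_ball [ProperSpace V] (hV : 1 < Module.rank ℝ V) (a0 : Bl V) (ha : ‖(a0 : V)‖ = 1) :
    Collapse a0 (qB : Bl V → OnePoint V) jB PB where
  cont_q := by
    have : Continuous fun x : Bl V => ((1 - ‖(x : V)‖, (x : V)) : ℝ × V) := by fun_prop
    refine continuousOn_GG.comp_continuous this fun x => ?_
    by_cases h : (x : V) = 0
    · left; simp [h]
    · right; exact h
  q_a0 := qB_infty.2 ha
  cont_j := by
    refine Continuous.subtype_mk ?_ _
    refine Continuous.smul (Continuous.inv₀ (by fun_prop) fun v => ?_) continuous_id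
    positivity
  q_j v := by
    unfold qB jB
    have h : 0 < 1 + ‖v‖ := by positivity
    have e : 1 - ‖(1 + ‖v‖)⁻¹ • v‖ = (1 + ‖v‖)⁻¹ := by
      rw [norm_smul, norm_inv, Real.norm_eq_abs, abs_of_pos h]; field_simp; ring
    simp only [e]
    rw [GG_ne (by positivity), inv_inv, smul_inv_smul₀ h.ne']
  j_q x v h := by
    have h1 : ‖(x : V)‖ ≠ 1 := by
      intro h2
      rw [qB_infty.2 h2] at h; exact OnePoint.coe_ne_infty _ h.symm
    have h2 : 0 < 1 - ‖(x : V)‖ := by have := lt_of_le_of_ne (Bl.norm_le x) h1; linarith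
    unfold qB at h
    rw [GG_ne h2.ne', OnePoint.coe_eq_coe] at h
    subst h
    apply Subtype.ext
    show (1 + ‖(1 - ‖(x : V)‖)⁻¹ • (x : V)‖)⁻¹ • (1 - ‖(x : V)‖)⁻¹ • (x : V) = x
    rw [norm_smul, norm_inv, Real.norm_eq_abs, abs_of_pos h2, smul_smul]
    have : (1 + (1 - ‖(x : V)‖)⁻¹ * ‖(x : V)‖)⁻¹ * (1 - ‖(x : V)‖)⁻¹ = 1 := by
      field_simp; ring
    rw [this, one_smul]
  cont_Ψ := by
    rw [Topology.IsInducing.subtypeVal.continuousOn_iff]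
    have : ContinuousOn (fun p : Bl V × ℝ => ((1 - cl01 p.2) + cl01 p.2 * ‖(p.1 : V)‖⁻¹) • (p.1 : V))
        ({x : Bl V | qB x ≠ ((0 : V) : OnePoint V)} ×ˢ Set.Icc 0 1) := by
      have hcl : Continuous fun p : Bl V × ℝ => cl01 p.2 := by unfold cl01; fun_prop
      have hn : Continuous fun p : Bl V × ℝ => ‖(p.1 : V)‖ := by fun_prop
      refine ContinuousOn.smul (ContinuousOn.add (by fun_prop) (hcl.continuousOn.mul (hn.continuousOn.inv₀ ?_))) (by fun_prop)
      rintro ⟨x, t⟩ ⟨hx, _⟩ h0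
      exact hx (qB_zero.2 (norm_eq_zero.1 h0))
    exact this
  Ψ0 x _ := by
    apply Subtype.ext
    show ((1 - cl01 0) + cl01 0 * ‖(x : V)‖⁻¹) • (x : V) = x
    simp [cl01_zero]
  Ψinf x hx t _ := by
    apply Subtype.ext
    show ((1 - cl01 t) + cl01 t * ‖(x : V)‖⁻¹) • (x : V) = x
    rw [qB_infty.1 hx]; simp
  Ψ1 x hx := by
    rw [qB_infty, PB_norm x (fun h => hx (qB_zero.2 h)), cl01_one]; simp
  mono x r hr h t _ := by
    have hx : (x : V) ≠ 0 := by
      intro h0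
      rw [qB_zero.2 h0] at h
      have := h 0 rfl
      rw [norm_zero] at this; linarith
    unfold qB at h ⊢
    rw [GG_far] at h ⊢
    have h1 := cl01_nonneg t
    have h2 := cl01_le t
    have h4 := Bl.norm_le x
    right
    rw [PB_norm x hx]
    have e : 1 - ((1 - cl01 t) * ‖(x : V)‖ + cl01 t) = (1 - cl01 t) * (1 - ‖(x : V)‖) := by ring
    have h5 : r * (1 - ‖(x : V)‖) < ‖(x : V)‖ := by
      rcases h with h | h
      · rw [h, mul_zero]; exact norm_pos_iff.2 hx
      · rwa [Real.norm_eq_abs, abs_of_nonneg (by linarith)] at h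
    rw [e, Real.norm_eq_abs, abs_of_nonneg (by apply mul_nonneg <;> linarith)]
    rcases h1.eq_or_lt with h6 | h6
    · rw [← h6]; linarith
    · nlinarith
  path a h := by
    have := isPathConnected_sphere hV (0 : V) zero_le_one
    obtain ⟨γ, hγ⟩ := this.joinedIn a0 (by simpa using ha) a (by simpa using qB_infty.1 h)
    have hs : ∀ t, ‖γ.extend t‖ = 1 := by
      intro t
      have := hγ (Set.projIcc 0 1 zero_le_one t)
      rw [mem_sphere_zero_iff_norm] at this
      exact this
    refine ⟨fun t => ⟨γ.extend t, by simp [hs t]⟩, ?_, ?_, ?_, ?_⟩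
    · exact γ.continuous_extend.subtype_mk _
    · apply Subtype.ext; simp
    · apply Subtype.ext; simp
    · intro t; exact qB_infty.2 (hs t)

lemma conn_ball (a0 : Bl V) (ι : Type) [Fintype ι] : Conn ι (Set.univ : Set (Z (Bl V) a0)) {zz a0} := by
  refine Conn.contract (Φ := fun p => ⟨(p.1 : V) + cl01 p.2 • ((a0 : V) - (p.1 : V)),
    (convex_closedBall (0:V) 1).add_smul_sub_mem p.1.2 a0.2 (cl01_mem _)⟩) ?_ ?_ ?_ ?_ ι
  · refine Continuous.subtype_mk ?_ _
    unfold cl01; fun_prop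
  · intro x; apply Subtype.ext; simp [cl01_zero]
  · intro x; apply Subtype.ext; simp [cl01_one]
  · intro t; apply Subtype.ext; simp

end

/-! ### induction over spheres -/

abbrev Eu (m : ℕ) := EuclideanSpace ℝ (Fin m)

structure SphOK (m : ℕ) : Prop where
  hasZ : ∀ (ι : Type) [Fintype ι] (i : ι), Fintype.card ι = m → HasZ ι i Set.univ (zz (∞ : OnePoint (Eu m)))
  conn : ∀ (ι : Type) [Fintype ι], Fintype.card ι ≠ m →
    Conn ι (Set.univ : Set (Z (OnePoint (Eu m)) ∞)) {zz (∞ : OnePoint (Eu m))}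

lemma pre_zz {X : Type*} [TopologicalSpace X] {a0 : X} {V : Type*} [TopologicalSpace V] {q0 : X → OnePoint V} (h : q0 a0 = ∞) :
    (zmap q0 : Z X a0 → Z (OnePoint V) ∞) ⁻¹' {zz ∞} = sup {x | q0 x = ∞} := by
  ext ξ
  have e0 : ξ ∈ (zmap q0 : Z X a0 → Z (OnePoint V) ∞) ⁻¹' {zz ∞} ↔ (zmap q0 ξ : Z (OnePoint V) ∞).1 = 0 := by
    rw [← zz_val (∞ : OnePoint V)]; exact Subtype.ext_iff
  rw [e0]
  have e : zmap q0 ξ = (mkZ ∞ (ξ.1.map q0) : Z (OnePoint V) ∞) := by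
    rw [← zmap_mk h, mkZ_val]
  rw [e]
  constructor
  · intro h1 x hx
    by_contra h2
    have : q0 x ∈ (mkZ ∞ (ξ.1.map q0) : Z (OnePoint V) ∞).1 := mem_mkZ.2 ⟨Multiset.mem_map_of_mem _ hx, h2⟩
    rw [h1] at this
    simp at this
  · intro h1
    have : (mkZ ∞ (ξ.1.map q0) : Z (OnePoint V) ∞) = mkZ ∞ 0 := mkZ_const fun y hy => by
      obtain ⟨x, hx, rfl⟩ := Multiset.mem_map.1 hy
      exact h1 x hx
    rw [this, mkZ_zero_val]

lemma HasZ.some_reindex {ι κ : Type} [Fintype ι] [Fintype κ] {Y : Type*} [TopologicalSpace Y] {y0 : Y}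
    (k : κ) (h : ∀ i : ι, HasZ (Option ι) (Option.some i) (Set.univ : Set Y) y0)
    (hc : Fintype.card κ = Fintype.card ι + 1) (hι : 0 < Fintype.card ι) : HasZ κ k (Set.univ : Set Y) y0 := by
  classical
  obtain ⟨i⟩ := Fintype.card_pos_iff.1 hι
  have e0 : Option ι ≃ κ := Fintype.equivOfCardEq (by simp [hc])
  let e := e0.trans (Equiv.swap (e0 (Option.some i)) k)
  have := (h i).reindex e
  have e1 : e (Option.some i) = k := by simp [e]
  rwa [e1] at this

theorem SphOK.succ {m : ℕ} (hm : 1 ≤ m) (h : SphOK m) : SphOK (m + 1) := by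
  let e : OnePoint (Eu m) ≃ₜ Metric.sphere (0 : Eu (m + 1)) 1 :=
    onePointEquivSphereOfFinrankEq (by simp)
  let f : OnePoint (Eu m) → Bl (Eu (m + 1)) := fun p => ⟨e p, Metric.sphere_subset_closedBall (e p).2⟩
  have hfc : Continuous f := (continuous_subtype_val.comp e.continuous).subtype_mk _
  have hfi : Function.Injective f := by
    intro p q hpq
    exact e.injective (Subtype.ext (congrArg (fun x : Bl (Eu (m+1)) => (x : Eu (m+1))) hpq))
  have hf : Topology.IsClosedEmbedding f := hfc.isClosedEmbedding hfi
  have hfr : Set.range f = {x | qB x = ∞} := by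
    ext x
    simp only [Set.mem_range, Set.mem_ofPred_eq]
    rw [qB_infty]
    constructor
    · rintro ⟨p, rfl⟩; exact mem_sphere_zero_iff_norm.1 (e p).2
    · intro hx
      refine ⟨e.symm ⟨x, by simpa using hx⟩, Subtype.ext ?_⟩
      simp [f]
  set a0 := f ∞ with ha0
  have ha : ‖(a0 : Eu (m + 1))‖ = 1 := mem_sphere_zero_iff_norm.1 (e ∞).2
  have hV : 1 < Module.rank ℝ (Eu (m + 1)) := by
    rw [← Module.finrank_eq_rank]
    have : Module.finrank ℝ (Eu (m + 1)) = m + 1 := by simp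
    rw [this]; exact_mod_cast (by omega)
  have hC := collapse_ball hV a0 ha
  have hQ := hC.QF' (zz ∞)
  have hemb := (zmap_closedEmbedding (a0 := (∞ : OnePoint (Eu m))) (a0' := a0) hf rfl).isEmbedding
  have hF : (zmap f : Z (OnePoint (Eu m)) ∞ → Z (Bl (Eu (m + 1))) a0) '' Set.univ = zmap qB ⁻¹' {zz (∞ : OnePoint (Eu (m + 1)))} := by
    rw [pre_zz hC.q_a0, Set.image_univ, zmap_range rfl, hfr]
  have h0 : (zmap f : Z (OnePoint (Eu m)) ∞ → Z (Bl (Eu (m + 1))) a0) (zz ∞) = zz a0 := zmap_zz rfl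
  have he : (zmap qB : Z (Bl (Eu (m + 1))) a0 → Z (OnePoint (Eu (m + 1))) ∞) (zz a0) = zz ∞ := zmap_zz hC.q_a0
  have hc0 : ∀ (ι : Type) [Fintype ι], Fintype.card ι ≠ m →
      Conn ι ((zmap qB : Z (Bl (Eu (m + 1))) a0 → Z (OnePoint (Eu (m + 1))) ∞) ⁻¹' {zz ∞}) {zz a0} := by
    intro ι _ hι
    have := Conn.emb hemb (Set.subset_univ _) (h.conn ι hι)
    rwa [hF, Set.image_singleton, h0] at this
  refine ⟨?_, ?_⟩
  · intro κ _ k hk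
    refine HasZ.some_reindex (ι := Fin m) k (fun i => ?_) (by simpa using hk) (by rw [Fintype.card_fin]; omega)
    refine HasZ.boundary hQ he (conn_ball _ _) (conn_ball _ _) ?_
    have := HasZ.emb hemb (h.hasZ (Fin m) i (by simp))
    rwa [hF, h0] at this
  · intro κ _ hk
    rcases Nat.eq_zero_or_pos (Fintype.card κ) with h1 | h1
    · have : PathConnectedSpace (OnePoint (Eu (m + 1))) := by
        let e' : OnePoint (Eu (m + 1)) ≃ₜ Metric.sphere (0 : Eu (m + 2)) 1 :=
          onePointEquivSphereOfFinrankEq (by simp)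
        have hV : 1 < Module.rank ℝ (Eu (m + 2)) := by
          rw [← Module.finrank_eq_rank]
          have : Module.finrank ℝ (Eu (m + 2)) = m + 2 := by simp
          rw [this]; exact_mod_cast (by omega)
        have := isPathConnected_iff_pathConnectedSpace.1 (isPathConnected_sphere hV 0 zero_le_one)
        exact e'.symm.surjective.pathConnectedSpace e'.symm.continuous
      exact Z.conn0 κ h1
    · have := Conn.boundary (ι := Fin (Fintype.card κ - 1)) hQ he (conn_ball _ _) (hc0 _ (by simp; omega))
      exact this.of_card (by simp; omega)

end HS

namespace HS

/-! ## Finite symmetric products inside the infinite one -/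

lemma HasZ.of_emb {ι : Type} [Fintype ι] {Y : Type*} [TopologicalSpace Y] {Y' : Type*} [TopologicalSpace Y']
    {j : Y → Y'} (hj : Topology.IsEmbedding j) {i : ι}
    {A : Set Y} {y0 : Y} (h : HasZ ι i (j '' A) (j y0)) : HasZ ι i A y0 := by
  classical
  have lift : ∀ {M : Type} [TopologicalSpace M] (F : M → Y'), Continuous F → (∀ m, F m ∈ j '' A) →
      ∃ G : M → Y, Continuous G ∧ (∀ m, G m ∈ A) ∧ ∀ m, j (G m) = F m := by
    intro M _ F hF hm
    choose G h1 h2 using hm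
    refine ⟨G, hj.continuous_iff.2 ?_, h1, h2⟩
    simpa [Function.comp_def, h2] using hF
  refine h.transfer (fun f' f => ∀ x, f' x = j (f x)) ?_ ?_ ?_ ?_
  · intro f' hf'
    obtain ⟨G, h1, h2, h3⟩ := lift f' hf'.cont hf'.mem
    exact ⟨G, ⟨h1, h2, fun x hx => hj.injective (by rw [h3, hf'.out x hx])⟩, fun x => (h3 x).symm⟩
  · intro f hf
    exact ⟨fun x => j (f x), ⟨hj.continuous.comp hf.cont, fun x => ⟨_, hf.mem x, rfl⟩,
      fun x hx => by simp only [hf.out x hx]⟩, fun _ => rfl⟩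
  · intro f g f' g' hf hg hf' hg' rf rg x
    simp only [mulAt]; split_ifs
    · exact rf _
    · exact rg _
  · intro f' f hf' hf rf
    have ef : f' = fun x => j (f x) := funext rf
    symm
    constructor
    · intro h
      rw [ef]; exact RH.map h hj.continuous fun y hy => ⟨y, hy, rfl⟩
    · rintro ⟨H, c, h0, h1, hm, ho⟩
      obtain ⟨G, g1, g2, g3⟩ := lift H c hm
      exact ⟨G, g1, fun x => hj.injective (by rw [g3, h0, rf]),
        fun x => hj.injective (by rw [g3, h1]), g2,
        fun x t hx => hj.injective (by rw [g3, ho x t hx, rf])⟩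

section
variable {X : Type*} [TopologicalSpace X] {a0 : X} {d : ℕ}

def SP.ms (p : SP d X) : Multiset X :=
  Quotient.lift (fun f : Fin d → X => HS.ms f) (by
    rintro f g ⟨σ, rfl⟩
    exact (ms_equiv σ f).symm) p

lemma SP.ms_mk (f : Fin d → X) : SP.ms (_root_.SP.mk f) = HS.ms f := rfl

lemma SP.mk_surj : Function.Surjective (_root_.SP.mk : (Fin d → X) → SP d X) := Quotient.mk_surjective

lemma SP.isQuotientMap_mk : Topology.IsQuotientMap (_root_.SP.mk : (Fin d → X) → SP d X) :=
  isQuotientMap_quotient_mk'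

lemma SP.mk_eq {f g : Fin d → X} : (_root_.SP.mk f : SP d X) = _root_.SP.mk g ↔ HS.ms f = HS.ms g := by
  constructor
  · intro h; rw [← SP.ms_mk, h, SP.ms_mk]
  · intro h
    obtain ⟨σ, hσ⟩ := exists_perm_of_ms_eq h
    exact Quotient.sound ⟨σ, hσ⟩

lemma SP.card_ms (p : SP d X) : (SP.ms p).card = d := by
  obtain ⟨f, rfl⟩ := SP.mk_surj p
  rw [SP.ms_mk, HS.card_ms, Fintype.card_fin]

lemma SP.ext {p q : SP d X} (h : SP.ms p = SP.ms q) : p = q := by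
  obtain ⟨f, rfl⟩ := SP.mk_surj p
  obtain ⟨g, rfl⟩ := SP.mk_surj q
  exact SP.mk_eq.2 h

lemma SP.exists_ms {s : Multiset X} (h : s.card = d) : ∃ p : SP d X, SP.ms p = s := by
  obtain ⟨f, hf⟩ := ms_surj s
  subst h
  exact ⟨_root_.SP.mk f, hf⟩

/-- inclusion in the infinite symmetric product -/
def SP.inc (a0 : X) (p : SP d X) : Z X a0 := mkZ a0 (SP.ms p)

lemma SP.continuous_inc : Continuous (SP.inc a0 : SP d X → Z X a0) :=
  SP.isQuotientMap_mk.continuous_iff.2 continuous_mkZ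

lemma ms_eq_replicate {ι : Type*} [Fintype ι] {w : ι → X} (h : ∀ i, w i = a0) :
    HS.ms w = Multiset.replicate (Fintype.card ι) a0 :=
  Multiset.eq_replicate.2 ⟨HS.card_ms w, fun b hb => by obtain ⟨i, rfl⟩ := mem_ms.1 hb; exact h i⟩

lemma mkZ_add_replicate (s : Multiset X) (n : ℕ) : mkZ a0 (s + Multiset.replicate n a0) = mkZ a0 s := by
  have : mkZ a0 (s + Multiset.replicate n a0) = mkZ a0 (s + 0) :=
    mkZ_add_congr rfl (mkZ_const fun x hx => Multiset.eq_of_mem_replicate hx)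
  simpa using this

lemma pad_eq {s t : Multiset X} (h : mkZ a0 s = mkZ a0 t) :
    s + Multiset.replicate t.card a0 = t + Multiset.replicate s.card a0 := by
  obtain ⟨m, hm⟩ := mkZ_rep (a0 := a0) s
  obtain ⟨n, hn⟩ := mkZ_rep (a0 := a0) t
  have c1 := congrArg Multiset.card hm
  have c2 := congrArg Multiset.card hn
  rw [h] at hm c1
  simp only [Multiset.card_add, Multiset.card_replicate] at c1 c2
  generalize (mkZ a0 t).1 = u at *
  rw [c1, c2, hm, hn, add_assoc, add_assoc, ← Multiset.replicate_add, ← Multiset.replicate_add]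
  congr 2; omega

lemma SP.inc_injective : Function.Injective (SP.inc a0 : SP d X → Z X a0) := by
  intro p q h
  have := pad_eq h
  rw [SP.card_ms, SP.card_ms] at this
  exact SP.ext (add_right_cancel this)

lemma SP.isClosedEmbedding_inc [T1Space X] : Topology.IsClosedEmbedding (SP.inc a0 : SP d X → Z X a0) := by
  refine .of_continuous_injective_isClosedMap SP.continuous_inc SP.inc_injective ?_
  intro C hC
  rw [Z.isClosed_iff]
  intro e
  have : {y : Fin e → X | mkZ a0 (HS.ms y) ∈ SP.inc a0 '' C} =
      ⋃ τ : Fin d ⊕ Fin e ≃ Fin e ⊕ Fin d, {y : Fin e → X |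
        (∀ k, Sum.elim y (fun _ => a0) (τ (Sum.inr k)) = a0) ∧
        _root_.SP.mk (fun k => Sum.elim y (fun _ => a0) (τ (Sum.inl k))) ∈ C} := by
    ext y
    simp only [Set.mem_ofPred_eq, Set.mem_iUnion]
    constructor
    · rintro ⟨p, hp, hpy⟩
      obtain ⟨x, rfl⟩ := SP.mk_surj p
      have h1 : HS.ms x + Multiset.replicate (HS.ms y).card a0 = HS.ms y + Multiset.replicate (HS.ms x).card a0 := pad_eq hpy
      rw [HS.card_ms, HS.card_ms, ← ms_eq_replicate (w := fun _ : Fin e => a0) (fun _ => rfl),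
        ← ms_eq_replicate (w := fun _ : Fin d => a0) (fun _ => rfl), ← ms_sum, ← ms_sum,
        ← ms_equiv (Equiv.sumComm (Fin d) (Fin e)) (Sum.elim y _)] at h1
      obtain ⟨σ, hσ⟩ := exists_perm_of_ms_eq h1.symm
      refine ⟨σ.trans (Equiv.sumComm _ _), fun k => ?_, ?_⟩
      · exact congrFun hσ (Sum.inr k)
      · have : (fun k => Sum.elim y (fun _ => a0) ((σ.trans (Equiv.sumComm _ _)) (Sum.inl k))) = x := by
          funext k; exact congrFun hσ (Sum.inl k)
        rw [this]; exact hp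
    · rintro ⟨τ, h1, h2⟩
      refine ⟨_, h2, ?_⟩
      unfold SP.inc
      rw [SP.ms_mk]
      have e1 := ms_equiv τ (Sum.elim y (fun _ => a0))
      have e2 : (fun i => Sum.elim y (fun _ => a0) (τ i)) =
          Sum.elim (fun k => Sum.elim y (fun _ => a0) (τ (Sum.inl k))) (fun k => Sum.elim y (fun _ => a0) (τ (Sum.inr k))) := by
        funext i; cases i <;> rfl
      rw [e2, ms_sum, ms_sum, ms_eq_replicate h1, ms_eq_replicate (w := fun _ : Fin d => a0) (fun _ => rfl)] at e1
      rw [← mkZ_add_replicate (a0 := a0) _ (Fintype.card (Fin e)), e1, mkZ_add_replicate]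
  rw [this]
  refine isClosed_iUnion_of_finite fun τ => ?_
  have hcont : Continuous fun (y : Fin e → X) (s : Fin e ⊕ Fin d) => (Sum.elim y (fun _ => a0) s : X) := by
    refine continuous_pi fun s => ?_
    cases s with
    | inl k => exact continuous_apply k
    | inr k => exact continuous_const
  have h1 : ∀ s, Continuous fun y : Fin e → X => (Sum.elim y (fun _ => a0) s : X) := fun s => (continuous_apply s).comp hcont
  rw [show {y : Fin e → X | (∀ k, Sum.elim y (fun _ => a0) (τ (Sum.inr k)) = a0) ∧
        _root_.SP.mk (fun k => Sum.elim y (fun _ => a0) (τ (Sum.inl k))) ∈ C} =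
      (⋂ k, (fun y : Fin e → X => (Sum.elim y (fun _ => a0) (τ (Sum.inr k)) : X)) ⁻¹' {a0}) ∩
      (fun y : Fin e → X => (_root_.SP.mk (fun k => Sum.elim y (fun _ => a0) (τ (Sum.inl k))) : SP d X)) ⁻¹' C by
    ext y; simp]
  refine (isClosed_iInter fun k => isClosed_singleton.preimage (h1 _)).inter (hC.preimage ?_)
  exact SP.isQuotientMap_mk.continuous.comp (continuous_pi fun k => h1 _)

lemma SP.range_inc : Set.range (SP.inc a0 : SP d X → Z X a0) = {ξ | ξ.1.card ≤ d} := by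
  ext ξ
  constructor
  · rintro ⟨p, rfl⟩
    classical
    have := Multiset.card_le_card (Multiset.filter_le (fun x => x ≠ a0) (SP.ms p))
    rw [SP.card_ms] at this
    show (Multiset.filter (fun x => x ≠ a0) (SP.ms p)).card ≤ d
    convert this
  · intro h
    have h : ξ.1.card ≤ d := h
    obtain ⟨p, hp⟩ := SP.exists_ms (d := d) (s := ξ.1 + Multiset.replicate (d - ξ.1.card) a0) (by simp; omega)
    refine ⟨p, ?_⟩
    unfold SP.inc
    rw [hp, mkZ_add_replicate, mkZ_val]

lemma SP.isClosed_singleton [T1Space X] (p : SP d X) : IsClosed {p} := by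
  obtain ⟨x, rfl⟩ := SP.mk_surj p
  rw [← SP.isQuotientMap_mk.isClosed_preimage]
  have : (_root_.SP.mk ⁻¹' {_root_.SP.mk x} : Set (Fin d → X)) = ⋃ σ : Equiv.Perm (Fin d), {x ∘ σ} := by
    ext y
    simp only [Set.mem_preimage, Set.mem_singleton_iff, Set.mem_iUnion]
    rw [SP.mk_eq]
    constructor
    · intro h
      obtain ⟨σ, hσ⟩ := exists_perm_of_ms_eq h.symm
      exact ⟨σ, hσ.symm⟩
    · rintro ⟨σ, rfl⟩; exact ms_equiv σ x
  rw [this]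
  exact isClosed_iUnion_of_finite fun σ => _root_.isClosed_singleton

lemma Z.isClosed_singleton [T1Space X] (ξ : Z X a0) : IsClosed {ξ} := by
  have : ξ ∈ Set.range (SP.inc a0 : SP ξ.1.card X → Z X a0) := by
    rw [SP.range_inc]; exact le_refl ξ.1.card
  obtain ⟨p, hp⟩ := this
  have := (SP.isClosedEmbedding_inc (a0 := a0)).isClosedMap _ (SP.isClosed_singleton p)
  rwa [Set.image_singleton, hp] at this

lemma Z.card_mkZ_le {m : ℕ} (y : Fin m → X) : (mkZ a0 (HS.ms y)).1.card ≤ m := by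
  have : mkZ a0 (HS.ms y) ∈ Set.range (SP.inc a0 : SP m X → Z X a0) := ⟨_root_.SP.mk y, rfl⟩
  rw [SP.range_inc] at this; exact this

lemma Z.bounded_card [T1Space X] {K : Set (Z X a0)} (hK : IsCompact K) : ∃ d, ∀ ξ ∈ K, ξ.1.card ≤ d := by
  by_contra hcon
  push Not at hcon
  choose ξ h1 h2 using hcon
  let S : ℕ → Set (Z X a0) := fun n => {η | ∃ m, n ≤ m ∧ ξ m = η}
  have hS : ∀ n, IsClosed (S n) := by
    intro n
    rw [Z.isClosed_iff]
    intro e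
    have : {y : Fin e → X | mkZ a0 (HS.ms y) ∈ S n} = ⋃ m ∈ Finset.Icc n e, (fun y : Fin e → X => mkZ a0 (HS.ms y)) ⁻¹' {ξ m} := by
      ext y
      simp only [Set.mem_ofPred_eq, Set.mem_iUnion, Set.mem_preimage, Set.mem_singleton_iff, S, Finset.mem_Icc]
      constructor
      · rintro ⟨m, hm, hy⟩
        refine ⟨m, ⟨hm, ?_⟩, hy.symm⟩
        have := h2 m
        have h4 := Z.card_mkZ_le (a0 := a0) y
        rw [← hy] at h4
        exact this.le.trans h4
      · rintro ⟨m, hm, hy⟩; exact ⟨m, hm.1, hy.symm⟩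
    rw [this]
    exact isClosed_biUnion_finset fun m _ => (Z.isClosed_singleton _).preimage continuous_mkZ
  obtain ⟨n, hn⟩ := hK.elim_directed_cover (fun n => (S n)ᶜ) (fun n => (hS n).isOpen_compl) (by
      intro η hη
      simp only [Set.mem_iUnion]
      refine ⟨η.1.card, ?_⟩
      rintro ⟨m, hm, rfl⟩
      have := h2 m
      exact absurd (hm.trans_lt' this) (by simp)) (by
      refine directed_of_isDirected_le fun a b hab => ?_
      intro η hη ⟨m, hm, h⟩
      exact hη ⟨m, hab.trans hm, h⟩)
  exact hn (h1 n) ⟨n, le_rfl, rfl⟩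

end
end HS

namespace HS

/-! ## Homotopy groups of the circle -/

section
variable {ι : Type} [Fintype ι]

lemma exists_lift {A : Type} [TopologicalSpace A] [SimplyConnectedSpace A] [LocallyPathConnectedSpace A]
    {f : A → Circle} (hf : Continuous f) (a : A) (e : ℝ) (he : Circle.exp e = f a) :
    ∃ F : A → ℝ, Continuous F ∧ F a = e ∧ ∀ x, Circle.exp (F x) = f x := by
  obtain ⟨F, ⟨h1, h2⟩, -⟩ := Circle.isCoveringMap_exp.existsUnique_continuousMap_lifts ⟨f, hf⟩ a e he
  exact ⟨F, F.continuous, h1, fun x => congrFun h2 x⟩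

lemma isPreconnected_out (hι : 2 ≤ Fintype.card ι) : IsPreconnected {x : ι → ℝ | 1 ≤ ‖x‖} := by
  have hr : 1 < Module.rank ℝ (ι → ℝ) := by
    rw [← Module.finrank_eq_rank, Module.finrank_fintype_fun_eq_card]
    exact_mod_cast (by omega)
  have h1 := (isConnected_compl_singleton_of_one_lt_rank hr 0).isPreconnected
  have h2 := h1.image (fun x : ι → ℝ => (max 1 (‖x‖⁻¹)) • x) (by
    refine ContinuousOn.smul (ContinuousOn.sup continuousOn_const (ContinuousOn.inv₀ continuous_norm.continuousOn ?_)) continuousOn_id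
    intro x hx; exact norm_ne_zero_iff.2 hx)
  convert h2
  ext x
  constructor
  · intro hx
    have hx : 1 ≤ ‖x‖ := hx
    refine ⟨x, ?_, ?_⟩
    · rintro rfl; rw [norm_zero] at hx; norm_num at hx
    · simp only
      rw [max_eq_left (inv_le_one_of_one_le₀ hx), one_smul]
  · rintro ⟨y, hy, rfl⟩
    have hy : 0 < ‖y‖ := norm_pos_iff.2 hy
    show 1 ≤ ‖max 1 (‖y‖⁻¹) • y‖
    rw [norm_smul, Real.norm_eq_abs, abs_of_pos (lt_of_lt_of_le one_pos (le_max_left _ _))]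
    have := mul_le_mul_of_nonneg_right (le_max_right 1 (‖y‖⁻¹)) hy.le
    rwa [inv_mul_cancel₀ hy.ne'] at this

lemma circle_null {f : (ι → ℝ) → Circle} (hf : ∀ x, 1 ≤ ‖x‖ → f x = 1) {F : (ι → ℝ) → ℝ} (hF : Continuous F)
    (h : ∀ x, Circle.exp (F x) = f x) (h0 : ∀ x, 1 ≤ ‖x‖ → F x = 0) : Null Set.univ 1 f := by
  refine ⟨fun p => Circle.exp ((1 - p.2) * F p.1), by fun_prop, ?_, ?_, fun _ => trivial, ?_⟩
  · intro x; simp [h]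
  · intro x; simp
  · intro x t hx
    simp only
    rw [h0 x hx, mul_zero, Circle.exp_zero, hf x hx]

instance : PathConnectedSpace Circle := by
  have h : Function.Surjective Circle.exp := fun z => ⟨Complex.arg z, Circle.exp_arg z⟩
  exact h.pathConnectedSpace Circle.exp.continuous

lemma circle_conn (hι : Fintype.card ι ≠ 1) : Conn ι (Set.univ : Set Circle) {1} := by
  rcases Nat.lt_or_ge (Fintype.card ι) 2 with h | h
  · refine Conn.of_path (fun x _ => ?_) ι (by omega)
    obtain ⟨γ⟩ := PathConnectedSpace.joined x (1 : Circle)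
    exact ⟨γ.extend, γ.continuous_extend, by simp, by simp, fun _ => trivial⟩
  · refine Conn.of_null fun f hf => ?_
    have : Nonempty ι := Fintype.card_pos_iff.1 (by omega)
    let a : ι → ℝ := fun _ => 1
    have ha : 1 ≤ ‖a‖ := by simp [a]
    obtain ⟨F, h1, h2, h3⟩ := exists_lift hf.cont a 0 (by rw [Circle.exp_zero, hf.out a ha])
    refine circle_null hf.out h1 h3 ?_
    intro x hx
    rw [← h2]
    refine Circle.isCoveringMap_exp.isSeparatedMap.constOn_of_comp
      Circle.isCoveringMap_exp.isLocalHomeomorph.isLocallyInjective (isPreconnected_out h) h1.continuousOn ?_ hx ha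
    intro y hy z hz
    rw [h3, h3, hf.out y hy, hf.out z hz]

lemma norm_card_one (hι : Fintype.card ι = 1) (i : ι) (x : ι → ℝ) : ‖x‖ = |x i| := by
  have := Fintype.card_le_one_iff_subsingleton.1 hι.le
  apply le_antisymm
  · rw [pi_norm_le_iff_of_nonneg (abs_nonneg _)]
    intro j; rw [Subsingleton.elim j i]; rfl
  · exact norm_le_pi_norm x i

lemma circle_hasZ (hι : Fintype.card ι = 1) (i : ι) : HasZ ι i Set.univ (1 : Circle) := by
  have hss := Fintype.card_le_one_iff_subsingleton.1 hι.le
  have hn := norm_card_one hι i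
  have hup : ∀ v x, upd i v x = fun _ => v := by
    intro v x; funext j; rw [Subsingleton.elim j i]; exact upd_same i v x
  have hpi : (0:ℝ) < 2 * Real.pi := by positivity
  have hpc : ∀ {s : Set (ι → ℝ)} {F : (ι → ℝ) → ℝ} {f : (ι → ℝ) → Circle}, Convex ℝ s → Continuous F →
      (∀ x, Circle.exp (F x) = f x) → (∀ x ∈ s, f x = 1) → ∀ x ∈ s, ∀ y ∈ s, F x = F y := by
    intro s F f hs hF h h1 x hx y hy
    refine Circle.isCoveringMap_exp.isSeparatedMap.constOn_of_comp
      Circle.isCoveringMap_exp.isLocalHomeomorph.isLocallyInjective hs.isPreconnected hF.continuousOn ?_ hx hy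
    intro y hy z hz
    rw [h, h, h1 y hy, h1 z hz]
  have hm : ∀ x : ι → ℝ, x i ≤ -1 → 1 ≤ ‖x‖ := fun x hx => by rw [hn]; exact le_abs.2 (Or.inr (by linarith))
  have hp : ∀ x : ι → ℝ, 1 ≤ x i → 1 ≤ ‖x‖ := fun x hx => by rw [hn]; exact le_abs.2 (Or.inl hx)
  have cm : Convex ℝ {x : ι → ℝ | x i ≤ -1} := convex_halfSpace_le (LinearMap.proj (R := ℝ) (φ := fun _ : ι => ℝ) i).isLinear _
  have cp : Convex ℝ {x : ι → ℝ | 1 ≤ x i} := convex_halfSpace_ge (LinearMap.proj (R := ℝ) (φ := fun _ : ι => ℝ) i).isLinear _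
  refine ⟨fun f n => ∃ F : (ι → ℝ) → ℝ, Continuous F ∧ (∀ x, Circle.exp (F x) = f x) ∧
    (∀ x, x i ≤ -1 → F x = 0) ∧ ∀ x, 1 ≤ x i → F x = n * (2 * Real.pi), ?_, ?_, ?_, ?_⟩
  · intro f hf
    obtain ⟨F, h1, h2, h3⟩ := exists_lift hf.cont (fun _ => -1) 0 (by rw [Circle.exp_zero, hf.out _ (hm _ le_rfl)])
    have h4 : Circle.exp (F fun _ => 1) = 1 := by rw [h3, hf.out _ (hp _ le_rfl)]
    obtain ⟨n, hnn⟩ := Circle.exp_eq_one.1 h4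
    refine ⟨n, F, h1, h3, ?_, ?_⟩
    · intro x hx
      rw [← h2]
      exact hpc cm h1 h3 (fun y hy => hf.out y (hm y hy)) x hx _ (show (-1:ℝ) ≤ -1 from le_rfl)
    · intro x hx
      rw [← hnn]
      exact hpc cp h1 h3 (fun y hy => hf.out y (hp y hy)) x hx _ (show (1:ℝ) ≤ 1 from le_rfl)
  · intro n
    let F : (ι → ℝ) → ℝ := fun x => n * (2 * Real.pi) * cl01 ((x i + 1) / 2)
    have hF : Continuous F := by unfold F cl01; fun_prop
    have a1 : ∀ x : ι → ℝ, x i ≤ -1 → F x = 0 := fun x hx => by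
      simp only [F]; rw [cl01_of_le (by linarith), mul_zero]
    have a2 : ∀ x : ι → ℝ, 1 ≤ x i → F x = n * (2 * Real.pi) := fun x hx => by
      simp only [F]; rw [cl01_of_ge (by linarith), mul_one]
    refine ⟨fun x => Circle.exp (F x), ⟨by fun_prop, fun _ => trivial, ?_⟩, F, hF, fun _ => rfl, a1, a2⟩
    intro x hx
    rw [hn] at hx
    rcases le_abs.1 hx with h | h
    · simp only [a2 x h]; exact Circle.exp_eq_one.2 ⟨n, rfl⟩
    · simp only [a1 x (by linarith), Circle.exp_zero]
  · rintro f g n m hf hg ⟨F, f1, f2, f3, f4⟩ ⟨G, g1, g2, g3, g4⟩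
    refine ⟨mulAt i F (fun x => n * (2 * Real.pi) + G x), ?_, ?_, ?_, ?_⟩
    · unfold mulAt
      simp only [hup]
      refine Continuous.if_le (by fun_prop) (by fun_prop) (by fun_prop) (by fun_prop) ?_
      intro x hx
      rw [hx, f4 _ (by norm_num), g3 _ (by norm_num), add_zero]
    · intro x
      simp only [mulAt]
      split_ifs
      · exact f2 _
      · rw [Circle.exp_add, g2, Circle.exp_eq_one.2 ⟨n, rfl⟩, one_mul]
    · intro x hx
      simp only [mulAt]
      rw [if_pos (by linarith), hup]; exact f3 _ (by linarith)
    · intro x hx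
      simp only [mulAt]
      rw [if_neg (by linarith), hup, g4 _ (by linarith)]; push_cast; ring
  · rintro f n hf ⟨F, f1, f2, f3, f4⟩
    constructor
    · rintro rfl
      refine circle_null hf.out f1 f2 ?_
      intro x hx
      rw [hn] at hx
      rcases le_abs.1 hx with h | h
      · rw [f4 x h]; simp
      · exact f3 x (by linarith)
    · rintro ⟨H, c, h0, h1, -, ho⟩
      obtain ⟨K, k1, k2, k3⟩ := exists_lift c ((fun _ => -1), 0) 0
        (by rw [h0, Circle.exp_zero, hf.out _ (hm _ le_rfl)])
      have e0 : (fun x => K (x, 0)) = F := by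
        refine Circle.isCoveringMap_exp.eq_of_comp_eq (k1.comp (by fun_prop)) f1 (funext fun x => ?_) (fun _ => -1) ?_
        · simp only [Function.comp]; rw [k3, h0, f2]
        · exact k2.trans (f3 _ le_rfl).symm
      have ct : ∀ x : ι → ℝ, 1 ≤ ‖x‖ → ∀ t, K (x, t) = F x := by
        intro x hx t
        have := Circle.isCoveringMap_exp.const_of_comp (g := fun t : ℝ => K (x, t)) (k1.comp (by fun_prop))
          (fun a b => by rw [k3, k3, ho x _ hx, ho x _ hx]) t 0
        rw [← congrFun e0 x]; exact this
      have c1 := Circle.isCoveringMap_exp.const_of_comp (g := fun x : ι → ℝ => K (x, 1)) (k1.comp (by fun_prop))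
          (fun a b => by rw [k3, k3, h1, h1]) (fun _ => 1) (fun _ => -1)
      rw [ct (fun _ => 1) (hp _ le_rfl), ct (fun _ => -1) (hm _ le_rfl), f3 (fun _ => -1) le_rfl, f4 (fun _ => 1) le_rfl] at c1
      have := (mul_eq_zero.1 c1).resolve_right hpi.ne'
      exact_mod_cast this

end
end HS

namespace HS

section poly
open Polynomial

/-- the coefficients of the monic polynomial with given roots -/
def cf {d : ℕ} (x : Fin d → ℂ) (k : Fin d) : ℂ := (∏ i, (X - C (x i))).coeff k

lemma continuous_coeff_prod {ι : Type*} (s : Finset ι) (k : ℕ) :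
    Continuous fun x : ι → ℂ => (∏ i ∈ s, (X - C (x i))).coeff k := by
  classical
  induction s using Finset.induction_on generalizing k with
  | empty => simpa using continuous_const
  | insert a s ha ih =>
    have : (fun x : ι → ℂ => (∏ i ∈ insert a s, (X - C (x i))).coeff k) = fun x =>
        (if 1 ≤ k then (∏ i ∈ s, (X - C (x i))).coeff (k - 1) else 0) - x a * (∏ i ∈ s, (X - C (x i))).coeff k := by
      funext x
      rw [Finset.prod_insert ha, sub_mul, coeff_sub, coeff_C_mul]
      cases k <;> simp [coeff_X_mul]
    rw [this]
    have h1 := ih k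
    have h2 := ih (k - 1)
    split_ifs <;> fun_prop

lemma continuous_cf {d : ℕ} : Continuous (cf : (Fin d → ℂ) → Fin d → ℂ) :=
  continuous_pi fun _ => continuous_coeff_prod _ _

lemma prod_monic {d : ℕ} (x : Fin d → ℂ) : (∏ i, (X - C (x i))).Monic :=
  monic_prod_of_monic _ _ fun i _ => monic_X_sub_C _

lemma prod_natDegree {d : ℕ} (x : Fin d → ℂ) : (∏ i, (X - C (x i))).natDegree = d := by
  rw [natDegree_prod_of_monic _ _ fun i _ => monic_X_sub_C _]; simp

lemma prod_roots {d : ℕ} (x : Fin d → ℂ) : (∏ i, (X - C (x i))).roots = ms x := by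
  have := roots_multiset_prod_X_sub_C (ms x)
  rw [← this]; unfold ms; rw [Multiset.map_map]; rfl

/-- monic polynomial with given coefficients -/
def cpol {d : ℕ} (c : Fin d → ℂ) : ℂ[X] := X ^ d + ∑ k : Fin d, C (c k) * X ^ (k : ℕ)

lemma cpol_coeff {d : ℕ} (c : Fin d → ℂ) (k : Fin d) : (cpol c).coeff k = c k := by
  unfold cpol
  rw [coeff_add, coeff_X_pow, if_neg (by have := k.2; omega), zero_add, finsetSum_coeff]
  rw [Finset.sum_eq_single k]
  · simp
  · intro j _ hj
    rw [coeff_C_mul, coeff_X_pow, if_neg (fun h => hj (Fin.ext h.symm)), mul_zero]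
  · simp

lemma cpol_low {d : ℕ} (c : Fin d → ℂ) : (∑ k : Fin d, C (c k) * X ^ (k : ℕ) : ℂ[X]).degree < (d : WithBot ℕ) := by
  exact degree_sum_fin_lt c

lemma cpol_monic {d : ℕ} (c : Fin d → ℂ) : (cpol c).Monic := monic_X_pow_add (cpol_low c)

lemma cpol_natDegree {d : ℕ} (c : Fin d → ℂ) : (cpol c).natDegree = d :=
  natDegree_eq_of_degree_eq_some (by
    unfold cpol
    rw [degree_add_eq_left_of_degree_lt (by rw [degree_X_pow]; exact cpol_low c), degree_X_pow])

lemma cpol_cf {d : ℕ} (x : Fin d → ℂ) : cpol (cf x) = ∏ i, (X - C (x i)) := by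
  ext k
  rcases lt_trichotomy k d with h | h | h
  · exact cpol_coeff (cf x) ⟨k, h⟩
  · have h1 := (cpol_monic (cf x)).coeff_natDegree
    have h2 := (prod_monic x).coeff_natDegree
    rw [cpol_natDegree] at h1; rw [prod_natDegree] at h2
    rw [h, h1, h2]
  · rw [coeff_eq_zero_of_natDegree_lt (by rw [cpol_natDegree]; exact h),
      coeff_eq_zero_of_natDegree_lt (by rw [prod_natDegree]; exact h)]

lemma cf_eq {d : ℕ} {x y : Fin d → ℂ} : cf x = cf y ↔ ms x = ms y := by
  constructor
  · intro h
    rw [← prod_roots, ← prod_roots, ← cpol_cf, ← cpol_cf, h]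
  · intro h
    obtain ⟨σ, rfl⟩ := exists_perm_of_ms_eq h
    funext k
    unfold cf
    congr 1
    first
    | exact (Equiv.prod_comp σ (fun i => X - C (y i)))
    | exact (Equiv.prod_comp σ (fun i => X - C (x i))).symm

lemma cf_surj {d : ℕ} : Function.Surjective (cf : (Fin d → ℂ) → Fin d → ℂ) := by
  intro c
  have hs : (cpol c).Splits := IsAlgClosed.splits _
  have hc : (cpol c).roots.card = d := by rw [← hs.natDegree_eq_card_roots, cpol_natDegree]
  obtain ⟨x, hx⟩ : ∃ x : Fin d → ℂ, ms x = (cpol c).roots := by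
    obtain ⟨p, hp⟩ := SP.exists_ms (d := d) hc
    obtain ⟨x, rfl⟩ := SP.mk_surj p
    exact ⟨x, hp⟩
  refine ⟨x, ?_⟩
  have h1 : cpol c = ∏ i, (X - C (x i)) := by
    rw [hs.eq_prod_roots_of_monic (cpol_monic c), ← hx]
    unfold ms; rw [Multiset.map_map]; rfl
  funext k
  rw [← cpol_coeff c k, h1]; rfl

lemma cf_bound {d : ℕ} (x : Fin d → ℂ) (M : ℝ) (h : ∀ k, ‖cf x k‖ ≤ M) (i : Fin d) : ‖x i‖ ≤ max 1 (d * M) := by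
  by_contra! hc
  have h1 : 1 < ‖x i‖ := lt_of_le_of_lt (le_max_left _ _) hc
  have h2 : d * M < ‖x i‖ := lt_of_le_of_lt (le_max_right _ _) hc
  have h3 : (cpol (cf x)).eval (x i) = 0 := by
    rw [cpol_cf, eval_prod]
    exact Finset.prod_eq_zero (Finset.mem_univ i) (by simp)
  have h4 : x i ^ d = - ∑ k : Fin d, cf x k * x i ^ (k : ℕ) := by
    unfold cpol at h3
    rw [eval_add, eval_finsetSum] at h3
    simp only [eval_pow, eval_X, eval_mul, eval_C] at h3
    linear_combination h3
  have hd : 0 < d := i.pos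
  have h5 : ‖x i‖ ^ d ≤ d * M * ‖x i‖ ^ (d - 1) := by
    rw [← norm_pow, h4, norm_neg]
    refine (norm_sum_le _ _).trans ?_
    have : ∀ k ∈ (Finset.univ : Finset (Fin d)), ‖cf x k * x i ^ (k : ℕ)‖ ≤ M * ‖x i‖ ^ (d - 1) := by
      intro k _
      rw [norm_mul, norm_pow]
      have hk := k.2
      exact mul_le_mul (h k) (pow_le_pow_right₀ h1.le (by omega)) (by positivity) ((norm_nonneg _).trans (h k))
    refine (Finset.sum_le_sum this).trans (le_of_eq ?_)
    simp; ring
  have h6 : ‖x i‖ ^ d = ‖x i‖ * ‖x i‖ ^ (d - 1) := by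
    rw [← pow_succ']; congr 1; omega
  rw [h6] at h5
  have h7 : 0 < ‖x i‖ ^ (d - 1) := by positivity
  exact absurd (le_of_mul_le_mul_right h5 h7) (not_le.2 h2)

lemma isProperMap_cf {d : ℕ} : IsProperMap (cf : (Fin d → ℂ) → Fin d → ℂ) := by
  refine isProperMap_iff_isCompact_preimage.2 ⟨continuous_cf, fun K hK => ?_⟩
  obtain ⟨M, hM⟩ := hK.isBounded.exists_norm_le
  refine (isCompact_closedBall (0 : Fin d → ℂ) (max 1 (d * M))).of_isClosed_subset
    (hK.isClosed.preimage continuous_cf) ?_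
  intro x hx
  rw [mem_closedBall_zero_iff, pi_norm_le_iff_of_nonneg (by positivity)]
  intro i
  exact cf_bound x M (fun k => (norm_le_pi_norm _ k).trans (hM _ hx)) i

lemma isQuotientMap_cf {d : ℕ} : Topology.IsQuotientMap (cf : (Fin d → ℂ) → Fin d → ℂ) :=
  isProperMap_cf.isClosedMap.isQuotientMap continuous_cf cf_surj

lemma cf_zero {d : ℕ} (x : Fin (d + 1) → ℂ) : cf x 0 = (-1) ^ (d + 1) * ∏ i, x i := by
  unfold cf
  rw [show ((0 : Fin (d + 1)) : ℕ) = 0 from rfl, coeff_zero_eq_eval_zero, eval_prod]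
  simp [Finset.prod_neg]

end poly

lemma quot_lift_on {A B T : Type*} [TopologicalSpace A] [TopologicalSpace B] [TopologicalSpace T] [Nonempty T] {q : A → B}
    (hq : Topology.IsQuotientMap q) {O : Set B} (hO : IsOpen O) {φ : A → T} (hφ : ContinuousOn φ (q ⁻¹' O))
    (hc : ∀ a a', q a ∈ O → q a = q a' → φ a = φ a') : ∃ ψ : B → T, ContinuousOn ψ O ∧ ∀ a, q a ∈ O → ψ (q a) = φ a := by
  classical
  have hr := hq.restrictPreimage_isOpen hO
  refine ⟨fun b => φ (Function.surjInv hq.surjective b), ?_, ?_⟩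
  · rw [continuousOn_iff_continuous_domRestrict, hr.continuous_iff]
    rw [continuousOn_iff_continuous_domRestrict] at hφ
    refine hφ.congr ?_
    rintro ⟨a, ha⟩
    exact hc _ _ ha (Function.surjInv_eq hq.surjective (q a)).symm
  · intro a ha
    exact (hc _ _ ha (Function.surjInv_eq hq.surjective (q a)).symm).symm

end HS

namespace HS

open Classical in
/-- radial projection to the circle -/
def nrm (z : ℂ) : Circle := if h : z = 0 then 1 else
  ⟨z / ‖z‖, by
    rw [← SetLike.mem_coe, Submonoid.coe_unitSphere, mem_sphere_zero_iff_norm, norm_div, Complex.norm_real, norm_norm, div_self (norm_ne_zero_iff.2 h)]⟩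

lemma coe_nrm {z : ℂ} (h : z ≠ 0) : ((nrm z : Circle) : ℂ) = z / ‖z‖ := by
  have : nrm z = (⟨z / ‖z‖, by
    rw [← SetLike.mem_coe, Submonoid.coe_unitSphere, mem_sphere_zero_iff_norm, norm_div, Complex.norm_real, norm_norm, div_self (norm_ne_zero_iff.2 h)]⟩ : Circle) := dif_neg h
  rw [this]

lemma nrm_coe (z : Circle) : nrm z = z := by
  apply Circle.ext
  rw [coe_nrm z.coe_ne_zero, show ‖(z : ℂ)‖ = 1 from Circle.norm_coe z, Complex.ofReal_one, div_one]

lemma isInducing_circle : Topology.IsInducing (fun z : Circle => (z : ℂ)) := Topology.IsInducing.subtypeVal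

lemma continuousOn_nrm : ContinuousOn nrm {z | z ≠ 0} := by
  rw [isInducing_circle.continuousOn_iff]
  have h : ContinuousOn (fun z : ℂ => z / ‖z‖) {z | z ≠ 0} := by
    have : Continuous fun z : ℂ => ((‖z‖ : ℝ) : ℂ) := by fun_prop
    exact continuousOn_id.div this.continuousOn (fun z hz => by simpa using hz)
  refine h.congr ?_
  intro z hz
  exact coe_nrm hz

lemma nrmZ_exists (d : ℕ) : ∃ φ : (Fin (d + 1) → ℂ) → Z Circle 1, ContinuousOn φ {c | c 0 ≠ 0} ∧
    ∀ x : Fin (d + 1) → ℂ, cf x 0 ≠ 0 → φ (cf x) = mkZ 1 (ms fun i => nrm (x i)) := by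
  haveI : Nonempty (Z Circle 1) := ⟨zz 1⟩
  have hO : IsOpen {c : Fin (d + 1) → ℂ | c 0 ≠ 0} := isOpen_ne_fun (continuous_apply 0) continuous_const
  refine quot_lift_on isQuotientMap_cf hO (φ := fun x => mkZ 1 (ms fun i => nrm (x i))) ?_ ?_
  · refine continuous_mkZ.comp_continuousOn (continuousOn_pi.2 fun i => ?_)
    refine continuousOn_nrm.comp (continuous_apply i).continuousOn ?_
    intro x hx
    have hx : cf x 0 ≠ 0 := hx
    rw [cf_zero] at hx
    exact (Finset.prod_ne_zero_iff.1 (mul_ne_zero_iff.1 hx).2) i (Finset.mem_univ i)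
  · intro x y _ h
    rw [← ms_map nrm x, ← ms_map nrm y, cf_eq.1 h]

lemma prod_mkZ (s : Multiset Circle) : (mkZ (1 : Circle) s).1.prod = s.prod := by
  obtain ⟨n, hn⟩ := mkZ_rep (a0 := (1 : Circle)) s
  conv_rhs => rw [hn]
  simp

def muZ (ξ : Z Circle 1) : Circle := ξ.1.prod

lemma prod_ms {M : Type*} [CommMonoid M] {ι : Type*} [Fintype ι] (x : ι → M) : (ms x).prod = ∏ i, x i := rfl

lemma continuous_muZ : Continuous muZ := by
  rw [Z.continuous_iff]
  intro d
  simp only [muZ, prod_mkZ, prod_ms]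
  fun_prop

def sigZ (z : Circle) : Z Circle 1 := mkZ 1 {z}

lemma continuous_sigZ : Continuous sigZ := by
  have h : sigZ = fun z => mkZ 1 (ms (fun _ : Unit => z)) := by funext z; rfl
  rw [h]
  exact continuous_mkZ.comp (by fun_prop)

lemma muZ_sigZ (z : Circle) : muZ (sigZ z) = z := by
  unfold muZ sigZ; rw [prod_mkZ]; simp

lemma muZ_zz : muZ (zz 1) = 1 := by unfold muZ; rw [zz_val]; simp
lemma sigZ_one : sigZ 1 = zz 1 := by
  apply Subtype.ext
  rw [zz_val]
  unfold sigZ mkZ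
  simp

lemma ms_cons {X : Type*} {d : ℕ} (a : X) (w : Fin d → X) : ms (Fin.cons a w : Fin (d + 1) → X) = a ::ₘ ms w := by
  unfold ms
  rw [Fin.univ_succ]
  simp

lemma loop_range_compact {ι Y : Type*} [Fintype ι] [TopologicalSpace Y] {g : (ι → ℝ) → Y} (hg : Continuous g) {y0 : Y}
    (ho : ∀ x, 1 ≤ ‖x‖ → g x = y0) : ∃ K, IsCompact K ∧ ∀ x, g x ∈ K := by
  refine ⟨g '' Metric.closedBall 0 1 ∪ {y0}, ((isCompact_closedBall _ _).image hg).union isCompact_singleton, ?_⟩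
  intro x
  rcases le_total 1 ‖x‖ with h | h
  · exact Or.inr (ho x h)
  · exact Or.inl ⟨x, mem_closedBall_zero_iff.2 h, rfl⟩

variable {ι : Type} [Fintype ι]

lemma Zc_retract {g : (ι → ℝ) → Z Circle 1} (hg : LoopIn Set.univ (zz 1) g) :
    RH Set.univ g (fun x => sigZ (muZ (g x))) := by
  obtain ⟨K, hK, hgK⟩ := loop_range_compact hg.cont hg.out
  obtain ⟨d, hd⟩ := Z.bounded_card hK
  have hr : ∀ x, g x ∈ Set.range (SP.inc 1 : SP (d + 1) Circle → Z Circle 1) := by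
    intro x
    rw [SP.range_inc]
    exact (hd _ (hgK x)).trans (Nat.le_succ d)
  choose g' hg' using hr
  have cg' : Continuous g' := by
    rw [(SP.isClosedEmbedding_inc (a0 := (1 : Circle)) (d := d + 1)).isInducing.continuous_iff]
    have : (SP.inc 1 ∘ g') = g := funext hg'
    rw [this]; exact hg.cont
  -- coefficients
  let a : SP (d + 1) Circle → Fin (d + 1) → ℂ :=
    Quotient.lift (fun f : Fin (d + 1) → Circle => cf (fun i => (f i : ℂ))) (by
      rintro f f' ⟨σ, rfl⟩
      rw [cf_eq]
      exact (ms_equiv σ fun i => (f i : ℂ)).symm)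
  let b : SP (d + 1) Circle → Fin (d + 1) → ℂ := fun p =>
    cf (Fin.cons (((SP.ms p).prod : Circle) : ℂ) (fun _ => 1))
  have am : ∀ f : Fin (d + 1) → Circle, a (_root_.SP.mk f) = cf (fun i => (f i : ℂ)) := fun f => rfl
  have bm : ∀ f : Fin (d + 1) → Circle, b (_root_.SP.mk f) = cf (Fin.cons ((∏ i, f i : Circle) : ℂ) (fun _ => 1)) := fun f => rfl
  have ca : Continuous a := SP.isQuotientMap_mk.continuous_iff.2 (continuous_cf.comp (by fun_prop))
  have cb : Continuous b := by
    refine SP.isQuotientMap_mk.continuous_iff.2 (continuous_cf.comp (continuous_pi fun i => ?_))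
    refine Fin.cases ?_ (fun j => ?_) i
    · simp only [Fin.cons_zero]
      have : Continuous fun f : Fin (d + 1) → Circle => ((∏ i, f i : Circle) : ℂ) := by fun_prop
      exact this
    · simp only [Fin.cons_succ]; exact continuous_const
  have ab0 : ∀ p, a p 0 = b p 0 := by
    intro p
    obtain ⟨f, rfl⟩ := SP.mk_surj p
    rw [am, bm, cf_zero, cf_zero, Fin.prod_univ_succ (Fin.cons _ _)]
    have : ((∏ i, f i : Circle) : ℂ) = ∏ i, (f i : ℂ) := map_prod Circle.coeHom _ _
    simp [this]
  have a0 : ∀ p, a p 0 ≠ 0 := by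
    intro p
    obtain ⟨f, rfl⟩ := SP.mk_surj p
    rw [am, cf_zero]
    exact mul_ne_zero (by simp) (Finset.prod_ne_zero_iff.2 fun i _ => (f i).coe_ne_zero)
  obtain ⟨φ, cφ, hφ⟩ := nrmZ_exists d
  have φa : ∀ p, φ (a p) = SP.inc 1 p := by
    intro p
    have h0 := a0 p
    obtain ⟨f, rfl⟩ := SP.mk_surj p
    rw [am] at h0 ⊢
    rw [hφ _ h0]
    simp only [nrm_coe]
    rfl
  have φb : ∀ p, φ (b p) = sigZ (muZ (SP.inc 1 p)) := by
    intro p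
    have h0 := a0 p
    rw [ab0] at h0
    have e : muZ (SP.inc 1 p) = (SP.ms p).prod := prod_mkZ _
    rw [e]
    show φ (cf _) = _
    rw [hφ _ h0, ← ms_map, ms_cons, Multiset.map_cons, nrm_coe, ms_map]
    unfold sigZ
    have h2 : mkZ (1 : Circle) (ms fun _ : Fin d => nrm 1) = mkZ 1 0 := by
      have : nrm 1 = 1 := by have := nrm_coe 1; simpa using this
      rw [this]
      exact mkZ_const fun x hx => (mem_ms.1 hx).elim fun _ h => h.symm
    rw [← Multiset.singleton_add]
    rw [mkZ_add_congr rfl h2, add_zero]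
  have arg0 : ∀ x (t : ℝ), ((1 - (t : ℂ)) • a (g' x) + (t : ℂ) • b (g' x)) 0 ≠ 0 := by
    intro x t
    simp only [Pi.add_apply, Pi.smul_apply, smul_eq_mul]
    rw [← ab0, ← add_mul]
    simpa using a0 (g' x)
  refine ⟨fun p => φ ((1 - (p.2 : ℂ)) • a (g' p.1) + (p.2 : ℂ) • b (g' p.1)), ?_, ?_, ?_, fun _ => Set.mem_univ _, ?_⟩
  · refine cφ.comp_continuous ?_ (fun p => arg0 p.1 p.2)
    fun_prop
  · intro x
    simp only [Complex.ofReal_zero, sub_zero, one_smul, zero_smul, add_zero]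
    rw [φa, hg']
  · intro x
    simp only [Complex.ofReal_one, sub_self, one_smul, zero_smul, zero_add]
    rw [φb, hg']
  · intro x t hx
    have e : a (g' x) = b (g' x) := by
      have h1 : g' x = _root_.SP.mk (fun _ => 1) := by
        apply SP.inc_injective (a0 := (1 : Circle))
        rw [hg', hg.out x hx]
        show _ = mkZ 1 (ms _)
        exact (mkZ_const fun x hx => (mem_ms.1 hx).elim fun _ h => h.symm).symm
      rw [h1, am, bm]
      congr 1
      funext i
      refine Fin.cases ?_ (fun j => ?_) i <;> simp
    show φ _ = _
    rw [← e, ← add_smul]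
    simp only [sub_add_cancel, one_smul]
    rw [φa, hg']

lemma Zc_conn (hι : Fintype.card ι ≠ 1) : Conn ι (Set.univ : Set (Z Circle 1)) {zz 1} := by
  apply Conn.of_null
  intro f hf
  have h1 : LoopIn Set.univ 1 (fun x => muZ (f x)) :=
    ⟨continuous_muZ.comp hf.cont, fun _ => Set.mem_univ _, fun x hx => by rw [hf.out x hx, muZ_zz]⟩
  have h2 := RH.map ((circle_conn hι).null h1) (A' := Set.univ) continuous_sigZ (fun _ _ => Set.mem_univ _)
  simp only [sigZ_one] at h2
  exact (Zc_retract hf).trans h2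

lemma Zc_hasZ (hι : Fintype.card ι = 1) (i : ι) : HasZ ι i (Set.univ : Set (Z Circle 1)) (zz 1) := by
  have hL : ∀ f : (ι → ℝ) → Circle, LoopIn Set.univ 1 f → LoopIn Set.univ (zz 1) (fun x => sigZ (f x)) := fun f hf =>
    ⟨continuous_sigZ.comp hf.cont, fun _ => Set.mem_univ _, fun x hx => by rw [hf.out x hx, sigZ_one]⟩
  refine (circle_hasZ hι i).transfer (fun f F => RH Set.univ (fun x => sigZ (f x)) F) ?_ ?_ ?_ ?_
  · intro f hf
    exact ⟨_, hL f hf, RH.refl (hL f hf).cont (fun _ => Set.mem_univ _)⟩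
  · intro F hF
    exact ⟨fun x => muZ (F x), ⟨continuous_muZ.comp hF.cont, fun _ => Set.mem_univ _, fun x hx => by rw [hF.out x hx, muZ_zz]⟩,
      (Zc_retract hF).symm⟩
  · intro f g F G hf hg hF hG hr hr'
    have := RH.mul hr hr' (hL f hf).out (hL g hg).out i
    rwa [← map_mulAt] at this
  · intro f F hf hF hr
    constructor
    · intro h
      have h2 := RH.map h (A' := Set.univ) continuous_sigZ (fun _ _ => Set.mem_univ _)
      simp only [sigZ_one] at h2
      exact hr.symm.trans h2
    · intro h
      have h2 := RH.map (hr.trans h) (A' := Set.univ) continuous_muZ (fun _ _ => Set.mem_univ _)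
      simp only [muZ_sigZ, muZ_zz] at h2
      exact h2

end HS

namespace HS

section
variable {X X' : Type*} [TopologicalSpace X] [TopologicalSpace X'] {a0 : X} {a0' : X'} {ι : Type} [Fintype ι]

lemma zmap_homeo_univ (h : X ≃ₜ X') (e : h a0 = a0') :
    (zmap h : Z X a0 → Z X' a0') '' Set.univ = Set.univ := by
  rw [Set.image_univ, zmap_range e]
  refine Set.eq_univ_of_forall fun ξ x hx => ?_
  exact h.surjective x

lemma HasZ.homeo (h : X ≃ₜ X') (e : h a0 = a0') {i : ι} (hz : HasZ ι i Set.univ (zz a0')) : HasZ ι i Set.univ (zz a0) := by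
  refine HasZ.of_emb (zmap_closedEmbedding h.isClosedEmbedding e).isEmbedding ?_
  rw [zmap_homeo_univ h e, zmap_zz e]; exact hz

lemma Conn.homeo (h : X ≃ₜ X') (e : h a0 = a0') (hz : Conn ι Set.univ {zz a0'}) : Conn ι Set.univ {zz a0} := by
  refine Conn.of_emb (zmap_closedEmbedding h.isClosedEmbedding e).isEmbedding ?_
  rw [zmap_homeo_univ h e, Set.image_singleton, zmap_zz e]; exact hz
end

open OnePoint Module

lemma exists_circle_homeo : ∃ h : OnePoint (Eu 1) ≃ₜ Circle, h ∞ = 1 := by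
  have hV : finrank ℝ (Eu 1) = finrank ℝ (Submodule.span ℝ {(1 : ℂ)})ᗮ := by
    have := Complex.finrank_real_complex_fact
    rw [Submodule.finrank_orthogonal_span_singleton (n := 1) one_ne_zero]
    simp
  let e : Eu 1 ≃ₜ (Submodule.span ℝ {(1 : ℂ)})ᗮ :=
    (FiniteDimensional.nonempty_continuousLinearEquiv_of_finrank_eq hV).some.toHomeomorph
  let h1 : OnePoint (Eu 1) ≃ₜ Metric.sphere (0 : ℂ) 1 :=
    e.onePointCongr.trans (onePointHyperplaneHomeoUnitSphere (by simp))
  let h2 : Metric.sphere (0 : ℂ) 1 ≃ₜ Circle :=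
    { toFun := fun x => ⟨x.1, x.2⟩
      invFun := fun x => ⟨x.1, x.2⟩
      left_inv := fun _ => rfl
      right_inv := fun _ => rfl
      continuous_toFun := isInducing_circle.continuous_iff.2 continuous_subtype_val
      continuous_invFun := Topology.IsInducing.subtypeVal.continuous_iff.2 isInducing_circle.continuous }
  refine ⟨(h1.trans h2).trans (Homeomorph.mulLeft (h2 (h1 ∞))⁻¹), ?_⟩
  simp

lemma SphOK.one : SphOK 1 := by
  obtain ⟨h, e⟩ := exists_circle_homeo
  exact ⟨fun ι _ i hι => HasZ.homeo h e (Zc_hasZ hι i), fun ι _ hι => Conn.homeo h e (Zc_conn hι)⟩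

lemma SphOK.all (m : ℕ) (hm : 1 ≤ m) : SphOK m := by
  induction m, hm using Nat.le_induction with
  | base => exact SphOK.one
  | succ m hm ih => exact SphOK.succ hm ih

end HS

namespace HS

section CPn
variable {n : ℕ}

abbrev Vn (n : ℕ) := Fin (n + 1) → ℂ

def cpq (v : {v : Vn n // v ≠ 0}) : CP n := Quotient.mk _ v

lemma cpq_eq {v w : {v : Vn n // v ≠ 0}} : cpq v = cpq w ↔ ∃ c : ℂ, c ≠ 0 ∧ w.1 = c • v.1 := by
  have h := Projectivization.mk_eq_mk_iff' ℂ w.1 v.1 w.2 v.2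
  have h' : cpq v = cpq w ↔ Projectivization.mk ℂ w.1 w.2 = Projectivization.mk ℂ v.1 v.2 := eq_comm
  rw [h', h]
  constructor
  · rintro ⟨c, hc⟩
    refine ⟨c, ?_, hc.symm⟩
    rintro rfl
    rw [zero_smul] at hc; exact w.2 hc.symm
  · rintro ⟨c, -, hc⟩; exact ⟨c, hc.symm⟩

lemma cpq_eq' {v w : {v : Vn n // v ≠ 0}} : cpq v = cpq w ↔ ∀ i j, v.1 i * w.1 j = v.1 j * w.1 i := by
  rw [cpq_eq]
  constructor
  · rintro ⟨c, -, h⟩ i j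
    rw [h]; simp only [Pi.smul_apply, smul_eq_mul]; ring
  · intro h
    obtain ⟨i, hi⟩ := Function.ne_iff.1 v.2
    have hi : v.1 i ≠ 0 := hi
    have e : w.1 = (w.1 i / v.1 i) • v.1 := by
      funext j
      simp only [Pi.smul_apply, smul_eq_mul]
      field_simp
      rw [mul_comm, h i j, mul_comm]
    refine ⟨_, ?_, e⟩
    intro h0
    rw [h0, zero_smul] at e; exact w.2 e

lemma cpq_surj : Function.Surjective (cpq : _ → CP n) := Quotient.mk_surjective

lemma isQuotientMap_cpq : Topology.IsQuotientMap (cpq : _ → CP n) := isQuotientMap_quotient_mk'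

lemma isOpenMap_cpq : IsOpenMap (cpq : _ → CP n) := by
  intro U hU
  rw [← isQuotientMap_cpq.isOpen_preimage]
  have : cpq ⁻¹' (cpq '' U) = ⋃ c : {c : ℂ // c ≠ 0}, (fun v : {v : Vn n // v ≠ 0} =>
      (⟨c.1 • v.1, smul_ne_zero c.2 v.2⟩ : {v : Vn n // v ≠ 0})) ⁻¹' U := by
    ext v
    simp only [Set.mem_preimage, Set.mem_image, Set.mem_iUnion]
    constructor
    · rintro ⟨w, hw, e⟩
      obtain ⟨c, hc, h⟩ := cpq_eq.1 e.symm
      refine ⟨⟨c, hc⟩, ?_⟩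
      have : (⟨c • v.1, smul_ne_zero hc v.2⟩ : {v : Vn n // v ≠ 0}) = w := Subtype.ext h.symm
      simp only [this]; exact hw
    · rintro ⟨c, h⟩
      exact ⟨_, h, (cpq_eq.2 ⟨c.1, c.2, rfl⟩).symm⟩
  rw [this]
  refine isOpen_iUnion fun c => hU.preimage ?_
  have : Continuous fun v : {v : Vn n // v ≠ 0} => c.1 • v.1 := (continuous_const_smul c.1).comp continuous_subtype_val
  exact Continuous.subtype_mk this _

lemma isOpenQuotientMap_cpq : IsOpenQuotientMap (cpq : _ → CP n) :=
  ⟨cpq_surj, isQuotientMap_cpq.continuous, isOpenMap_cpq⟩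

instance : T2Space (CP n) := by
  rw [t2Space_iff_of_isOpenQuotientMap isOpenQuotientMap_cpq]
  simp only [cpq_eq']
  simp only [Set.ofPred_forall]
  refine isClosed_iInter fun i => isClosed_iInter fun j => ?_
  have h : ∀ k, Continuous fun v : {v : Vn n // v ≠ 0} => v.1 k := fun k => (continuous_apply k).comp continuous_subtype_val
  exact isClosed_eq (((h i).comp continuous_fst).mul ((h j).comp continuous_snd))
    (((h j).comp continuous_fst).mul ((h i).comp continuous_snd))

/-- a point with given homogeneous coordinates -/
def cp (v : Vn n) : CP n := open Classical in if h : v ≠ 0 then cpq ⟨v, h⟩ else cpq ⟨1, one_ne_zero⟩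

lemma cp_of {v : Vn n} (h : v ≠ 0) : cp v = cpq ⟨v, h⟩ := dif_pos h

lemma continuousOn_cp : ContinuousOn (cp : Vn n → CP n) {v | v ≠ 0} := by
  rw [continuousOn_iff_continuous_domRestrict]
  refine isQuotientMap_cpq.continuous.congr ?_
  rintro ⟨v, h⟩
  exact (cp_of h).symm

lemma cp_surj (x : CP n) : ∃ v : Vn n, v ≠ 0 ∧ cp v = x := by
  obtain ⟨⟨v, h⟩, rfl⟩ := cpq_surj x
  exact ⟨v, h, cp_of h⟩

lemma cp_eq {v w : Vn n} (hv : v ≠ 0) (hw : w ≠ 0) : cp v = cp w ↔ ∃ c : ℂ, c ≠ 0 ∧ w = c • v := by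
  rw [cp_of hv, cp_of hw, cpq_eq]

lemma cp_smul {v : Vn n} (hv : v ≠ 0) {c : ℂ} (hc : c ≠ 0) : cp (c • v) = cp v :=
  ((cp_eq hv (smul_ne_zero hc hv)).2 ⟨c, hc, rfl⟩).symm

/-- chosen homogeneous coordinates -/
def rep (x : CP n) : Vn n := (cp_surj x).choose

lemma rep_ne (x : CP n) : rep x ≠ 0 := (cp_surj x).choose_spec.1
lemma cp_rep (x : CP n) : cp (rep x) = x := (cp_surj x).choose_spec.2

lemma rep_cp {v : Vn n} (h : v ≠ 0) : ∃ c : ℂ, c ≠ 0 ∧ rep (cp v) = c • v :=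
  (cp_eq h (rep_ne _)).1 (cp_rep _).symm

lemma cp_contOn {P T : Type*} [TopologicalSpace P] [TopologicalSpace T] {F : CP n × P → T} {S : Set (CP n × P)}
    (h : ContinuousOn (fun p : Vn n × P => F (cp p.1, p.2)) {p | p.1 ≠ 0 ∧ (cp p.1, p.2) ∈ S}) : ContinuousOn F S := by
  rintro ⟨x, a⟩ hx
  obtain ⟨v, rfl⟩ := cpq_surj x
  have hom : IsOpenQuotientMap (Prod.map cpq id : {v : Vn n // v ≠ 0} × P → CP n × P) :=
    isOpenQuotientMap_cpq.prodMap .id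
  have e : 𝓝[S] (cpq v, a) = Filter.map (Prod.map cpq id) (𝓝[Prod.map cpq id ⁻¹' S] (v, a)) := by
    unfold nhdsWithin
    rw [← Filter.comap_principal, Filter.push_pull, hom.isOpenMap.map_nhds_eq hom.continuous.continuousAt]
    rfl
  show Filter.Tendsto F (𝓝[S] (cpq v, a)) _
  rw [e, Filter.tendsto_map'_iff]
  have h1 : ContinuousOn (fun p : {v : Vn n // v ≠ 0} × P => F (cp p.1.1, p.2)) (Prod.map cpq id ⁻¹' S) := by
    refine h.comp (f := fun p : {v : Vn n // v ≠ 0} × P => (p.1.1, p.2)) (by fun_prop) ?_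
    rintro ⟨w, b⟩ hb
    refine ⟨w.2, ?_⟩
    simp only [cp_of w.2]; exact hb
  have h2 := h1 (v, a) hx
  have e2 : (fun p : {v : Vn n // v ≠ 0} × P => F (cp p.1.1, p.2)) = F ∘ Prod.map cpq id := by
    funext p
    simp only [cp_of p.1.2]; rfl
  rw [e2] at h2
  exact h2

lemma cp_contOn' {T : Type*} [TopologicalSpace T] {F : CP n → T} {S : Set (CP n)}
    (h : ContinuousOn (fun v : Vn n => F (cp v)) {v | v ≠ 0 ∧ cp v ∈ S}) : ContinuousOn F S := by
  have h1 : ContinuousOn (fun p : CP n × Unit => F p.1) {p | p.1 ∈ S} :=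
    cp_contOn (h.comp continuous_fst.continuousOn fun p hp => hp)
  exact h1.comp (f := fun x => (x, ())) (by fun_prop) fun x hx => hx

lemma cp_cont {T : Type*} [TopologicalSpace T] {F : CP n → T}
    (h : ContinuousOn (fun v : Vn n => F (cp v)) {v | v ≠ 0}) : Continuous F := by
  rw [← continuousOn_univ]
  exact cp_contOn' (h.mono fun v hv => hv.1)

instance : CompactSpace (CP n) := by
  rw [← isCompact_univ_iff]
  have h := (isCompact_sphere (0 : Vn n) 1).image_of_continuousOn (continuousOn_cp.mono fun v hv h0 => by
    rw [mem_sphere_zero_iff_norm, h0, norm_zero] at hv; exact zero_ne_one hv)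
  convert h
  symm
  refine Set.eq_univ_of_forall fun x => ?_
  obtain ⟨v, hv, rfl⟩ := cp_surj x
  have h0 : ‖v‖ ≠ 0 := norm_ne_zero_iff.2 hv
  have hc : ((‖v‖⁻¹ : ℝ) : ℂ) ≠ 0 := by exact_mod_cast inv_ne_zero h0
  refine ⟨((‖v‖⁻¹ : ℝ) : ℂ) • v, ?_, cp_smul hv hc⟩
  rw [mem_sphere_zero_iff_norm, norm_smul, Complex.norm_real, norm_inv, norm_norm, inv_mul_cancel₀ h0]

lemma cp_path {v w : Vn n} (hv : v ≠ 0) (hw : w ≠ 0) : ∃ γ : ℝ → CP n, Continuous γ ∧ γ 0 = cp v ∧ γ 1 = cp w ∧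
    ∀ t, ∃ a b : ℂ, a • v + b • w ≠ 0 ∧ γ t = cp (a • v + b • w) := by
  by_cases h : ∃ c : ℂ, w = c • v
  · obtain ⟨c, rfl⟩ := h
    have hc : c ≠ 0 := by rintro rfl; exact hw (zero_smul _ _)
    exact ⟨fun _ => cp v, continuous_const, rfl, (cp_smul hv hc).symm, fun t => ⟨1, 0, by simpa using hv, by simp⟩⟩
  · have hne : ∀ t : ℝ, (1 - (t : ℂ)) • v + (t : ℂ) • w ≠ 0 := by
      intro t h0
      by_cases ht : t = 0
      · subst ht; apply hv; simpa using h0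
      · apply h
        have ht' : (t : ℂ) ≠ 0 := by exact_mod_cast ht
        refine ⟨-((t : ℂ)⁻¹ * (1 - t)), ?_⟩
        have := eq_neg_of_add_eq_zero_right h0
        rw [neg_smul, mul_smul, ← smul_neg, ← this, inv_smul_smul₀ ht']
    refine ⟨fun t => cp ((1 - (t : ℂ)) • v + (t : ℂ) • w), ?_, by simp, by simp, fun t => ⟨_, _, hne t, rfl⟩⟩
    exact continuousOn_cp.comp_continuous (by fun_prop) hne

instance : PathConnectedSpace (CP n) := by
  refine ⟨⟨cp 1⟩, fun x y => ?_⟩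
  obtain ⟨v, hv, rfl⟩ := cp_surj x
  obtain ⟨w, hw, rfl⟩ := cp_surj y
  obtain ⟨γ, h, h0, h1, -⟩ := cp_path hv hw
  exact ⟨⟨⟨fun t => γ t, h.comp continuous_subtype_val⟩, by simpa using h0, by simpa using h1⟩⟩

end CPn

end HS

namespace HS

section CPcol
variable {n : ℕ}
open OnePoint

def tl (z : Vn (n + 1)) : Vn n := fun i => z i.succ
def cn (s : ℂ) (v : Vn n) : Vn (n + 1) := Fin.cons s v

@[simp] lemma cn_zero (s : ℂ) (v : Vn n) : cn s v 0 = s := rfl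
@[simp] lemma tl_cn (s : ℂ) (v : Vn n) : tl (cn s v) = v := rfl
lemma cn_tl (z : Vn (n + 1)) : cn (z 0) (tl z) = z := Fin.cons_self_tail z
lemma cn_smul (c s : ℂ) (v : Vn n) : cn (c * s) (c • v) = c • cn s v := by
  funext i; refine Fin.cases ?_ (fun j => ?_) i <;> rfl
lemma cn_ne {s : ℂ} {v : Vn n} (h : s ≠ 0 ∨ v ≠ 0) : cn s v ≠ 0 := by
  intro h0
  rcases h with h | h
  · exact h (by have := congrFun h0 0; exact this)
  · apply h; rw [← tl_cn s v, h0]; rfl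
lemma ne_cases {z : Vn (n + 1)} (h : z ≠ 0) : z 0 ≠ 0 ∨ tl z ≠ 0 := by
  by_contra! hc
  apply h; rw [← cn_tl z, hc.1, hc.2]; funext i; refine Fin.cases ?_ (fun j => ?_) i <;> rfl
lemma continuous_tl : Continuous (tl : Vn (n + 1) → Vn n) := by unfold tl; fun_prop
lemma continuous_cn : Continuous fun p : ℂ × Vn n => cn p.1 p.2 := by
  refine continuous_pi fun i => ?_
  refine Fin.cases ?_ (fun j => ?_) i
  · exact continuous_fst
  · exact (continuous_apply j).comp continuous_snd

/-- the base point -/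
def aL (n : ℕ) : CP n := cp (Pi.single (Fin.last n) 1)

lemma cn_last : cn 0 (Pi.single (Fin.last n) 1 : Vn n) = Pi.single (Fin.last (n + 1)) 1 := by
  funext i
  refine Fin.cases ?_ (fun j => ?_) i
  · rw [cn_zero, Pi.single_eq_of_ne]; exact (Fin.last_pos).ne
  · show (Pi.single (Fin.last n) 1 : Vn n) j = _
    by_cases h : j = Fin.last n
    · subst h; rw [Pi.single_eq_same, Fin.succ_last, Pi.single_eq_same]
    · rw [Pi.single_eq_of_ne h, Pi.single_eq_of_ne]
      rw [← Fin.succ_last]; exact fun h' => h (Fin.succ_injective _ h')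

lemma single_last_ne : (Pi.single (Fin.last n) 1 : Vn n) ≠ 0 := by
  intro h; have := congrFun h (Fin.last n); rw [Pi.single_eq_same] at this; exact one_ne_zero this

def qC (x : CP (n + 1)) : OnePoint (Vn n) := GG (rep x 0) (tl (rep x))
def jC (v : Vn n) : CP (n + 1) := cp (cn 1 v)
def PC (p : CP (n + 1) × ℝ) : CP (n + 1) := cp (cn ((1 - p.2) * rep p.1 0) (tl (rep p.1)))
/-- inclusion of the hyperplane -/
def hC (y : CP n) : CP (n + 1) := cp (cn 0 (rep y))

lemma tl_smul (c : ℂ) (z : Vn (n + 1)) : tl (c • z) = c • tl z := rfl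

lemma qC_cp {z : Vn (n + 1)} (h : z ≠ 0) : qC (cp z) = GG (z 0) (tl z) := by
  obtain ⟨c, hc, e⟩ := rep_cp h
  unfold qC; rw [e, tl_smul]
  exact GG_scale hc

lemma PC_cp {z : Vn (n + 1)} (h : z ≠ 0) (h' : tl z ≠ 0) (t : ℝ) : PC (cp z, t) = cp (cn ((1 - t) * z 0) (tl z)) := by
  obtain ⟨c, hc, e⟩ := rep_cp h
  unfold PC
  simp only
  rw [e, tl_smul, ← cp_smul (cn_ne (Or.inr h')) hc, ← cn_smul]
  congr 2
  simp only [Pi.smul_apply, smul_eq_mul]; ring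

lemma hC_cp {w : Vn n} (h : w ≠ 0) : hC (cp w) = cp (cn 0 w) := by
  obtain ⟨c, hc, e⟩ := rep_cp h
  unfold hC
  rw [e, ← cp_smul (cn_ne (Or.inr h)) hc, ← cn_smul, mul_zero]

lemma hC_aL : hC (aL n) = aL (n + 1) := by
  unfold aL; rw [hC_cp single_last_ne, cn_last]

lemma continuous_hC : Continuous (hC : CP n → CP (n + 1)) := by
  refine cp_cont ?_
  have : ContinuousOn (fun w : Vn n => cp (cn 0 w)) {w | w ≠ 0} :=
    continuousOn_cp.comp (continuous_cn.comp (Continuous.prodMk continuous_const continuous_id)).continuousOn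
      fun w hw => cn_ne (Or.inr hw)
  exact this.congr fun w hw => hC_cp hw

lemma hC_injective : Function.Injective (hC : CP n → CP (n + 1)) := by
  intro x y h
  obtain ⟨v, hv, rfl⟩ := cp_surj x
  obtain ⟨w, hw, rfl⟩ := cp_surj y
  rw [hC_cp hv, hC_cp hw, cp_eq (cn_ne (Or.inr hv)) (cn_ne (Or.inr hw))] at h
  obtain ⟨c, hc, e⟩ := h
  refine (cp_eq hv hw).2 ⟨c, hc, ?_⟩
  have := congrArg tl e
  exact this

lemma hC_closedEmb : Topology.IsClosedEmbedding (hC : CP n → CP (n + 1)) :=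
  continuous_hC.isClosedEmbedding hC_injective

lemma qC_infty {x : CP (n + 1)} : qC x = ∞ ↔ x ∈ Set.range (hC : CP n → CP (n + 1)) := by
  obtain ⟨z, hz, rfl⟩ := cp_surj x
  rw [qC_cp hz, GG_eq_infty]
  constructor
  · intro h
    have ht := (ne_cases hz).resolve_left (not_not.2 h)
    exact ⟨cp (tl z), by rw [hC_cp ht, ← h, cn_tl]⟩
  · rintro ⟨y, hy⟩
    obtain ⟨w, hw, rfl⟩ := cp_surj y
    rw [hC_cp hw, cp_eq (cn_ne (Or.inr hw)) hz] at hy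
    obtain ⟨c, hc, e⟩ := hy
    rw [e]; simp

lemma GG_eq_zero {s : ℂ} {v : Vn n} (h : s ≠ 0 ∨ v ≠ 0) : GG s v = ((0 : Vn n) : OnePoint (Vn n)) ↔ v = 0 := by
  by_cases hs : s = 0
  · have hv := h.resolve_left (not_not.2 hs)
    rw [hs, GG_zero]
    exact ⟨fun h => absurd h (OnePoint.infty_ne_coe _), fun h => absurd h hv⟩
  · rw [GG_ne hs, OnePoint.coe_eq_coe, smul_eq_zero]
    simp [hs]

lemma collapse_CP : Collapse (aL (n + 1)) (qC : CP (n + 1) → OnePoint (Vn n)) jC PC where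
  cont_q := by
    refine cp_cont ?_
    have : ContinuousOn (fun z : Vn (n + 1) => GG (z 0) (tl z)) {z | z ≠ 0} :=
      continuousOn_GG.comp ((continuous_apply 0).prodMk continuous_tl).continuousOn fun z hz => ne_cases hz
    exact this.congr fun w hw => qC_cp hw
  q_a0 := qC_infty.2 ⟨aL n, hC_aL⟩
  cont_j := continuousOn_cp.comp_continuous (continuous_cn.comp (Continuous.prodMk continuous_const continuous_id))
    fun v => cn_ne (Or.inl one_ne_zero)
  q_j v := by
    unfold jC
    rw [qC_cp (cn_ne (Or.inl one_ne_zero)), cn_zero, tl_cn, GG_ne one_ne_zero, inv_one, one_smul]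
  j_q x v h := by
    obtain ⟨z, hz, rfl⟩ := cp_surj x
    rw [qC_cp hz] at h
    have h0 : z 0 ≠ 0 := by
      intro h0; rw [h0, GG_zero] at h; exact OnePoint.infty_ne_coe _ h
    rw [GG_ne h0, OnePoint.coe_eq_coe] at h
    unfold jC
    rw [← h, ← cp_smul (cn_ne (Or.inl one_ne_zero)) h0, ← cn_smul, mul_one, smul_inv_smul₀ h0, cn_tl]
  cont_Ψ := by
    refine cp_contOn ?_
    have h1 : Continuous fun p : Vn (n + 1) × ℝ => cn ((1 - (p.2 : ℂ)) * p.1 0) (tl p.1) := by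
      have : Continuous fun p : Vn (n + 1) × ℝ => (1 - (p.2 : ℂ)) * p.1 0 := by fun_prop
      exact continuous_cn.comp (this.prodMk (continuous_tl.comp continuous_fst))
    have h3 : ∀ p : Vn (n + 1) × ℝ, p ∈ {p : Vn (n + 1) × ℝ | p.1 ≠ 0 ∧ (cp p.1, p.2) ∈
        {x : CP (n + 1) | qC x ≠ ((0 : Vn n) : OnePoint (Vn n))} ×ˢ Set.Icc (0:ℝ) 1} → p.1 ≠ 0 ∧ tl p.1 ≠ 0 := by
      rintro ⟨z, t⟩ ⟨hz, h, -⟩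
      have h : qC (cp z) ≠ ((0 : Vn n) : OnePoint (Vn n)) := h
      rw [qC_cp hz] at h
      exact ⟨hz, fun h0 => h ((GG_eq_zero (ne_cases hz)).2 h0)⟩
    have h2 := continuousOn_cp.comp h1.continuousOn (t := {v : Vn (n + 1) | v ≠ 0}) (fun p hp => cn_ne (Or.inr (h3 p hp).2))
    exact h2.congr fun p hp => PC_cp (h3 p hp).1 (h3 p hp).2 _
  Ψ0 x hx := by
    obtain ⟨z, hz, rfl⟩ := cp_surj x
    rw [qC_cp hz] at hx
    have ht : tl z ≠ 0 := fun h0 => hx ((GG_eq_zero (ne_cases hz)).2 h0)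
    rw [PC_cp hz ht]
    simp [cn_tl]
  Ψinf x hx t _ := by
    obtain ⟨z, hz, rfl⟩ := cp_surj x
    rw [qC_cp hz, GG_eq_infty] at hx
    have ht : tl z ≠ 0 := (ne_cases hz).resolve_left (not_not.2 hx)
    rw [PC_cp hz ht, hx, mul_zero]
    conv_rhs => rw [← cn_tl z, hx]
  Ψ1 x hx := by
    obtain ⟨z, hz, rfl⟩ := cp_surj x
    rw [qC_cp hz] at hx
    have ht : tl z ≠ 0 := fun h0 => hx ((GG_eq_zero (ne_cases hz)).2 h0)
    rw [PC_cp hz ht, qC_cp (cn_ne (Or.inr ht)), GG_eq_infty]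
    simp
  mono x r hr h t ht' := by
    obtain ⟨z, hz, rfl⟩ := cp_surj x
    rw [qC_cp hz, GG_far] at h
    have ht : tl z ≠ 0 := by
      intro h0
      rw [h0, norm_zero] at h
      rcases h with h | h
      · exact (ne_cases hz).elim (fun h' => h' h) (fun h' => h' h0)
      · have : 0 ≤ r * ‖z 0‖ := by positivity
        linarith
    rw [PC_cp hz ht, qC_cp (cn_ne (Or.inr ht)), GG_far, cn_zero, tl_cn]
    rcases h with h | h
    · left; rw [h, mul_zero]
    · right
      refine lt_of_le_of_lt (mul_le_mul_of_nonneg_left ?_ hr) h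
      have e : (1 - (t : ℂ)) = ((1 - t : ℝ) : ℂ) := by push_cast; rfl
      rw [norm_mul, e, Complex.norm_real, Real.norm_eq_abs, abs_of_nonneg (by linarith [ht'.2])]
      have := norm_nonneg (z 0)
      nlinarith [ht'.1]
  path a ha := by
    obtain ⟨y, rfl⟩ := qC_infty.1 ha
    obtain ⟨w, hw, rfl⟩ := cp_surj y
    obtain ⟨γ, h, h0, h1, -⟩ := cp_path single_last_ne hw
    refine ⟨fun t => hC (γ t), continuous_hC.comp h, ?_, ?_, fun t => qC_infty.2 ⟨_, rfl⟩⟩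
    · simp only [h0]; exact hC_aL
    · simp only [h1]

structure CPOK (n : ℕ) : Prop where
  hasZ : ∀ (ι : Type) [Fintype ι] (i : ι), Even (Fintype.card ι) → Fintype.card ι ≤ 2 * n →
    HasZ ι i Set.univ (zz (aL n))
  conn : ∀ (ι : Type) [Fintype ι], ¬ (Even (Fintype.card ι) ∧ 1 ≤ Fintype.card ι ∧ Fintype.card ι ≤ 2 * n) →
    Conn ι Set.univ {zz (aL n)}

lemma CPOK.zero : CPOK 0 := by
  have hp : ∀ x : CP 0, x = aL 0 := by
    intro x
    obtain ⟨v, hv, rfl⟩ := cp_surj x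
    have h0 : v 0 ≠ 0 := by
      intro h; apply hv; funext i; rw [show i = 0 from Fin.ext (by have := i.2; omega)]; exact h
    refine (cp_eq hv single_last_ne).2 ⟨(v 0)⁻¹, inv_ne_zero h0, ?_⟩
    funext i
    rw [show i = 0 from Fin.ext (by have := i.2; omega)]
    show (1 : ℂ) = _
    simp [h0]
  have hz : ∀ ξ : Z (CP 0) (aL 0), ξ = zz (aL 0) := by
    intro ξ
    apply Subtype.ext
    rw [zz_val]
    refine Multiset.eq_zero_of_forall_notMem fun x hx => ξ.2 ?_
    have hx : x ∈ ξ.1 := hx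
    have e := hp x
    subst e; exact hx
  constructor
  · intro ι _ i _ h
    have := Fintype.card_pos_iff.2 ⟨i⟩
    omega
  · intro ι _ _
    apply Conn.of_null
    intro f hf
    have e : f = fun _ => zz (aL 0) := funext fun x => hz _
    rw [e]
    exact RH.refl continuous_const fun _ => Set.mem_univ _

lemma exists_homeo_V (n : ℕ) : ∃ h : OnePoint (Vn n) ≃ₜ OnePoint (Eu (2 * (n + 1))), h ∞ = ∞ := by
  have hV : Module.finrank ℝ (Vn n) = Module.finrank ℝ (Eu (2 * (n + 1))) := by
    rw [Module.finrank_pi_fintype]; simp [Complex.finrank_real_complex]; ring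
  let e : Vn n ≃ₜ Eu (2 * (n + 1)) :=
    (FiniteDimensional.nonempty_continuousLinearEquiv_of_finrank_eq hV).some.toHomeomorph
  exact ⟨e.onePointCongr, rfl⟩

lemma CPOK.succ (h : CPOK n) : CPOK (n + 1) := by
  obtain ⟨hh, he⟩ := exists_homeo_V n
  have hS := SphOK.all (2 * (n + 1)) (by omega)
  have hBz : ∀ (ι : Type) [Fintype ι] (i : ι), Fintype.card ι = 2 * (n + 1) → HasZ ι i Set.univ (zz (∞ : OnePoint (Vn n))) :=
    fun ι _ i hi => HasZ.homeo hh he (hS.hasZ ι i hi)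
  have hBc : ∀ (ι : Type) [Fintype ι], Fintype.card ι ≠ 2 * (n + 1) →
      Conn ι (Set.univ : Set (Z (OnePoint (Vn n)) ∞)) {zz (∞ : OnePoint (Vn n))} :=
    fun ι _ hi => Conn.homeo hh he (hS.conn ι hi)
  have hQ := (collapse_CP (n := n)).QF' (zz ∞)
  have hq0 : (zmap qC : Z (CP (n + 1)) (aL (n + 1)) → Z (OnePoint (Vn n)) ∞) (zz _) = zz ∞ := zmap_zz collapse_CP.q_a0
  have hemb := (zmap_closedEmbedding (hC_closedEmb (n := n)) hC_aL).isEmbedding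
  have h0 := zmap_zz (hC_aL (n := n))
  have hF : (zmap hC : Z (CP n) (aL n) → Z (CP (n + 1)) (aL (n + 1))) '' Set.univ =
      (zmap qC : Z (CP (n + 1)) (aL (n + 1)) → Z (OnePoint (Vn n)) ∞) ⁻¹' {zz ∞} := by
    rw [pre_zz collapse_CP.q_a0, Set.image_univ, zmap_range hC_aL]
    congr 1
    ext x; exact qC_infty.symm
  have hFc : ∀ (ι : Type) [Fintype ι], ¬ (Even (Fintype.card ι) ∧ 1 ≤ Fintype.card ι ∧ Fintype.card ι ≤ 2 * n) →
      Conn ι ((zmap qC : Z (CP (n + 1)) (aL (n + 1)) → Z (OnePoint (Vn n)) ∞) ⁻¹' {zz ∞}) {zz (aL (n + 1))} := by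
    intro ι _ hι
    have := Conn.emb hemb (Set.subset_univ _) (h.conn ι hι)
    rwa [hF, Set.image_singleton, h0] at this
  have hFz : ∀ (ι : Type) [Fintype ι] (i : ι), Even (Fintype.card ι) → Fintype.card ι ≤ 2 * n →
      HasZ ι i ((zmap qC : Z (CP (n + 1)) (aL (n + 1)) → Z (OnePoint (Vn n)) ∞) ⁻¹' {zz ∞}) (zz (aL (n + 1))) := by
    intro ι _ i h1 h2
    have := HasZ.emb hemb (h.hasZ ι i h1 h2)
    rwa [hF, h0] at this
  constructor
  · intro ι _ i hev hle
    rcases eq_or_ne (Fintype.card ι) (2 * (n + 1)) with hc | hc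
    · refine HasZ.some_reindex (ι := Fin (2 * n + 1)) i (fun k => ?_) (by simp; omega) (by simp)
      refine HasZ.total hQ hq0 (hFc _ ?_) (hFc _ ?_) (hBz _ _ ?_)
      · simp; try omega
      · simp
      · simp; try omega
    · refine (HasZ.incl (y0 := zz (aL (n + 1))) (Set.subset_univ _) (show _ ∈ (zmap qC : Z (CP (n + 1)) (aL (n + 1)) → Z (OnePoint (Vn n)) ∞) ⁻¹' {zz ∞} from hq0) (hQ.connF (hBc ι hc)) (hQ.connF (hBc (Option ι) ?_))).1 (hFz ι i hev ?_)
      · rw [Fintype.card_option]; obtain ⟨r, hr⟩ := hev; omega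
      · obtain ⟨r, hr⟩ := hev; omega
  · intro ι _ hι
    have hc : Fintype.card ι ≠ 2 * (n + 1) := by
      intro hc; exact hι ⟨⟨n + 1, by omega⟩, by omega, by omega⟩
    refine Conn.trans (Set.subset_univ _) ?_ (hQ.connF (hBc ι hc)) (hFc ι fun h' => hι ⟨h'.1, h'.2.1, by omega⟩)
    rw [Set.singleton_subset_iff]; exact hq0

lemma CPOK.all (n : ℕ) : CPOK n := by
  induction n with
  | zero => exact CPOK.zero
  | succ n ih => exact ih.succ

end CPcol

end HS

namespace HS

section sard
variable {κ : Type} [Fintype κ]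

/-- radial clamp homotopy -/
def rcl (p : (κ → ℝ) × ℝ) : κ → ℝ :=
  ((1 - cl01 p.2) + cl01 p.2 * (max 1 ‖p.1‖)⁻¹) • p.1

lemma continuous_rcl : Continuous (rcl (κ := κ)) := by
  have h : Continuous fun p : (κ → ℝ) × ℝ => (max 1 ‖p.1‖)⁻¹ :=
    Continuous.inv₀ (by fun_prop) (fun p => (lt_of_lt_of_le one_pos (le_max_left _ _)).ne')
  have h1 := continuous_cl01
  unfold rcl
  fun_prop

lemma rcl_zero (x : κ → ℝ) : rcl (x, 0) = x := by
  simp [rcl, cl01_of_le le_rfl]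

lemma norm_rcl_one (x : κ → ℝ) : ‖rcl (x, 1)‖ ≤ 1 := by
  have h0 : 0 < max 1 ‖x‖ := lt_of_lt_of_le one_pos (le_max_left _ _)
  simp only [rcl, cl01_of_ge le_rfl, sub_self, zero_add, one_mul, norm_smul, norm_inv,
    Real.norm_of_nonneg h0.le]
  rw [inv_mul_le_iff₀ h0]; simp

lemma norm_rcl_ge {x : κ → ℝ} (hx : 1 ≤ ‖x‖) (t : ℝ) : 1 ≤ ‖rcl (x, t)‖ := by
  have hx0 : 0 < ‖x‖ := by linarith
  have h0 := cl01_nonneg t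
  have h1 := cl01_le t
  have hp : 0 ≤ (1 - cl01 t) + cl01 t * ‖x‖⁻¹ := by
    have := inv_pos.2 hx0
    nlinarith [mul_nonneg h0 this.le]
  simp only [rcl, max_eq_right hx, norm_smul, Real.norm_of_nonneg hp]
  rw [add_mul, mul_assoc, inv_mul_cancel₀ hx0.ne']
  nlinarith

/-- Any map of pairs is pair-homotopic to a radially constant one. -/
lemma PH.rad {Y : Type*} [TopologicalSpace Y] {A B : Set Y} {g : (κ → ℝ) → Y} (hg : Continuous g)
    (hA : ∀ x, g x ∈ A) (hB : ∀ x, 1 ≤ ‖x‖ → g x ∈ B) : PH A B g fun x => g (rcl (x, 1)) :=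
  ⟨fun p => g (rcl p), hg.comp continuous_rcl, fun x => by simp [rcl_zero], fun x => rfl,
    fun p => hA _, fun x t hx => hB _ (norm_rcl_ge hx t)⟩

lemma exists_close_avoid {E : Type*} [NormedAddCommGroup E] [NormedSpace ℝ E]
    [FiniteDimensional ℝ E] {B : Set E} (hB : B.Finite)
    (hκ : Fintype.card κ < Module.finrank ℝ E) {f : (κ → ℝ) → E} (hf : Continuous f) {ε : ℝ}
    (hε : 0 < ε) : ∃ f' : (κ → ℝ) → E, Continuous f' ∧ (∀ x, ‖f' x - f x‖ < ε) ∧ ∀ x, f' x ∉ B := by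
  obtain ⟨g, hg, hgf, -⟩ := hf.exists_contDiff_approx 1 (ε := fun _ => ε / 2) continuous_const
    (fun _ => by positivity)
  have hd : dimH (⋃ β ∈ B, Set.range fun x => β - g x) < Module.finrank ℝ E := by
    rw [dimH_bUnion hB.countable]
    refine lt_of_le_of_lt (iSup₂_le fun β _ => ?_) (Nat.cast_lt.2 hκ)
    have h1 : ContDiff ℝ 1 fun x => β - g x := contDiff_const.sub hg
    have := h1.dimH_range_le
    simpa using this
  obtain ⟨b, hb, hb'⟩ := (_root_.dense_compl_of_dimH_lt_finrank hd).exists_mem_open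
    Metric.isOpen_ball (Metric.nonempty_ball.2 (half_pos hε) : (Metric.ball (0 : E) (ε / 2)).Nonempty)
  refine ⟨fun x => g x + b, hg.continuous.add continuous_const, fun x => ?_, fun x hx => ?_⟩
  · have h1 := hgf x
    rw [dist_eq_norm] at h1
    have h2 : ‖b‖ < ε / 2 := mem_ball_zero_iff.1 hb'
    calc ‖g x + b - f x‖ = ‖(g x - f x) + b‖ := by congr 1; abel
      _ ≤ _ := norm_add_le _ _
      _ < ε := by linarith
  · refine hb ?_
    simp only [Set.mem_iUnion]
    exact ⟨_, hx, x, by simp⟩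

/-- General position: finite sets can be avoided by low dimensional discs. -/
lemma Conn.avoid {E : Type*} [NormedAddCommGroup E] [NormedSpace ℝ E]
    [FiniteDimensional ℝ E] {Ω B : Set E} (hΩ : IsOpen Ω) (hB : B.Finite)
    (hκ : Fintype.card κ < Module.finrank ℝ E) : Conn κ Ω (Ω \ B) := by
  intro g hg hA hO
  let f := fun x : κ → ℝ => g (rcl (x, 1))
  have hf : Continuous f := hg.comp (continuous_rcl.comp (by fun_prop))
  have hK : IsCompact (g '' Metric.closedBall 0 1) := (isCompact_closedBall _ _).image hg
  have hS : IsCompact (g '' Metric.sphere 0 1) := (isCompact_sphere _ _).image hg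
  obtain ⟨δ, hδ, h1⟩ := hK.exists_thickening_subset_open hΩ (by rintro _ ⟨x, -, rfl⟩; exact hA x)
  obtain ⟨δ', hδ', h2⟩ := hS.exists_thickening_subset_open hB.isClosed.isOpen_compl
    (by rintro _ ⟨x, hx, rfl⟩; exact (hO x (mem_sphere_zero_iff_norm.1 hx).ge).2)
  obtain ⟨f', hf', hff, hB'⟩ := exists_close_avoid hB hκ hf (lt_min hδ hδ')
  have hd : ∀ x t, dist (f x + cl01 t • (f' x - f x)) (f x) < min δ δ' := fun x t => by
    rw [dist_eq_norm, add_sub_cancel_left, norm_smul, Real.norm_of_nonneg (cl01_nonneg t)]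
    exact lt_of_le_of_lt (mul_le_of_le_one_left (norm_nonneg _) (cl01_le t)) (hff x)
  have hin : ∀ x t, f x + cl01 t • (f' x - f x) ∈ Ω := fun x t => h1
    (Metric.mem_thickening_iff.2 ⟨f x, ⟨_, mem_closedBall_zero_iff.2 (norm_rcl_one x), rfl⟩,
      (hd x t).trans_le (min_le_left _ _)⟩)
  have hc : Continuous fun p : (κ → ℝ) × ℝ => f p.1 + cl01 p.2 • (f' p.1 - f p.1) := by
    have := continuous_cl01
    fun_prop
  refine ((PH.rad hg hA hO).trans (g'' := f') ⟨_, hc, fun x => ?_, fun x => ?_, fun p => hin _ _,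
    fun x t hx => ⟨hin _ _, ?_⟩⟩).compress fun x => ⟨?_, hB' x⟩
  · simp [cl01_of_le le_rfl, f]
  · simp [cl01_of_ge le_rfl]
  · exact h2 (Metric.mem_thickening_iff.2 ⟨f x, ⟨_, mem_sphere_zero_iff_norm.2
      (le_antisymm (norm_rcl_one x) (norm_rcl_ge hx 1)), rfl⟩, (hd x t).trans_le (min_le_right _ _)⟩)
  · simpa [cl01_of_ge le_rfl] using hin x 1

end sard
end HS

namespace HS

section spmap
variable {X X' P : Type*} [TopologicalSpace X] [TopologicalSpace X'] [TopologicalSpace P] {d : ℕ}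

lemma SP.isOpenMap_mk : IsOpenMap (_root_.SP.mk : (Fin d → X) → SP d X) := by
  intro U hU
  rw [← SP.isQuotientMap_mk.isOpen_preimage]
  have : (_root_.SP.mk : (Fin d → X) → SP d X) ⁻¹' (_root_.SP.mk '' U)
      = ⋃ σ : Equiv.Perm (Fin d), (fun f : Fin d → X => f ∘ σ) ⁻¹' U := by
    ext f
    simp only [Set.mem_preimage, Set.mem_image, Set.mem_iUnion]
    constructor
    · rintro ⟨g, hg, h⟩
      obtain ⟨σ, hσ⟩ := exists_perm_of_ms_eq (SP.mk_eq.1 h)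
      refine ⟨σ⁻¹, ?_⟩
      convert hg using 1
      first
        | (rw [← hσ]; funext i; simp)
        | (rw [hσ]; funext i; simp)
    · rintro ⟨σ, hσ⟩
      exact ⟨_, hσ, SP.mk_eq.2 (ms_equiv σ f)⟩
  rw [this]
  exact isOpen_iUnion fun σ => hU.preimage (by fun_prop)

lemma SP.quot_prod : Topology.IsQuotientMap
    (Prod.map (_root_.SP.mk : (Fin d → X) → SP d X) (id : P → P)) :=
  (IsOpenMap.prodMap SP.isOpenMap_mk IsOpenMap.id).isQuotientMap
    (SP.isQuotientMap_mk.continuous.prodMap continuous_id)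
    (SP.mk_surj.prodMap Function.surjective_id)

/-- points of the symmetric product supported in `O` -/
def spO (d : ℕ) (O : Set X) : Set (SP d X) := {p | ∀ x ∈ SP.ms p, x ∈ O}

lemma spO_mk {O : Set X} {f : Fin d → X} : _root_.SP.mk f ∈ spO d O ↔ ∀ i, f i ∈ O := by
  simp only [spO, Set.mem_ofPred_eq, SP.ms_mk, mem_ms]
  constructor
  · intro h i; exact h _ ⟨i, rfl⟩
  · rintro h _ ⟨i, rfl⟩; exact h i

lemma isOpen_spO {O : Set X} (hO : IsOpen O) : IsOpen (spO d O) := by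
  rw [← SP.isQuotientMap_mk.isOpen_preimage]
  have : _root_.SP.mk ⁻¹' (spO d O) = ⋂ i, {f : Fin d → X | f i ∈ O} := by
    ext f; simp [spO_mk]
  rw [this]
  exact isOpen_iInter_of_finite fun i => hO.preimage (continuous_apply i)

/-- functoriality of the symmetric product, with parameters -/
def SP.mp (φ : X × P → X') (q : SP d X × P) : SP d X' :=
  _root_.SP.mk fun i => φ (Function.surjInv SP.mk_surj q.1 i, q.2)

lemma SP.ms_mp (φ : X × P → X') (q : SP d X × P) :
    SP.ms (SP.mp φ q) = (SP.ms q.1).map fun x => φ (x, q.2) := by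
  rw [SP.mp, SP.ms_mk, ← ms_map (fun x => φ (x, q.2)), ← SP.ms_mk, Function.surjInv_eq SP.mk_surj]

lemma SP.mp_mk (φ : X × P → X') (f : Fin d → X) (p : P) :
    SP.mp φ (_root_.SP.mk f, p) = _root_.SP.mk fun i => φ (f i, p) := by
  apply SP.ext
  rw [SP.ms_mp, SP.ms_mk, SP.ms_mk, ms_map (fun x => φ (x, p))]

lemma SP.contOn_mp {φ : X × P → X'} {O : Set X} (hO : IsOpen O)
    (hφ : ContinuousOn φ (O ×ˢ Set.univ)) :
    ContinuousOn (SP.mp φ : SP d X × P → SP d X') (spO d O ×ˢ Set.univ) := by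
  rcases isEmpty_or_nonempty (SP d X') with he | he
  · intro q; exact (he.false (SP.mp φ q)).elim
  obtain ⟨ψ, h1, h2⟩ := quot_lift_on (SP.quot_prod (X := X) (P := P) (d := d))
    (O := spO d O ×ˢ Set.univ) ((isOpen_spO hO).prod isOpen_univ)
    (φ := fun q => _root_.SP.mk fun i => φ (q.1 i, q.2)) (by
      refine SP.isQuotientMap_mk.continuous.comp_continuousOn (continuousOn_pi.2 fun i => ?_)
      refine hφ.comp (by fun_prop) fun q hq => ⟨?_, trivial⟩
      exact spO_mk.1 hq.1 i)
    (by
      rintro ⟨f, p⟩ ⟨f', p'⟩ - h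
      simp only [Prod.map, id, Prod.mk.injEq] at h
      obtain ⟨h, rfl⟩ := h
      simp only
      rw [← SP.mp_mk, ← SP.mp_mk, h])
  refine h1.congr ?_
  rintro ⟨q, p⟩ hq
  obtain ⟨f, rfl⟩ := SP.mk_surj q
  exact (SP.mp_mk φ f p).trans (h2 (f, p) hq).symm

/-- Good open sets: there is a deformation onto the image of a planar domain,
compatible with the subset `H`. -/
structure GB (H O : Set X) : Prop where
  op : IsOpen O
  ex : ∃ (R : Set ℂ) (r : X → ℂ) (s : ℂ → X) (Φ : X × ℝ → X), IsOpen R ∧ Bornology.IsBounded R ∧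
    {w | w ∈ R ∧ s w ∈ H}.Finite ∧ ContinuousOn r O ∧ Set.MapsTo r O R ∧ ContinuousOn s R ∧
    Set.MapsTo s R O ∧ ContinuousOn Φ (O ×ˢ Set.univ) ∧ (∀ x ∈ O, Φ (x, 0) = x) ∧
    (∀ x ∈ O, Φ (x, 1) = s (r x)) ∧ (∀ x ∈ O, ∀ t, Φ (x, t) ∈ O) ∧
    ∀ x ∈ O, x ∉ H → ∀ t, Φ (x, t) ∉ H

lemma GB.conn {H O : Set X} (h : GB H O) {e : ℕ} {κ : Type} [Fintype κ]
    (hκ : Fintype.card κ ≤ 2 * e + 1) :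
    Conn κ (spO (e + 1) O) (spO (e + 1) O ∩ {p | ∃ x ∈ SP.ms p, x ∉ H}) := by
  obtain ⟨R, r, s, Φ, hR, -, hN, hr, hrR, hs, hsO, hΦ, hΦ0, hΦ1, hΦO, hΦH⟩ := h.ex
  rcases isEmpty_or_nonempty X with hX | hX
  · intro g; obtain ⟨f, -⟩ := SP.mk_surj (g 0); exact (hX.false (f 0)).elim
  haveI : Nonempty (SP (e + 1) X) := ⟨_root_.SP.mk fun _ => hX.some⟩
  let Ω : Set (Fin (e + 1) → ℂ) := {c | ∀ y, cf y = c → ∀ i, y i ∈ R}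
  have hΩ' : ∀ y, cf y ∈ Ω ↔ ∀ i, y i ∈ R := fun y => by
    refine ⟨fun h => h y rfl, fun h y' hy' i => ?_⟩
    have : y' i ∈ ms y := by rw [← cf_eq.1 hy']; exact mem_ms.2 ⟨i, rfl⟩
    obtain ⟨j, hj⟩ := mem_ms.1 this
    rw [← hj]; exact h j
  have hΩ : IsOpen Ω := by
    rw [← isQuotientMap_cf.isOpen_preimage]
    have : cf ⁻¹' Ω = ⋂ i, {f : Fin (e + 1) → ℂ | f i ∈ R} := by
      ext f; simp [hΩ']
    rw [this]
    exact isOpen_iInter_of_finite fun i => hR.preimage (continuous_apply i)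
  let B : Set (Fin (e + 1) → ℂ) := cf '' (Set.univ.pi fun _ => {w | w ∈ R ∧ s w ∈ H})
  have hB : B.Finite := (Set.Finite.pi' fun _ => hN).image _ |>.subset (by
    rintro _ ⟨y, hy, rfl⟩; exact ⟨y, fun i => hy i trivial, rfl⟩)
  obtain ⟨Λ, hΛ, hΛe⟩ := quot_lift_on (isQuotientMap_cf (d := e + 1)) hΩ
    (φ := fun y => (_root_.SP.mk fun i => s (y i) : SP (e + 1) X)) (by
      refine SP.isQuotientMap_mk.continuous.comp_continuousOn (continuousOn_pi.2 fun i => ?_)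
      exact hs.comp (by fun_prop) fun y hy => (hΩ' y).1 hy i)
    (by
      intro a a' _ haa
      refine SP.mk_eq.2 ?_
      rw [← ms_map s, ← ms_map s, cf_eq.1 haa])
  obtain ⟨Θ, hΘ, hΘe⟩ := quot_lift_on (SP.isQuotientMap_mk (X := X) (d := e + 1))
    (isOpen_spO h.op) (φ := fun f => cf fun i => r (f i)) (by
      refine continuous_cf.comp_continuousOn (continuousOn_pi.2 fun i => ?_)
      exact hr.comp (by fun_prop) fun y hy => spO_mk.1 hy i)
    (by
      intro a a' _ haa
      refine cf_eq.2 ?_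
      rw [← ms_map r, ← ms_map r, SP.mk_eq.1 haa])
  have hΘΩ : ∀ p ∈ spO (e + 1) O, Θ p ∈ Ω := fun p hp => by
    obtain ⟨f, rfl⟩ := SP.mk_surj p
    rw [hΘe f hp, hΩ']
    exact fun i => hrR (spO_mk.1 hp i)
  have hΛO : ∀ c ∈ Ω, Λ c ∈ spO (e + 1) O := fun c hc => by
    obtain ⟨y, rfl⟩ := cf_surj c
    rw [hΛe y hc, spO_mk]
    exact fun i => hsO ((hΩ' y).1 hc i)
  have hΛΘ : ∀ p ∈ spO (e + 1) O, SP.mp Φ (p, (1 : ℝ)) = Λ (Θ p) := fun p hp => by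
    obtain ⟨f, rfl⟩ := SP.mk_surj p
    have h1 := hΘΩ _ hp
    rw [hΘe f hp] at h1 ⊢
    rw [hΛe _ h1, SP.mp_mk]
    congr 1; funext i; exact hΦ1 _ (spO_mk.1 hp i)
  have hΛB : ∀ c ∈ Ω, (c ∉ B ↔ ∃ x ∈ SP.ms (Λ c), x ∉ H) := fun c hc => by
    constructor
    · intro hB
      obtain ⟨y, rfl⟩ := cf_surj c
      rw [hΛe y hc, SP.ms_mk]
      by_contra! hcon
      exact hB ⟨y, fun i _ => ⟨(hΩ' y).1 hc i, hcon _ (mem_ms.2 ⟨i, rfl⟩)⟩, rfl⟩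
    · rintro ⟨x, hx, hxH⟩ ⟨y, hy, rfl⟩
      rw [hΛe y hc, SP.ms_mk] at hx
      obtain ⟨i, rfl⟩ := mem_ms.1 hx
      exact hxH (hy i trivial).2
  intro g hg hA hV
  have hΦO' : ∀ p ∈ spO (e + 1) O, ∀ t : ℝ, SP.mp Φ (p, t) ∈ spO (e + 1) O := fun p hp t => by
    intro x hx
    rw [SP.ms_mp] at hx
    obtain ⟨z, hz, rfl⟩ := Multiset.mem_map.1 hx
    exact hΦO z (hp z hz) t
  have hΦV : ∀ p ∈ spO (e + 1) O, (∃ x ∈ SP.ms p, x ∉ H) → ∀ t : ℝ,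
      ∃ x ∈ SP.ms (SP.mp Φ (p, t)), x ∉ H := fun p hp ⟨x, hx, hxH⟩ t => by
    rw [SP.ms_mp]
    exact ⟨_, Multiset.mem_map.2 ⟨x, hx, rfl⟩, hΦH x (hp x hx) hxH t⟩
  have hP1 : PH (spO (e + 1) O) (spO (e + 1) O ∩ {p | ∃ x ∈ SP.ms p, x ∉ H}) g
      fun x => Λ (Θ (g x)) := by
    refine ⟨fun p => SP.mp Φ (g p.1, p.2), ?_, fun x => ?_, fun x => hΛΘ _ (hA x),
      fun p => hΦO' _ (hA _) _, fun x t hx => ⟨hΦO' _ (hA _) _, hΦV _ (hA _) (hV x hx).2 t⟩⟩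
    · rw [← continuousOn_univ]
      exact (SP.contOn_mp h.op hΦ).comp (by fun_prop) fun p _ => ⟨hA _, trivial⟩
    · apply SP.ext
      rw [SP.ms_mp]
      exact (Multiset.map_congr rfl fun z hz => hΦ0 z (hA x z hz)).trans (Multiset.map_id _)
  have hΘg : Continuous fun x => Θ (g x) := by
    rw [← continuousOn_univ]
    exact hΘ.comp hg.continuousOn fun x _ => hA x
  have hfr : Fintype.card κ < Module.finrank ℝ (Fin (e + 1) → ℂ) := by
    rw [Module.finrank_pi_fintype]
    simp only [Complex.finrank_real_complex, Finset.sum_const, Finset.card_univ, Fintype.card_fin,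
      smul_eq_mul]
    omega
  obtain ⟨c', ⟨K, hK, hK0, hK1, hKΩ, hKo⟩, hc'⟩ := Conn.avoid hΩ hB hfr _ hΘg
    (fun x => hΘΩ _ (hA x)) (fun x hx => ⟨hΘΩ _ (hA x), (hΛB _ (hΘΩ _ (hA x))).2 (by
      rw [← hΛΘ _ (hA x)]
      exact hΦV _ (hA _) (hV x hx).2 1)⟩)
  have hc'' : ∀ x, Λ (c' x) ∈ spO (e + 1) O ∩ {p | ∃ x ∈ SP.ms p, x ∉ H} := fun x =>
    ⟨hΛO _ (hc' x).1, (hΛB _ (hc' x).1).1 (hc' x).2⟩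
  refine (hP1.trans (g'' := fun x => Λ (c' x)) ⟨fun p => Λ (K p), ?_, fun x => by simp only [hK0],
    fun x => by simp only [hK1], fun p => hΛO _ (hKΩ p), fun x t hx => ?_⟩).compress hc''
  · rw [← continuousOn_univ]
    exact hΛ.comp hK.continuousOn fun x _ => hKΩ x
  · simp only [hKo x t hx]
    refine ⟨hΛO _ (hΘΩ _ (hA x)), ?_⟩
    have := hΦV _ (hA _) (hV x hx).2 1
    rwa [hΛΘ _ (hA x)] at this

end spmap
end HS

namespace HS

section charts
variable {n : ℕ}

/-- normalized size of a homogeneous coordinate -/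
def co (k : Fin (n + 1)) (x : CP n) : ℝ := ‖rep x k‖ / ‖rep x‖

lemma co_cp (k : Fin (n + 1)) {v : Vn n} (hv : v ≠ 0) : co k (cp v) = ‖v k‖ / ‖v‖ := by
  obtain ⟨c, hc, h⟩ := rep_cp hv
  simp only [co, h, Pi.smul_apply, norm_smul]
  exact mul_div_mul_left _ _ (norm_ne_zero_iff.2 hc)

lemma continuous_co (k : Fin (n + 1)) : Continuous (co k : CP n → ℝ) := by
  refine cp_cont ?_
  have : ContinuousOn (fun v : Vn n => ‖v k‖ / ‖v‖) {v | v ≠ 0} :=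
    ContinuousOn.div (by fun_prop) (by fun_prop) fun v hv => norm_ne_zero_iff.2 hv
  exact this.congr fun v hv => co_cp k hv

lemma co_nonneg (k : Fin (n + 1)) (x : CP n) : 0 ≤ co k x := by unfold co; positivity

lemma co_cp_eq_zero {k : Fin (n + 1)} {v : Vn n} (hv : v ≠ 0) : co k (cp v) = 0 ↔ v k = 0 := by
  rw [co_cp k hv, div_eq_zero_iff, norm_eq_zero, norm_eq_zero]
  exact ⟨fun h => h.resolve_right hv, Or.inl⟩

/-- affine coordinates -/
def qa (k : Fin (n + 1)) (x : CP n) : Vn n := fun j => rep x j / rep x k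

lemma qa_cp {k : Fin (n + 1)} {v : Vn n} (hv : v ≠ 0) : qa k (cp v) = fun j => v j / v k := by
  obtain ⟨c, hc, h⟩ := rep_cp hv
  funext j
  simp only [qa, h, Pi.smul_apply, smul_eq_mul]
  exact mul_div_mul_left _ _ hc

lemma contOn_qa (k : Fin (n + 1)) : ContinuousOn (qa k : CP n → Vn n) {x | co k x ≠ 0} := by
  refine cp_contOn' ?_
  have : ContinuousOn (fun (v : Vn n) j => v j / v k) {v | v ≠ 0 ∧ co k (cp v) ≠ 0} :=
    continuousOn_pi.2 fun j => ContinuousOn.div (by fun_prop) (by fun_prop) fun v hv h =>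
      hv.2 ((co_cp_eq_zero hv.1).2 h)
  exact this.congr fun v hv => qa_cp hv.1

lemma cp_qa {k : Fin (n + 1)} {x : CP n} (h : co k x ≠ 0) : cp (qa k x) = x ∧ qa k x k = 1 := by
  obtain ⟨v, hv, rfl⟩ := cp_surj x
  have hk : v k ≠ 0 := fun h0 => h ((co_cp_eq_zero hv).2 h0)
  rw [qa_cp hv]
  refine ⟨?_, div_self hk⟩
  rw [← cp_smul hv (inv_ne_zero hk)]
  congr 1
  funext j
  simp [div_eq_inv_mul]

/-- the hyperplane at infinity -/
def Hy (n : ℕ) : Set (CP n) := {x | co (Fin.last n) x = 0}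

lemma mem_Hy {v : Vn n} (hv : v ≠ 0) : cp v ∈ Hy n ↔ v (Fin.last n) = 0 := co_cp_eq_zero hv

lemma ne_of_one {k : Fin (n + 1)} {v : Vn n} (h : v k = 1) : v ≠ 0 := fun h0 => by
  rw [h0] at h; exact zero_ne_one h

lemma GB.box (x : CP n) {W : Set (CP n)} (hW : IsOpen W) (hx : x ∈ W) :
    ∃ O, x ∈ O ∧ O ⊆ W ∧ GB (Hy n) O := by
  have hk : ∃ (k : Fin (n + 1)) (c : ℂ) (v : Vn n), v k = 1 ∧ cp v = x ∧
      ((c = 0 ∧ k = Fin.last n) ∨ (c = 1 ∧ k ≠ Fin.last n ∧ v (Fin.last n) = 0)) := by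
    by_cases hl : co (Fin.last n) x = 0
    · have : ∃ k, co k x ≠ 0 := by
        by_contra! hcon
        obtain ⟨v, hv, rfl⟩ := cp_surj x
        exact hv (funext fun k => (co_cp_eq_zero hv).1 (hcon k))
      obtain ⟨k, hk⟩ := this
      refine ⟨k, 1, qa k x, (cp_qa hk).2, (cp_qa hk).1, Or.inr ⟨rfl, fun h => hk (h ▸ hl), ?_⟩⟩
      rw [← mem_Hy (ne_of_one (cp_qa hk).2), (cp_qa hk).1]
      exact hl
    · exact ⟨Fin.last n, 0, qa _ x, (cp_qa hl).2, (cp_qa hl).1, Or.inl ⟨rfl, rfl⟩⟩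
  obtain ⟨k, c, v, hv1, rfl, hc⟩ := hk
  have hv0 := ne_of_one hv1
  have hat : ContinuousAt (cp : Vn n → CP n) v :=
    continuousOn_cp.continuousAt (isOpen_ne.mem_nhds hv0)
  obtain ⟨ε, hε, hεW⟩ := Metric.mem_nhds_iff.1 (hat (hW.mem_nhds hx))
  let O : Set (CP n) := {x | co k x ≠ 0} ∩ qa k ⁻¹' Metric.ball v ε
  have hO : IsOpen O := (contOn_qa k).isOpen_inter_preimage
    (isOpen_ne.preimage (continuous_co k)) Metric.isOpen_ball
  have hmem : ∀ u : Vn n, u k = 1 → ‖u - v‖ < ε → cp u ∈ O := fun u hu hd => by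
    have hu0 := ne_of_one hu
    refine ⟨fun h => ?_, ?_⟩
    · rw [co_cp_eq_zero hu0, hu] at h; exact one_ne_zero h
    · rw [Set.mem_preimage, qa_cp hu0, mem_ball_iff_norm]
      simpa [hu] using hd
  have hqO : ContinuousOn (qa k) O := (contOn_qa k).mono fun x hx => hx.1
  -- the slice
  let E : ℂ → Vn n := fun w => v + Pi.single (Fin.last n) (c * w)
  have hE : Continuous E := by
    have : Continuous fun w : ℂ => (Pi.single (Fin.last n) (c * w) : Vn n) :=
      (continuous_single (Fin.last n)).comp (by fun_prop)
    fun_prop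
  have hEk : ∀ w, E w k = 1 := fun w => by
    rcases hc with ⟨rfl, -⟩ | ⟨-, hk, -⟩
    · simp [E, hv1]
    · simp [E, hv1, Pi.single_eq_of_ne hk]
  have hEn : ∀ w, ‖E w - v‖ ≤ ‖w‖ := fun w => by
    simp only [E, add_sub_cancel_left, Pi.norm_single]
    rcases hc with ⟨rfl, -⟩ | ⟨rfl, -⟩ <;> simp
  have hr : ∀ u : Vn n, ‖u - v‖ < ε → ‖c * u (Fin.last n)‖ < ε := fun u hu => by
    rcases hc with ⟨rfl, -⟩ | ⟨rfl, -, h0⟩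
    · simpa using hε
    · have := norm_le_pi_norm (u - v) (Fin.last n)
      simp only [Pi.sub_apply, h0, sub_zero] at this
      rw [one_mul]; linarith
  have hcc : c * c = c := by
    rcases hc with ⟨rfl, -⟩ | ⟨rfl, -⟩ <;> simp
  let M : Vn n × ℝ → Vn n := fun p =>
    p.1 + ((cl01 p.2 : ℝ) : ℂ) • (E (c * p.1 (Fin.last n)) - p.1)
  have hM : Continuous M := by
    have h1 := continuous_cl01
    have h2 : Continuous fun p : Vn n × ℝ => ((cl01 p.2 : ℝ) : ℂ) :=
      Complex.continuous_ofReal.comp (h1.comp continuous_snd)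
    have h3 : Continuous fun p : Vn n × ℝ => E (c * p.1 (Fin.last n)) := hE.comp (by fun_prop)
    exact continuous_fst.add (h2.smul (h3.sub continuous_fst))
  have hMk : ∀ u : Vn n, u k = 1 → ∀ t, M (u, t) k = 1 := fun u hu t => by
    simp [M, hu, hEk]
  have hMn : ∀ u : Vn n, ‖u - v‖ < ε → ∀ t, ‖M (u, t) - v‖ < ε := fun u hu t => by
    have h1 : ‖E (c * u (Fin.last n)) - v‖ < ε := (hEn _).trans_lt (hr u hu)
    have := (convex_ball v ε).add_smul_sub_mem (x := u) (y := E (c * u (Fin.last n)))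
      (mem_ball_iff_norm.2 hu) (mem_ball_iff_norm.2 h1) ⟨cl01_nonneg t, cl01_le t⟩
    rw [mem_ball_iff_norm] at this
    simpa only [M, Complex.coe_smul] using this
  have hqn : ∀ x ∈ O, ‖qa k x - v‖ < ε := fun x hx => mem_ball_iff_norm.1 hx.2
  refine ⟨O, hmem v hv1 (by simpa using hε), fun x hx => ?_, hO, Metric.ball 0 ε,
    fun x => c * qa k x (Fin.last n), fun w => cp (E w), fun p => cp (M (qa k p.1, p.2)),
    Metric.isOpen_ball, Metric.isBounded_ball, ?_, ?_, fun x hx => ?_, ?_, fun w hw => ?_, ?_,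
    fun x hx => ?_, fun x hx => ?_, fun x hx t => ?_, fun x hx hH t => ?_⟩
  · have := hεW hx.2
    rwa [Set.mem_preimage, (cp_qa hx.1).1] at this
  · refine (Set.finite_singleton (0 : ℂ)).subset ?_
    rintro w ⟨-, hw⟩
    rw [mem_Hy (ne_of_one (hEk w))] at hw
    rcases hc with ⟨rfl, rfl⟩ | ⟨rfl, hk, h0⟩
    · rw [hEk] at hw; exact (one_ne_zero hw).elim
    · simpa [E, h0] using hw
  · exact continuousOn_const.mul ((continuous_apply (Fin.last n)).comp_continuousOn hqO)
  · exact mem_ball_zero_iff.2 (hr _ (hqn x hx))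
  · exact continuousOn_cp.comp hE.continuousOn fun w _ => ne_of_one (hEk w)
  · exact hmem _ (hEk w) ((hEn w).trans_lt (mem_ball_zero_iff.1 hw))
  · refine continuousOn_cp.comp (hM.comp_continuousOn ((hqO.comp continuousOn_fst
      fun p hp => hp.1).prodMk continuousOn_snd)) fun p hp => ?_
    exact ne_of_one (hMk _ (cp_qa hp.1.1).2 p.2)
  · simp only [M, cl01_of_le le_rfl, Complex.ofReal_zero, zero_smul, add_zero]
    exact (cp_qa hx.1).1
  · simp only [M, cl01_of_ge le_rfl, Complex.ofReal_one, one_smul, add_sub_cancel]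
  · exact hmem _ (hMk _ (cp_qa hx.1).2 t) (hMn _ (hqn x hx) t)
  · have hq := (cp_qa hx.1)
    rw [mem_Hy (ne_of_one (hMk _ hq.2 t))]
    rw [← hq.1, mem_Hy (ne_of_one hq.2)] at hH
    rcases hc with ⟨rfl, rfl⟩ | ⟨rfl, hk, h0⟩
    · rw [hMk _ hq.2 t]; exact one_ne_zero
    · simpa [M, E, h0] using hH

end charts

section unions
variable {X : Type*} [TopologicalSpace X]

lemma contOn_piece {α β : Type*} [TopologicalSpace α] [TopologicalSpace β] {A B : Set α}
    (hA : IsOpen A) (hB : IsOpen B) (hd : ∀ x ∈ A, x ∉ B) {f g : α → β} (hf : ContinuousOn f A)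
    (hg : ContinuousOn g B) [DecidablePred (· ∈ A)] :
    ContinuousOn (fun x => if x ∈ A then f x else g x) (A ∪ B) := by
  refine ContinuousOn.union_of_isOpen (hf.congr fun x hx => if_pos hx)
    (hg.congr fun x hx => if_neg fun h => hd x h hx) hA hB

lemma GB.union {H O O' : Set X} (h : GB H O) (h' : GB H O') (hd : ∀ x ∈ O, x ∉ O') :
    GB H (O ∪ O') := by
  classical
  refine ⟨h.op.union h'.op, ?_⟩
  obtain ⟨R, r, s, Φ, hR, hb, hN, hr, hrR, hs, hsO, hΦ, hΦ0, hΦ1, hΦO, hΦH⟩ := h.ex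
  obtain ⟨R', r', s', Φ', hR', hb', hN', hr', hrR', hs', hsO', hΦ', hΦ0', hΦ1', hΦO', hΦH'⟩ := h'.ex
  obtain ⟨m, hm0, hm⟩ := hb.exists_pos_norm_le
  obtain ⟨m', hm0', hm'⟩ := hb'.exists_pos_norm_le
  let c : ℂ := ((m + m' + 1 : ℝ) : ℂ)
  have hRR : ∀ w ∈ R, w - c ∉ R' := fun w hw hw' => by
    have h1 := hm w hw
    have h2 := hm' _ hw'
    have h3 : ‖c‖ = m + m' + 1 := by
      simp only [c, Complex.norm_real]; exact Real.norm_of_nonneg (by positivity)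
    have h4 := norm_sub_le w (w - c)
    rw [sub_sub_cancel] at h4
    linarith
  let S : Set ℂ := (fun w => w - c) ⁻¹' R'
  have hS : IsOpen S := hR'.preimage (by fun_prop)
  have hcS : ∀ z ∈ R', z + c ∈ S ∧ z + c ∉ R := fun z hz =>
    ⟨by simpa [S] using hz, fun h => hRR _ h (by simpa using hz)⟩
  have hd' : ∀ x ∈ O', x ∉ O := fun x hx h => hd x h hx
  refine ⟨R ∪ S, fun x => if x ∈ O then r x else r' x + c,
    fun w => if w ∈ R then s w else s' (w - c),
    fun p => if p ∈ O ×ˢ (Set.univ : Set ℝ) then Φ p else Φ' p, hR.union hS, ?_, ?_, ?_, ?_, ?_, ?_, ?_, ?_, ?_, ?_, ?_⟩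
  · refine hb.union (isBounded_iff_forall_norm_le.2 ⟨m' + ‖c‖, fun w hw => ?_⟩)
    have h1 := hm' _ hw
    have h2 := norm_add_le (w - c) c
    rw [sub_add_cancel] at h2
    linarith
  · refine (hN.union (hN'.image (· + c))).subset ?_
    rintro w ⟨hw, hH⟩
    simp only at hH
    by_cases hwR : w ∈ R
    · rw [if_pos hwR] at hH; exact Or.inl ⟨hwR, hH⟩
    · rw [if_neg hwR] at hH
      exact Or.inr ⟨w - c, ⟨hw.resolve_left hwR, hH⟩, by simp⟩
  · exact contOn_piece h.op h'.op hd hr (hr'.add continuousOn_const)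
  · rintro x (hx | hx)
    · simp only [if_pos hx]; exact Or.inl (hrR hx)
    · simp only [if_neg (hd' x hx)]; exact Or.inr (hcS _ (hrR' hx)).1
  · exact contOn_piece hR hS (fun w hw => hRR w hw) hs (hs'.comp (by fun_prop) fun w hw => hw)
  · rintro w (hw | hw)
    · simp only [if_pos hw]; exact Or.inl (hsO hw)
    · simp only [if_neg fun h => hRR w h hw]; exact Or.inr (hsO' hw)
  · rw [Set.union_prod]
    exact contOn_piece (h.op.prod isOpen_univ) (h'.op.prod isOpen_univ)
      (fun p hp h => hd _ hp.1 h.1) hΦ hΦ'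
  · rintro x (hx | hx)
    · simp only [Set.mem_prod, hx, Set.mem_univ, and_self, if_true]; exact hΦ0 x hx
    · simp only [Set.mem_prod, hd' x hx, false_and, if_false]; exact hΦ0' x hx
  · rintro x (hx | hx)
    · simp only [Set.mem_prod, hx, Set.mem_univ, and_self, if_true, hrR hx]; exact hΦ1 x hx
    · simp only [Set.mem_prod, hd' x hx, false_and, if_false, (hcS _ (hrR' hx)).2,
        add_sub_cancel_right]; exact hΦ1' x hx
  · rintro x (hx | hx) t
    · simp only [Set.mem_prod, hx, Set.mem_univ, and_self, if_true]; exact Or.inl (hΦO x hx t)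
    · simp only [Set.mem_prod, hd' x hx, false_and, if_false]; exact Or.inr (hΦO' x hx t)
  · rintro x (hx | hx) hH t
    · simp only [Set.mem_prod, hx, Set.mem_univ, and_self, if_true]; exact hΦH x hx hH t
    · simp only [Set.mem_prod, hd' x hx, false_and, if_false]; exact hΦH' x hx hH t

lemma GB.empty [Nonempty X] (H : Set X) : GB H ∅ :=
  ⟨isOpen_empty, ∅, fun _ => 0, fun _ => Classical.arbitrary X, Prod.fst, isOpen_empty,
    Bornology.isBounded_empty, by simp, by simp, fun x hx => hx.elim, by simp,
    fun x hx => hx.elim, by simp, by simp, by simp, by simp, by simp⟩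

lemma GB.finite [Nonempty X] {H : Set X} {α : Type*} (S : Finset α) {O : α → Set X}
    (h : ∀ i ∈ S, GB H (O i)) (hd : ∀ i ∈ S, ∀ j ∈ S, i ≠ j → ∀ x ∈ O i, x ∉ O j) :
    GB H (⋃ i ∈ S, O i) := by
  classical
  induction S using Finset.induction_on with
  | empty => simpa using GB.empty H
  | insert a S ha ih =>
    rw [Finset.set_biUnion_insert]
    refine GB.union (h a (by simp)) (ih (fun i hi => h i (by simp [hi]))
      fun i hi j hj => hd i (by simp [hi]) j (by simp [hj])) fun x hx hx' => ?_
    simp only [Set.mem_iUnion] at hx'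
    obtain ⟨i, hi, hxi⟩ := hx'
    exact hd a (by simp) i (by simp [hi]) (fun h => ha (h ▸ hi)) x hx hxi

end unions

/-- Good neighbourhoods of finite subsets of projective space. -/
lemma GB.exists_finset {n : ℕ} (S : Finset (CP n)) {W : Set (CP n)} (hW : IsOpen W)
    (hS : ∀ x ∈ S, x ∈ W) : ∃ O, (∀ x ∈ S, x ∈ O) ∧ O ⊆ W ∧ GB (Hy n) O := by
  haveI : Nonempty (CP n) := ⟨aL n⟩
  obtain ⟨U, hU, hdis⟩ := (S.finite_toSet).t2_separation
  choose! O hO1 hO2 hO3 using fun x (hx : x ∈ S) =>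
    GB.box x ((hU x).2.inter hW) ⟨(hU x).1, hS x hx⟩
  refine ⟨⋃ x ∈ S, O x, fun x hx => Set.mem_biUnion hx (hO1 x hx), Set.iUnion₂_subset fun x hx =>
    (hO2 x hx).trans Set.inter_subset_right, GB.finite S hO3 fun i hi j hj hij x hx hx' => ?_⟩
  exact Set.disjoint_left.1 (hdis hi hj hij) (hO2 i hi hx).1 (hO2 j hj hx').1

/-- Low dimensional families of effective cycles can be moved off the cycles supported at
infinity. -/
lemma conn_off {n e : ℕ} {ι : Type} [Fintype ι] (hι : Fintype.card ι ≤ 2 * e + 1) :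
    Conn ι (Set.univ : Set (SP (e + 1) (CP n))) {p | ∃ x ∈ SP.ms p, x ∉ Hy n} := by
  classical
  refine Conn.locGlob (𝓑 := {U | ∃ O, GB (Hy n) O ∧ U = spO (e + 1) O}) ⟨?_, fun b => ?_, ?_⟩
    (2 * e + 1) ?_ hι
  · rintro U ⟨O, hO, rfl⟩; exact isOpen_spO hO.op
  · obtain ⟨O, h1, -, h2⟩ := GB.exists_finset (SP.ms b).toFinset isOpen_univ fun x _ => trivial
    exact ⟨_, ⟨O, h2, rfl⟩, fun x hx => h1 x (Multiset.mem_toFinset.2 hx)⟩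
  · rintro _ ⟨O, hO, rfl⟩ _ ⟨O', hO', rfl⟩ b hb hb'
    obtain ⟨O'', h1, h2, h3⟩ := GB.exists_finset (SP.ms b).toFinset (hO.op.inter hO'.op) fun x hx =>
      ⟨hb x (Multiset.mem_toFinset.1 hx), hb' x (Multiset.mem_toFinset.1 hx)⟩
    exact ⟨_, ⟨O'', h3, rfl⟩, fun x hx => h1 x (Multiset.mem_toFinset.2 hx),
      fun p hp x hx => (h2 (hp x hx)).1, fun p hp x hx => (h2 (hp x hx)).2⟩
  · rintro _ ⟨O, hO, rfl⟩ κ _ hκ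
    exact hO.conn hκ

end HS

namespace HS

section flow
variable {n : ℕ}

/-- rescaling of all coordinates but the last -/
def rsc (s : ℝ) (v : Vn n) : Vn n := fun j => if j = Fin.last n then v j else (s : ℂ) * v j

/-- scaling factor -/
def thf (R t : ℝ) (x : CP n) : ℝ := max 0 (1 - cl01 t * (R * co (Fin.last n) x))

lemma rsc_smul (s : ℝ) (c : ℂ) (v : Vn n) : rsc s (c • v) = c • rsc s v := by
  funext j
  simp only [rsc, Pi.smul_apply, smul_eq_mul]
  split_ifs <;> ring

lemma rsc_ne {R t : ℝ} {v : Vn n} (hv : v ≠ 0) : rsc (thf R t (cp v)) v ≠ 0 := by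
  intro h
  have hl : v (Fin.last n) = 0 := by simpa [rsc] using congrFun h (Fin.last n)
  have h1 : thf R t (cp v) = 1 := by
    simp [thf, (co_cp_eq_zero hv).2 hl]
  apply hv
  rw [h1] at h
  rw [← h]
  funext j
  simp [rsc]

/-- the flow towards the base point -/
def th (R : ℝ) (p : CP n × ℝ) : CP n := cp (rsc (thf R p.2 p.1) (rep p.1))

lemma th_cp (R : ℝ) {v : Vn n} (hv : v ≠ 0) (t : ℝ) :
    th R (cp v, t) = cp (rsc (thf R t (cp v)) v) := by
  obtain ⟨c, hc, h⟩ := rep_cp hv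
  simp only [th]
  rw [h, rsc_smul, cp_smul (rsc_ne hv) hc]

lemma continuous_th (R : ℝ) : Continuous (th R : CP n × ℝ → CP n) := by
  rw [← continuousOn_univ]
  refine cp_contOn ?_
  have h0 : ContinuousOn (fun p : Vn n × ℝ => co (Fin.last n) (cp p.1)) {p | p.1 ≠ 0} :=
    (continuous_co _).comp_continuousOn (continuousOn_cp.comp continuousOn_fst fun p hp => hp)
  have h1 : ContinuousOn (fun p : Vn n × ℝ => thf R p.2 (cp p.1)) {p | p.1 ≠ 0} := by
    have hc : ContinuousOn (fun p : Vn n × ℝ => cl01 p.2) {p | p.1 ≠ 0} :=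
      (continuous_cl01.comp continuous_snd).continuousOn
    unfold thf
    fun_prop
  have h2 : ContinuousOn (fun p : Vn n × ℝ => rsc (thf R p.2 (cp p.1)) p.1) {p | p.1 ≠ 0} := by
    refine continuousOn_pi.2 fun j => ?_
    simp only [rsc]
    split_ifs
    · fun_prop
    · exact (Complex.continuous_ofReal.comp_continuousOn h1).mul (by fun_prop)
  have h3 : ContinuousOn (fun p : Vn n × ℝ => cp (rsc (thf R p.2 (cp p.1)) p.1)) {p | p.1 ≠ 0} :=
    continuousOn_cp.comp h2 fun p hp => rsc_ne hp
  exact (h3.congr fun p hp => th_cp R hp p.2).mono fun p hp => hp.1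

lemma th_zero (R : ℝ) (x : CP n) : th R (x, 0) = x := by
  obtain ⟨v, hv, rfl⟩ := cp_surj x
  rw [th_cp R hv]
  congr 1
  funext j
  simp [rsc, thf, cl01_of_le le_rfl]

lemma th_aL (R t : ℝ) : th R (aL n, t) = aL n := by
  rw [aL, th_cp R single_last_ne]
  congr 1
  funext j
  by_cases hj : j = Fin.last n
  · simp [rsc, hj]
  · simp [rsc, hj]

lemma th_one {R : ℝ} {x : CP n} (h : 1 ≤ R * co (Fin.last n) x) : th R (x, 1) = aL n := by
  obtain ⟨v, hv, rfl⟩ := cp_surj x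
  rw [th_cp R hv]
  have h0 : thf R 1 (cp v) = 0 := by
    simp only [thf, cl01_of_ge le_rfl, one_mul]; exact max_eq_left (by linarith)
  have hl : v (Fin.last n) ≠ 0 := fun h' => by
    rw [(co_cp_eq_zero hv).2 h', mul_zero] at h; linarith
  rw [h0, aL, ← cp_smul (single_last_ne (n := n)) hl]
  congr 1
  funext j
  by_cases hj : j = Fin.last n
  · subst hj; simp [rsc]
  · simp [rsc, hj]

/-- sum of a continuous function over a cycle -/
lemma continuous_spsum {X : Type*} [TopologicalSpace X] {d : ℕ} {f : X → ℝ} (hf : Continuous f) :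
    Continuous fun p : SP d X => ((SP.ms p).map f).sum := by
  rw [SP.isQuotientMap_mk.continuous_iff]
  have : Continuous fun g : Fin d → X => ∑ i, f (g i) := by fun_prop
  refine this.congr fun g => ?_
  simp only [Function.comp, SP.ms_mk, ms_map]
  rfl

/-- One step of stabilisation. -/
lemma conn_step {e : ℕ} {ι : Type} [Fintype ι] (hι : Fintype.card ι ≤ 2 * e + 1) :
    Conn ι (Set.univ : Set (SP (e + 1) (CP n))) {p | aL n ∈ SP.ms p} := by
  intro g hg _ hA
  have haL : aL n ∉ Hy n := by
    rw [aL, mem_Hy single_last_ne]; simp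
  obtain ⟨g1, hr, hV⟩ := conn_off (n := n) hι g hg (fun _ => trivial) fun x hx =>
    ⟨_, hA x hx, haL⟩
  have hg1 := hr.cont_right
  have hA1 : ∀ x, 1 ≤ ‖x‖ → g1 x ∈ {p | aL n ∈ SP.ms p} := fun x hx => by
    rw [hr.eq_out hx]; exact hA x hx
  let f : CP n → ℝ := co (Fin.last n)
  have hF := (continuous_spsum (d := e + 1) (continuous_co (Fin.last n) : Continuous f)).comp hg1
  obtain ⟨x0, -, hx0⟩ := (isCompact_closedBall (0 : ι → ℝ) 1).exists_isMinOn
    ⟨0, by simp⟩ hF.continuousOn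
  have hpos : 0 < ((SP.ms (g1 x0)).map f).sum := by
    obtain ⟨x, hx, hxH⟩ := hV x0
    have h1 : 0 < f x := lt_of_le_of_ne (co_nonneg _ _) (Ne.symm hxH)
    refine lt_of_lt_of_le h1 (Multiset.single_le_sum ?_ _ (Multiset.mem_map_of_mem f hx))
    intro y hy
    obtain ⟨z, -, rfl⟩ := Multiset.mem_map.1 hy
    exact co_nonneg _ _
  set m := ((SP.ms (g1 x0)).map f).sum with hm
  let R : ℝ := (e + 1) / m
  have hR : ∀ x, ‖x‖ ≤ 1 → ∃ z ∈ SP.ms (g1 x), 1 ≤ R * f z := fun x hx => by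
    by_contra! hcon
    have h1 : m ≤ ((SP.ms (g1 x)).map f).sum := hx0 (mem_closedBall_zero_iff.2 hx)
    have h2 : ∀ y ∈ (SP.ms (g1 x)).map f, y ≤ m / (e + 1) ∧ y < m / (e + 1) := fun y hy => by
      obtain ⟨z, hz, rfl⟩ := Multiset.mem_map.1 hy
      have := hcon z hz
      have he : (0 : ℝ) < e + 1 := by positivity
      have h3 : f z < m / (e + 1) := by
        rw [lt_div_iff₀ he]
        simp only [R] at this
        rw [div_mul_eq_mul_div, div_lt_one hpos] at this
        linarith
      exact ⟨h3.le, h3⟩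
    obtain ⟨v, hv⟩ := SP.mk_surj (g1 x)
    have h4 : ((SP.ms (g1 x)).map f).sum = ∑ i, f (v i) := by
      rw [← hv, SP.ms_mk, ms_map]; rfl
    have h5 : ∑ i, f (v i) < ∑ i : Fin (e + 1), m / (e + 1) :=
      Finset.sum_lt_sum_of_nonempty Finset.univ_nonempty fun i _ =>
        (h2 _ (Multiset.mem_map_of_mem f (by rw [← hv, SP.ms_mk]; exact mem_ms.2 ⟨i, rfl⟩))).2
    rw [Finset.sum_const, Finset.card_univ, Fintype.card_fin, nsmul_eq_mul] at h5
    have h6 : ((e + 1 : ℕ) : ℝ) * (m / (e + 1)) = m := by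
      push_cast; field_simp
    linarith
  have hmem : ∀ (p : SP (e + 1) (CP n)) (t : ℝ), aL n ∈ SP.ms p → aL n ∈ SP.ms (SP.mp (th R) (p, t)) :=
    fun p t h => by
    rw [SP.ms_mp]
    exact Multiset.mem_map.2 ⟨_, h, th_aL R t⟩
  refine ((hr.toPH hA).trans ((PH.rad (A := Set.univ) hg1 (fun _ => trivial) hA1).trans
    (g'' := fun x => SP.mp (th R) (g1 (rcl (x, 1)), (1 : ℝ)))
    ⟨fun p => SP.mp (th R) (g1 (rcl (p.1, 1)), p.2), ?_, fun x => ?_, fun x => rfl,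
      fun _ => trivial, fun x t hx => hmem _ _ (hA1 _ (norm_rcl_ge hx 1))⟩)).compress fun x => ?_
  · have h1 : Continuous (SP.mp (th R) : SP (e + 1) (CP n) × ℝ → SP (e + 1) (CP n)) := by
      rw [← continuousOn_univ]
      exact (SP.contOn_mp isOpen_univ (continuous_th R).continuousOn).mono
        fun q _ => ⟨fun _ _ => trivial, trivial⟩
    exact h1.comp ((hg1.comp (continuous_rcl.comp (by fun_prop))).prodMk continuous_snd)
  · apply SP.ext
    rw [SP.ms_mp]
    simp only [th_zero, Multiset.map_id']
  · obtain ⟨z, hz, h1⟩ := hR _ (norm_rcl_one x)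
    rw [Set.mem_ofPred_eq, SP.ms_mp]
    exact Multiset.mem_map.2 ⟨z, hz, th_one h1⟩

end flow
end HS

namespace HS

section final
variable {n : ℕ}

/-- cycles of reduced degree at most `d` -/
def Zd (n d : ℕ) : Set (Z (CP n) (aL n)) := {ξ | ξ.1.card ≤ d}

lemma Zd_mono {d e : ℕ} (h : d ≤ e) : Zd n d ⊆ Zd n e := fun _ hξ => le_trans hξ h

lemma inc_univ (d : ℕ) : SP.inc (aL n) '' (Set.univ : Set (SP d (CP n))) = Zd n d := by
  rw [Set.image_univ, SP.range_inc]; rfl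

lemma inc_step (e : ℕ) :
    SP.inc (aL n) '' {p : SP (e + 1) (CP n) | aL n ∈ SP.ms p} = Zd n e := by
  classical
  ext ξ
  constructor
  · rintro ⟨p, hp, rfl⟩
    obtain ⟨t, ht⟩ := Multiset.exists_cons_of_mem hp
    have hc : t.card = e := by
      have := SP.card_ms p
      rw [ht, Multiset.card_cons] at this
      omega
    show ((SP.inc (aL n) p).1).card ≤ e
    simp only [SP.inc, mkZ, ht]
    rw [Multiset.filter_cons_of_neg _ (by simp), ← hc]
    exact Multiset.card_le_card (Multiset.filter_le _ _)
  · intro hξ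
    have hξ : ξ.1.card ≤ e := hξ
    obtain ⟨p, hp⟩ := SP.exists_ms (d := e + 1) (s := ξ.1 + Multiset.replicate (e + 1 - ξ.1.card) (aL n))
      (by simp; omega)
    refine ⟨p, ?_, ?_⟩
    · rw [Set.mem_ofPred_eq, hp, Multiset.mem_add]
      exact Or.inr (Multiset.mem_replicate.2 ⟨by omega, rfl⟩)
    · rw [SP.inc, hp, mkZ_add_replicate, mkZ_val]

lemma conn_Zd_step {e : ℕ} {ι : Type} [Fintype ι] (hι : Fintype.card ι ≤ 2 * e + 1) :
    Conn ι (Zd n (e + 1)) (Zd n e) := by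
  have := (conn_step (n := n) hι).emb (SP.isClosedEmbedding_inc (a0 := aL n)).isEmbedding
    (Set.subset_univ _)
  rwa [inc_univ, inc_step] at this

lemma conn_Zd_le {d : ℕ} {ι : Type} [Fintype ι] (hι : Fintype.card ι ≤ 2 * d + 1) {D : ℕ}
    (h : d ≤ D) : Conn ι (Zd n D) (Zd n d) := by
  induction D, h using Nat.le_induction with
  | base => exact Conn.refl _
  | succ D hD ih =>
    exact Conn.trans (Zd_mono (Nat.le_succ D)) (Zd_mono hD) (conn_Zd_step (by omega)) ih

lemma conn_Zd {d : ℕ} {ι : Type} [Fintype ι] (hι : Fintype.card ι ≤ 2 * d + 1) :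
    Conn ι Set.univ (Zd n d) := by
  intro g hg _ ho
  obtain ⟨D, hD⟩ := Z.bounded_card ((isCompact_closedBall (0 : ι → ℝ) 1).image hg)
  have hgD : ∀ x, g x ∈ Zd n (max d D) := fun x => by
    rcases le_total 1 ‖x‖ with hx | hx
    · exact Zd_mono (le_max_left _ _) (ho x hx)
    · exact le_trans (hD _ ⟨x, mem_closedBall_zero_iff.2 hx, rfl⟩) (le_max_right _ _)
  obtain ⟨g', hr, hg'⟩ := conn_Zd_le hι (le_max_left d D) g hg hgD ho
  exact ⟨g', hr.mono (Set.subset_univ _), hg'⟩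

/-- the base point -/
def p0 (n d : ℕ) : SP d (CP n) := _root_.SP.mk fun _ => aL n

lemma inc_p0 (d : ℕ) : SP.inc (aL n) (p0 n d) = zz (aL n) := by
  have h : SP.ms (p0 n d) = 0 + Multiset.replicate d (aL n) := by
    rw [p0, SP.ms_mk, zero_add]; simp [HS.ms]
  rw [SP.inc, h, mkZ_add_replicate, zz]

lemma zz_mem (d : ℕ) : zz (aL n) ∈ Zd n d := by
  show ((zz (aL n)).1).card ≤ d
  rw [zz_val]; simp

lemma sp_hasZ {d : ℕ} {ι : Type} [Fintype ι] (i : ι) (he : Even (Fintype.card ι))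
    (hn : Fintype.card ι ≤ 2 * n) (hd : Fintype.card ι ≤ 2 * d) :
    HasZ ι i Set.univ (p0 n d) := by
  refine HasZ.of_emb (SP.isClosedEmbedding_inc (a0 := aL n)).isEmbedding ?_
  rw [inc_univ, inc_p0]
  refine (HasZ.incl (Set.subset_univ _) (zz_mem d) (conn_Zd (by omega)) (conn_Zd ?_)).2
    ((CPOK.all n).hasZ ι i he hn)
  rw [Fintype.card_option]; omega

lemma sp_conn {d : ℕ} {ι : Type} [Fintype ι] (h : ¬ (Even (Fintype.card ι) ∧ Fintype.card ι ≤ 2 * n))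
    (hd : Fintype.card ι ≤ 2 * d) : Conn ι Set.univ {p0 n d} := by
  refine Conn.of_emb (SP.isClosedEmbedding_inc (a0 := aL n)).isEmbedding ?_
  rw [inc_univ, Set.image_singleton, inc_p0]
  refine Conn.of_null fun f hf => ?_
  have h1 : Null Set.univ (zz (aL n)) f :=
    ((CPOK.all n).conn ι fun hh => h ⟨hh.1, hh.2.2⟩).null ⟨hf.cont, fun _ => trivial, hf.out⟩
  exact Conn.inj (conn_Zd (by rw [Fintype.card_option]; omega)) hf.mem (fun _ => zz_mem d) h1

instance sp_path (n d : ℕ) : PathConnectedSpace (SP d (CP n)) :=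
  SP.mk_surj.pathConnectedSpace SP.isQuotientMap_mk.continuous

lemma exists_gamma {Y : Type*} [TopologicalSpace Y] [PathConnectedSpace Y] (a b : Y) :
    ∃ γ : ℝ → Y, Continuous γ ∧ γ 0 = a ∧ γ 1 = b := by
  obtain ⟨γ⟩ := PathConnectedSpace.joined a b
  exact ⟨γ.extend, γ.continuous_extend, γ.extend_zero, γ.extend_one⟩

end final
end HS

theorem homotopy_groups_of_symmetric_product
    (n d : ℕ) (hn : 1 ≤ n) (hd : 1 ≤ d) :
    PathConnectedSpace (SP d (CP n)) ∧
    ∀ (bp : SP d (CP n)) (k : ℕ), k + 1 ≤ 2 * d →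
      ((Even (k + 1) ∧ k + 1 ≤ min (2 * d) (2 * n)) →
        Nonempty (HomotopyGroup (Fin (k + 1)) (SP d (CP n)) bp ≃* Multiplicative ℤ)) ∧
      (¬(Even (k + 1) ∧ k + 1 ≤ min (2 * d) (2 * n)) → k + 1 < 2 * d →
        ∀ a : HomotopyGroup (Fin (k + 1)) (SP d (CP n)) bp, a = 1) := by
  refine ⟨HS.sp_path n d, fun bp k hk => ⟨fun ⟨he, hm⟩ => ?_, fun h hlt => ?_⟩⟩
  · obtain ⟨γ, hγ, h0, h1⟩ := HS.exists_gamma (HS.p0 n d) bp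
    have hm2 := hm.trans (min_le_right _ _)
    exact HS.HasZ.group (i := 0) (HS.HasZ.basept hγ h0 h1
      (HS.sp_hasZ 0 (by simpa using he) (by simpa using hm2) (by simpa using hk)))
  · obtain ⟨γ, hγ, h0, h1⟩ := HS.exists_gamma (HS.p0 n d) bp
    exact HS.Conn.group (HS.Conn.basept hγ h0 h1 (HS.sp_conn
      (by
        rw [Fintype.card_fin]
        rintro ⟨h1, h2⟩
        exact h ⟨h1, le_min hk h2⟩) (by simpa using hk)))
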